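/- Suppose Conditions D, M_r with r = 14 + 4a₀, and S hold (a₀ as in Condition D). If the subsample size satisfies m ∝ n^{1/2} and the pilot block satisfies ℓ̃_n ∝ n^{1/3} (i.e., m/n^{1/2} and ℓ̃_n/n^{1/3} are bounded away from 0 and ∞), then as n → ∞ both |ℓ̂_{n,∞}^{opt} − ℓ_n^{opt}|/ℓ_n^{opt} = O_p(n^{-1/6}) and |ℓ̂_{n,HHJ}^{opt} − ℓ_n^{opt}|/ℓ_n^{opt} = O_p(n^{-1/6}). -/

import Mathlib

open MeasureTheory ProbabilityTheory Filter
open scoped Classical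

noncomputable section

namespace BlockLength

variable {Ω : Type*} [MeasurableSpace Ω] {d : ℕ}

/-- σ-algebra generated by the coordinates `X i`, `i ∈ S`. -/
def sigmaOf (X : ℤ → Ω → Fin d → ℝ) (S : Set ℤ) : MeasurableSpace Ω :=
  ⨆ i ∈ S, MeasurableSpace.comap (X i) inferInstance

/-- Strong mixing (α-mixing) coefficient of the process `X`. -/
def alphaMix (μ : Measure Ω) (X : ℤ → Ω → Fin d → ℝ) (k : ℕ) : ℝ :=
  sSup { x | ∃ A B : Set Ω,
    MeasurableSet[sigmaOf X {i | i ≤ 0}] A ∧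
    MeasurableSet[sigmaOf X {i | (k : ℤ) ≤ i}] B ∧
    x = |(μ (A ∩ B)).toReal - (μ A).toReal * (μ B).toReal| }

/-- Strict stationarity of the process `X`. -/
def IsStationary (μ : Measure Ω) (X : ℤ → Ω → Fin d → ℝ) : Prop :=
  ∀ k : ℤ, Measure.map (fun ω => fun i : ℤ => X (i + k) ω) μ =
    Measure.map (fun ω => fun i : ℤ => X i ω) μ

/-- Condition (D): `H` is three times continuously differentiable with
third derivatives of polynomial growth of order `a₀`. -/
def CondD (H : (Fin d → ℝ) → ℝ) (a₀ : ℕ) : Prop :=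
  ContDiff ℝ 3 H ∧ ∃ C : ℝ, 0 < C ∧ ∀ x : Fin d → ℝ,
    ‖iteratedFDeriv ℝ 3 H x‖ ≤ C * (1 + ‖x‖ ^ a₀)

/-- Condition (M_r): moment and strong-mixing conditions. -/
def CondM (μ : Measure Ω) (X : ℤ → Ω → Fin d → ℝ) (r : ℕ) : Prop :=
  ∃ δ : ℝ, 0 < δ ∧
    Integrable (fun ω => ‖X 1 ω‖ ^ ((2 * r : ℝ) + δ)) μ ∧
    Summable (fun k : ℕ => (k : ℝ) ^ (2 * r - 1) *
      alphaMix μ X k ^ (δ / ((2 * r : ℝ) + δ)))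

/-- The mean vector `μ = E X₁`. -/
def meanVec (μ : Measure Ω) (X : ℤ → Ω → Fin d → ℝ) : Fin d → ℝ :=
  fun j => ∫ ω, X 1 ω j ∂μ

/-- Centered linearization `Y_i = ∇'(X_i − μ)`, where `∇ = ∂H(μ)/∂x`. -/
def Ylin (μ : Measure Ω) (X : ℤ → Ω → Fin d → ℝ) (H : (Fin d → ℝ) → ℝ)
    (i : ℤ) (ω : Ω) : ℝ :=
  fderiv ℝ H (meanVec μ X) (fun j => X i ω j - meanVec μ X j)

/-- Autocovariance `r(k) = Cov(∇'X₀, ∇'X_k)`. -/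
def rcov (μ : Measure Ω) (X : ℤ → Ω → Fin d → ℝ) (H : (Fin d → ℝ) → ℝ)
    (k : ℤ) : ℝ :=
  ∫ ω, Ylin μ X H 0 ω * Ylin μ X H k ω ∂μ -
    (∫ ω, Ylin μ X H 0 ω ∂μ) * ∫ ω, Ylin μ X H k ω ∂μ

/-- `B₀ = Σ_k |k| r(k)`. -/
def B0 (μ : Measure Ω) (X : ℤ → Ω → Fin d → ℝ) (H : (Fin d → ℝ) → ℝ) : ℝ :=
  ∑' k : ℤ, |(k : ℝ)| * rcov μ X H k

/-- `σ_∞² = Σ_k r(k)`. -/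
def sigInfSq (μ : Measure Ω) (X : ℤ → Ω → Fin d → ℝ) (H : (Fin d → ℝ) → ℝ) : ℝ :=
  ∑' k : ℤ, rcov μ X H k

/-- `V₀ = (4/3) σ_∞⁴`. -/
def V0 (μ : Measure Ω) (X : ℤ → Ω → Fin d → ℝ) (H : (Fin d → ℝ) → ℝ) : ℝ :=
  (4 / 3) * sigInfSq μ X H ^ 2

/-- `C₀ = (2B₀²/V₀)^{1/3}`. -/
def C0 (μ : Measure Ω) (X : ℤ → Ω → Fin d → ℝ) (H : (Fin d → ℝ) → ℝ) : ℝ :=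
  (2 * B0 μ X H ^ 2 / V0 μ X H) ^ ((1 : ℝ) / 3)

/-- Condition (S): `B₀ ≠ 0` and `V₀ > 0`. -/
def CondS (μ : Measure Ω) (X : ℤ → Ω → Fin d → ℝ) (H : (Fin d → ℝ) → ℝ) : Prop :=
  B0 μ X H ≠ 0 ∧ 0 < V0 μ X H

/-- Sample mean `X̄_n` of `X₁,…,X_n`. -/
def sampleMean (X : ℤ → Ω → Fin d → ℝ) (n : ℕ) (ω : Ω) : Fin d → ℝ :=
  fun j => (∑ i ∈ Finset.range n, X ((i : ℤ) + 1) ω j) / n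

/-- `σ_∞² = lim_n n · Var(H(X̄_n))`, identifying the target variance with `Σ_k r(k)`. -/
def SigLimit (μ : Measure Ω) (X : ℤ → Ω → Fin d → ℝ) (H : (Fin d → ℝ) → ℝ) : Prop :=
  Tendsto (fun n : ℕ => (n : ℝ) * variance (fun ω => H (sampleMean X n ω)) μ)
    atTop (nhds (sigInfSq μ X H))

/-- MBB variance estimator obtained by resampling `k` blocks of length `ℓ`
(i.i.d. uniformly over the block-start offsets in `S`) from the data
`X_s, X_{s+1}, …`; the bootstrap variance is written out as the exact average
over all `|S|^k` equally likely block-index tuples. -/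
def mbbVarOn (X : ℤ → Ω → Fin d → ℝ) (H : (Fin d → ℝ) → ℝ)
    (s : ℤ) (ℓ k : ℕ) (S : Finset ℕ) (ω : Ω) : ℝ :=
  let bm : ℕ → Fin d → ℝ := fun i j =>
    (∑ t ∈ Finset.range ℓ, X (s + (i : ℤ) + (t : ℤ)) ω j) / ℓ
  let θ : (Fin k → ↥S) → ℝ := fun f => H (fun j => (∑ a, bm (f a : ℕ) j) / k)
  (ℓ * k : ℝ) *
    ((∑ f : Fin k → ↥S, θ f ^ 2) / (S.card : ℝ) ^ k -
      ((∑ f : Fin k → ↥S, θ f) / (S.card : ℝ) ^ k) ^ 2)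

/-- MBB variance estimator with block length `ℓ` based on the sample
`X_s, …, X_{s+m-1}` (all `m − ℓ + 1` overlapping blocks, `⌊m/ℓ⌋` resampled blocks). -/
def mbbVar (X : ℤ → Ω → Fin d → ℝ) (H : (Fin d → ℝ) → ℝ)
    (s : ℤ) (m ℓ : ℕ) (ω : Ω) : ℝ :=
  mbbVarOn X H s ℓ (m / ℓ) (Finset.range (m - ℓ + 1)) ω

/-- `σ̂_n²(ℓ)`: MBB variance estimator from `X₁,…,X_n`. -/
def sigmaHat (X : ℤ → Ω → Fin d → ℝ) (H : (Fin d → ℝ) → ℝ)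
    (n ℓ : ℕ) (ω : Ω) : ℝ :=
  mbbVar X H 1 n ℓ ω

/-- `MSE_n(ℓ) = E(σ̂_n²(ℓ) − σ_∞²)²`. -/
def MSEfun (μ : Measure Ω) (X : ℤ → Ω → Fin d → ℝ) (H : (Fin d → ℝ) → ℝ)
    (n ℓ : ℕ) : ℝ :=
  ∫ ω, (sigmaHat X H n ℓ ω - sigInfSq μ X H) ^ 2 ∂μ

/-- `f_n(ℓ) = B₀²/ℓ² + V₀ ℓ/n`. -/
def fapprox (μ : Measure Ω) (X : ℤ → Ω → Fin d → ℝ) (H : (Fin d → ℝ) → ℝ)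
    (n ℓ : ℕ) : ℝ :=
  B0 μ X H ^ 2 / (ℓ : ℝ) ^ 2 + V0 μ X H * ℓ / n

/-- The block set `J_n = {ℓ ∈ ℕ : K⁻¹ n^{1/3} ≤ ℓ ≤ K n^{1/3}}` (with `ℓ ≤ n`). -/
def Jset (K : ℝ) (n : ℕ) : Finset ℕ :=
  (Finset.Icc 1 n).filter fun ℓ =>
    K⁻¹ * (n : ℝ) ^ ((1 : ℝ) / 3) ≤ (ℓ : ℝ) ∧ (ℓ : ℝ) ≤ K * (n : ℝ) ^ ((1 : ℝ) / 3)

/-- `b` minimizes `g` over the finite block set `S`. -/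
def IsArgminOn (g : ℕ → ℝ) (S : Finset ℕ) (b : ℕ) : Prop :=
  b ∈ S ∧ ∀ c ∈ S, g b ≤ g c

/-- `Z_n = O_p(a_n)`: `Z_n/a_n` is bounded in probability. -/
def IsBigOp (μ : Measure Ω) (Z : ℕ → Ω → ℝ) (a : ℕ → ℝ) : Prop :=
  ∀ ε : ℝ, 0 < ε → ∃ C : ℝ, 0 < C ∧
    ∀ᶠ n in atTop, (μ {ω | C * |a n| < |Z n ω|}).toReal ≤ ε

/-- Convergence in probability to a constant `c`. -/
def TendstoInProb (μ : Measure Ω) (Z : ℕ → Ω → ℝ) (c : ℝ) : Prop :=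
  ∀ ε : ℝ, 0 < ε →
    Tendsto (fun n => (μ {ω | ε < |Z n ω - c|}).toReal) atTop (nhds 0)

/-- Oracle subsampling MSE `MŜE_m^∞(b)`. -/
def MSEhatInf (μ : Measure Ω) (X : ℤ → Ω → Fin d → ℝ) (H : (Fin d → ℝ) → ℝ)
    (n m b : ℕ) (ω : Ω) : ℝ :=
  (∑ i ∈ Finset.range (n - m + 1),
    (mbbVar X H ((i : ℤ) + 1) m b ω - sigInfSq μ X H) ^ 2) / ((n - m + 1 : ℕ) : ℝ)

/-- HHJ subsampling MSE `MŜE_m(b)` with pilot block length `ℓpil`. -/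
def MSEhatPilot (X : ℤ → Ω → Fin d → ℝ) (H : (Fin d → ℝ) → ℝ)
    (n m b ℓpil : ℕ) (ω : Ω) : ℝ :=
  (∑ i ∈ Finset.range (n - m + 1),
    (mbbVar X H ((i : ℤ) + 1) m b ω - sigmaHat X H n ℓpil ω) ^ 2) / ((n - m + 1 : ℕ) : ℝ)

/-- `i`-th block-deleted JAB point value (`i` 0-based), deleting `m` consecutive blocks
from the `n − ℓ + 1` MBB blocks of length `ℓ`. -/
def jabPoint (X : ℤ → Ω → Fin d → ℝ) (H : (Fin d → ℝ) → ℝ)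
    (n ℓ m i : ℕ) (ω : Ω) : ℝ :=
  mbbVarOn X H 1 ℓ (n / ℓ) (Finset.range (n - ℓ + 1) \ Finset.Ico i (i + m)) ω

/-- JAB variance estimator `VÂR` of the MBB variance estimator `σ̂_n²(ℓ)`. -/
def jabVar (X : ℤ → Ω → Fin d → ℝ) (H : (Fin d → ℝ) → ℝ)
    (n ℓ m : ℕ) (ω : Ω) : ℝ :=
  (↑m / ((((n - ℓ + 1) - m : ℕ) : ℝ) * (((n - ℓ + 1) - m + 1 : ℕ) : ℝ))) *
    ∑ i ∈ Finset.range ((n - ℓ + 1) - m + 1),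
      (((((n - ℓ + 1 : ℕ) : ℝ) * sigmaHat X H n ℓ ω -
          (((n - ℓ + 1) - m : ℕ) : ℝ) * jabPoint X H n ℓ m i ω) / m) -
        sigmaHat X H n ℓ ω) ^ 2

/-- `V̂₀ = (n/ℓ₁) VÂR`. -/
def V0hat (X : ℤ → Ω → Fin d → ℝ) (H : (Fin d → ℝ) → ℝ)
    (n ℓ₁ m : ℕ) (ω : Ω) : ℝ :=
  ((n : ℝ) / (ℓ₁ : ℝ)) * jabVar X H n ℓ₁ m ω

/-- `B̂₀ = ℓ₂ · BIÂS = 2 ℓ₂ (σ̂_n²(ℓ₂) − σ̂_n²(2ℓ₂))`. -/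
def B0hat (X : ℤ → Ω → Fin d → ℝ) (H : (Fin d → ℝ) → ℝ)
    (n ℓ₂ : ℕ) (ω : Ω) : ℝ :=
  (ℓ₂ : ℝ) * (2 * (sigmaHat X H n ℓ₂ ω - sigmaHat X H n (2 * ℓ₂) ω))

/-- The NPPI block length estimator `ℓ̂_{n,NPPI}^{opt} = (2B̂₀²/V̂₀)^{1/3} n^{1/3}`. -/
def nppiEst (X : ℤ → Ω → Fin d → ℝ) (H : (Fin d → ℝ) → ℝ)
    (n ℓ₁ ℓ₂ m : ℕ) (ω : Ω) : ℝ :=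
  (2 * B0hat X H n ℓ₂ ω ^ 2 / V0hat X H n ℓ₁ m ω) ^ ((1 : ℝ) / 3) *
    (n : ℝ) ^ ((1 : ℝ) / 3)

/-- The flat-top lag window `λ`. -/
def flatTop (t : ℝ) : ℝ :=
  if |t| ≤ 1 / 2 then 1 else if |t| ≤ 1 then 2 * (1 - |t|) else 0

/-- `Ŷ_i = ∇̂'(X_i − X̄_n)` with `∇̂ = ∂H(X̄_n)/∂x`. -/
def YhatPW (X : ℤ → Ω → Fin d → ℝ) (H : (Fin d → ℝ) → ℝ)
    (n : ℕ) (i : ℤ) (ω : Ω) : ℝ :=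
  fderiv ℝ H (sampleMean X n ω) (fun j => X i ω j - sampleMean X n ω j)

/-- `∇̂' r̂(k) ∇̂ = n⁻¹ Σ_{i=1}^{n-k} Ŷ_i Ŷ_{i+k}` for `k ≥ 0`. -/
def rhatQuad (X : ℤ → Ω → Fin d → ℝ) (H : (Fin d → ℝ) → ℝ)
    (n k : ℕ) (ω : Ω) : ℝ :=
  (∑ i ∈ Finset.range (n - k),
    YhatPW X H n ((i : ℤ) + 1) ω * YhatPW X H n ((i : ℤ) + 1 + (k : ℤ)) ω) / n

/-- `B̂ = Σ_{k=-2M}^{2M} λ(k/(2M)) |k| ∇̂'r̂(k)∇̂`. -/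
def BhatPW (X : ℤ → Ω → Fin d → ℝ) (H : (Fin d → ℝ) → ℝ)
    (n Mb : ℕ) (ω : Ω) : ℝ :=
  ∑ k ∈ Finset.Icc (-(2 * Mb : ℤ)) (2 * Mb : ℤ),
    flatTop ((k : ℝ) / (2 * Mb)) * |(k : ℝ)| * rhatQuad X H n k.natAbs ω

/-- `Ŝ = Σ_{k=-2M}^{2M} λ(k/(2M)) ∇̂'r̂(k)∇̂`. -/
def ShatPW (X : ℤ → Ω → Fin d → ℝ) (H : (Fin d → ℝ) → ℝ)
    (n Mb : ℕ) (ω : Ω) : ℝ :=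
  ∑ k ∈ Finset.Icc (-(2 * Mb : ℤ)) (2 * Mb : ℤ),
    flatTop ((k : ℝ) / (2 * Mb)) * rhatQuad X H n k.natAbs ω

/-- The Politis–White block length estimator `ℓ̂_{n,PW}^{opt}`. -/
def pwEst (X : ℤ → Ω → Fin d → ℝ) (H : (Fin d → ℝ) → ℝ)
    (n Mb : ℕ) (ω : Ω) : ℝ :=
  (2 * BhatPW X H n Mb ω ^ 2 / ((4 / 3) * ShatPW X H n Mb ω ^ 4)) ^ ((1 : ℝ) / 3) *
    (n : ℝ) ^ ((1 : ℝ) / 3)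

/-- `Δ_m^∞(b)`: difference of the centered oracle subsampling MSE at `b_m^{opt}` and `b`. -/
def DeltaInf (μ : Measure Ω) (X : ℤ → Ω → Fin d → ℝ) (H : (Fin d → ℝ) → ℝ)
    (bopt n m b : ℕ) (ω : Ω) : ℝ :=
  (MSEhatInf μ X H n m bopt ω - ∫ ω', MSEhatInf μ X H n m bopt ω' ∂μ) -
    (MSEhatInf μ X H n m b ω - ∫ ω', MSEhatInf μ X H n m b ω' ∂μ)

/-- `Ω_{3,m}(b)`. -/
def Omega3 (μ : Measure Ω) (X : ℤ → Ω → Fin d → ℝ) (H : (Fin d → ℝ) → ℝ)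
    (bopt ℓpil n m b : ℕ) (ω : Ω) : ℝ :=
  2 * (sigmaHat X H n ℓpil ω - sigInfSq μ X H) / ((n - m + 1 : ℕ) : ℝ) *
    ∑ i ∈ Finset.range (n - m + 1),
      ((mbbVar X H ((i : ℤ) + 1) m b ω - mbbVar X H ((i : ℤ) + 1) m bopt ω) -
        ∫ ω', (mbbVar X H ((i : ℤ) + 1) m b ω' - mbbVar X H ((i : ℤ) + 1) m bopt ω') ∂μ)

/-- `Ω_{1,m}(b) = Ω_{3,m}(b) − E Ω_{3,m}(b)`. -/
def Omega1 (μ : Measure Ω) (X : ℤ → Ω → Fin d → ℝ) (H : (Fin d → ℝ) → ℝ)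
    (bopt ℓpil n m b : ℕ) (ω : Ω) : ℝ :=
  Omega3 μ X H bopt ℓpil n m b ω - ∫ ω', Omega3 μ X H bopt ℓpil n m b ω' ∂μ

/-- `Ω_{2,m}(b) = 2[σ̂_n²(ℓ̃) − Eσ̂_n²(ℓ̃)] · E[σ̂²_{1,m}(b_m^{opt}) − σ̂²_{1,m}(b)]`. -/
def Omega2 (μ : Measure Ω) (X : ℤ → Ω → Fin d → ℝ) (H : (Fin d → ℝ) → ℝ)
    (bopt ℓpil n m b : ℕ) (ω : Ω) : ℝ :=
  2 * (sigmaHat X H n ℓpil ω - ∫ ω', sigmaHat X H n ℓpil ω' ∂μ) *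
    ∫ ω', (mbbVar X H 1 m bopt ω' - mbbVar X H 1 m b ω') ∂μ

/-- `J_m^{opt}(C) = {b ∈ J_m : |b_m^{opt} − b| ≤ C m^{1/3}}`. -/
def JmOpt (K : ℝ) (bopt m : ℕ) (C : ℝ) : Finset ℕ :=
  (Jset K m).filter fun b => |(bopt : ℝ) - (b : ℝ)| ≤ C * (m : ℝ) ^ ((1 : ℝ) / 3)

/-- `Ȳ_k = k⁻¹ Σ_{i=1}^k Y_i`. -/
def Ybar (μ : Measure Ω) (X : ℤ → Ω → Fin d → ℝ) (H : (Fin d → ℝ) → ℝ)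
    (k : ℕ) (ω : Ω) : ℝ :=
  (∑ i ∈ Finset.range k, Ylin μ X H ((i : ℤ) + 1) ω) / k

section Proof

open Finset

/-- Continuous linear functionals on `ℝ^d`. -/
abbrev LinForm (d : ℕ) := (Fin d → ℝ) →L[ℝ] ℝ

/-- The `j`-th coordinate functional on `ℝ^d`. -/
abbrev coord (j : Fin d) : LinForm d := ContinuousLinearMap.proj j

variable {μ : Measure Ω} [IsProbabilityMeasure μ] {X : ℤ → Ω → Fin d → ℝ} {a₀ : ℕ} {A : ℝ}
  {H : (Fin d → ℝ) → ℝ}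

set_option linter.unusedSectionVars false

lemma sigmaOf_eq_comap (X : ℤ → Ω → Fin d → ℝ) (S : Set ℤ) :
    sigmaOf X S = MeasurableSpace.comap (fun ω i => X i ω)
      (⨆ i ∈ S, MeasurableSpace.comap (fun x : ℤ → Fin d → ℝ => x i) inferInstance) := by
  simp only [sigmaOf, MeasurableSpace.comap_iSup, MeasurableSpace.comap_comp]
  rfl

lemma sigmaOf_mono (X : ℤ → Ω → Fin d → ℝ) {S T : Set ℤ} (h : S ⊆ T) : sigmaOf X S ≤ sigmaOf X T :=
  biSup_mono fun _ hi => h hi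

lemma sigmaOf_le (hX : ∀ i, Measurable (X i)) (S : Set ℤ) :
    sigmaOf X S ≤ (inferInstance : MeasurableSpace Ω) :=
  iSup₂_le fun i _ => (hX i).comap_le

lemma measurable_coord_sigmaOf (X : ℤ → Ω → Fin d → ℝ) {S : Set ℤ} {i : ℤ} (hi : i ∈ S) :
    Measurable[sigmaOf X S] (X i) :=
  Measurable.mono (comap_measurable (X i))
    (le_iSup₂_of_le (f := fun i (_ : i ∈ S) => MeasurableSpace.comap (X i) inferInstance)
      i hi le_rfl) le_rfl

lemma measurable_shift (hX : ∀ i, Measurable (X i)) (k : ℤ) :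
    Measurable (fun ω => fun i : ℤ => X (i + k) ω) :=
  measurable_pi_lambda _ fun i => hX (i + k)

lemma coordSigma_le (S : Set ℤ) :
    (⨆ i ∈ S, MeasurableSpace.comap (fun x : ℤ → Fin d → ℝ => x i) inferInstance)
      ≤ (inferInstance : MeasurableSpace (ℤ → Fin d → ℝ)) :=
  iSup₂_le fun i _ => (measurable_pi_apply i).comap_le

lemma measure_shift_preimage (hX : ∀ i, Measurable (X i)) (hst : IsStationary μ X) (k : ℤ)
    {A : Set (ℤ → Fin d → ℝ)} (hA : MeasurableSet A) :
    μ ((fun ω => fun i : ℤ => X (i + k) ω) ⁻¹' A) = μ ((fun ω => fun i : ℤ => X i ω) ⁻¹' A) := by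
  have h := congrArg (fun ν => ν A) (hst k)
  have h0 := measurable_shift hX 0
  simp only [add_zero] at h0
  simpa only [Measure.map_apply (measurable_shift hX k) hA, Measure.map_apply h0 hA] using h

lemma abs_measure_inter_sub_le_one (μ : Measure Ω) [IsProbabilityMeasure μ] (A B : Set Ω) :
    |(μ (A ∩ B)).toReal - (μ A).toReal * (μ B).toReal| ≤ 1 := by
  have h1 : (μ (A ∩ B)).toReal ≤ 1 := measureReal_le_one
  have h2 : (μ A).toReal ≤ 1 := measureReal_le_one
  have h3 : (μ B).toReal ≤ 1 := measureReal_le_one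
  have h4 : 0 ≤ (μ (A ∩ B)).toReal := ENNReal.toReal_nonneg
  have h5 : 0 ≤ (μ A).toReal := ENNReal.toReal_nonneg
  have h6 : 0 ≤ (μ B).toReal := ENNReal.toReal_nonneg
  rw [abs_le]
  constructor <;> nlinarith

lemma alphaMix_set_bddAbove (μ : Measure Ω) [IsProbabilityMeasure μ]
    (X : ℤ → Ω → Fin d → ℝ) (k : ℕ) :
    BddAbove { x | ∃ A B : Set Ω,
      MeasurableSet[sigmaOf X {i | i ≤ 0}] A ∧ MeasurableSet[sigmaOf X {i | (k : ℤ) ≤ i}] B ∧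
      x = |(μ (A ∩ B)).toReal - (μ A).toReal * (μ B).toReal| } := by
  refine ⟨1, ?_⟩
  rintro x ⟨A, B, -, -, rfl⟩
  exact abs_measure_inter_sub_le_one μ A B

lemma alphaMix_nonneg (μ : Measure Ω) (X : ℤ → Ω → Fin d → ℝ) (k : ℕ) : 0 ≤ alphaMix μ X k := by
  apply Real.sSup_nonneg
  rintro x ⟨A, B, -, -, rfl⟩
  exact abs_nonneg _

lemma alphaMix_le_one (μ : Measure Ω) [IsProbabilityMeasure μ]
    (X : ℤ → Ω → Fin d → ℝ) (k : ℕ) : alphaMix μ X k ≤ 1 := by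
  apply Real.sSup_le _ zero_le_one
  rintro x ⟨A, B, -, -, rfl⟩
  exact abs_measure_inter_sub_le_one μ A B

lemma abs_measure_inter_sub_le
    (hX : ∀ i, Measurable (X i)) (hst : IsStationary μ X) (s : ℤ) (k : ℕ) {A B : Set Ω}
    (hA : MeasurableSet[sigmaOf X {i | i ≤ s}] A)
    (hB : MeasurableSet[sigmaOf X {i | s + (k : ℤ) ≤ i}] B) :
    |μ.real (A ∩ B) - μ.real A * μ.real B| ≤ alphaMix μ X k := by
  rw [sigmaOf_eq_comap] at hA hB
  obtain ⟨A', hA', rfl⟩ := hA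
  obtain ⟨B', hB', rfl⟩ := hB
  have mA := coordSigma_le _ _ hA'
  have mB := coordSigma_le _ _ hB'
  have e1 := measure_shift_preimage hX hst (-s) mA
  have e2 := measure_shift_preimage hX hst (-s) mB
  have e3 := measure_shift_preimage hX hst (-s) (mA.inter mB)
  rw [Set.preimage_inter, Set.preimage_inter] at e3
  simp only [Measure.real]
  rw [← e1, ← e2, ← e3]
  apply le_csSup (alphaMix_set_bddAbove μ X k)
  have key : ∀ (S T : Set ℤ), (∀ i ∈ S, i + -s ∈ T) → ∀ E : Set (ℤ → Fin d → ℝ),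
      MeasurableSet[⨆ i ∈ S, MeasurableSpace.comap (fun x : ℤ → Fin d → ℝ => x i) inferInstance] E →
      MeasurableSet[sigmaOf X T] ((fun ω => fun i : ℤ => X (i + -s) ω) ⁻¹' E) := by
    intro S T hST E hE
    have hle : MeasurableSpace.comap (fun ω => fun i : ℤ => X (i + -s) ω)
        (⨆ i ∈ S, MeasurableSpace.comap (fun x : ℤ → Fin d → ℝ => x i) inferInstance)
        ≤ sigmaOf X T := by
      simp only [MeasurableSpace.comap_iSup, MeasurableSpace.comap_comp]
      refine iSup₂_le fun i hi => ?_
      exact (measurable_coord_sigmaOf X (hST i hi)).comap_le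
    exact hle _ ⟨E, hE, rfl⟩
  refine ⟨_, _, key _ _ ?_ A' hA', key _ _ ?_ B' hB', rfl⟩
  · simp
  · grind

lemma alphaMix_decay {r : ℕ} (hr : 1 ≤ r) (h : CondM μ X r) :
    ∃ C : ℝ, 1 ≤ C ∧ ∀ k : ℕ, alphaMix μ X k ≤ C / ((k : ℝ) + 1) ^ (2 * r - 1) := by
  obtain ⟨δ, hδ, -, hs⟩ := h
  have ht := hs.tendsto_atTop_zero
  obtain ⟨C, hC⟩ := ht.bddAbove_range
  have hC' : ∀ k : ℕ, (k : ℝ) ^ (2 * r - 1) *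
      alphaMix μ X k ^ (δ / ((2 * r : ℝ) + δ)) ≤ C := fun k => hC ⟨k, rfl⟩
  refine ⟨max 1 (2 ^ (2 * r - 1) * C), le_max_left _ _, fun k => ?_⟩
  have hα := alphaMix_nonneg μ X k
  have hα1 := alphaMix_le_one μ X k
  rcases Nat.eq_zero_or_pos k with rfl | hk
  · simp_all
  rw [le_div_iff₀ (by positivity)]
  have hle : alphaMix μ X k ≤ alphaMix μ X k ^ (δ / ((2 * r : ℝ) + δ)) := by
    have hθ : δ / ((2 * r : ℝ) + δ) ≤ 1 := by bound
    have hθ0 : 0 < δ / ((2 * r : ℝ) + δ) := by positivity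
    exact Real.self_le_rpow_of_le_one hα hα1 hθ
  have hk1 : (1 : ℝ) ≤ k := by exact_mod_cast hk
  calc alphaMix μ X k * ((k : ℝ) + 1) ^ (2 * r - 1)
      ≤ alphaMix μ X k ^ (δ / ((2 * r : ℝ) + δ)) * (2 * (k : ℝ)) ^ (2 * r - 1) := by bound
    _ = 2 ^ (2 * r - 1) *
        ((k : ℝ) ^ (2 * r - 1) * alphaMix μ X k ^ (δ / ((2 * r : ℝ) + δ))) := by ring
    _ ≤ 2 ^ (2 * r - 1) * C := by gcongr; exact hC' k
    _ ≤ _ := le_max_right _ _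

section BoundedCov

variable {E : Type*} {m m₁ m₂ mE : MeasurableSpace E} {μ : Measure E} [IsProbabilityMeasure μ]

lemma abs_cov_le_of_sets {f g : E → ℝ} {M c : ℝ} (hm : m ≤ mE)
    (hf : Measurable[m] f) (hfM : ∀ ω, |f ω| ≤ M) (hg : Integrable g μ)
    (hc : ∀ A, MeasurableSet[m] A → |∫ ω in A, g ω ∂μ - μ.real A * ∫ ω, g ω ∂μ| ≤ c) :
    |∫ ω, f ω * g ω ∂μ - (∫ ω, f ω ∂μ) * ∫ ω, g ω ∂μ| ≤ 2 * M * c := by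
  have hM0 : 0 ≤ M := by
    obtain ⟨ω⟩ := μ.nonempty_of_neZero
    exact (abs_nonneg _).trans (hfM ω)
  have hfm : StronglyMeasurable[m] f := hf.stronglyMeasurable
  have hf' : Measurable f := hf.mono hm le_rfl
  have hfi : Integrable f μ :=
    Integrable.of_bound hf'.aestronglyMeasurable M (by simpa using ae_of_all μ hfM)
  have hfg : Integrable (fun ω => f ω * g ω) μ :=
    hg.bdd_mul hf'.aestronglyMeasurable (c := M) (by simpa using ae_of_all μ hfM)
  have hD : Integrable (fun ω => (μ[g|m]) ω - ∫ ω, g ω ∂μ) μ :=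
    integrable_condExp.sub (integrable_const _)
  have hDm : Measurable[m] (fun ω => (μ[g|m]) ω - ∫ ω, g ω ∂μ) :=
    (stronglyMeasurable_condExp.measurable).sub measurable_const
  set D : E → ℝ := fun ω => (μ[g|m]) ω - ∫ ω, g ω ∂μ with hDdef
  have hset : ∀ A, MeasurableSet[m] A →
      ∫ ω in A, D ω ∂μ = ∫ ω in A, g ω ∂μ - μ.real A * ∫ ω, g ω ∂μ := by
    intro A hA
    rw [hDdef, integral_sub integrable_condExp.integrableOn (integrable_const _).integrableOn,
      setIntegral_condExp hm hg hA]
    simp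
  have e1 : ∫ ω, f ω * g ω ∂μ = ∫ ω, f ω * (μ[g|m]) ω ∂μ := by
    have h1 : μ[fun ω => f ω * g ω|m] =ᵐ[μ] fun ω => f ω * (μ[g|m]) ω :=
      condExp_mul_of_stronglyMeasurable_left hfm hfg hg
    rw [← integral_condExp hm (f := fun ω => f ω * g ω)]
    exact integral_congr_ae h1
  have hfc : Integrable (fun ω => f ω * (μ[g|m]) ω) μ :=
    (integrable_condExp (m := m)).bdd_mul hf'.aestronglyMeasurable (c := M)
      (by simpa using ae_of_all μ hfM)
  have e2 : ∫ ω, f ω * g ω ∂μ - (∫ ω, f ω ∂μ) * ∫ ω, g ω ∂μ = ∫ ω, f ω * D ω ∂μ := by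
    rw [e1, ← integral_mul_const, ← integral_sub hfc (hfi.mul_const _)]
    congr 1; ext ω; simp only [hDdef]; ring
  have hA : MeasurableSet[m] {ω | 0 ≤ D ω} := measurableSet_le measurable_const hDm
  have hA' : MeasurableSet {ω | 0 ≤ D ω} := hm _ hA
  have e3 : ∫ ω, |D ω| ∂μ = ∫ ω in {ω | 0 ≤ D ω}, D ω ∂μ - ∫ ω in {ω | 0 ≤ D ω}ᶜ, D ω ∂μ := by
    rw [← integral_add_compl hA' hD.abs, sub_eq_add_neg, ← integral_neg]
    congr 1
    · exact setIntegral_congr_fun hA' fun ω hω => abs_of_nonneg hω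
    · refine setIntegral_congr_fun hA'.compl fun ω hω => abs_of_nonpos ?_
      simp only [Set.mem_compl_iff, Set.mem_ofPred_eq, not_le] at hω
      exact hω.le
  have e4 : ∫ ω, |D ω| ∂μ ≤ 2 * c := by
    rw [e3, hset _ hA, hset _ hA.compl]
    have h1 := abs_le.1 (hc _ hA)
    have h2 := abs_le.1 (hc _ hA.compl)
    linarith [h1.2, h2.1]
  rw [e2]
  calc |∫ ω, f ω * D ω ∂μ| ≤ ∫ ω, |f ω * D ω| ∂μ := abs_integral_le_integral_abs
    _ ≤ ∫ ω, M * |D ω| ∂μ := by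
        apply integral_mono_of_nonneg (ae_of_all _ fun _ => abs_nonneg _) (hD.abs.const_mul M)
        refine ae_of_all _ fun ω => ?_
        simp only [abs_mul]
        exact mul_le_mul_of_nonneg_right (hfM ω) (abs_nonneg _)
    _ = M * ∫ ω, |D ω| ∂μ := integral_const_mul _ _
    _ ≤ 2 * M * c := by nlinarith

lemma abs_cov_le_of_bounded {f g : E → ℝ} {M M' α : ℝ} (hm₁ : m₁ ≤ mE) (hm₂ : m₂ ≤ mE)
    (hf : Measurable[m₁] f) (hfM : ∀ ω, |f ω| ≤ M)
    (hg : Measurable[m₂] g) (hgM : ∀ ω, |g ω| ≤ M')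
    (hα : ∀ A B, MeasurableSet[m₁] A → MeasurableSet[m₂] B →
      |μ.real (A ∩ B) - μ.real A * μ.real B| ≤ α) :
    |∫ ω, f ω * g ω ∂μ - (∫ ω, f ω ∂μ) * ∫ ω, g ω ∂μ| ≤ 4 * α * (M * M') := by
  have hg' : Measurable g := hg.mono hm₂ le_rfl
  have hgi : Integrable g μ :=
    Integrable.of_bound hg'.aestronglyMeasurable M' (by simpa using ae_of_all μ hgM)
  have := abs_cov_le_of_sets (c := 2 * M' * α) hm₁ hf hfM hgi ?_
  · linarith
  intro A hA
  have hA' := hm₁ _ hA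
  have h := abs_cov_le_of_sets (μ := μ) (f := g) (g := A.indicator fun _ => (1 : ℝ)) (c := α)
    hm₂ hg hgM ((integrable_const _).indicator hA') ?_
  · have e1 : ∫ ω, g ω * A.indicator (fun _ => (1 : ℝ)) ω ∂μ = ∫ ω in A, g ω ∂μ := by
      rw [← integral_indicator hA']
      congr 1; ext ω; by_cases h : ω ∈ A <;> simp [h]
    have e2 : ∫ ω, A.indicator (fun _ => (1 : ℝ)) ω ∂μ = μ.real A := by simp_all
    rw [e1, e2] at h
    rwa [mul_comm (μ.real A)]
  · intro B hB
    have hB' := hm₂ _ hB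
    have e2 : ∫ ω, A.indicator (fun _ => (1 : ℝ)) ω ∂μ = μ.real A := by simp_all
    have e1 : ∫ ω in B, A.indicator (fun _ => (1 : ℝ)) ω ∂μ = μ.real (A ∩ B) := by simp_all
    rw [e1, e2, mul_comm (μ.real B)]
    exact hα A B hA hB

end BoundedCov

/-- The centered observation `X_i - E X_1`. -/
def cen (μ : Measure Ω) (X : ℤ → Ω → Fin d → ℝ) (i : ℤ) (ω : Ω) : Fin d → ℝ :=
  fun j => X i ω j - meanVec μ X j

/-- A linear functional of the centered observation. -/
def xi (μ : Measure Ω) (X : ℤ → Ω → Fin d → ℝ) (φ : LinForm d) (i : ℤ) (ω : Ω) : ℝ :=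
  φ (cen μ X i ω)

/-- Envelope of the centered observations over the window `[a, b)`. -/
def envU (μ : Measure Ω) (X : ℤ → Ω → Fin d → ℝ) (a b : ℤ) (ω : Ω) : ℝ :=
  1 + ‖fun t : ↥(Ico a b) => cen μ X t ω‖

/-- The quantitative form of the moment and mixing conditions. -/
structure Good (μ : Measure Ω) (X : ℤ → Ω → Fin d → ℝ) (a₀ : ℕ) (A : ℝ) : Prop where
  meas : ∀ i, Measurable (X i)
  stat : IsStationary μ X
  one_le : 1 ≤ A
  mom : ∀ i, Integrable (fun ω => ‖cen μ X i ω‖ ^ (28 + 8 * a₀)) μ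
  mom_le : ∀ i, ∫ ω, ‖cen μ X i ω‖ ^ (28 + 8 * a₀) ∂μ ≤ A
  mix : ∀ k : ℕ, alphaMix μ X k ≤ A / ((k : ℝ) + 1) ^ (27 + 8 * a₀)

/-- Functionals of the window `[a, b)` with polynomial growth of degree `i`. -/
structure Pw (μ : Measure Ω) (X : ℤ → Ω → Fin d → ℝ) (a b : ℤ) (i : ℕ) (C : ℝ) (f : Ω → ℝ) :
    Prop where
  meas : Measurable[sigmaOf X (Set.Ico a b)] f
  nonneg : 0 ≤ C
  bound : ∀ ω, |f ω| ≤ C * envU μ X a b ω ^ i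

lemma one_le_envU (a b : ℤ) (ω : Ω) : 1 ≤ envU μ X a b ω := by
  simp only [envU, le_add_iff_nonneg_right]; exact norm_nonneg _

lemma envU_pos (a b : ℤ) (ω : Ω) : 0 < envU μ X a b ω :=
  zero_lt_one.trans_le (one_le_envU a b ω)

lemma norm_cen_le_envU {a b t : ℤ} (h : t ∈ Ico a b) (ω : Ω) : ‖cen μ X t ω‖ ≤ envU μ X a b ω := by
  have := norm_le_pi_norm (fun t : ↥(Ico a b) => cen μ X t ω) ⟨t, h⟩
  simp only [envU]; simp only at this; linarith

lemma envU_mono {a b a' b' : ℤ} (ha : a' ≤ a) (hb : b ≤ b') (ω : Ω) :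
    envU μ X a b ω ≤ envU μ X a' b' ω := by
  simp only [envU]
  gcongr
  rw [pi_norm_le_iff_of_nonneg (norm_nonneg _)]
  rintro ⟨t, ht⟩
  rw [mem_Ico] at ht
  exact norm_le_pi_norm (fun t : ↥(Ico a' b') => cen μ X t ω) ⟨t, mem_Ico.2 ⟨by omega, by omega⟩⟩

lemma measurable_cen_sigmaOf {S : Set ℤ} {i : ℤ} (hi : i ∈ S) :
    Measurable[sigmaOf X S] (cen μ X i) := by
  have h := measurable_coord_sigmaOf X hi
  unfold cen
  exact @measurable_pi_lambda _ _ _ (sigmaOf X S) _ _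
    fun j => ((measurable_pi_apply j).comp h).sub_const _

lemma measurable_envU_sigmaOf (a b : ℤ) : Measurable[sigmaOf X (Set.Ico a b)] (envU μ X a b) := by
  exact measurable_const.add (measurable_norm.comp
    (@measurable_pi_lambda _ _ _ (sigmaOf X (Set.Ico a b)) _ _ fun t =>
      measurable_cen_sigmaOf (mem_Ico.1 t.2)))

lemma Good.measurable_cen (hP : Good μ X a₀ A) (i : ℤ) : Measurable (cen μ X i) :=
  (measurable_cen_sigmaOf (Set.mem_singleton i)).mono (sigmaOf_le hP.meas _) le_rfl

lemma Good.measurable_envU (hP : Good μ X a₀ A) (a b : ℤ) : Measurable (envU μ X a b) :=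
  (measurable_envU_sigmaOf a b).mono (sigmaOf_le hP.meas _) le_rfl

lemma envU_pow_le (a b : ℤ) {p : ℕ} (hp : p ≠ 0) (ω : Ω) :
    envU μ X a b ω ^ p ≤ 2 ^ p * (1 + ∑ t ∈ Ico a b, ‖cen μ X t ω‖ ^ p) := by
  set N := ‖fun t : ↥(Ico a b) => cen μ X t ω‖ with hN
  have hN0 : 0 ≤ N := norm_nonneg _
  have hS0 : 0 ≤ ∑ t ∈ Ico a b, ‖cen μ X t ω‖ ^ p :=
    sum_nonneg fun _ _ => by positivity
  have h1 : N ^ p ≤ ∑ t ∈ Ico a b, ‖cen μ X t ω‖ ^ p := by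
    have : N ≤ (∑ t ∈ Ico a b, ‖cen μ X t ω‖ ^ p) ^ ((p : ℝ)⁻¹) := by
      rw [hN, pi_norm_le_iff_of_nonneg (by positivity)]
      rintro ⟨t, ht⟩
      rw [← Real.pow_rpow_inv_natCast (norm_nonneg (cen μ X t ω)) hp]
      refine Real.rpow_le_rpow (by positivity) ?_ (by positivity)
      exact single_le_sum (f := fun t => ‖cen μ X t ω‖ ^ p) (fun _ _ => by positivity) ht
    calc N ^ p ≤ ((∑ t ∈ Ico a b, ‖cen μ X t ω‖ ^ p) ^ ((p : ℝ)⁻¹)) ^ p := by gcongr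
      _ = _ := Real.rpow_inv_natCast_pow hS0 hp
  have h2 : envU μ X a b ω ≤ 2 * max 1 N := by
    have := le_max_left 1 N; have := le_max_right 1 N
    simp only [envU, ← hN]; linarith
  calc envU μ X a b ω ^ p ≤ (2 * max 1 N) ^ p := by gcongr; exact (envU_pos a b ω).le
    _ = 2 ^ p * (max 1 N) ^ p := mul_pow _ _ _
    _ ≤ _ := by
      gcongr
      rcases max_cases 1 N with ⟨h, -⟩ | ⟨h, -⟩ <;> rw [h]
      · simpa using hS0
      · linarith

lemma Good.integrable_envU_pow (hP : Good μ X a₀ A) (a b : ℤ) :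
    Integrable (fun ω => envU μ X a b ω ^ (28 + 8 * a₀)) μ := by
  have h : Integrable (fun ω => (2:ℝ) ^ (28 + 8 * a₀) *
      (1 + ∑ t ∈ Ico a b, ‖cen μ X t ω‖ ^ (28 + 8 * a₀))) μ :=
    ((integrable_const _).add (integrable_finsetSum _ fun t _ => hP.mom t)).const_mul _
  refine h.mono' ((hP.measurable_envU a b).pow_const _).aestronglyMeasurable
    (ae_of_all _ fun ω => ?_)
  rw [Real.norm_of_nonneg (pow_nonneg (envU_pos a b ω).le _)]
  exact envU_pow_le a b (by omega) ω

lemma Good.integral_envU_pow_le (hP : Good μ X a₀ A) {a b : ℤ} {w : ℝ}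
    (hw1 : 1 ≤ w) (hw : ((b - a : ℤ) : ℝ) ≤ w) :
    ∫ ω, envU μ X a b ω ^ (28 + 8 * a₀) ∂μ ≤ 2 ^ (29 + 8 * a₀) * A * w := by
  have hi : Integrable (fun ω => ∑ t ∈ Ico a b, ‖cen μ X t ω‖ ^ (28 + 8 * a₀)) μ :=
    integrable_finsetSum _ fun t _ => hP.mom t
  have h : Integrable (fun ω => (2:ℝ) ^ (28 + 8 * a₀) *
      (1 + ∑ t ∈ Ico a b, ‖cen μ X t ω‖ ^ (28 + 8 * a₀))) μ :=
    ((integrable_const _).add hi).const_mul _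
  have hc : ((Ico a b).card : ℝ) ≤ w := by
    rw [Int.card_Ico, ← Int.cast_natCast, Int.toNat_eq_max]
    push_cast at hw ⊢
    exact max_le hw (by linarith)
  have hA := hP.one_le
  calc _ ≤ ∫ ω, (2:ℝ) ^ (28 + 8 * a₀) *
      (1 + ∑ t ∈ Ico a b, ‖cen μ X t ω‖ ^ (28 + 8 * a₀)) ∂μ :=
        integral_mono (hP.integrable_envU_pow a b) h fun ω => envU_pow_le a b (by omega) ω
    _ = 2 ^ (28 + 8 * a₀) * (1 + ∑ t ∈ Ico a b, ∫ ω, ‖cen μ X t ω‖ ^ (28 + 8 * a₀) ∂μ) := by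
        rw [integral_const_mul, integral_add (integrable_const _) hi,
          integral_finsetSum _ fun t _ => hP.mom t]
        simp
    _ ≤ 2 ^ (28 + 8 * a₀) * (A * w + A * w) := by
        gcongr
        · nlinarith
        · calc _ ≤ ∑ t ∈ Ico a b, A := sum_le_sum fun t _ => hP.mom_le t
            _ = (Ico a b).card * A := by simp
            _ ≤ A * w := by nlinarith
    _ = 2 ^ (29 + 8 * a₀) * A * w := by
        rw [show 29 + 8 * a₀ = (28 + 8 * a₀) + 1 by ring, pow_succ]; ring

namespace Pw

variable {a b : ℤ} {i j : ℕ} {C D : ℝ} {f g : Ω → ℝ}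

lemma mono_window (h : Pw μ X a b i C f) {a' b' : ℤ} (ha : a' ≤ a) (hb : b ≤ b') :
    Pw μ X a' b' i C f where
  meas := h.meas.mono (sigmaOf_mono X (Set.Ico_subset_Ico ha hb)) le_rfl
  nonneg := h.nonneg
  bound ω := (h.bound ω).trans (mul_le_mul_of_nonneg_left
    (pow_le_pow_left₀ (envU_pos a b ω).le (envU_mono ha hb ω) _) h.nonneg)

lemma mono (h : Pw μ X a b i C f) (hij : i ≤ j) (hCD : C ≤ D) : Pw μ X a b j D f where
  meas := h.meas
  nonneg := h.nonneg.trans hCD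
  bound ω := (h.bound ω).trans (mul_le_mul hCD
    (pow_le_pow_right₀ (one_le_envU a b ω) hij) (pow_nonneg (envU_pos a b ω).le _)
    (h.nonneg.trans hCD))

lemma const (c : ℝ) : Pw μ X a b 0 |c| (fun _ => c) where
  meas := measurable_const
  nonneg := abs_nonneg c
  bound ω := by simp

lemma add (hf : Pw μ X a b i C f) (hg : Pw μ X a b i D g) :
    Pw μ X a b i (C + D) (fun ω => f ω + g ω) where
  meas := hf.meas.add hg.meas
  nonneg := add_nonneg hf.nonneg hg.nonneg
  bound ω := (abs_add_le _ _).trans (by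
    rw [add_mul]; exact add_le_add (hf.bound ω) (hg.bound ω))

lemma neg (hf : Pw μ X a b i C f) : Pw μ X a b i C (fun ω => - f ω) where
  meas := hf.meas.neg
  nonneg := hf.nonneg
  bound ω := by simpa using hf.bound ω

lemma sub (hf : Pw μ X a b i C f) (hg : Pw μ X a b i D g) :
    Pw μ X a b i (C + D) (fun ω => f ω - g ω) := by
  simpa only [sub_eq_add_neg] using hf.add hg.neg

lemma mul (hf : Pw μ X a b i C f) (hg : Pw μ X a b j D g) :
    Pw μ X a b (i + j) (C * D) (fun ω => f ω * g ω) where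
  meas := hf.meas.mul hg.meas
  nonneg := mul_nonneg hf.nonneg hg.nonneg
  bound ω := by
    rw [abs_mul, pow_add]
    calc |f ω| * |g ω| ≤ (C * envU μ X a b ω ^ i) * (D * envU μ X a b ω ^ j) :=
          mul_le_mul (hf.bound ω) (hg.bound ω) (abs_nonneg _)
            (mul_nonneg hf.nonneg (pow_nonneg (envU_pos a b ω).le _))
      _ = _ := by ring

lemma const_mul (hf : Pw μ X a b i C f) (c : ℝ) : Pw μ X a b i (|c| * C) (fun ω => c * f ω) := by
  simpa using (Pw.const (μ := μ) (X := X) (a := a) (b := b) c).mul hf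

lemma div_const (hf : Pw μ X a b i C f) (c : ℝ) : Pw μ X a b i (C / |c|) (fun ω => f ω / c) := by
  simpa [div_eq_mul_inv, mul_comm, abs_inv] using hf.const_mul c⁻¹

lemma pow (hf : Pw μ X a b i C f) (p : ℕ) : Pw μ X a b (i * p) (C ^ p) (fun ω => f ω ^ p) where
  meas := hf.meas.pow_const p
  nonneg := pow_nonneg hf.nonneg p
  bound ω := by
    rw [abs_pow, pow_mul, ← mul_pow]
    exact pow_le_pow_left₀ (abs_nonneg _) (hf.bound ω) p

lemma sum {ι : Type*} (s : Finset ι) {F : ι → Ω → ℝ} (h : ∀ x ∈ s, Pw μ X a b i C (F x)) :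
    Pw μ X a b i (s.card * C) (fun ω => ∑ x ∈ s, F x ω) := by
  induction s using Finset.induction_on with
  | empty =>
    refine ⟨by simp, by simp, fun ω => by simp⟩
  | insert x s hx ih =>
    have h1 := (h x (mem_insert_self x s)).add (ih fun y hy => h y (mem_insert_of_mem hy))
    simp only [sum_insert hx, card_insert_of_notMem hx]
    exact h1.mono le_rfl (le_of_eq (by push_cast; ring))

lemma xi_single (φ : LinForm d) (t : ℤ) : Pw μ X t (t + 1) 1 ‖φ‖ (xi μ X φ t) where
  meas := φ.measurable.comp (measurable_cen_sigmaOf (by simp))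
  nonneg := norm_nonneg _
  bound ω := by
    rw [pow_one, ← Real.norm_eq_abs]
    refine (φ.le_opNorm _).trans (mul_le_mul_of_nonneg_left ?_ (norm_nonneg _))
    exact norm_cen_le_envU (by simp) ω

lemma xi (φ : LinForm d) {t : ℤ} (h1 : a ≤ t) (h2 : t < b) : Pw μ X a b 1 ‖φ‖ (xi μ X φ t) :=
  (xi_single φ t).mono_window h1 (by omega)

lemma measurable (hf : Pw μ X a b i C f) (hP : Good μ X a₀ A) : Measurable f :=
  hf.meas.mono (sigmaOf_le hP.meas _) le_rfl

lemma abs_pow_le (hf : Pw μ X a b i C f) {p : ℕ} (hp : i * p ≤ 28 + 8 * a₀) (ω : Ω) :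
    |f ω| ^ p ≤ C ^ p * envU μ X a b ω ^ (28 + 8 * a₀) := by
  have h := (hf.pow p).mono hp le_rfl
  simpa [abs_pow] using h.bound ω

lemma integrable_abs_pow (hf : Pw μ X a b i C f) (hP : Good μ X a₀ A)
    {p : ℕ} (hp : i * p ≤ 28 + 8 * a₀) : Integrable (fun ω => |f ω| ^ p) μ := by
  refine ((hP.integrable_envU_pow a b).const_mul (C ^ p)).mono'
    ((hf.measurable hP).abs.pow_const p).aestronglyMeasurable (ae_of_all _ fun ω => ?_)
  rw [Real.norm_of_nonneg (by positivity)]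
  exact hf.abs_pow_le hp ω

lemma integral_abs_pow_le (hf : Pw μ X a b i C f) (hP : Good μ X a₀ A)
    {p : ℕ} (hp : i * p ≤ 28 + 8 * a₀) {w : ℝ} (hw1 : 1 ≤ w) (hw : ((b - a : ℤ) : ℝ) ≤ w) :
    ∫ ω, |f ω| ^ p ∂μ ≤ C ^ p * (2 ^ (29 + 8 * a₀) * A * w) := by
  calc _ ≤ ∫ ω, C ^ p * envU μ X a b ω ^ (28 + 8 * a₀) ∂μ :=
        integral_mono (hf.integrable_abs_pow hP hp)
          ((hP.integrable_envU_pow a b).const_mul _) fun ω => hf.abs_pow_le hp ω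
    _ = C ^ p * ∫ ω, envU μ X a b ω ^ (28 + 8 * a₀) ∂μ := integral_const_mul _ _
    _ ≤ _ := mul_le_mul_of_nonneg_left (hP.integral_envU_pow_le hw1 hw) (pow_nonneg hf.nonneg p)

lemma integrable (hf : Pw μ X a b i C f) (hP : Good μ X a₀ A)
    (hi : i ≤ 28 + 8 * a₀) : Integrable f μ := by
  have h := hf.integrable_abs_pow hP (p := 1) (by simpa using hi)
  simp only [pow_one] at h
  exact (integrable_norm_iff (hf.measurable hP).aestronglyMeasurable).1 h

lemma memLp (hf : Pw μ X a b i C f) (hP : Good μ X a₀ A)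
    {p : ℕ} (hp0 : p ≠ 0) (hp : i * p ≤ 28 + 8 * a₀) : MemLp f p μ := by
  have h := hf.integrable_abs_pow hP hp
  rw [← integrable_norm_rpow_iff (hf.measurable hP).aestronglyMeasurable (by simpa using hp0)
    (by simp)]
  simpa using h

end Pw

lemma truncation_bound {u v M f g C D : ℝ} {i j κ : ℕ} (hu : 1 ≤ u) (hv : 1 ≤ v) (hM : 1 ≤ M)
    (hC : 0 ≤ C) (hD : 0 ≤ D)
    (hf : |f| ≤ C * u ^ i) (hg : |g| ≤ D * v ^ j) (hij : i + j ≤ κ) :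
    |f * g - (if u ≤ M then f else 0) * (if v ≤ M then g else 0)|
      ≤ C * D / M ^ (κ - (i + j)) * (u ^ κ + v ^ κ) := by
  have hM0 : 0 < M := by linarith
  by_cases h : u ≤ M ∧ v ≤ M
  · rw [if_pos h.1, if_pos h.2]; simp; positivity
  have e : f * g - (if u ≤ M then f else 0) * (if v ≤ M then g else 0) = f * g := by
    rw [not_and_or] at h
    rcases h with h | h <;> simp [h]
  rw [e, abs_mul]
  set w := max u v
  have hw1 : 1 ≤ w := hu.trans (le_max_left _ _)
  have hwM : M ≤ w := by
    rw [not_and_or, not_le, not_le] at h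
    exact le_max_iff.2 (h.imp le_of_lt le_of_lt)
  have hwk : w ^ κ ≤ u ^ κ + v ^ κ := by
    have hu' : 0 ≤ u ^ κ := by positivity
    have hv' : 0 ≤ v ^ κ := by positivity
    rcases max_choice u v with h | h <;> simp only [w, h] <;> linarith
  calc |f| * |g| ≤ (C * u ^ i) * (D * v ^ j) :=
        mul_le_mul hf hg (abs_nonneg _) (by positivity)
    _ ≤ (C * w ^ i) * (D * w ^ j) := by
        gcongr
        · exact le_max_left _ _
        · exact le_max_right _ _
    _ = C * D * w ^ (i + j) := by rw [pow_add]; ring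
    _ ≤ C * D / M ^ (κ - (i + j)) * w ^ κ := by
        rw [div_mul_eq_mul_div, le_div_iff₀ (by positivity), mul_assoc]
        gcongr
        calc w ^ (i + j) * M ^ (κ - (i + j)) ≤ w ^ (i + j) * w ^ (κ - (i + j)) := by gcongr
          _ = w ^ κ := by rw [← pow_add]; congr 1; omega
    _ ≤ _ := by gcongr

lemma Pw.truncate {a b : ℤ} {i : ℕ} {C M : ℝ} {f : Ω → ℝ} (hf : Pw μ X a b i C f)
    (hP : Good μ X a₀ A) (hM : 0 ≤ M) :
    let T := fun ω => if envU μ X a b ω ≤ M then f ω else 0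
    Measurable[sigmaOf X (Set.Ico a b)] T ∧ Measurable T ∧ (∀ ω, |T ω| ≤ C * M ^ i) ∧
      Integrable T μ := by
  intro T
  have hT : Measurable[sigmaOf X (Set.Ico a b)] T :=
    Measurable.ite (measurableSet_le (measurable_envU_sigmaOf a b) measurable_const)
      hf.meas measurable_const
  have hTm := hT.mono (sigmaOf_le hP.meas _) le_rfl
  have hTb (ω) : |T ω| ≤ C * M ^ i := by
    simp only [T]
    split_ifs with h
    · exact (hf.bound ω).trans (mul_le_mul_of_nonneg_left
        (pow_le_pow_left₀ (envU_pos a b ω).le h _) hf.nonneg)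
    · simpa using mul_nonneg hf.nonneg (pow_nonneg hM i)
  exact ⟨hT, hTm, hTb, .of_bound hTm.aestronglyMeasurable _ (by simpa using ae_of_all μ hTb)⟩

lemma abs_integral_sub_le_of_marginals {Z : Type*} [MeasurableSpace Z] {ρ : Measure Z}
    {p q : Z → Ω} {F G : Z → ℝ} {u v : Ω → ℝ} {Q B : ℝ} (hp : MeasurePreserving p ρ μ)
    (hq : MeasurePreserving q ρ μ) (hu : Integrable u μ) (hv : Integrable v μ)
    (hF : Integrable F ρ) (hG : Integrable G ρ) (h : ∀ z, |F z - G z| ≤ Q * (u (p z) + v (q z)))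
    (hQ : 0 ≤ Q) (huB : ∫ ω, u ω ∂μ ≤ B) (hvB : ∫ ω, v ω ∂μ ≤ B) :
    |∫ z, F z ∂ρ - ∫ z, G z ∂ρ| ≤ Q * (2 * B) := by
  have hu' := hp.integrable_comp_of_integrable hu
  have hv' := hq.integrable_comp_of_integrable hv
  rw [← hp.map_eq, integral_map hp.aemeasurable (by rw [hp.map_eq]; exact hu.1)] at huB
  rw [← hq.map_eq, integral_map hq.aemeasurable (by rw [hq.map_eq]; exact hv.1)] at hvB
  rw [← integral_sub hF hG]
  calc _ ≤ ∫ z, |F z - G z| ∂ρ := abs_integral_le_integral_abs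
    _ ≤ ∫ z, Q * (u (p z) + v (q z)) ∂ρ :=
      integral_mono (hF.sub hG).abs ((hu'.add hv').const_mul Q) h
    _ = Q * (∫ z, u (p z) ∂ρ + ∫ z, v (q z) ∂ρ) := by
      rw [integral_const_mul]
      congr 1
      exact integral_add hu' hv'
    _ ≤ _ := by gcongr; linarith

theorem Good.abs_cov_le (hP : Good μ X a₀ A) {a b c e : ℤ} {i j k : ℕ}
    {C D : ℝ} {f g : Ω → ℝ} (hf : Pw μ X a b i C f) (hg : Pw μ X c e j D g)
    (hk : b + k ≤ c) (hij : i + j ≤ 13 + 4 * a₀) {w : ℝ} (hw1 : 1 ≤ w)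
    (hw : ((b - a : ℤ) : ℝ) ≤ w) (hw' : ((e - c : ℤ) : ℝ) ≤ w) :
    |∫ ω, f ω * g ω ∂μ - (∫ ω, f ω ∂μ) * ∫ ω, g ω ∂μ|
      ≤ (4 * A + 2 ^ (31 + 8 * a₀) * A) * (C * D * w) / ((k : ℝ) + 1) ^ (14 + 4 * a₀) := by
  set M : ℝ := (k : ℝ) + 1 with hMdef
  have hM1 : 1 ≤ M := by simp [hMdef]
  have hM0 : 0 < M := by linarith
  set κ := 28 + 8 * a₀ with hκ
  set u := envU μ X a b
  set v := envU μ X c e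
  have hui := hP.integrable_envU_pow a b
  have hvi := hP.integrable_envU_pow c e
  have hfi := hf.integrable hP (by omega)
  have hgi := hg.integrable hP (by omega)
  set Tf : Ω → ℝ := fun ω => if u ω ≤ M then f ω else 0
  set Tg : Ω → ℝ := fun ω => if v ω ≤ M then g ω else 0
  obtain ⟨hTf, hTfm, hTfb, hTfi⟩ := hf.truncate hP hM0.le
  obtain ⟨hTg, -, hTgb, hTgi⟩ := hg.truncate hP hM0.le
  have hTfg : Integrable (fun ω => Tf ω * Tg ω) μ :=
    hTgi.bdd_mul hTfm.aestronglyMeasurable (by simpa using ae_of_all μ hTfb)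
  have hfg : Integrable (fun ω => f ω * g ω) μ := by
    have h1 := hf.mono_window (min_le_left a c) (le_max_left b e)
    have h2 := hg.mono_window (min_le_right a c) (le_max_right b e)
    exact (h1.mul h2).integrable hP (by omega)
  set Q : ℝ := C * D / M ^ (κ - (i + j)) with hQ
  have hQ0 : 0 ≤ Q := div_nonneg (mul_nonneg hf.nonneg hg.nonneg) (by positivity)
  set B : ℝ := 2 ^ (29 + 8 * a₀) * A * w with hB
  have hub : ∫ ω, u ω ^ κ ∂μ ≤ B := hP.integral_envU_pow_le hw1 hw
  have hvb : ∫ ω, v ω ^ κ ∂μ ≤ B := hP.integral_envU_pow_le hw1 hw'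
  have hpt : ∀ ω ω', |f ω * g ω' - Tf ω * Tg ω'| ≤ Q * (u ω ^ κ + v ω' ^ κ) := fun ω ω' =>
    truncation_bound (one_le_envU a b ω) (one_le_envU c e ω') hM1 hf.nonneg hg.nonneg
      (hf.bound ω) (hg.bound ω') (by omega)
  have e1 : |∫ ω, f ω * g ω ∂μ - ∫ ω, Tf ω * Tg ω ∂μ| ≤ Q * (2 * B) :=
    abs_integral_sub_le_of_marginals (.id μ) (.id μ) hui hvi hfg hTfg
    (fun ω => hpt ω ω) hQ0 hub hvb
  have e2 : |(∫ ω, f ω ∂μ) * (∫ ω, g ω ∂μ) - (∫ ω, Tf ω ∂μ) * ∫ ω, Tg ω ∂μ| ≤ Q * (2 * B) := by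
    rw [← integral_prod_mul f g, ← integral_prod_mul Tf Tg]
    exact abs_integral_sub_le_of_marginals measurePreserving_fst measurePreserving_snd hui hvi
      (hfi.mul_prod hgi) (hTfi.mul_prod hTgi) (fun z => hpt z.1 z.2) hQ0 hub hvb
  have e3 : |∫ ω, Tf ω * Tg ω ∂μ - (∫ ω, Tf ω ∂μ) * ∫ ω, Tg ω ∂μ|
      ≤ 4 * alphaMix μ X k * ((C * M ^ i) * (D * M ^ j)) := by
    refine abs_cov_le_of_bounded (sigmaOf_le hP.meas _) (sigmaOf_le hP.meas _) hTf hTfb hTg hTgb ?_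
    intro S T hS hT
    refine abs_measure_inter_sub_le hP.meas hP.stat b k
      (sigmaOf_mono X ?_ _ hS) (sigmaOf_mono X ?_ _ hT)
    all_goals intro t ht; simp only [Set.mem_Ico, Set.mem_ofPred_eq] at ht ⊢; omega
  have hCD := mul_nonneg hf.nonneg hg.nonneg
  have hA := hP.one_le
  have e4 : 4 * alphaMix μ X k * ((C * M ^ i) * (D * M ^ j))
      ≤ 4 * A * (C * D * w) / M ^ (14 + 4 * a₀) := by
    have h1 := hP.mix k
    rw [← hMdef] at h1
    rw [le_div_iff₀ (by positivity)] at h1 ⊢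
    calc _ = 4 * (C * D) * (alphaMix μ X k * M ^ (i + j + (14 + 4 * a₀))) := by
          rw [pow_add, pow_add]; ring
      _ ≤ 4 * (C * D) * (alphaMix μ X k * M ^ (27 + 8 * a₀)) := by
          have := alphaMix_nonneg μ X k
          have h2 := pow_le_pow_right₀ hM1 (show i + j + (14 + 4 * a₀) ≤ 27 + 8 * a₀ by omega)
          gcongr
      _ ≤ 4 * (C * D) * (A * w) := by
          have : A ≤ A * w := le_mul_of_one_le_right (by linarith) hw1
          gcongr ?_ * ?_
          linarith
      _ = _ := by ring
  have e5 : Q * (2 * B) ≤ 2 ^ (30 + 8 * a₀) * A * (C * D * w) / M ^ (14 + 4 * a₀) := by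
    have h0 : Q ≤ C * D / M ^ (14 + 4 * a₀) := by
      rw [hQ]
      have h2 := pow_le_pow_right₀ hM1 (show 14 + 4 * a₀ ≤ κ - (i + j) by omega)
      gcongr
    have hB0 : 0 ≤ B := by positivity
    calc Q * (2 * B) ≤ C * D / M ^ (14 + 4 * a₀) * (2 * B) := by gcongr
      _ = _ := by rw [hB, show 30 + 8 * a₀ = (29 + 8 * a₀) + 1 by ring, pow_succ]; ring
  have e6 : (4 * A + 2 ^ (31 + 8 * a₀) * A) * (C * D * w) / M ^ (14 + 4 * a₀) =
      4 * A * (C * D * w) / M ^ (14 + 4 * a₀) +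
      2 * (2 ^ (30 + 8 * a₀) * A * (C * D * w) / M ^ (14 + 4 * a₀)) := by
    rw [show 31 + 8 * a₀ = (30 + 8 * a₀) + 1 by ring, pow_succ]; ring
  rw [e6]
  rw [abs_le] at e1 e2 e3 ⊢
  constructor <;> linarith [e1.1, e1.2, e2.1, e2.2, e3.1, e3.2]

lemma integral_shift (hX : ∀ i, Measurable (X i)) (hst : IsStationary μ X) (k : ℤ)
    {G : (ℤ → Fin d → ℝ) → ℝ} (hG : Measurable G) :
    ∫ ω, G (fun i => X (i + k) ω) ∂μ = ∫ ω, G (fun i => X i ω) ∂μ := by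
  have h := congrArg (fun ν => ∫ x, G x ∂ν) (hst k)
  have h0 := measurable_shift hX 0
  simp only [add_zero] at h0
  rwa [integral_map (measurable_shift hX k).aemeasurable hG.aestronglyMeasurable,
    integral_map h0.aemeasurable hG.aestronglyMeasurable] at h

lemma identDistrib_coord (hX : ∀ i, Measurable (X i)) (hst : IsStationary μ X) (i : ℤ) :
    IdentDistrib (X i) (X 1) μ μ where
  aemeasurable_fst := (hX i).aemeasurable
  aemeasurable_snd := (hX 1).aemeasurable
  map_eq := by
    have h := congrArg (fun ν => Measure.map (fun x : ℤ → Fin d → ℝ => x 1) ν) (hst (i - 1))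
    have h0 := measurable_shift hX 0
    simp only [add_zero] at h0
    rw [Measure.map_map (measurable_pi_apply _) (measurable_shift hX _),
      Measure.map_map (measurable_pi_apply _) h0] at h
    simpa [Function.comp_def] using h

lemma exists_good (hX : ∀ i, Measurable (X i)) (hst : IsStationary μ X)
    (hM : CondM μ X (14 + 4 * a₀)) : ∃ A, Good μ X a₀ A := by
  obtain ⟨C, hC1, hC⟩ := alphaMix_decay (by omega) hM
  obtain ⟨δ, hδ, hmom, -⟩ := hM
  have hκ : ∀ ω, ‖X 1 ω‖ ^ (28 + 8 * a₀) ≤ 1 + ‖X 1 ω‖ ^ ((2 * ((14 + 4 * a₀ : ℕ) : ℝ)) + δ) := by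
    intro ω
    rcases le_total ‖X 1 ω‖ 1 with h | h
    · have := pow_le_one₀ (norm_nonneg _) h (n := 28 + 8 * a₀)
      have : 0 ≤ ‖X 1 ω‖ ^ ((2 * ((14 + 4 * a₀ : ℕ) : ℝ)) + δ) := by positivity
      linarith
    · rw [← Real.rpow_natCast]
      have := Real.rpow_le_rpow_of_exponent_le h
        (show ((28 + 8 * a₀ : ℕ) : ℝ) ≤ (2 * ((14 + 4 * a₀ : ℕ) : ℝ)) + δ by
          push_cast; linarith)
      linarith
  have hi1 : Integrable (fun ω => ‖X 1 ω‖ ^ (28 + 8 * a₀)) μ := by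
    refine ((integrable_const (1 : ℝ)).add hmom).mono'
      (((hX 1).norm).pow_const _).aestronglyMeasurable (ae_of_all _ fun ω => ?_)
    rw [Real.norm_of_nonneg (by positivity)]
    exact hκ ω
  have hcen : ∀ i, Measurable (cen μ X i) := fun i =>
    (measurable_cen_sigmaOf (Set.mem_singleton i)).mono (sigmaOf_le hX _) le_rfl
  have hb : ∀ i ω, ‖cen μ X i ω‖ ^ (28 + 8 * a₀) ≤ 2 ^ (28 + 8 * a₀) *
      (‖X i ω‖ ^ (28 + 8 * a₀) + ‖meanVec μ X‖ ^ (28 + 8 * a₀)) := by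
    intro i ω
    have h1 : ‖cen μ X i ω‖ ≤ ‖X i ω‖ + ‖meanVec μ X‖ := norm_sub_le (X i ω) (meanVec μ X)
    set x := ‖X i ω‖
    set y := ‖meanVec μ X‖
    have hx : 0 ≤ x := norm_nonneg _
    have hy : 0 ≤ y := norm_nonneg _
    calc _ ≤ (2 * max x y) ^ (28 + 8 * a₀) := by
          gcongr; linarith [le_max_left x y, le_max_right x y]
      _ = 2 ^ (28 + 8 * a₀) * (max x y) ^ (28 + 8 * a₀) := mul_pow _ _ _
      _ ≤ _ := by
        gcongr
        rcases max_cases x y with ⟨h, -⟩ | ⟨h, -⟩ <;> rw [h]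
        · bound
        · bound
  have hXi : ∀ i, IdentDistrib (fun ω => ‖X i ω‖ ^ (28 + 8 * a₀))
      (fun ω => ‖X 1 ω‖ ^ (28 + 8 * a₀)) μ μ := fun i =>
    (identDistrib_coord hX hst i).comp (u := fun x => ‖x‖ ^ (28 + 8 * a₀))
      (measurable_norm.pow_const _)
  have hXint : ∀ i, Integrable (fun ω => ‖X i ω‖ ^ (28 + 8 * a₀)) μ := fun i =>
    (hXi i).symm.integrable_snd hi1
  have hci : ∀ i, Integrable (fun ω => ‖cen μ X i ω‖ ^ (28 + 8 * a₀)) μ := by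
    intro i
    refine (((hXint i).add (integrable_const (‖meanVec μ X‖ ^ (28 + 8 * a₀)))).const_mul
      (2 ^ (28 + 8 * a₀))).mono' ((hcen i).norm.pow_const _).aestronglyMeasurable
      (ae_of_all _ fun ω => ?_)
    rw [Real.norm_of_nonneg (by positivity)]
    exact hb i ω
  set T : ℝ := 2 ^ (28 + 8 * a₀) * (∫ ω, ‖X 1 ω‖ ^ (28 + 8 * a₀) ∂μ + ‖meanVec μ X‖ ^ (28 + 8 * a₀))
  refine ⟨max C T, hX, hst, hC1.trans (le_max_left _ _), hci, fun i => ?_, fun k => ?_⟩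
  · refine le_trans ?_ (le_max_right _ _)
    calc _ ≤ ∫ ω, 2 ^ (28 + 8 * a₀) *
          (‖X i ω‖ ^ (28 + 8 * a₀) + ‖meanVec μ X‖ ^ (28 + 8 * a₀)) ∂μ :=
          integral_mono (hci i) (((hXint i).add (integrable_const _)).const_mul _) (hb i)
      _ = T := by
          rw [integral_const_mul, integral_add (hXint i) (integrable_const _), (hXi i).integral_eq]
          simp [T]
  · refine (hC k).trans ?_
    rw [show 2 * (14 + 4 * a₀) - 1 = 27 + 8 * a₀ by omega]
    gcongr
    exact le_max_left _ _

lemma Good.integrable_coord (hP : Good μ X a₀ A) (i : ℤ) : Integrable (cen μ X i) μ := by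
  have h1 : MemLp (cen μ X i) ((28 + 8 * a₀ : ℕ) : ENNReal) μ := by
    rw [← integrable_norm_rpow_iff (hP.measurable_cen i).aestronglyMeasurable
      (by simp) (ENNReal.natCast_ne_top _)]
    have := hP.mom i
    simp only [ENNReal.toReal_natCast, Real.rpow_natCast]
    exact this
  exact h1.integrable (by exact_mod_cast (by omega : 1 ≤ 28 + 8 * a₀))

lemma Good.integral_cen (hP : Good μ X a₀ A) (i : ℤ) : ∫ ω, cen μ X i ω ∂μ = 0 := by
  ext j
  have hi := hP.integrable_coord i
  have hij : Integrable (fun ω => cen μ X i ω j) μ := hi.eval j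
  rw [eval_integral (fun j => hi.eval j)]
  have hX1 : Integrable (fun ω => X i ω j) μ := by
    have := hij.add (integrable_const (meanVec μ X j))
    refine this.congr (ae_of_all _ fun ω => ?_)
    simp [cen]
  have h2 : ∫ ω, X i ω j ∂μ = ∫ ω, X 1 ω j ∂μ :=
    (IdentDistrib.comp (identDistrib_coord hP.meas hP.stat i)
      (show Measurable (fun x : Fin d → ℝ => x j) from measurable_pi_apply j)).integral_eq
  simp only [cen]
  rw [integral_sub hX1 (integrable_const _), h2]
  simp [meanVec]

lemma Good.integral_xi (hP : Good μ X a₀ A) (φ : LinForm d) (i : ℤ) : ∫ ω, xi μ X φ i ω ∂μ = 0 := by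
  unfold xi
  rw [φ.integral_comp_comm (hP.integrable_coord i), hP.integral_cen]
  simp

lemma Good.integral_xi_mul_shift (hP : Good μ X a₀ A) (φ ψ : LinForm d) (s t k : ℤ) :
    ∫ ω, xi μ X φ (s + k) ω * xi μ X ψ (t + k) ω ∂μ = ∫ ω, xi μ X φ s ω * xi μ X ψ t ω ∂μ := by
  refine integral_shift hP.meas hP.stat k (G := fun x =>
    φ (fun j => x s j - meanVec μ X j) * ψ (fun j => x t j - meanVec μ X j)) ?_
  have h : ∀ (φ : LinForm d) (s : ℤ), Measurable (fun x : ℤ → Fin d → ℝ =>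
      φ (fun j => x s j - meanVec μ X j)) := fun φ s =>
    φ.measurable.comp (measurable_pi_lambda _ fun j =>
      ((measurable_pi_apply j).comp (measurable_pi_apply s)).sub_const _)
  exact (h φ s).mul (h ψ t)

/-- The weight `1 / (1 + |h|)`. -/
def dk (h : ℤ) : ℝ := 1 / (1 + |(h : ℝ)|)

lemma dk_pos (h : ℤ) : 0 < dk h := by unfold dk; positivity

lemma dk_nonneg (h : ℤ) : 0 ≤ dk h := (dk_pos h).le

lemma dk_le_one (h : ℤ) : dk h ≤ 1 := by
  unfold dk; rw [div_le_one (by positivity)]; simp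

lemma dk_neg (h : ℤ) : dk (-h) = dk h := by simp [dk]

lemma dk_sub_comm (a b : ℤ) : dk (a - b) = dk (b - a) := by rw [← dk_neg, neg_sub]

lemma dk_pow_le_pow (h : ℤ) {p q : ℕ} (hpq : q ≤ p) : dk h ^ p ≤ dk h ^ q :=
  pow_le_pow_of_le_one (dk_nonneg h) (dk_le_one h) hpq

lemma inv_gap_le_dk (h : ℤ) (k : ℕ) (p : ℕ) (hk : |h| ≤ k + 1) :
    1 / ((k : ℝ) + 1) ^ p ≤ 2 ^ p * dk h ^ p := by
  rw [← mul_pow, ← one_div_pow]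
  gcongr
  unfold dk
  have h1 : |(h : ℝ)| ≤ k + 1 := by exact_mod_cast hk
  rw [mul_one_div, div_le_div_iff₀ (by positivity) (by positivity)]
  linarith [show (0 : ℝ) ≤ k by positivity]

lemma dk_sq_le_telescope (h : ℕ) : dk h ^ 2 ≤ 2 * (1 / ((h : ℝ) + 1) - 1 / ((h : ℝ) + 2)) := by
  unfold dk
  have h0 : (0 : ℝ) ≤ h := by positivity
  simp only [Int.cast_natCast, Nat.abs_cast]
  rw [div_sub_div _ _ (by positivity) (by positivity), ← mul_div_assoc, div_pow,
    div_le_div_iff₀ (by positivity) (by positivity)]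
  nlinarith

lemma sum_dk_sq_range_le (n : ℕ) : ∑ h ∈ range n, dk (h : ℤ) ^ 2 ≤ 2 := by
  have h : ∑ h ∈ range n, dk (h : ℤ) ^ 2 ≤ 2 - 2 / ((n : ℝ) + 1) := by
    induction n with
    | zero => simp
    | succ n ih =>
      rw [sum_range_succ]
      have := dk_sq_le_telescope n
      push_cast
      have e : (n : ℝ) + 1 + 1 = n + 2 := by ring
      rw [e]
      have e2 : 2 * (1 / ((n : ℝ) + 1) - 1 / ((n : ℝ) + 2)) = 2 / ((n : ℝ) + 1) - 2 / ((n : ℝ) + 2) := by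
        ring
      linarith
  have : 0 ≤ 2 / ((n : ℝ) + 1) := by positivity
  linarith

lemma sum_dk_sq_le (T : Finset ℤ) (s : ℤ) : ∑ t ∈ T, dk (s - t) ^ 2 ≤ 4 := by
  have h1 : ∀ T : Finset ℤ, (∀ t ∈ T, t ≤ s) → ∑ t ∈ T, dk (s - t) ^ 2 ≤ 2 := by
    intro T hT
    have hinj : Set.InjOn (fun t : ℤ => (s - t).toNat) T := by
      intro x hx y hy hxy
      have := hT x hx; have := hT y hy
      simp only at hxy; omega
    set n := (T.image fun t : ℤ => (s - t).toNat).sup id + 1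
    calc ∑ t ∈ T, dk (s - t) ^ 2 = ∑ h ∈ T.image (fun t : ℤ => (s - t).toNat), dk (h : ℤ) ^ 2 := by
          simp_all
      _ ≤ ∑ h ∈ range n, dk (h : ℤ) ^ 2 := by
          refine sum_le_sum_of_subset_of_nonneg ?_ fun _ _ _ => sq_nonneg _
          intro x hx
          rw [mem_range]
          exact Nat.lt_succ_of_le (le_sup (f := id) hx)
      _ ≤ 2 := sum_dk_sq_range_le n
  have h2 : ∀ T : Finset ℤ, (∀ t ∈ T, s ≤ t) → ∑ t ∈ T, dk (s - t) ^ 2 ≤ 2 := by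
    intro T hT
    have hinj : Set.InjOn (fun t : ℤ => (t - s).toNat) T := by
      intro x hx y hy hxy
      have := hT x hx; have := hT y hy
      simp only at hxy; omega
    set n := (T.image fun t : ℤ => (t - s).toNat).sup id + 1
    calc ∑ t ∈ T, dk (s - t) ^ 2 = ∑ h ∈ T.image (fun t : ℤ => (t - s).toNat), dk (h : ℤ) ^ 2 := by
          rw [sum_image hinj]
          refine sum_congr rfl fun t ht => ?_
          rw [Int.toNat_of_nonneg (by have := hT t ht; omega), dk_sub_comm]
      _ ≤ ∑ h ∈ range n, dk (h : ℤ) ^ 2 := by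
          refine sum_le_sum_of_subset_of_nonneg ?_ fun _ _ _ => sq_nonneg _
          intro x hx
          rw [mem_range]
          exact Nat.lt_succ_of_le (le_sup (f := id) hx)
      _ ≤ 2 := sum_dk_sq_range_le n
  rw [← sum_filter_add_sum_filter_not T (fun t => t ≤ s)]
  have := h1 (T.filter fun t => t ≤ s) fun t ht => (mem_filter.1 ht).2
  have := h2 (T.filter fun t => ¬ t ≤ s) fun t ht => by grind
  linarith

lemma sum_range_dk_le (n : ℕ) (s a : ℤ) {p : ℕ} (hp : 2 ≤ p) :
    ∑ t ∈ range n, dk (s - (a + t)) ^ p ≤ 4 := by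
  calc _ ≤ ∑ t ∈ range n, dk (s - (a + t)) ^ 2 :=
        sum_le_sum fun t _ => dk_pow_le_pow _ hp
    _ = ∑ t ∈ (range n).map ⟨fun t : ℕ => a + t, fun x y h => by simpa using h⟩,
        dk (s - t) ^ 2 := by rw [sum_map]; rfl
    _ ≤ 4 := sum_dk_sq_le _ s

/-- Partial sums of a linear functional. -/
def psum (μ : Measure Ω) (X : ℤ → Ω → Fin d → ℝ) (φ : LinForm d) (s : ℤ) (n : ℕ) (ω : Ω) : ℝ :=
  ∑ t ∈ range n, xi μ X φ (s + t) ω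

lemma abs_pow_sum_le {ι : Type*} (s : Finset ι) (f : ι → ℝ) {p : ℕ} (hp : p ≠ 0) :
    |∑ i ∈ s, f i| ^ p ≤ (s.card : ℝ) ^ (p - 1) * ∑ i ∈ s, |f i| ^ p := by
  obtain ⟨k, rfl⟩ := Nat.exists_eq_succ_of_ne_zero hp
  calc |∑ i ∈ s, f i| ^ (k + 1) ≤ (∑ i ∈ s, |f i|) ^ (k + 1) := by
        gcongr; exact abs_sum_le_sum_abs _ _
    _ ≤ _ := by
        rcases s.eq_empty_or_nonempty with rfl | hs
        · simp
        have h := pow_sum_div_card_le_sum_pow (s := s) (f := fun i => |f i|)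
          (fun _ _ => abs_nonneg _) k
        have hc : 0 < (s.card : ℝ) ^ k := by positivity
        rw [div_le_iff₀ hc] at h
        simpa [mul_comm] using h

lemma psum_Pw (φ : LinForm d) (s : ℤ) (n : ℕ) : Pw μ X s (s + n) 1 (n * ‖φ‖) (psum μ X φ s n) := by
  have h := Pw.sum (μ := μ) (X := X) (a := s) (b := s + n) (i := 1) (C := ‖φ‖) (range n)
    (F := fun t => xi μ X φ (s + t)) (fun t ht => Pw.xi φ (by omega) (by
      have := mem_range.1 ht; omega))
  rw [card_range] at h
  exact h

lemma psum_add (φ : LinForm d) (s : ℤ) (m n : ℕ) (ω : Ω) :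
    psum μ X φ s (m + n) ω = psum μ X φ s m ω + psum μ X φ (s + m) n ω := by
  simp only [psum, sum_range_add, Nat.cast_add, add_assoc]

lemma Good.integral_psum (hP : Good μ X a₀ A)
    (φ : LinForm d) (s : ℤ) (n : ℕ) : ∫ ω, psum μ X φ s n ω ∂μ = 0 := by
  unfold psum
  rw [integral_finsetSum _ fun t _ => (Pw.xi_single φ _).integrable hP (by omega)]
  exact sum_eq_zero fun t _ => hP.integral_xi φ _

/-- A constant for the covariance inequality, in terms of the data of `Good`. -/
def covC (a₀ : ℕ) (A : ℝ) : ℝ := 4 * A + 2 ^ (31 + 8 * a₀) * A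

lemma Good.covC_nonneg (hP : Good μ X a₀ A) : 0 ≤ covC a₀ A := by
  have := hP.one_le
  unfold covC; positivity

lemma Good.cov_xi_decay (hP : Good μ X a₀ A) (φ ψ : LinForm d) :
    ∃ C, 0 ≤ C ∧ ∀ s t : ℤ, |∫ ω, xi μ X φ s ω * xi μ X ψ t ω ∂μ| ≤ C * dk (s - t) ^ 14 := by
  have hA := hP.one_le
  have main : ∃ C, 0 ≤ C ∧ ∀ (φ' ψ' : LinForm d), ‖φ'‖ * ‖ψ'‖ ≤ ‖φ‖ * ‖ψ‖ → ∀ s t : ℤ, s ≤ t →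
      |∫ ω, xi μ X φ' s ω * xi μ X ψ' t ω ∂μ| ≤ C * dk (s - t) ^ 14 := by
    refine ⟨‖φ‖ * ‖ψ‖ * (2 ^ (29 + 8 * a₀) * A) +
      2 ^ (14 + 4 * a₀) * (covC a₀ A * (‖φ‖ * ‖ψ‖)), ?_, ?_⟩
    · have := hP.covC_nonneg; positivity
    intro φ' ψ' hn s t hst
    have hcC := hP.covC_nonneg
    rcases hst.eq_or_lt with rfl | hlt
    · have h1 : Pw μ X s (s + 1) (1 + 1) (‖φ'‖ * ‖ψ'‖)
          (fun ω => BlockLength.xi μ X φ' s ω * BlockLength.xi μ X ψ' s ω) :=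
        (Pw.xi_single φ' s).mul (Pw.xi_single ψ' s)
      have h2 := h1.integral_abs_pow_le hP (p := 1) (by omega) (w := 1) le_rfl (by simp)
      simp only [pow_one, mul_one] at h2
      have h3 : dk (s - s) ^ 14 = 1 := by simp [dk]
      rw [h3, mul_one]
      refine abs_integral_le_integral_abs.trans (h2.trans ?_)
      have : 0 ≤ 2 ^ (14 + 4 * a₀) * (covC a₀ A * (‖φ‖ * ‖ψ‖)) := by positivity
      have h5 : ‖φ'‖ * ‖ψ'‖ * (2 ^ (29 + 8 * a₀) * A) ≤ ‖φ‖ * ‖ψ‖ * (2 ^ (29 + 8 * a₀) * A) := by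
        gcongr
      linarith
    · obtain ⟨k, hk⟩ := Int.eq_ofNat_of_zero_le (show 0 ≤ t - s - 1 by omega)
      have h := hP.abs_cov_le (Pw.xi_single φ' s) (Pw.xi_single ψ' t) (k := k) (by omega)
        (by omega) (w := 1) le_rfl (by simp) (by simp)
      rw [hP.integral_xi, zero_mul, sub_zero] at h
      refine h.trans ?_
      have hd := inv_gap_le_dk (s - t) k (14 + 4 * a₀) (by rw [abs_le]; constructor <;> omega)
      have hd2 := dk_pow_le_pow (s - t) (show 14 ≤ 14 + 4 * a₀ by omega)
      calc _ = covC a₀ A * (‖φ'‖ * ‖ψ'‖) * (1 / ((k : ℝ) + 1) ^ (14 + 4 * a₀)) := by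
            unfold covC; ring
        _ ≤ covC a₀ A * (‖φ‖ * ‖ψ‖) * (2 ^ (14 + 4 * a₀) * dk (s - t) ^ 14) := by
            gcongr
            exact hd.trans (by gcongr)
        _ ≤ _ := by
            have h6 : 0 ≤ ‖φ‖ * ‖ψ‖ * (2 ^ (29 + 8 * a₀) * A) * dk (s - t) ^ 14 := by positivity
            linarith
  obtain ⟨C, hC, h⟩ := main
  refine ⟨C, hC, fun s t => ?_⟩
  rcases le_total s t with hst | hst
  · exact h φ ψ le_rfl s t hst
  · have := h ψ φ (by rw [mul_comm]) t s hst
    rw [dk_sub_comm] at this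
    simpa only [mul_comm (xi μ X ψ _ _)] using this

lemma Good.moment_two (hP : Good μ X a₀ A) (φ : LinForm d) :
    ∃ C, 0 ≤ C ∧ ∀ (s : ℤ) (n : ℕ), ∫ ω, psum μ X φ s n ω ^ 2 ∂μ ≤ C * n := by
  obtain ⟨C, hC, h⟩ := hP.cov_xi_decay φ φ
  refine ⟨4 * C, by positivity, fun s n => ?_⟩
  have hfi : ∀ i j : ℤ, Integrable (fun ω => xi μ X φ i ω * xi μ X φ j ω) μ := fun i j =>
    ((Pw.xi φ (a := min i j) (b := max i j + 1) (by omega) (by omega)).mul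
      (Pw.xi φ (a := min i j) (b := max i j + 1) (by omega) (by omega))).integrable hP (by omega)
  simp only [psum, pow_two, sum_mul_sum]
  rw [integral_finsetSum _ fun i _ => integrable_finsetSum _ fun j _ => hfi _ _]
  calc _ ≤ ∑ i ∈ range n, 4 * C := by
        refine sum_le_sum fun i _ => ?_
        rw [integral_finsetSum _ fun j _ => hfi _ _]
        calc _ ≤ ∑ j ∈ range n, C * dk ((s + i) - (s + j)) ^ 14 :=
              sum_le_sum fun j _ => (le_abs_self _).trans (h _ _)
          _ = C * ∑ j ∈ range n, dk ((s + i) - (s + j)) ^ 14 := by rw [mul_sum]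
          _ ≤ C * 4 := by gcongr; exact sum_range_dk_le n _ _ (by norm_num)
          _ = 4 * C := by ring
    _ = 4 * C * n := by simp; ring

lemma Good.moment_trivial (hP : Good μ X a₀ A)
    (φ : LinForm d) {p : ℕ} (hp0 : p ≠ 0) (hp : p ≤ 28 + 8 * a₀) :
    ∃ C, 0 ≤ C ∧ ∀ (s : ℤ) (n : ℕ), ∫ ω, |psum μ X φ s n ω| ^ p ∂μ ≤ C * (n : ℝ) ^ p := by
  have hA := hP.one_le
  refine ⟨‖φ‖ ^ p * (2 ^ (29 + 8 * a₀) * A), by positivity, fun s n => ?_⟩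
  have hi : ∀ t : ℤ, Integrable (fun ω => |xi μ X φ t ω| ^ p) μ := fun t =>
    (Pw.xi_single φ t).integrable_abs_pow hP (by omega)
  calc _ ≤ ∫ ω, (n : ℝ) ^ (p - 1) * ∑ t ∈ range n, |xi μ X φ (s + t) ω| ^ p ∂μ := by
        refine integral_mono ((psum_Pw φ s n).integrable_abs_pow hP (by omega))
          ((integrable_finsetSum _ fun t _ => hi _).const_mul _) fun ω => ?_
        have h := abs_pow_sum_le (range n) (fun t : ℕ => xi μ X φ (s + t) ω) hp0
        rw [card_range] at h
        exact h
    _ = (n : ℝ) ^ (p - 1) * ∑ t ∈ range n, ∫ ω, |xi μ X φ (s + t) ω| ^ p ∂μ := by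
        rw [integral_const_mul, integral_finsetSum _ fun t _ => hi _]
    _ ≤ (n : ℝ) ^ (p - 1) * ∑ t ∈ range n, ‖φ‖ ^ p * (2 ^ (29 + 8 * a₀) * A) := by
        gcongr with t _
        have := (Pw.xi_single (μ := μ) (X := X) φ (s + t)).integral_abs_pow_le hP (p := p)
          (by omega) (w := 1) le_rfl (by simp)
        simpa using this
    _ = _ := by
        rw [sum_const, card_range, nsmul_eq_mul]
        obtain ⟨k, rfl⟩ := Nat.exists_eq_succ_of_ne_zero hp0
        simp only [Nat.succ_eq_add_one, Nat.add_sub_cancel, pow_succ]; ring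

lemma exists_split_const {p : ℕ} (hp : p ≠ 0) :
    ∃ C : ℝ, 0 ≤ C ∧ ∀ x y : ℝ, |x + y| ^ p ≤ 5 / 4 * |x| ^ p + C * |y| ^ p := by
  obtain ⟨θ, hθ0, hθ1, hθ⟩ : ∃ θ : ℝ, 0 < θ ∧ θ < 1 ∧ (1 / θ) ^ (p - 1) ≤ 5 / 4 := by
    have hc : Tendsto (fun x : ℝ => (1 / x) ^ (p - 1)) (nhdsWithin 1 (Set.Iio 1)) (nhds 1) := by
      have : ContinuousAt (fun x : ℝ => (1 / x) ^ (p - 1)) 1 := by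
        apply ContinuousAt.pow
        exact continuousAt_const.div continuousAt_id one_ne_zero
      have h := this.tendsto
      simp only [div_one, one_pow] at h
      exact h.mono_left nhdsWithin_le_nhds
    have h1 : ∀ᶠ x in nhdsWithin (1 : ℝ) (Set.Iio 1), (1 / x) ^ (p - 1) ≤ 5 / 4 :=
      hc.eventually_le_const (by norm_num)
    have h2 : ∀ᶠ x in nhdsWithin (1 : ℝ) (Set.Iio 1), 0 < x :=
      nhdsWithin_le_nhds (lt_mem_nhds one_pos)
    have h3 : ∀ᶠ x in nhdsWithin (1 : ℝ) (Set.Iio 1), x < 1 := self_mem_nhdsWithin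
    obtain ⟨x, hx⟩ := (h1.and (h2.and h3)).exists
    exact ⟨x, hx.2.1, hx.2.2, hx.1⟩
  refine ⟨(1 / (1 - θ)) ^ (p - 1), by have : 0 < 1 - θ := by linarith
                                      positivity, fun x y => ?_⟩
  have hθ2 : 0 < 1 - θ := by linarith
  have hconv := (convexOn_pow p).2 (x := |x| / θ) (y := |y| / (1 - θ))
    (Set.mem_Ici.2 (by positivity)) (Set.mem_Ici.2 (by positivity)) hθ0.le hθ2.le (by ring)
  simp only [smul_eq_mul] at hconv
  rw [mul_div_cancel₀ _ hθ0.ne', mul_div_cancel₀ _ hθ2.ne'] at hconv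
  obtain ⟨k, rfl⟩ := Nat.exists_eq_succ_of_ne_zero hp
  simp only [Nat.succ_eq_add_one, Nat.add_sub_cancel] at *
  have e : ∀ (z t : ℝ), t ≠ 0 → t * (z / t) ^ (k + 1) = (1 / t) ^ k * z ^ (k + 1) := by
    intro z t ht
    rw [div_pow, div_pow, one_pow, pow_succ t]; field_simp
  rw [e _ _ hθ0.ne', e _ _ hθ2.ne'] at hconv
  calc |x + y| ^ (k + 1) ≤ (|x| + |y|) ^ (k + 1) := by gcongr; exact abs_add_le x y
    _ ≤ _ := hconv
    _ ≤ _ := by gcongr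

lemma abs_pow_le_scaled {x r : ℝ} (hr : 0 < r) {i p : ℕ} (hip : i ≤ p) :
    |x| ^ i ≤ r ^ i * (1 + |x| ^ p / r ^ p) := by
  have hz : 0 ≤ |x| / r := by positivity
  have h : (|x| / r) ^ i ≤ 1 + (|x| / r) ^ p := by
    rcases le_total (|x| / r) 1 with h | h
    · have := pow_le_one₀ hz h (n := i)
      have : 0 ≤ (|x| / r) ^ p := by positivity
      linarith
    · have := pow_le_pow_right₀ h hip
      linarith
  rw [div_pow, div_pow] at h
  calc |x| ^ i = r ^ i * (|x| ^ i / r ^ i) := by field_simp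
    _ ≤ _ := by gcongr

/-- Low order moments of partial sums from one even moment. -/
lemma Good.abs_integral_psum_pow_le (hP : Good μ X a₀ A)
    (φ : LinForm d) {q : ℕ} (hq : 2 * q ≤ 28 + 8 * a₀) {C : ℝ} (hC : 0 ≤ C)
    (h : ∀ (s : ℤ) (n : ℕ), ∫ ω, psum μ X φ s n ω ^ (2 * q) ∂μ ≤ C * (n : ℝ) ^ q)
    (s : ℤ) {m n : ℕ} (hn : 0 < n) (hmn : m ≤ n) {i : ℕ} (hi : i ≤ 2 * q) :
    |∫ ω, psum μ X φ s m ω ^ i ∂μ| ≤ (1 + C) * √n ^ i := by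
  have hr : 0 < √(n : ℝ) := by positivity
  have hfi := (psum_Pw (μ := μ) (X := X) φ s m).integrable_abs_pow hP (p := 2 * q) (by omega)
  have hfi2 := (psum_Pw (μ := μ) (X := X) φ s m).integrable_abs_pow hP (p := i) (by omega)
  calc |∫ ω, psum μ X φ s m ω ^ i ∂μ| ≤ ∫ ω, |psum μ X φ s m ω| ^ i ∂μ := by
        refine abs_integral_le_integral_abs.trans (le_of_eq ?_)
        simp only [abs_pow]
    _ ≤ ∫ ω, √n ^ i * (1 + |psum μ X φ s m ω| ^ (2 * q) / √n ^ (2 * q)) ∂μ :=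
        integral_mono hfi2 (((integrable_const _).add (hfi.div_const _)).const_mul _)
          fun ω => abs_pow_le_scaled hr hi
    _ = √n ^ i * (1 + (∫ ω, psum μ X φ s m ω ^ (2 * q) ∂μ) / (n : ℝ) ^ q) := by
        rw [integral_const_mul, integral_add (integrable_const _) (hfi.div_const _), integral_div]
        simp only [pow_mul, sq_abs, Real.sq_sqrt (Nat.cast_nonneg n)]
        simp
    _ ≤ √n ^ i * (1 + C) := by
        gcongr
        rw [div_le_iff₀ (by positivity)]
        refine (h s m).trans ?_
        gcongr
    _ = _ := by ring

/-- One splitting step for even moments. -/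
lemma Good.moment_split (hP : Good μ X a₀ A)
    (φ : LinForm d) {q : ℕ} (hq1 : 1 ≤ q) (hq : 2 * (q + 1) ≤ 12 + 4 * a₀)
    {C : ℝ} (hC : 0 ≤ C)
    (h : ∀ (s : ℤ) (n : ℕ), ∫ ω, psum μ X φ s n ω ^ (2 * q) ∂μ ≤ C * (n : ℝ) ^ q) :
    ∃ c, 0 ≤ c ∧ ∀ (s s' : ℤ) (n m m' : ℕ), 0 < n → m ≤ n → m' ≤ n → s + m + (Nat.sqrt n : ℤ) ≤ s' →
      ∫ ω, (psum μ X φ s m ω + psum μ X φ s' m' ω) ^ (2 * (q + 1)) ∂μ ≤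
        ∫ ω, psum μ X φ s m ω ^ (2 * (q + 1)) ∂μ + ∫ ω, psum μ X φ s' m' ω ^ (2 * (q + 1)) ∂μ
        + c * (n : ℝ) ^ (q + 1) := by
  set Q := 2 * (q + 1) with hQ
  have hcC := hP.covC_nonneg
  set c0 : ℝ := (1 + C) ^ 2 + covC a₀ A * ‖φ‖ ^ Q with hc0
  have hc00 : 0 ≤ c0 := by positivity
  refine ⟨∑ i ∈ range (Q + 1), c0 * (Q.choose i), by positivity, ?_⟩
  intro s s' n m m' hn hm hm' hs
  set P1 := psum_Pw (μ := μ) (X := X) φ s m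
  set P2 := psum_Pw (μ := μ) (X := X) φ s' m'
  set S := psum μ X φ s m
  set T := psum μ X φ s' m'
  have hn1 : (1 : ℝ) ≤ n := by exact_mod_cast hn
  have hintm : ∀ i j : ℕ, i + j ≤ 28 + 8 * a₀ → Integrable (fun ω => S ω ^ i * T ω ^ j) μ := by
    intro i j hij
    have h1 := (P1.mono_window (min_le_left s s') (le_max_left (s + m) (s' + m'))).pow i
    have h2 := (P2.mono_window (min_le_right s s') (le_max_right (s + m) (s' + m'))).pow j
    exact (h1.mul h2).integrable hP (by omega)
  have hbd : ∀ i ∈ range (Q + 1), ∫ ω, S ω ^ i * T ω ^ (Q - i) * (Q.choose i) ∂μ ≤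
      (if i = 0 then ∫ ω, T ω ^ Q ∂μ else 0) + (if i = Q then ∫ ω, S ω ^ Q ∂μ else 0) +
        c0 * (Q.choose i) * (n : ℝ) ^ (q + 1) := by
    intro i hi
    rw [mem_range] at hi
    have hpos : 0 ≤ c0 * (Q.choose i) * (n : ℝ) ^ (q + 1) := by positivity
    by_cases h0 : i = 0
    · simp_all
    by_cases h1 : i = Q
    · simp_all
    simp only [h0, h1, if_false, zero_add]
    rw [integral_mul_const]
    have key : |∫ ω, S ω ^ i * T ω ^ (Q - i) ∂μ| ≤ c0 * (n : ℝ) ^ (q + 1) := by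
      have hcov := hP.abs_cov_le (P1.pow i) (P2.pow (Q - i)) (k := Nat.sqrt n) hs (by omega)
        (w := n) hn1 (by simpa using hm) (by simpa using hm')
      have herr : (4 * A + 2 ^ (31 + 8 * a₀) * A) *
          ((m * ‖φ‖) ^ i * (m' * ‖φ‖) ^ (Q - i) * n) / ((Nat.sqrt n : ℝ) + 1) ^ (14 + 4 * a₀)
          ≤ covC a₀ A * ‖φ‖ ^ Q * (n : ℝ) ^ (q + 1) := by
        rw [div_le_iff₀ (by positivity)]
        have hsq : (n : ℝ) ^ (7 + 2 * a₀) ≤ ((Nat.sqrt n : ℝ) + 1) ^ (14 + 4 * a₀) := by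
          rw [show 14 + 4 * a₀ = 2 * (7 + 2 * a₀) by ring, pow_mul _ 2]
          gcongr
          have := (Nat.lt_succ_sqrt' n).le
          exact_mod_cast this
        calc _ ≤ covC a₀ A * ((n * ‖φ‖) ^ i * (n * ‖φ‖) ^ (Q - i) * n) := by
              unfold covC
              have := hP.one_le
              gcongr
          _ = covC a₀ A * ‖φ‖ ^ Q * (n : ℝ) ^ (Q + 1) := by
              rw [← pow_add, show i + (Q - i) = Q by omega, mul_pow]; ring
          _ ≤ covC a₀ A * ‖φ‖ ^ Q * (n : ℝ) ^ (q + 1 + (7 + 2 * a₀)) := by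
              have := pow_le_pow_right₀ hn1 (show Q + 1 ≤ q + 1 + (7 + 2 * a₀) by omega)
              gcongr
          _ = covC a₀ A * ‖φ‖ ^ Q * (n : ℝ) ^ (q + 1) * (n : ℝ) ^ (7 + 2 * a₀) := by ring
          _ ≤ _ := by gcongr
      have hprod : |(∫ ω, S ω ^ i ∂μ) * ∫ ω, T ω ^ (Q - i) ∂μ| ≤
          (1 + C) ^ 2 * (n : ℝ) ^ (q + 1) := by
        by_cases hi1 : i = 1
        · subst hi1
          simp only [pow_one, S, hP.integral_psum, zero_mul, abs_zero]; positivity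
        by_cases hi2 : Q - i = 1
        · simp only [hi2, pow_one, T, hP.integral_psum, mul_zero, abs_zero]; positivity
        rw [abs_mul]
        have b1 := hP.abs_integral_psum_pow_le φ (by omega) hC h s hn hm
          (show i ≤ 2 * q by omega)
        have b2 := hP.abs_integral_psum_pow_le φ (by omega) hC h s' hn hm'
          (show Q - i ≤ 2 * q by omega)
        calc _ ≤ ((1 + C) * √n ^ i) * ((1 + C) * √n ^ (Q - i)) := by gcongr
          _ = (1 + C) ^ 2 * (√n ^ i * √n ^ (Q - i)) := by ring
          _ = _ := by
            rw [← pow_add, show i + (Q - i) = 2 * (q + 1) by omega, pow_mul,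
              Real.sq_sqrt (Nat.cast_nonneg n)]
      have := abs_add_le (∫ ω, S ω ^ i * T ω ^ (Q - i) ∂μ -
        (∫ ω, S ω ^ i ∂μ) * ∫ ω, T ω ^ (Q - i) ∂μ) ((∫ ω, S ω ^ i ∂μ) * ∫ ω, T ω ^ (Q - i) ∂μ)
      rw [sub_add_cancel] at this
      rw [hc0, add_mul]
      linarith [hcov.trans herr]
    calc _ ≤ c0 * (n : ℝ) ^ (q + 1) * (Q.choose i) := by
          gcongr; exact (le_abs_self _).trans key
      _ = _ := by ring
  calc _ = ∑ i ∈ range (Q + 1), ∫ ω, S ω ^ i * T ω ^ (Q - i) * (Q.choose i) ∂μ := by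
        simp only [add_pow]
        rw [integral_finsetSum]
        intro i hi
        rw [mem_range] at hi
        exact (hintm _ _ (by omega)).mul_const _
    _ ≤ _ := sum_le_sum hbd
    _ = _ := by
        rw [sum_add_distrib, sum_add_distrib, sum_ite_eq' _ 0,
          sum_ite_eq' _ Q, if_pos (by simp), if_pos (by simp), sum_mul]
        ring

lemma Good.moment_step (hP : Good μ X a₀ A)
    (φ : LinForm d) {q : ℕ} (hq1 : 1 ≤ q) (hq : 2 * (q + 1) ≤ 12 + 4 * a₀)
    {C : ℝ} (hC : 0 ≤ C)
    (h : ∀ (s : ℤ) (n : ℕ), ∫ ω, psum μ X φ s n ω ^ (2 * q) ∂μ ≤ C * (n : ℝ) ^ q) :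
    ∃ K, 0 ≤ K ∧ ∀ (s : ℤ) (n : ℕ),
      ∫ ω, psum μ X φ s n ω ^ (2 * (q + 1)) ∂μ ≤ K * (n : ℝ) ^ (q + 1) := by
  obtain ⟨c, hc, hsplit⟩ := hP.moment_split φ hq1 hq hC h
  obtain ⟨c', hc', htriv⟩ := hP.moment_trivial φ (p := 2 * (q + 1)) (by omega) (by omega)
  obtain ⟨c'', hc'', hxy⟩ := exists_split_const (p := 2 * (q + 1)) (by omega)
  set Q := 2 * (q + 1) with hQ
  set K : ℝ := (8 / 3) * (5 / 4 * c + c'' * c') with hK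
  have hK0 : 0 ≤ K := by positivity
  have hev : ∀ x : ℝ, |x| ^ Q = x ^ Q := fun x => Even.pow_abs ⟨q + 1, by omega⟩ x
  refine ⟨K, hK0, fun s n => ?_⟩
  induction n using Nat.strong_induction_on generalizing s with
  | _ n ih =>
  rcases Nat.eq_zero_or_pos n with rfl | hn
  · have : Q ≠ 0 := by omega
    simp [psum, this]
  set g := Nat.sqrt n with hg
  have hg1 : 1 ≤ g := Nat.sqrt_pos.2 hn
  have hgn : g ≤ n := Nat.sqrt_le_self n
  set p := (n - g) / 2 with hp
  set p' := n - g - p with hp'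
  have hpn : 2 * p ≤ n := by omega
  have hpn' : 2 * p' ≤ n := by omega
  have hdec : ∀ ω, psum μ X φ s n ω = (psum μ X φ s p ω + psum μ X φ (s + p + g) p' ω) +
      psum μ X φ (s + p) g ω := by
    intro ω
    have : n = p + (g + p') := by omega
    conv_lhs => rw [this, psum_add, psum_add]
    ring
  have hS := hsplit s (s + p + g) n p p' hn (by omega) (by omega) le_rfl
  have hnq : 2 * ((n : ℝ) / 2) ^ (q + 1) ≤ (n : ℝ) ^ (q + 1) / 2 := by
    rw [div_pow]
    have h4 : (4 : ℝ) ≤ 2 ^ (q + 1) := by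
      calc (4 : ℝ) = 2 ^ 2 := by norm_num
        _ ≤ _ := pow_le_pow_right₀ (by norm_num) (by omega)
    have hnn : 0 ≤ (n : ℝ) ^ (q + 1) := by positivity
    rw [← mul_div_assoc, div_le_div_iff₀ (by positivity) (by norm_num)]
    nlinarith
  have hi1 := ih p (by omega) s
  have hi2 := ih p' (by omega) (s + p + g)
  have hp1 : (p : ℝ) ^ (q + 1) ≤ ((n : ℝ) / 2) ^ (q + 1) := by
    gcongr
    rw [le_div_iff₀ (by norm_num)]
    exact_mod_cast (by omega : p * 2 ≤ n)
  have hp2 : (p' : ℝ) ^ (q + 1) ≤ ((n : ℝ) / 2) ^ (q + 1) := by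
    gcongr
    rw [le_div_iff₀ (by norm_num)]
    exact_mod_cast (by omega : p' * 2 ≤ n)
  have hgb : ∫ ω, |psum μ X φ (s + p) g ω| ^ Q ∂μ ≤ c' * (n : ℝ) ^ (q + 1) := by
    refine (htriv _ _).trans ?_
    gcongr
    rw [hQ, pow_mul]
    gcongr
    exact_mod_cast Nat.sqrt_le' n
  have hIG := (psum_Pw (μ := μ) (X := X) φ (s + p) g).integrable_abs_pow hP (p := Q) (by omega)
  have hIST : Integrable (fun ω => |psum μ X φ s p ω + psum μ X φ (s + p + g) p' ω| ^ Q) μ := by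
    have h1 := (psum_Pw (μ := μ) (X := X) φ s p).mono_window (a' := s) (b' := s + n)
      le_rfl (by omega)
    have h2 := (psum_Pw (μ := μ) (X := X) φ (s + p + g) p').mono_window (a' := s) (b' := s + n)
      (by omega) (by omega)
    exact (h1.add h2).integrable_abs_pow hP (by omega)
  have hIS := (psum_Pw (μ := μ) (X := X) φ s n).integrable_abs_pow hP (p := Q) (by omega)
  calc ∫ ω, psum μ X φ s n ω ^ Q ∂μ = ∫ ω, |psum μ X φ s n ω| ^ Q ∂μ := by simp only [hev]
    _ ≤ ∫ ω, (5 / 4 * |psum μ X φ s p ω + psum μ X φ (s + p + g) p' ω| ^ Q +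
          c'' * |psum μ X φ (s + p) g ω| ^ Q) ∂μ := by
        refine integral_mono hIS ((hIST.const_mul _).add (hIG.const_mul _)) fun ω => ?_
        simp only []
        rw [hdec ω]
        exact hxy _ _
    _ = 5 / 4 * ∫ ω, (psum μ X φ s p ω + psum μ X φ (s + p + g) p' ω) ^ Q ∂μ +
          c'' * ∫ ω, |psum μ X φ (s + p) g ω| ^ Q ∂μ := by
        rw [integral_add (hIST.const_mul _) (hIG.const_mul _), integral_const_mul,
          integral_const_mul]
        simp only [hev]
    _ ≤ 5 / 4 * (K * ((n : ℝ) / 2) ^ (q + 1) + K * ((n : ℝ) / 2) ^ (q + 1) +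
          c * (n : ℝ) ^ (q + 1)) + c'' * (c' * (n : ℝ) ^ (q + 1)) := by nlinarith
    _ ≤ 5 / 4 * (K * ((n : ℝ) ^ (q + 1) / 2) + c * (n : ℝ) ^ (q + 1)) +
          c'' * (c' * (n : ℝ) ^ (q + 1)) := by nlinarith
    _ = K * (n : ℝ) ^ (q + 1) := by rw [hK]; ring

theorem Good.moment_bound (hP : Good μ X a₀ A)
    (φ : LinForm d) {q : ℕ} (hq1 : 1 ≤ q) (hq : 2 * q ≤ 12 + 4 * a₀) :
    ∃ K, 0 ≤ K ∧ ∀ (s : ℤ) (n : ℕ), ∫ ω, psum μ X φ s n ω ^ (2 * q) ∂μ ≤ K * (n : ℝ) ^ q := by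
  induction q, hq1 using Nat.le_induction with
  | base => simpa using hP.moment_two φ
  | succ q hq1 ih =>
    obtain ⟨C, hC, h⟩ := ih (by omega)
    exact hP.moment_step φ hq1 hq hC h

/-- `f` is in `L^p` with norm at most `C`. -/
structure Bd (μ : Measure Ω) (p : ℕ) (C : ℝ) (f : Ω → ℝ) : Prop where
  memLp : MemLp f p μ
  nonneg : 0 ≤ C
  le : eLpNorm f p μ ≤ ENNReal.ofReal C

lemma holderTriple_two_mul (p : ℕ) :
    ENNReal.HolderTriple ((2 * p : ℕ) : ENNReal) ((2 * p : ℕ) : ENNReal) (p : ENNReal) where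
  inv_add_inv_eq_inv := by
    push_cast
    rw [ENNReal.mul_inv (by simp) (by simp), ← add_mul, ENNReal.inv_two_add_inv_two, one_mul]

lemma holderTriple_six_twelve :
    ENNReal.HolderTriple ((6 : ℕ) : ENNReal) ((12 : ℕ) : ENNReal) ((4 : ℕ) : ENNReal) where
  inv_add_inv_eq_inv := by
    rw [← ENNReal.toReal_eq_toReal_iff' (by simp) (by simp), ENNReal.toReal_add (by simp) (by simp)]
    simp only [ENNReal.toReal_inv, ENNReal.toReal_natCast]
    norm_num

namespace Bd

variable {p q r : ℕ} {C D : ℝ} {f g : Ω → ℝ}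

lemma mono_const (h : Bd μ p C f) (hCD : C ≤ D) : Bd μ p D f :=
  ⟨h.memLp, h.nonneg.trans hCD, h.le.trans (ENNReal.ofReal_le_ofReal hCD)⟩

lemma mono_exp (h : Bd μ p C f) (hqp : q ≤ p) : Bd μ q C f := by
  have hqp' : (q : ENNReal) ≤ p := by exact_mod_cast hqp
  exact ⟨h.memLp.mono_exponent hqp', h.nonneg,
    (eLpNorm_le_eLpNorm_of_exponent_le hqp' h.memLp.1).trans h.le⟩

lemma add (hf : Bd μ p C f) (hg : Bd μ p D g) (hp : 1 ≤ p) :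
    Bd μ p (C + D) (fun ω => f ω + g ω) := by
  refine ⟨hf.memLp.add hg.memLp, add_nonneg hf.nonneg hg.nonneg, ?_⟩
  rw [ENNReal.ofReal_add hf.nonneg hg.nonneg]
  exact (eLpNorm_add_le hf.memLp.1 hg.memLp.1 (by exact_mod_cast hp)).trans
    (add_le_add hf.le hg.le)

lemma neg (hf : Bd μ p C f) : Bd μ p C (fun ω => - f ω) :=
  ⟨hf.memLp.neg, hf.nonneg, (eLpNorm_neg f p μ).le.trans hf.le⟩

lemma sub (hf : Bd μ p C f) (hg : Bd μ p D g) (hp : 1 ≤ p) :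
    Bd μ p (C + D) (fun ω => f ω - g ω) := by
  simpa only [sub_eq_add_neg] using hf.add hg.neg hp

lemma const (c : ℝ) (hp : 1 ≤ p) : Bd μ p |c| (fun _ => c) := by
  refine ⟨memLp_const c, abs_nonneg c, ?_⟩
  rw [eLpNorm_const _ (by exact_mod_cast (by omega : p ≠ 0)) (IsProbabilityMeasure.ne_zero μ)]
  simp [← Real.enorm_eq_ofReal_abs]

lemma const_mul (hf : Bd μ p C f) (c : ℝ) : Bd μ p (|c| * C) (fun ω => c * f ω) := by
  refine ⟨hf.memLp.const_mul c, mul_nonneg (abs_nonneg c) hf.nonneg, ?_⟩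
  have : (fun ω => c * f ω) = c • f := rfl
  rw [this, eLpNorm_const_smul, ENNReal.ofReal_mul (abs_nonneg c), Real.enorm_eq_ofReal_abs]
  gcongr
  exact hf.le

lemma div_const (hf : Bd μ p C f) (c : ℝ) : Bd μ p (C / |c|) (fun ω => f ω / c) := by
  have := hf.const_mul c⁻¹
  simp only [abs_inv, inv_mul_eq_div] at this
  exact this

lemma sum {ι : Type*} (s : Finset ι) {F : ι → Ω → ℝ} {c : ι → ℝ}
    (h : ∀ x ∈ s, Bd μ p (c x) (F x)) (hp : 1 ≤ p) :
    Bd μ p (∑ x ∈ s, c x) (fun ω => ∑ x ∈ s, F x ω) := by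
  induction s using Finset.induction_on with
  | empty => simpa using ⟨MemLp.zero, le_rfl, by simp⟩
  | insert a s ha ih =>
    simp only [sum_insert ha]
    exact (h a (by simp)).add (ih fun x hx => h x (by simp [hx])) hp

lemma avg {n : ℕ} {F : ℕ → Ω → ℝ} (h : ∀ i < n, Bd μ p C (F i)) (hC : 0 ≤ C) (hp : 1 ≤ p) :
    Bd μ p C (fun ω => (∑ i ∈ range n, F i ω) / n) := by
  have := (sum (range n) (c := fun _ => C) (fun i hi => h i (by simpa using hi)) hp).div_const
    (n : ℝ)
  refine this.mono_const ?_
  rcases n.eq_zero_or_pos with rfl | hn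
  · simpa using hC
  have : (0 : ℝ) < n := by exact_mod_cast hn
  simp only [sum_const, card_range, nsmul_eq_mul, abs_of_pos this]
  rw [mul_div_cancel_left₀ _ this.ne']

lemma mul (hf : Bd μ p C f) (hg : Bd μ q D g)
    (hpqr : ENNReal.HolderTriple (p : ENNReal) (q : ENNReal) (r : ENNReal)) :
    Bd μ r (C * D) (fun ω => f ω * g ω) := by
  refine ⟨hg.memLp.mul hf.memLp (hpqr := hpqr), mul_nonneg hf.nonneg hg.nonneg, ?_⟩
  have := eLpNorm_smul_le_mul_eLpNorm (hpqr := hpqr) hg.memLp.1 hf.memLp.1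
  refine this.trans ?_
  rw [ENNReal.ofReal_mul hf.nonneg]
  exact mul_le_mul' hf.le hg.le

lemma mul_self_exp (hf : Bd μ (2 * p) C f) (hg : Bd μ (2 * p) D g) :
    Bd μ p (C * D) (fun ω => f ω * g ω) :=
  hf.mul hg (holderTriple_two_mul p)

lemma dominated (hg : Bd μ p C g) (hf : AEStronglyMeasurable f μ) (h : ∀ ω, |f ω| ≤ |g ω|) :
    Bd μ p C f :=
  ⟨hg.memLp.mono hf (ae_of_all _ h), hg.nonneg, (eLpNorm_mono h).trans hg.le⟩

lemma abs (hf : Bd μ p C f) : Bd μ p C (fun ω => |f ω|) :=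
  hf.dominated hf.memLp.1.norm fun ω => by simp

lemma integrable (hf : Bd μ p C f) (hp : 1 ≤ p) : Integrable f μ :=
  hf.memLp.integrable (by exact_mod_cast hp)

lemma integrable_abs_pow (hf : Bd μ p C f) (hp : p ≠ 0) : Integrable (fun ω => |f ω| ^ p) μ :=
  hf.memLp.integrable_norm_pow hp

lemma integral_abs_pow_le (hf : Bd μ p C f) (hp : p ≠ 0) : ∫ ω, |f ω| ^ p ∂μ ≤ C ^ p := by
  have h1 := hf.le
  rw [hf.memLp.eLpNorm_eq_integral_rpow_norm (by exact_mod_cast hp) (by simp),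
    ENNReal.ofReal_le_ofReal_iff hf.nonneg] at h1
  simp only [ENNReal.toReal_natCast, Real.rpow_natCast, Real.norm_eq_abs] at h1
  have h0 : 0 ≤ ∫ ω, |f ω| ^ p ∂μ := integral_nonneg fun ω => by positivity
  have h2 := pow_le_pow_left₀ (by positivity) h1 p
  rwa [Real.rpow_inv_natCast_pow h0 hp] at h2

lemma of_integral (hf : MemLp f p μ) (hp : p ≠ 0) (hC : 0 ≤ C)
    (h : ∫ ω, |f ω| ^ p ∂μ ≤ C ^ p) : Bd μ p C f := by
  refine ⟨hf, hC, ?_⟩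
  rw [hf.eLpNorm_eq_integral_rpow_norm (by exact_mod_cast hp) (by simp)]
  apply ENNReal.ofReal_le_ofReal
  simp only [ENNReal.toReal_natCast, Real.rpow_natCast, Real.norm_eq_abs]
  rw [Real.rpow_inv_le_iff_of_pos (integral_nonneg fun ω => by positivity) hC
    (by exact_mod_cast Nat.pos_of_ne_zero hp), Real.rpow_natCast]
  exact h

lemma pow (hf : Bd μ (p * q) C f) (hp : p ≠ 0) (hq : q ≠ 0) :
    Bd μ p (C ^ q) (fun ω => f ω ^ q) := by
  have hpq : p * q ≠ 0 := mul_ne_zero hp hq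
  have e : ∀ ω, |f ω ^ q| ^ p = |f ω| ^ (p * q) := fun ω => by rw [abs_pow, ← pow_mul, mul_comm]
  have hm : AEStronglyMeasurable (fun ω => f ω ^ q) μ := hf.memLp.1.pow q
  refine of_integral ?_ hp (pow_nonneg hf.nonneg q) ?_
  · rw [← integrable_norm_rpow_iff hm (by exact_mod_cast hp) (by simp)]
    simp only [ENNReal.toReal_natCast, Real.rpow_natCast, Real.norm_eq_abs, e]
    exact hf.integrable_abs_pow hpq
  · simp only [e, ← pow_mul, mul_comm q p]
    exact hf.integral_abs_pow_le hpq

lemma abs_integral_le (hf : Bd μ p C f) (hp : 1 ≤ p) :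
    |∫ ω, f ω ∂μ| ≤ C := by
  have := (hf.mono_exp hp).integral_abs_pow_le one_ne_zero
  simp only [pow_one] at this
  exact abs_integral_le_integral_abs.trans this

lemma sub_integral (hf : Bd μ p C f) (hp : 1 ≤ p) : Bd μ p (2 * C) (fun ω => f ω - ∫ ω', f ω' ∂μ) :=
  (hf.sub (Bd.const _ hp) hp).mono_const (by linarith [hf.abs_integral_le hp])

lemma measure_le (hf : Bd μ p C f) (hp : p ≠ 0) {c : ℝ} (hc : 0 < c) :
    (μ {ω | c ≤ |f ω|}).toReal ≤ C ^ p / c ^ p := by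
  rw [le_div_iff₀ (by positivity), mul_comm]
  have := mul_meas_ge_le_integral_of_nonneg (μ := μ) (f := fun ω => |f ω| ^ p)
    (ae_of_all _ fun ω => by positivity) (hf.integrable_abs_pow hp) (c ^ p)
  refine le_trans ?_ (this.trans (hf.integral_abs_pow_le hp))
  gcongr
  refine ENNReal.toReal_mono (measure_ne_top _ _) (measure_mono fun ω hω => ?_)
  simp only [Set.mem_ofPred_eq] at hω ⊢
  gcongr

end Bd

/-- Indicator that two indices are within distance `D`. -/
def near (D i j : ℕ) : ℝ := if j ≤ i + D ∧ i ≤ j + D then 1 else 0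

lemma near_nonneg (D i j : ℕ) : 0 ≤ near D i j := by unfold near; split_ifs <;> norm_num

lemma near_eq_one {D i j : ℕ} (h : j ≤ i + D ∧ i ≤ j + D) : near D i j = 1 := if_pos h

lemma sum_near_le (D N i : ℕ) : ∑ j ∈ range N, near D i j ≤ 2 * D + 1 := by
  unfold near
  rw [sum_ite]
  simp only [sum_const, nsmul_eq_mul, mul_one, sum_const_zero]
  have h : (range N).filter (fun j => j ≤ i + D ∧ i ≤ j + D) ⊆ Icc (i - D) (i + D) := by
    intro j hj
    simp only [mem_filter, mem_Icc] at hj ⊢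
    omega
  have := card_le_card h
  rw [Nat.card_Icc] at this
  have h2 : ((range N).filter (fun j => j ≤ i + D ∧ i ≤ j + D)).card ≤ 2 * D + 1 := by omega
  exact_mod_cast h2

lemma sum_sum_near_le (D N : ℕ) : ∑ i ∈ range N, ∑ j ∈ range N, near D i j ≤ N * (2 * D + 1) := by
  calc _ ≤ ∑ i ∈ range N, ((2 * D + 1 : ℝ)) :=
        sum_le_sum fun i _ => sum_near_le D N i
    _ = _ := by simp; ring

lemma integral_sum_le {ι : Type*} {s : Finset ι} {g : ι → Ω → ℝ} {c : ι → ℝ}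
    (hg : ∀ i ∈ s, Integrable (g i) μ) (h : ∀ i ∈ s, ∫ ω, g i ω ∂μ ≤ c i) :
    ∫ ω, ∑ i ∈ s, g i ω ∂μ ≤ ∑ i ∈ s, c i := by
  rw [integral_finsetSum _ hg]
  exact sum_le_sum h

lemma abs_integral_sum_le {ι : Type*} {s : Finset ι} {g : ι → Ω → ℝ} {c : ι → ℝ}
    (hg : ∀ i ∈ s, Integrable (g i) μ) (h : ∀ i ∈ s, |∫ ω, g i ω ∂μ| ≤ c i) :
    |∫ ω, ∑ i ∈ s, g i ω ∂μ| ≤ ∑ i ∈ s, c i := by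
  rw [integral_finsetSum _ hg]
  exact (abs_sum_le_sum_abs _ _).trans (sum_le_sum h)

/-- Bound for the covariance of functionals of windows that are `w` apart. -/
lemma Good.abs_integral_mul_le_of_gap (hP : Good μ X a₀ A)
    {a b c e : ℤ} {i j w L : ℕ} {C D : ℝ} {f g : Ω → ℝ}
    (hf : Pw μ X a b i C f) (hg : Pw μ X c e j D g) (hgap : b + w ≤ c ∨ e + w ≤ a)
    (hij : i + j ≤ 13 + 4 * a₀) (hL1 : 1 ≤ L) (hL : b - a ≤ L) (hL' : e - c ≤ L)
    (h0 : (∫ ω, f ω ∂μ) = 0) :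
    |∫ ω, f ω * g ω ∂μ| ≤ covC a₀ A * (C * D * L) / ((w : ℝ) + 1) ^ 14 := by
  have h14 : covC a₀ A * (C * D * L) / ((w : ℝ) + 1) ^ (14 + 4 * a₀) ≤
      covC a₀ A * (C * D * L) / ((w : ℝ) + 1) ^ 14 := by
    have := hP.covC_nonneg
    have := hf.nonneg
    have := hg.nonneg
    have hw : (1 : ℝ) ≤ (w : ℝ) + 1 := by linarith [Nat.cast_nonneg (α := ℝ) w]
    have := pow_le_pow_right₀ hw (show 14 ≤ 14 + 4 * a₀ by omega)
    gcongr
  refine le_trans ?_ h14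
  have hL1' : (1 : ℝ) ≤ L := by exact_mod_cast hL1
  rcases hgap with h | h
  · have := hP.abs_cov_le hf hg h hij hL1' (by exact_mod_cast hL) (by exact_mod_cast hL')
    simpa [h0, covC] using this
  · have := hP.abs_cov_le hg hf h (by omega) hL1' (by exact_mod_cast hL') (by exact_mod_cast hL)
    simpa [h0, covC, mul_comm] using this

/-- Second moment of an average of centered window functionals. -/
lemma Good.integral_avg_sq_le (hP : Good μ X a₀ A) {s : ℤ} {N w a L : ℕ} {C b : ℝ} {f : ℕ → Ω → ℝ}
    (hN : 0 < N) (hL : w ≤ L) (hL1 : 1 ≤ L)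
    (hf : ∀ i < N, Pw μ X (s + i) (s + i + w) a C (f i)) (ha : 2 * a ≤ 13 + 4 * a₀)
    (h0 : ∀ i < N, (∫ ω, f i ω ∂μ) = 0) (hb : ∀ i < N, Bd μ 2 b (f i)) :
    ∫ ω, ((∑ i ∈ range N, f i ω) / N) ^ 2 ∂μ ≤
      (4 * w + 1) / N * b ^ 2 + covC a₀ A * (C ^ 2 * L) / ((w : ℝ) + 1) ^ 14 := by
  set τ := covC a₀ A * (C ^ 2 * L) / ((w : ℝ) + 1) ^ 14 with hτ
  have hN' : (0 : ℝ) < N := by exact_mod_cast hN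
  have hC0 : 0 ≤ C := (hf 0 hN).nonneg
  have hτ0 : 0 ≤ τ := by have := hP.covC_nonneg; positivity
  have key : ∀ i < N, ∀ j < N, ∫ ω, f i ω * f j ω ∂μ ≤ near (2 * w) i j * b ^ 2 + τ := by
    intro i hi j hj
    by_cases h : j ≤ i + 2 * w ∧ i ≤ j + 2 * w
    · rw [near_eq_one h]
      have := ((hb i hi).mul_self_exp (p := 1) (hb j hj)).abs_integral_le le_rfl
      have := le_abs_self (∫ ω, f i ω * f j ω ∂μ)
      nlinarith
    · have := hP.abs_integral_mul_le_of_gap (L := L) (w := w) (hf i hi) (hf j hj) (by omega)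
        (by omega) hL1 (by omega) (by omega) (h0 i hi)
      rw [← sq] at this
      have := le_abs_self (∫ ω, f i ω * f j ω ∂μ)
      have := mul_nonneg (near_nonneg (2 * w) i j) (sq_nonneg b)
      linarith
  set R := range N with hR
  have e : ∀ ω, ((∑ i ∈ R, f i ω) / N) ^ 2 = (∑ p ∈ R ×ˢ R, f p.1 ω * f p.2 ω) / (N : ℝ) ^ 2 := by
    intro ω; rw [div_pow, sq, sum_mul_sum, sum_product]
  simp only [e]
  rw [integral_div, div_le_iff₀ (by positivity)]
  calc _ ≤ ∑ p ∈ R ×ˢ R, (near (2 * w) p.1 p.2 * b ^ 2 + τ) := by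
        refine integral_sum_le (fun p hp => ?_) fun p hp => ?_
        all_goals simp only [mem_product, hR, mem_range] at hp
        · exact ((hb _ hp.1).mul_self_exp (p := 1) (hb _ hp.2)).integrable le_rfl
        · exact key _ hp.1 _ hp.2
    _ = (∑ i ∈ R, ∑ j ∈ R, near (2 * w) i j) * b ^ 2 + N ^ 2 * τ := by
        rw [sum_add_distrib, sum_product]
        simp only [sum_const, hR, card_product, card_range, nsmul_eq_mul, sum_mul]
        push_cast
        ring
    _ ≤ (N * (2 * (2 * w : ℕ) + 1)) * b ^ 2 + N ^ 2 * τ := by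
        gcongr
        exact sum_sum_near_le _ _
    _ = _ := by push_cast; field_simp; ring

/-- Third mixed moments of averages of centered window functionals. -/
lemma Good.abs_integral_avg_three_le (hP : Good μ X a₀ A)
    {s : ℤ} {N w a b c L : ℕ} {Ca Cb Cc ba bb bc : ℝ} {f g h : ℕ → Ω → ℝ}
    (hN : 0 < N) (hL : N + w ≤ L)
    (hf : ∀ i < N, Pw μ X (s + i) (s + i + w) a Ca (f i))
    (hg : ∀ i < N, Pw μ X (s + i) (s + i + w) b Cb (g i))
    (hh : ∀ i < N, Pw μ X (s + i) (s + i + w) c Cc (h i))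
    (habc : a + b + c ≤ 13 + 4 * a₀)
    (hf0 : ∀ i < N, (∫ ω, f i ω ∂μ) = 0) (hg0 : ∀ i < N, (∫ ω, g i ω ∂μ) = 0)
    (hh0 : ∀ i < N, (∫ ω, h i ω ∂μ) = 0)
    (hbf : ∀ i < N, Bd μ 4 ba (f i)) (hbg : ∀ i < N, Bd μ 4 bb (g i))
    (hbh : ∀ i < N, Bd μ 4 bc (h i)) :
    |∫ ω, ((∑ i ∈ range N, f i ω) / N) * ((∑ i ∈ range N, g i ω) / N) *
        ((∑ i ∈ range N, h i ω) / N) ∂μ| ≤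
      ((8 * w + 1) / N) ^ 2 * (ba * bb * bc) +
        covC a₀ A * (Ca * Cb * Cc * L) / ((w : ℝ) + 1) ^ 14 := by
  set τ := covC a₀ A * (Ca * Cb * Cc * L) / ((w : ℝ) + 1) ^ 14 with hτ
  have hN' : (0 : ℝ) < N := by exact_mod_cast hN
  have hB0 : 0 ≤ ba * bb * bc := mul_nonneg (mul_nonneg (hbf 0 hN).nonneg (hbg 0 hN).nonneg)
    (hbh 0 hN).nonneg
  have hτ0 : 0 ≤ τ := by
    have := hP.covC_nonneg; have := (hf 0 hN).nonneg; have := (hg 0 hN).nonneg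
    have := (hh 0 hN).nonneg
    positivity
  have hbd : ∀ i < N, ∀ j < N, ∀ k < N,
      Bd μ 1 (ba * bb * bc) (fun ω => f i ω * g j ω * h k ω) := fun i hi j hj k hk =>
    ((hbf i hi).mul_self_exp (p := 2) (hbg j hj)).mul_self_exp (p := 1)
      ((hbh k hk).mono_exp (by norm_num))
  have iso : ∀ {i j k a b c : ℕ} {Ca Cb Cc : ℝ} {f g h : Ω → ℝ}, i < N → j < N → k < N →
      Pw μ X (s + i) (s + i + w) a Ca f → Pw μ X (s + j) (s + j + w) b Cb g →
      Pw μ X (s + k) (s + k + w) c Cc h → a + b + c ≤ 13 + 4 * a₀ → (∫ ω, f ω ∂μ) = 0 →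
      (i + 2 * w ≤ min j k ∨ max j k + 2 * w ≤ i) →
      |∫ ω, f ω * (g ω * h ω) ∂μ| ≤ covC a₀ A * (Ca * (Cb * Cc) * L) / ((w : ℝ) + 1) ^ 14 := by
    intro i j k a b c Ca Cb Cc f g h hi hj hk hf hg hh habc hf0 hc
    have hgh := (hg.mono_window (a' := s + min j k) (b' := s + max j k + w) (by omega)
      (by omega)).mul (hh.mono_window (by omega) (by omega))
    exact hP.abs_integral_mul_le_of_gap hf hgh (by omega) (by omega) (by omega) (by omega)
      (by omega) hf0
  have key : ∀ i < N, ∀ j < N, ∀ k < N, |∫ ω, f i ω * g j ω * h k ω ∂μ| ≤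
      near (4 * w) i j * near (4 * w) i k * (ba * bb * bc) + τ := by
    intro i hi j hj k hk
    have hn := mul_nonneg (mul_nonneg (near_nonneg (4 * w) i j) (near_nonneg (4 * w) i k)) hB0
    by_cases hcl : (j ≤ i + 4 * w ∧ i ≤ j + 4 * w) ∧ (k ≤ i + 4 * w ∧ i ≤ k + 4 * w)
    · rw [near_eq_one hcl.1, near_eq_one hcl.2]
      have := (hbd i hi j hj k hk).abs_integral_le le_rfl
      linarith
    suffices |∫ ω, f i ω * g j ω * h k ω ∂μ| ≤ τ by linarith
    have hcase : (i + 2 * w ≤ min j k ∨ max j k + 2 * w ≤ i) ∨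
        (j + 2 * w ≤ min i k ∨ max i k + 2 * w ≤ j) ∨
        (k + 2 * w ≤ min i j ∨ max i j + 2 * w ≤ k) := by omega
    rcases hcase with hc | hc | hc
    · convert iso hi hj hk (hf i hi) (hg j hj) (hh k hk) habc (hf0 i hi) hc using 4 <;> ring
    · convert iso hj hi hk (hg j hj) (hf i hi) (hh k hk) (by omega) (hg0 j hj) hc using 4 <;> ring
    · convert iso hk hi hj (hh k hk) (hf i hi) (hg j hj) (by omega) (hh0 k hk) hc using 4 <;> ring
  set R := range N with hR
  have e : ∀ ω, ((∑ i ∈ R, f i ω) / N) * ((∑ i ∈ R, g i ω) / N) * ((∑ i ∈ R, h i ω) / N) =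
      (∑ p ∈ R ×ˢ R ×ˢ R, f p.1 ω * g p.2.1 ω * h p.2.2 ω) / (N : ℝ) ^ 3 := by
    intro ω
    simp only [sum_product, ← mul_sum, ← sum_mul]
    field_simp
  simp only [e]
  rw [integral_div, abs_div, abs_of_pos (show (0 : ℝ) < (N : ℝ) ^ 3 by positivity),
    div_le_iff₀ (by positivity)]
  calc _ ≤ ∑ p ∈ R ×ˢ R ×ˢ R,
          (near (4 * w) p.1 p.2.1 * near (4 * w) p.1 p.2.2 * (ba * bb * bc) + τ) := by
        refine abs_integral_sum_le (fun p hp => ?_) fun p hp => ?_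
        all_goals simp only [mem_product, hR, mem_range] at hp
        · exact (hbd _ hp.1 _ hp.2.1 _ hp.2.2).integrable le_rfl
        · exact key _ hp.1 _ hp.2.1 _ hp.2.2
    _ = ∑ i ∈ R, ((∑ j ∈ R, near (4 * w) i j) * (∑ k ∈ R, near (4 * w) i k) * (ba * bb * bc)
          + N ^ 2 * τ) := by
        rw [sum_product]
        refine sum_congr rfl fun i _ => ?_
        simp only [sum_product, sum_add_distrib, sum_const, hR,
          card_product, card_range, nsmul_eq_mul, ← sum_mul, ← mul_sum]
        push_cast
        ring
    _ ≤ ∑ i ∈ range N, ((2 * (4 * w : ℕ) + 1) * (2 * (4 * w : ℕ) + 1) * (ba * bb * bc)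
          + N ^ 2 * τ) := by
        refine sum_le_sum fun i _ => ?_
        have h1 := sum_near_le (4 * w) N i
        have h2 : 0 ≤ ∑ j ∈ range N, near (4 * w) i j :=
          sum_nonneg fun j _ => near_nonneg _ _ _
        gcongr
    _ = _ := by
        simp only [sum_const, card_range, nsmul_eq_mul]
        push_cast
        field_simp
        ring

/-- Fourth moment of an average of centered window functionals. -/
lemma Good.integral_avg_four_le (hP : Good μ X a₀ A) {s : ℤ} {N w a L : ℕ} {C b : ℝ} {f : ℕ → Ω → ℝ}
    (hN : 0 < N) (hL : N + w ≤ L)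
    (hf : ∀ i < N, Pw μ X (s + i) (s + i + w) a C (f i)) (ha : 4 * a ≤ 13 + 4 * a₀)
    (h0 : ∀ i < N, (∫ ω, f i ω ∂μ) = 0) (hb : ∀ i < N, Bd μ 4 b (f i)) :
    ∫ ω, ((∑ i ∈ range N, f i ω) / N) ^ 4 ∂μ ≤
      3 * ((4 * w + 1) / N) ^ 2 * b ^ 4 + covC a₀ A * (C ^ 4 * L) / ((w : ℝ) + 1) ^ 14 := by
  set τ := covC a₀ A * (C ^ 4 * L) / ((w : ℝ) + 1) ^ 14 with hτ
  have hN' : (0 : ℝ) < N := by exact_mod_cast hN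
  have hC0 : 0 ≤ C := (hf 0 hN).nonneg
  have hb0 : 0 ≤ b := (hb 0 hN).nonneg
  have hτ0 : 0 ≤ τ := by have := hP.covC_nonneg; positivity
  have hbd : ∀ i < N, ∀ j < N, ∀ k < N, ∀ l < N,
      Bd μ 1 (b ^ 4) (fun ω => (f i ω * f j ω) * (f k ω * f l ω)) := by
    intro i hi j hj k hk l hl
    have := ((hb i hi).mul_self_exp (p := 2) (hb j hj)).mul_self_exp (p := 1)
      ((hb k hk).mul_self_exp (p := 2) (hb l hl))
    exact this.mono_const (le_of_eq (by ring))
  have iso : ∀ i < N, ∀ j < N, ∀ k < N, ∀ l < N,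
      (i + 2 * w < min j (min k l) ∨ max j (max k l) + 2 * w < i) →
      |∫ ω, f i ω * (f j ω * (f k ω * f l ω)) ∂μ| ≤ τ := by
    intro i hi j hj k hk l hl hc
    have hw : ∀ t, min j (min k l) ≤ t → t ≤ max j (max k l) → ∀ ht : t < N,
        Pw μ X (s + min j (min k l) : ℤ) (s + max j (max k l) + w) a C (f t) :=
      fun t h1 h2 ht => (hf t ht).mono_window (by omega) (by omega)
    have hjkl := (hw j (by omega) (by omega) hj).mul ((hw k (by omega) (by omega) hk).mul
      (hw l (by omega) (by omega) hl))
    have := hP.abs_integral_mul_le_of_gap (L := L) (w := w) (hf i hi) hjkl (by omega) (by omega)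
      (by omega) (by omega) (by omega) (h0 i hi)
    refine this.trans (le_of_eq ?_)
    rw [hτ]; ring
  have key : ∀ i < N, ∀ j < N, ∀ k < N, ∀ l < N, ∫ ω, (f i ω * f j ω) * (f k ω * f l ω) ∂μ ≤
      (near (2 * w) i j * near (2 * w) k l + near (2 * w) i k * near (2 * w) j l +
        near (2 * w) i l * near (2 * w) j k) * b ^ 4 + τ := by
    intro i hi j hj k hk l hl
    have hn1 := mul_nonneg (near_nonneg (2 * w) i j) (near_nonneg (2 * w) k l)
    have hn2 := mul_nonneg (near_nonneg (2 * w) i k) (near_nonneg (2 * w) j l)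
    have hn3 := mul_nonneg (near_nonneg (2 * w) i l) (near_nonneg (2 * w) j k)
    have hb4 : 0 ≤ b ^ 4 := by positivity
    have hle := (le_abs_self _).trans ((hbd i hi j hj k hk l hl).abs_integral_le le_rfl)
    by_cases c1 : (j ≤ i + 2 * w ∧ i ≤ j + 2 * w) ∧ (l ≤ k + 2 * w ∧ k ≤ l + 2 * w)
    · rw [near_eq_one c1.1, near_eq_one c1.2] at *
      nlinarith
    by_cases c2 : (k ≤ i + 2 * w ∧ i ≤ k + 2 * w) ∧ (l ≤ j + 2 * w ∧ j ≤ l + 2 * w)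
    · rw [near_eq_one c2.1, near_eq_one c2.2] at *
      nlinarith
    by_cases c3 : (l ≤ i + 2 * w ∧ i ≤ l + 2 * w) ∧ (k ≤ j + 2 * w ∧ j ≤ k + 2 * w)
    · rw [near_eq_one c3.1, near_eq_one c3.2] at *
      nlinarith
    suffices |∫ ω, (f i ω * f j ω) * (f k ω * f l ω) ∂μ| ≤ τ by
      have h1 := le_abs_self (∫ ω, (f i ω * f j ω) * (f k ω * f l ω) ∂μ)
      have h2 := mul_nonneg (add_nonneg (add_nonneg hn1 hn2) hn3) hb4
      linarith
    have hcase : (i + 2 * w < min j (min k l) ∨ max j (max k l) + 2 * w < i) ∨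
        (j + 2 * w < min i (min k l) ∨ max i (max k l) + 2 * w < j) ∨
        (k + 2 * w < min i (min j l) ∨ max i (max j l) + 2 * w < k) ∨
        (l + 2 * w < min i (min j k) ∨ max i (max j k) + 2 * w < l) := by omega
    rcases hcase with hc | hc | hc | hc
    · convert iso i hi j hj k hk l hl hc using 4; ring
    · convert iso j hj i hi k hk l hl hc using 4; ring
    · convert iso k hk i hi j hj l hl hc using 4; ring
    · convert iso l hl i hi j hj k hk hc using 4; ring
  set R := range N with hR
  have e : ∀ ω, ((∑ i ∈ R, f i ω) / N) ^ 4 = (∑ p ∈ R ×ˢ R ×ˢ R ×ˢ R,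
      (f p.1 ω * f p.2.1 ω) * (f p.2.2.1 ω * f p.2.2.2 ω)) / (N : ℝ) ^ 4 := by
    intro ω
    simp only [sum_product, ← mul_sum, ← sum_mul]
    field_simp
  simp only [e]
  rw [integral_div, div_le_iff₀ (by positivity)]
  set S := ∑ i ∈ R, ∑ j ∈ R, near (2 * w) i j with hS
  calc _ ≤ ∑ p ∈ R ×ˢ R ×ˢ R ×ˢ R, ((near (2 * w) p.1 p.2.1 * near (2 * w) p.2.2.1 p.2.2.2 +
          near (2 * w) p.1 p.2.2.1 * near (2 * w) p.2.1 p.2.2.2 +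
            near (2 * w) p.1 p.2.2.2 * near (2 * w) p.2.1 p.2.2.1) * b ^ 4 + τ) := by
        refine integral_sum_le (fun p hp => ?_) fun p hp => ?_
        all_goals simp only [mem_product, hR, mem_range] at hp
        · exact (hbd _ hp.1 _ hp.2.1 _ hp.2.2.1 _ hp.2.2.2).integrable le_rfl
        · exact key _ hp.1 _ hp.2.1 _ hp.2.2.1 _ hp.2.2.2
    _ = 3 * S ^ 2 * b ^ 4 + N ^ 4 * τ := by
        have r1 : ∑ p ∈ R ×ˢ R ×ˢ R ×ˢ R,
            near (2 * w) p.1 p.2.1 * near (2 * w) p.2.2.1 p.2.2.2 = S * S := by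
          simp only [sum_product, hS, ← mul_sum, ← sum_mul]
        have r2 : ∑ p ∈ R ×ˢ R ×ˢ R ×ˢ R,
            near (2 * w) p.1 p.2.2.1 * near (2 * w) p.2.1 p.2.2.2 = S * S := by
          rw [← r1]
          simp only [sum_product]
          exact sum_congr rfl fun i _ => sum_comm
        have r3 : ∑ p ∈ R ×ˢ R ×ˢ R ×ˢ R,
            near (2 * w) p.1 p.2.2.2 * near (2 * w) p.2.1 p.2.2.1 = S * S := by
          rw [← r2]
          simp only [sum_product]
          exact sum_congr rfl fun i _ => sum_congr rfl fun j _ => sum_comm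
        rw [sum_add_distrib, ← sum_mul, sum_add_distrib, sum_add_distrib, r1, r2, r3]
        simp [hR]
        ring
    _ ≤ 3 * (N * (2 * (2 * w : ℕ) + 1)) ^ 2 * b ^ 4 + N ^ 4 * τ := by
        have h0 : 0 ≤ S := sum_nonneg fun i _ => sum_nonneg fun j _ =>
          near_nonneg _ _ _
        have h1 : S ≤ _ := sum_sum_near_le (2 * w) N
        gcongr
    _ = _ := by push_cast; field_simp; ring

/-- Block lengths of order `ε⁻²` for a sample of size `n = ε⁻⁶`. -/
structure Reg (K ε : ℝ) (n ℓ : ℕ) : Prop where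
  one_le : 1 ≤ K
  pos : 0 < ε
  le_one : ε ≤ 1
  size : (n : ℝ) * ε ^ 6 = 1
  lower : 1 / (ℓ : ℝ) ≤ K * ε ^ 2
  upper : (ℓ : ℝ) * ε ^ 2 ≤ K
  half : 2 * ℓ ≤ n
  one_le_len : 1 ≤ ℓ

namespace Reg
variable {K ε : ℝ} {n ℓ : ℕ}

lemma len_pos (h : Reg K ε n ℓ) : (0 : ℝ) < ℓ := by
  have := h.one_le_len
  positivity

lemma size_pos (h : Reg K ε n ℓ) : (0 : ℝ) < n := by
  have h1 := h.one_le_len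
  have h2 := h.half
  have : 0 < n := by omega
  positivity

lemma inv_size (h : Reg K ε n ℓ) : 1 / (n : ℝ) = ε ^ 6 := by
  have := h.size_pos
  rw [div_eq_iff this.ne', mul_comm]
  exact h.size.symm

lemma cast_num (h : Reg K ε n ℓ) : ((n - ℓ + 1 : ℕ) : ℝ) = n - ℓ + 1 := by
  have := h.half
  push_cast [Nat.cast_sub (show ℓ ≤ n by omega)]
  ring

lemma num_pos (n ℓ : ℕ) : (0 : ℝ) < ((n - ℓ + 1 : ℕ) : ℝ) := by positivity

lemma size_le_two_num (h : Reg K ε n ℓ) : (n : ℝ) ≤ 2 * ((n - ℓ + 1 : ℕ) : ℝ) := by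
  have := h.half
  have : n ≤ 2 * (n - ℓ + 1) := by omega
  exact_mod_cast this

lemma num_le_size (h : Reg K ε n ℓ) : ((n - ℓ + 1 : ℕ) : ℝ) ≤ n := by
  have h1 := h.half
  have h2 := h.one_le_len
  have : (n - ℓ + 1) ≤ n := by omega
  exact_mod_cast this

lemma inv_num_le (h : Reg K ε n ℓ) : 1 / ((n - ℓ + 1 : ℕ) : ℝ) ≤ 2 * ε ^ 6 := by
  rw [← h.inv_size, ← mul_div_assoc, mul_one, div_le_div_iff₀ (num_pos n ℓ) h.size_pos]
  linarith [h.size_le_two_num]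

lemma pow_le (h : Reg K ε n ℓ) {i j : ℕ} (hij : j ≤ i) : ε ^ i ≤ ε ^ j :=
  pow_le_pow_of_le_one h.pos.le h.le_one hij

lemma K_nonneg (h : Reg K ε n ℓ) : 0 ≤ K := by linarith [h.one_le]

lemma ratio_le (h : Reg K ε n ℓ) : (8 * (ℓ : ℝ) + 1) / ((n - ℓ + 1 : ℕ) : ℝ) ≤ 18 * K * ε ^ 4 := by
  have h1 := h.inv_num_le
  have h2 : (1 : ℝ) ≤ ℓ := by exact_mod_cast h.one_le_len
  have h3 := h.upper
  have e : (0 : ℝ) < ε := h.pos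
  calc (8 * (ℓ : ℝ) + 1) / ((n - ℓ + 1 : ℕ) : ℝ)
      = (8 * ℓ + 1) * (1 / ((n - ℓ + 1 : ℕ) : ℝ)) := by ring
    _ ≤ (9 * ℓ) * (2 * ε ^ 6) := by
        apply mul_le_mul (by linarith) h1 (by positivity) (by positivity)
    _ = 18 * (ℓ * ε ^ 2) * ε ^ 4 := by ring
    _ ≤ 18 * K * ε ^ 4 := by gcongr

lemma ratio_four_le (h : Reg K ε n ℓ) :
    (4 * (ℓ : ℝ) + 1) / ((n - ℓ + 1 : ℕ) : ℝ) ≤ 18 * K * ε ^ 4 := by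
  refine le_trans ?_ h.ratio_le
  have := h.len_pos
  gcongr
  norm_num

lemma inv_len_pow_le (h : Reg K ε n ℓ) (p : ℕ) : 1 / ((ℓ : ℝ) + 1) ^ p ≤ K ^ p * ε ^ (2 * p) := by
  have h0 := h.len_pos
  rw [show K ^ p * ε ^ (2 * p) = (K * ε ^ 2) ^ p by rw [mul_pow, ← pow_mul], ← one_div_pow]
  refine pow_le_pow_left₀ (by positivity) (le_trans ?_ h.lower) p
  gcongr
  linarith

/-- The contribution of the mixing tail is negligible. -/
lemma tail_le (h : Reg K ε n ℓ) {c D : ℝ} {j : ℕ} (hc : 0 ≤ c) (hD : D ≤ c / ε ^ (2 * j))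
    (hj : j ≤ 4) (hD0 : 0 ≤ D) {B : ℝ} (hB : 0 ≤ B) :
    B * (D * ((2 * n : ℕ) : ℝ)) / ((ℓ : ℝ) + 1) ^ 14 ≤ 2 * B * c * K ^ 14 * ε ^ 14 := by
  have h1 := h.inv_len_pow_le 14
  have e := h.pos
  have hn : (n : ℝ) = 1 / ε ^ 6 := by
    rw [eq_div_iff (by positivity)]; exact h.size
  have h2 : c / ε ^ (2 * j) ≤ c / ε ^ 8 :=
    div_le_div_of_nonneg_left hc (by positivity) (h.pow_le (by omega))
  have hK := h.K_nonneg
  calc B * (D * ((2 * n : ℕ) : ℝ)) / ((ℓ : ℝ) + 1) ^ 14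
      = B * (D * (2 * n)) * (1 / ((ℓ : ℝ) + 1) ^ 14) := by push_cast; ring
    _ ≤ B * (c / ε ^ 8 * (2 * n)) * (K ^ 14 * ε ^ (2 * 14)) := by
        apply mul_le_mul _ h1 (by positivity) (by positivity)
        gcongr
        exact hD.trans h2
    _ = 2 * B * c * K ^ 14 * ε ^ 14 := by
        rw [hn]; field_simp; ring

lemma len_le (h : Reg K ε n ℓ) : (ℓ : ℝ) ≤ K / ε ^ 2 := by
  have := h.pos
  rw [le_div_iff₀ (by positivity)]
  exact h.upper

end Reg

lemma le_one_add_pow {x : ℝ} (hx : 0 ≤ x) {k : ℕ} (hk : k ≠ 0) : x ≤ (1 + x) ^ k :=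
  (by linarith : x ≤ 1 + x).trans (le_self_pow₀ (by linarith) hk)

/-- Normalized product of two block sums. -/
def blk (μ : Measure Ω) (X : ℤ → Ω → Fin d → ℝ) (φ ψ : LinForm d) (s : ℤ) (ℓ : ℕ) (ω : Ω) : ℝ :=
  psum μ X φ s ℓ ω * psum μ X ψ s ℓ ω / ℓ

/-- Average over all overlapping blocks of the normalized products of block sums. -/
def gam (μ : Measure Ω) (X : ℤ → Ω → Fin d → ℝ) (φ ψ : LinForm d) (s : ℤ) (n ℓ : ℕ) (ω : Ω) : ℝ :=
  (∑ i ∈ range (n - ℓ + 1), blk μ X φ ψ (s + i) ℓ ω) / ((n - ℓ + 1 : ℕ) : ℝ)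

/-- Average over all overlapping blocks of the block means. -/
def mav (μ : Measure Ω) (X : ℤ → Ω → Fin d → ℝ) (φ : LinForm d) (s : ℤ) (n ℓ : ℕ) (ω : Ω) : ℝ :=
  (∑ i ∈ range (n - ℓ + 1), psum μ X φ (s + i) ℓ ω / ℓ) / ((n - ℓ + 1 : ℕ) : ℝ)

/-- Mean of the normalized product of block sums. -/
def egam (μ : Measure Ω) (X : ℤ → Ω → Fin d → ℝ) (φ ψ : LinForm d) (ℓ : ℕ) : ℝ :=
  ∫ ω, blk μ X φ ψ 0 ℓ ω ∂μ

lemma Good.psum_bd (hP : Good μ X a₀ A) (φ : LinForm d) :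
    ∃ C, 0 ≤ C ∧ ∀ (s : ℤ) (n : ℕ), Bd μ (12 + 4 * a₀) (C * √n) (psum μ X φ s n) := by
  obtain ⟨K, hK, h⟩ := hP.moment_bound φ (q := 6 + 2 * a₀) (by omega) (by omega)
  refine ⟨1 + K, by positivity, fun s n => ?_⟩
  refine Bd.of_integral ((psum_Pw φ s n).memLp hP (by omega) (by omega)) (by omega)
    (by positivity) ?_
  have e : 12 + 4 * a₀ = 2 * (6 + 2 * a₀) := by ring
  rw [e]
  calc ∫ ω, |psum μ X φ s n ω| ^ (2 * (6 + 2 * a₀)) ∂μ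
      = ∫ ω, psum μ X φ s n ω ^ (2 * (6 + 2 * a₀)) ∂μ := by
        congr 1; ext ω; exact (even_two_mul _).pow_abs _
    _ ≤ K * (n : ℝ) ^ (6 + 2 * a₀) := h s n
    _ ≤ (1 + K) ^ (2 * (6 + 2 * a₀)) * (n : ℝ) ^ (6 + 2 * a₀) := by
        gcongr
        exact le_one_add_pow hK (by omega)
    _ = ((1 + K) * √n) ^ (2 * (6 + 2 * a₀)) := by
        rw [mul_pow, pow_mul (√(n : ℝ)), Real.sq_sqrt (by positivity)]

lemma Good.integral_psum_mul (hP : Good μ X a₀ A) (φ ψ : LinForm d) (s s' : ℤ) (n n' : ℕ) :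
    ∫ ω, psum μ X φ s n ω * psum μ X ψ s' n' ω ∂μ = ∑ t ∈ range n, ∑ u ∈ range n',
        ∫ ω, xi μ X φ (s + t) ω * xi μ X ψ (s' + u) ω ∂μ := by
  have hfi : ∀ a b : ℤ, Integrable (fun ω => xi μ X φ a ω * xi μ X ψ b ω) μ := fun a b =>
    ((Pw.xi (a := min a b) (b := max a b + 1) φ (by omega) (by omega)).mul
      (Pw.xi ψ (by omega) (by omega))).integrable hP (by omega)
  simp only [psum, sum_mul_sum]
  rw [integral_finsetSum _ (fun i _ => integrable_finsetSum _ (fun j _ => hfi _ _))]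
  refine sum_congr rfl fun i _ => ?_
  rw [integral_finsetSum _ (fun j _ => hfi _ _)]

lemma blk_Pw (φ ψ : LinForm d) (s : ℤ) (ℓ : ℕ) :
    Pw μ X s (s + ℓ) 2 (ℓ * (‖φ‖ * ‖ψ‖)) (blk μ X φ ψ s ℓ) := by
  refine (((psum_Pw φ s ℓ).mul (psum_Pw ψ s ℓ)).div_const (ℓ : ℝ)).mono (by norm_num) ?_
  rcases Nat.eq_zero_or_pos ℓ with rfl | h
  · simp
  · rw [Nat.abs_cast]
    exact le_of_eq (by field_simp)

lemma Good.integral_blk (hP : Good μ X a₀ A) (φ ψ : LinForm d) (s : ℤ) (ℓ : ℕ) :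
    ∫ ω, blk μ X φ ψ s ℓ ω ∂μ = egam μ X φ ψ ℓ := by
  simp only [egam, blk, integral_div]
  rw [hP.integral_psum_mul, hP.integral_psum_mul]
  congr 1
  refine sum_congr rfl fun t _ => sum_congr rfl fun u _ => ?_
  rw [← hP.integral_xi_mul_shift φ ψ (0 + t) (0 + u) s]
  congr 1; ext ω; congr 2 <;> ring

lemma Good.blk_bd (hP : Good μ X a₀ A) (φ ψ : LinForm d) :
    ∃ C, 0 ≤ C ∧ ∀ (s : ℤ) (ℓ : ℕ), Bd μ 6 C (blk μ X φ ψ s ℓ) := by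
  obtain ⟨C, h0, h⟩ := hP.psum_bd φ
  obtain ⟨D, h0', h'⟩ := hP.psum_bd ψ
  refine ⟨C * D, by positivity, fun s ℓ => ?_⟩
  refine ((Bd.mul_self_exp (p := 6) ((h s ℓ).mono_exp (by omega))
    ((h' s ℓ).mono_exp (by omega))).div_const (ℓ : ℝ)).mono_const ?_
  have h2 : √(ℓ : ℝ) * √(ℓ : ℝ) = ℓ := Real.mul_self_sqrt (by positivity)
  rw [abs_of_nonneg (by positivity)]
  exact div_le_of_le_mul₀ (by positivity) (by positivity)
    (le_of_eq (by linear_combination C * D * h2))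

lemma Good.gam_bd (hP : Good μ X a₀ A) (φ ψ : LinForm d) :
    ∃ C, 0 ≤ C ∧ ∀ (s : ℤ) (n ℓ : ℕ), Bd μ 6 C (gam μ X φ ψ s n ℓ) := by
  obtain ⟨C, h0, h⟩ := hP.blk_bd φ ψ
  exact ⟨C, h0, fun s n ℓ => Bd.avg (fun i _ => h (s + i) ℓ) h0 (by norm_num)⟩

lemma Good.abs_egam_le (hP : Good μ X a₀ A) (φ ψ : LinForm d) :
    ∃ C, 0 ≤ C ∧ ∀ (ℓ : ℕ), |egam μ X φ ψ ℓ| ≤ C := by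
  obtain ⟨C, h0, h⟩ := hP.blk_bd φ ψ
  exact ⟨C, h0, fun ℓ => (h 0 ℓ).abs_integral_le (by norm_num)⟩

lemma mav_swap (φ : LinForm d) (s : ℤ) (n ℓ : ℕ) (ω : Ω) : mav μ X φ s n ℓ ω = (∑ t ∈ range ℓ,
      psum μ X φ (s + t) (n - ℓ + 1) ω / ((n - ℓ + 1 : ℕ) : ℝ)) / ℓ := by
  simp only [mav, psum, ← sum_div]
  rw [sum_comm, div_div, div_div, mul_comm (ℓ : ℝ)]
  congr 1
  refine sum_congr rfl fun i _ => sum_congr rfl fun j _ => ?_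
  congr 1; ring

lemma Good.mav_bd (hP : Good μ X a₀ A) (φ : LinForm d) :
    ∃ C, 0 ≤ C ∧ ∀ K ε (s : ℤ) n ℓ, Reg K ε n ℓ →
      Bd μ (12 + 4 * a₀) (C * ε ^ 3) (mav μ X φ s n ℓ) := by
  obtain ⟨C, h0, h⟩ := hP.psum_bd φ
  refine ⟨2 * C, by positivity, fun K ε s n ℓ hr => ?_⟩
  have e := hr.pos
  rw [show mav μ X φ s n ℓ = _ from funext (mav_swap φ s n ℓ)]
  refine Bd.avg (fun i _ => ((h (s + i) (n - ℓ + 1)).div_const _).mono_const ?_)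
    (by positivity) (by omega)
  have hN := Reg.num_pos n ℓ
  rw [abs_of_pos hN, mul_div_assoc, mul_comm 2 C, mul_assoc]
  refine mul_le_mul_of_nonneg_left ?_ h0
  rw [Real.sqrt_div_self', ← Real.sqrt_one, ← Real.sqrt_div (by norm_num)]
  rw [Real.sqrt_le_left (by positivity)]
  refine hr.inv_num_le.trans ?_
  nlinarith [pow_pos e 6, show (ε ^ 3) ^ 2 = ε ^ 6 by ring]

/-- Centered normalized product of block sums. -/
def cblk (μ : Measure Ω) (X : ℤ → Ω → Fin d → ℝ) (φ ψ : LinForm d) (s : ℤ) (ℓ : ℕ) (ω : Ω) : ℝ :=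
  blk μ X φ ψ s ℓ ω - egam μ X φ ψ ℓ

/-- Centered version of `gam`. -/
def cgam (μ : Measure Ω) (X : ℤ → Ω → Fin d → ℝ) (φ ψ : LinForm d) (s : ℤ) (n ℓ : ℕ) (ω : Ω) : ℝ :=
  gam μ X φ ψ s n ℓ ω - egam μ X φ ψ ℓ

lemma cgam_eq (φ ψ : LinForm d) (s : ℤ) (n ℓ : ℕ) (ω : Ω) : cgam μ X φ ψ s n ℓ ω =
      (∑ i ∈ range (n - ℓ + 1), cblk μ X φ ψ (s + i) ℓ ω) / ((n - ℓ + 1 : ℕ) : ℝ) := by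
  have := (Reg.num_pos n ℓ).ne'
  simp only [cgam, gam, cblk, sum_sub_distrib, sum_const, card_range, nsmul_eq_mul]
  field_simp

lemma Good.cblk_Pw (hP : Good μ X a₀ A) (φ ψ : LinForm d) :
    ∃ C, 0 ≤ C ∧ ∀ (s : ℤ) (ℓ : ℕ), 1 ≤ ℓ → Pw μ X s (s + ℓ) 2 (C * ℓ) (cblk μ X φ ψ s ℓ) := by
  obtain ⟨C, h0, h⟩ := hP.abs_egam_le φ ψ
  refine ⟨‖φ‖ * ‖ψ‖ + C, by positivity, fun s ℓ hl => ?_⟩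
  have hl' : (1 : ℝ) ≤ ℓ := by exact_mod_cast hl
  refine ((blk_Pw φ ψ s ℓ).sub ((Pw.const (egam μ X φ ψ ℓ)).mono (Nat.zero_le 2) le_rfl)).mono
    le_rfl ?_
  nlinarith [h ℓ]

lemma Good.cblk_bd (hP : Good μ X a₀ A) (φ ψ : LinForm d) :
    ∃ C, 0 ≤ C ∧ ∀ (s : ℤ) (ℓ : ℕ), Bd μ 4 C (cblk μ X φ ψ s ℓ) := by
  obtain ⟨C, h0, h⟩ := hP.blk_bd φ ψ
  refine ⟨2 * C, by positivity, fun s ℓ => ?_⟩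
  have := ((h s ℓ).mono_exp (q := 4) (by norm_num)).sub_integral (by norm_num)
  rw [hP.integral_blk] at this
  exact this

lemma Good.integral_cblk (hP : Good μ X a₀ A)
    (φ ψ : LinForm d) (s : ℤ) (ℓ : ℕ) : ∫ ω, cblk μ X φ ψ s ℓ ω ∂μ = 0 := by
  simp only [cblk]
  rw [integral_sub ((blk_Pw φ ψ s ℓ).integrable hP (by omega)) (integrable_const _),
    hP.integral_blk]
  simp

lemma Good.avg_bd (hP : Good μ X a₀ A) (K : ℝ) {C : ℝ} (hC : 0 ≤ C) :
    ∃ D, 0 ≤ D ∧ ∀ (ε : ℝ) (s : ℤ) (n ℓ N : ℕ) (b : ℝ) (f : ℕ → Ω → ℝ), Reg K ε n ℓ →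
      n ≤ 2 * N → N ≤ n → 0 ≤ b → (∀ i < N, Pw μ X (s + i) (s + i + ℓ) 2 (C * ℓ) (f i)) →
      (∀ i < N, (∫ ω, f i ω ∂μ) = 0) → (∀ i < N, Bd μ 4 b (f i)) →
      Bd μ 4 (D * (b + ε) * ε ^ 2) (fun ω => (∑ i ∈ range N, f i ω) / N) := by
  have hcov := hP.covC_nonneg
  by_cases hK : 1 ≤ K
  swap
  · exact ⟨0, le_rfl, fun ε s n ℓ N b f hr => absurd hr.one_le hK⟩
  set D := 3 * (10 * K) ^ 2 + 2 * covC a₀ A * (C * K) ^ 4 * K ^ 14 with hD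
  have hD0 : 0 ≤ D := by positivity
  refine ⟨1 + D, by positivity, fun ε s n ℓ N b f hr hnN hNn hb0 hf h0 hb => ?_⟩
  have e := hr.pos
  have hN : 0 < N := by have := hr.half; have := hr.one_le_len; omega
  have hN' : (0 : ℝ) < N := by exact_mod_cast hN
  have key := hP.integral_avg_four_le (L := 2 * n) hN (by have := hr.half; omega) hf (by omega) h0 hb
  have hPw := Pw.div_const (Pw.sum (a := s) (b := s + (N + ℓ : ℕ)) (C := C * ℓ) (range N)
    fun i hi => (hf i (mem_range.1 hi)).mono_window (by omega)
      (by have := mem_range.1 hi; omega)) (N : ℝ)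
  refine Bd.of_integral (hPw.memLp hP (by norm_num) (by omega)) (by norm_num) (by positivity) ?_
  simp only [(by decide : Even 4).pow_abs]
  refine key.trans ?_
  have t1 := hr.tail_le (c := (C * K) ^ 4) (D := (C * ℓ) ^ 4) (j := 4) (by positivity) (by
      rw [show (C * K) ^ 4 / ε ^ (2 * 4) = (C * (K / ε ^ 2)) ^ 4 by field_simp]
      gcongr
      exact hr.len_le) le_rfl (by positivity) hcov
  have t2 : (4 * (ℓ : ℝ) + 1) / N ≤ 10 * K * ε ^ 4 := by
    have h1 : (n : ℝ) ≤ 2 * N := by exact_mod_cast hnN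
    have h2 : (1 : ℝ) ≤ ℓ := by exact_mod_cast hr.one_le_len
    rw [div_le_iff₀ hN']
    calc 4 * (ℓ : ℝ) + 1 ≤ 5 * (K / ε ^ 2) := by linarith [hr.len_le]
      _ = 5 * K * ε ^ 4 * (n * ε ^ 6) / ε ^ 6 := by rw [hr.size]; field_simp
      _ = 5 * K * ε ^ 4 * n := by field_simp
      _ ≤ 5 * K * ε ^ 4 * (2 * N) := by gcongr
      _ = _ := by ring
  have t3 : ε ^ 14 ≤ ε ^ 12 := hr.pow_le (by norm_num)
  calc _ ≤ 3 * (10 * K * ε ^ 4) ^ 2 * b ^ 4 + 2 * covC a₀ A * (C * K) ^ 4 * K ^ 14 * ε ^ 12 := by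
        refine add_le_add ?_ (t1.trans ?_) <;> gcongr
    _ = 3 * (10 * K) ^ 2 * (b ^ 4 * ε ^ 8) + 2 * covC a₀ A * (C * K) ^ 4 * K ^ 14 * (ε ^ 4 * ε ^ 8) := by
        ring
    _ ≤ 3 * (10 * K) ^ 2 * ((b + ε) ^ 4 * ε ^ 8) +
        2 * covC a₀ A * (C * K) ^ 4 * K ^ 14 * ((b + ε) ^ 4 * ε ^ 8) := by
        gcongr <;> linarith
    _ = D * ((b + ε) * ε ^ 2) ^ 4 := by rw [hD]; ring
    _ ≤ (1 + D) ^ 4 * ((b + ε) * ε ^ 2) ^ 4 := by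
        gcongr
        exact le_one_add_pow hD0 (by norm_num)
    _ = ((1 + D) * (b + ε) * ε ^ 2) ^ 4 := by ring

lemma Good.cgam_bd (hP : Good μ X a₀ A) (φ ψ : LinForm d) (K : ℝ) :
    ∃ C, 0 ≤ C ∧ ∀ ε (s : ℤ) n ℓ, Reg K ε n ℓ → Bd μ 4 (C * ε ^ 2) (cgam μ X φ ψ s n ℓ) := by
  obtain ⟨C, hC0, hC⟩ := hP.cblk_Pw φ ψ
  obtain ⟨b, hb0, hb⟩ := hP.cblk_bd φ ψ
  obtain ⟨D, hD, h⟩ := hP.avg_bd K hC0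
  refine ⟨D * (b + 1), by positivity, fun ε s n ℓ hr => ?_⟩
  have e := hr.pos
  rw [show cgam μ X φ ψ s n ℓ = _ from funext (cgam_eq φ ψ s n ℓ)]
  refine (h ε s n ℓ (n - ℓ + 1) b _ hr (by have := hr.half; omega)
    (by have := hr.half; have := hr.one_le_len; omega) hb0
    (fun i _ => hC (s + i) ℓ hr.one_le_len) (fun i _ => hP.integral_cblk φ ψ (s + i) ℓ)
    fun i _ => hb (s + i) ℓ).mono_const ?_
  have := hr.le_one
  gcongr

/-- Average of a family over all overlapping blocks. -/
def bavg (f : ℤ → Ω → ℝ) (s : ℤ) (n ℓ : ℕ) (ω : Ω) : ℝ :=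
  (∑ i ∈ range (n - ℓ + 1), f (s + i) ω) / ((n - ℓ + 1 : ℕ) : ℝ)

lemma cgam_eq_bavg (φ ψ : LinForm d) (s : ℤ) (n ℓ : ℕ) :
    cgam μ X φ ψ s n ℓ = bavg (fun i => cblk μ X φ ψ i ℓ) s n ℓ := by
  ext ω; exact cgam_eq φ ψ s n ℓ ω

/-- Block mean. -/
def pmean (μ : Measure Ω) (X : ℤ → Ω → Fin d → ℝ) (φ : LinForm d) (s : ℤ) (ℓ : ℕ) (ω : Ω) : ℝ :=
  psum μ X φ s ℓ ω / ℓ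

lemma mav_eq_bavg (φ : LinForm d) (s : ℤ) (n ℓ : ℕ) :
    mav μ X φ s n ℓ = bavg (fun i => pmean μ X φ i ℓ) s n ℓ := rfl

/-- A centered polynomial block statistic with constants of the stated orders. -/
structure Blk (μ : Measure Ω) (X : ℤ → Ω → Fin d → ℝ) (ℓ a : ℕ) (C b : ℝ) (f : ℤ → Ω → ℝ) :
    Prop where
  pw : ∀ s, Pw μ X s (s + ℓ) a C (f s)
  int : ∀ s, ∫ ω, f s ω ∂μ = 0
  bd : ∀ s, Bd μ 4 b (f s)

lemma Good.cblk_Blk (hP : Good μ X a₀ A) (φ ψ : LinForm d) :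
    ∃ C, 0 ≤ C ∧ ∀ ℓ : ℕ, 1 ≤ ℓ → Blk μ X ℓ 2 (C * ℓ) C (fun s => cblk μ X φ ψ s ℓ) := by
  obtain ⟨C, hC0, hC⟩ := hP.cblk_Pw φ ψ
  obtain ⟨b, hb0, hb⟩ := hP.cblk_bd φ ψ
  refine ⟨C + b, by positivity, fun ℓ hl => ⟨fun s => ?_, fun s => hP.integral_cblk φ ψ s ℓ,
    fun s => ?_⟩⟩
  · exact (hC s ℓ hl).mono le_rfl (by gcongr; linarith)
  · exact (hb s ℓ).mono_const (by linarith)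

lemma Reg.inv_sqrt_len_le {K ε : ℝ} {n ℓ : ℕ} (h : Reg K ε n ℓ) : √(ℓ : ℝ) / ℓ ≤ K * ε := by
  have hl := h.len_pos
  have e := h.pos
  have hK := h.one_le
  rw [Real.sqrt_div_self', ← Real.sqrt_one, ← Real.sqrt_div (by norm_num),
    Real.sqrt_le_left (by positivity)]
  refine h.lower.trans ?_
  rw [mul_pow]
  gcongr
  nlinarith

lemma Good.pmean_Blk (hP : Good μ X a₀ A) (φ : LinForm d) :
    ∃ C, 0 ≤ C ∧ ∀ (K ε : ℝ) (n ℓ : ℕ), Reg K ε n ℓ →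
      Blk μ X ℓ 1 C (C * (K * ε)) (fun s => pmean μ X φ s ℓ) := by
  obtain ⟨C, hC0, hC⟩ := hP.psum_bd φ
  refine ⟨C + ‖φ‖, by positivity, fun K ε n ℓ hr => ⟨fun s => ?_, fun s => ?_, fun s => ?_⟩⟩
  · refine ((psum_Pw φ s ℓ).div_const (ℓ : ℝ)).mono le_rfl ?_
    have := hr.len_pos
    rw [abs_of_pos this, mul_div_assoc, mul_div_cancel₀ _ this.ne']
    linarith
  · simp only [pmean, integral_div, hP.integral_psum, zero_div]
  · refine (((hC s ℓ).mono_exp (q := 4) (by omega)).div_const (ℓ : ℝ)).mono_const ?_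
    have h1 := hr.inv_sqrt_len_le
    have := hr.len_pos
    have hK := hr.K_nonneg
    have e := hr.pos
    rw [abs_of_pos this, mul_div_assoc]
    gcongr
    linarith [norm_nonneg φ]

lemma Good.abs_integral_bavg_three_le (hP : Good μ X a₀ A)
    {K ε : ℝ} {n ℓ a b c : ℕ} (hr : Reg K ε n ℓ) {f g h : ℤ → Ω → ℝ}
    {Ca Cb Cc ba bb bc D : ℝ} (hf : Blk μ X ℓ a Ca ba f) (hg : Blk μ X ℓ b Cb bb g)
    (hh : Blk μ X ℓ c Cc bc h) (habc : a + b + c ≤ 13 + 4 * a₀) (hD : 0 ≤ D)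
    (hC : Ca * Cb * Cc ≤ D / ε ^ 8) (s : ℤ) :
    |∫ ω, bavg f s n ℓ ω * bavg g s n ℓ ω * bavg h s n ℓ ω ∂μ| ≤
      (18 * K * ε ^ 4) ^ 2 * (ba * bb * bc) + 2 * covC a₀ A * D * K ^ 14 * ε ^ 14 := by
  have hle : (n - ℓ + 1) + ℓ ≤ 2 * n := by
    have := hr.half; have := hr.one_le_len; omega
  have key := hP.abs_integral_avg_three_le (s := s) (N := n - ℓ + 1) (w := ℓ) (L := 2 * n)
    (f := fun i => f (s + i)) (g := fun i => g (s + i)) (h := fun i => h (s + i))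
    (by omega) hle (fun i _ => hf.pw (s + i)) (fun i _ => hg.pw (s + i))
    (fun i _ => hh.pw (s + i)) habc (fun i _ => hf.int _) (fun i _ => hg.int _)
    (fun i _ => hh.int _) (fun i _ => hf.bd _) (fun i _ => hg.bd _) (fun i _ => hh.bd _)
  have h0 : 0 ≤ ba * bb * bc :=
    mul_nonneg (mul_nonneg (hf.bd 0).nonneg (hg.bd 0).nonneg) (hh.bd 0).nonneg
  refine key.trans (add_le_add ?_ ?_)
  · gcongr
    exact hr.ratio_le
  · exact hr.tail_le (j := 4) hD hC le_rfl
      (mul_nonneg (mul_nonneg (hf.pw 0).nonneg (hg.pw 0).nonneg) (hh.pw 0).nonneg) hP.covC_nonneg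

lemma Good.abs_integral_cgam_mav_mav_le (hP : Good μ X a₀ A) (φ ψ χ η : LinForm d) (K : ℝ) :
    ∃ C, 0 ≤ C ∧ ∀ ε (s : ℤ) n ℓ, Reg K ε n ℓ →
      |∫ ω, cgam μ X φ ψ s n ℓ ω * mav μ X χ s n ℓ ω * mav μ X η s n ℓ ω ∂μ| ≤ C * ε ^ 10 := by
  obtain ⟨C, hC0, hC⟩ := hP.cblk_Blk φ ψ
  obtain ⟨D, hD0, hD⟩ := hP.pmean_Blk χ
  obtain ⟨E, hE0, hE⟩ := hP.pmean_Blk η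
  have hcov := hP.covC_nonneg
  by_cases hK : 1 ≤ K
  swap
  · exact ⟨0, le_rfl, fun ε s n ℓ hr => absurd hr.one_le hK⟩
  refine ⟨(18 * K) ^ 2 * (C * (D * K) * (E * K)) + 2 * covC a₀ A * (C * K * D * E) * K ^ 14,
    by positivity, fun ε s n ℓ hr => ?_⟩
  have e := hr.pos
  rw [cgam_eq_bavg, mav_eq_bavg, mav_eq_bavg]
  refine (hP.abs_integral_bavg_three_le hr (hC ℓ hr.one_le_len) (hD K ε n ℓ hr) (hE K ε n ℓ hr)
    (by omega) (D := C * K * D * E) (by positivity) ?_ s).trans ?_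
  · calc C * ℓ * D * E ≤ C * (K / ε ^ 2) * D * E := by gcongr; exact hr.len_le
      _ = C * K * D * E / ε ^ 2 := by ring
      _ ≤ _ := div_le_div_of_nonneg_left (by positivity) (by positivity) (hr.pow_le (by norm_num))
  · have : ε ^ 14 ≤ ε ^ 10 := hr.pow_le (by norm_num)
    calc _ ≤ (18 * K * ε ^ 4) ^ 2 * (C * (D * (K * ε)) * (E * (K * ε))) +
          2 * covC a₀ A * (C * K * D * E) * K ^ 14 * ε ^ 10 := by gcongr
      _ = _ := by ring

lemma Good.abs_integral_cgam_cgam_mav_le (hP : Good μ X a₀ A) (φ ψ φ' ψ' χ : LinForm d) (K : ℝ) :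
    ∃ C, 0 ≤ C ∧ ∀ ε (s : ℤ) n ℓ, Reg K ε n ℓ →
      |∫ ω, cgam μ X φ ψ s n ℓ ω * cgam μ X φ' ψ' s n ℓ ω * mav μ X χ s n ℓ ω ∂μ|
        ≤ C * ε ^ 8 := by
  obtain ⟨C, hC0, hC⟩ := hP.cblk_Blk φ ψ
  obtain ⟨D, hD0, hD⟩ := hP.cblk_Blk φ' ψ'
  obtain ⟨E, hE0, hE⟩ := hP.pmean_Blk χ
  have hcov := hP.covC_nonneg
  by_cases hK : 1 ≤ K
  swap
  · exact ⟨0, le_rfl, fun ε s n ℓ hr => absurd hr.one_le hK⟩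
  refine ⟨(18 * K) ^ 2 * (C * D * (E * K)) + 2 * covC a₀ A * (C * K * (D * K) * E) * K ^ 14,
    by positivity, fun ε s n ℓ hr => ?_⟩
  have e := hr.pos
  rw [cgam_eq_bavg, cgam_eq_bavg, mav_eq_bavg]
  refine (hP.abs_integral_bavg_three_le hr (hC ℓ hr.one_le_len) (hD ℓ hr.one_le_len)
    (hE K ε n ℓ hr) (by omega) (D := C * K * (D * K) * E) (by positivity) ?_ s).trans ?_
  · calc C * ℓ * (D * ℓ) * E ≤ C * (K / ε ^ 2) * (D * (K / ε ^ 2)) * E := by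
          have := hr.len_le
          gcongr
      _ = C * K * (D * K) * E / ε ^ 4 := by field_simp
      _ ≤ _ := div_le_div_of_nonneg_left (by positivity) (by positivity) (hr.pow_le (by norm_num))
  · have h1 : ε ^ 14 ≤ ε ^ 8 := hr.pow_le (by norm_num)
    have h2 : ε ^ 9 ≤ ε ^ 8 := hr.pow_le (by norm_num)
    calc _ ≤ (18 * K) ^ 2 * (C * D * (E * K)) * ε ^ 9 +
          2 * covC a₀ A * (C * K * (D * K) * E) * K ^ 14 * ε ^ 14 := le_of_eq (by ring)
      _ ≤ (18 * K) ^ 2 * (C * D * (E * K)) * ε ^ 8 +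
          2 * covC a₀ A * (C * K * (D * K) * E) * K ^ 14 * ε ^ 8 := by gcongr
      _ = _ := by ring

lemma Good.abs_integral_mav_three_le (hP : Good μ X a₀ A) (φ ψ χ : LinForm d) (K : ℝ) :
    ∃ C, 0 ≤ C ∧ ∀ ε (s : ℤ) n ℓ, Reg K ε n ℓ →
      |∫ ω, mav μ X φ s n ℓ ω * mav μ X ψ s n ℓ ω * mav μ X χ s n ℓ ω ∂μ| ≤ C * ε ^ 10 := by
  obtain ⟨C, hC0, hC⟩ := hP.pmean_Blk φ
  obtain ⟨D, hD0, hD⟩ := hP.pmean_Blk ψ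
  obtain ⟨E, hE0, hE⟩ := hP.pmean_Blk χ
  have hcov := hP.covC_nonneg
  by_cases hK : 1 ≤ K
  swap
  · exact ⟨0, le_rfl, fun ε s n ℓ hr => absurd hr.one_le hK⟩
  refine ⟨(18 * K) ^ 2 * (C * K * (D * K) * (E * K)) + 2 * covC a₀ A * (C * D * E) * K ^ 14,
    by positivity, fun ε s n ℓ hr => ?_⟩
  have e := hr.pos
  rw [mav_eq_bavg, mav_eq_bavg, mav_eq_bavg]
  refine (hP.abs_integral_bavg_three_le hr (hC K ε n ℓ hr) (hD K ε n ℓ hr) (hE K ε n ℓ hr)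
    (by omega) (D := C * D * E) (by positivity) ?_ s).trans ?_
  · rw [le_div_iff₀ (by positivity)]
    exact mul_le_of_le_one_right (by positivity) (pow_le_one₀ e.le hr.le_one)
  · have h1 : ε ^ 14 ≤ ε ^ 10 := hr.pow_le (by norm_num)
    have h2 : ε ^ 11 ≤ ε ^ 10 := hr.pow_le (by norm_num)
    calc _ ≤ (18 * K) ^ 2 * (C * K * (D * K) * (E * K)) * ε ^ 11 +
          2 * covC a₀ A * (C * D * E) * K ^ 14 * ε ^ 14 := le_of_eq (by ring)
      _ ≤ (18 * K) ^ 2 * (C * K * (D * K) * (E * K)) * ε ^ 10 +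
          2 * covC a₀ A * (C * D * E) * K ^ 14 * ε ^ 10 := by gcongr
      _ = _ := by ring

lemma dk_le_of_abs_le {a b : ℤ} (h : |b| ≤ |a|) : dk a ≤ dk b := by
  unfold dk
  have : (|b| : ℝ) ≤ |(a : ℝ)| := by exact_mod_cast h
  have h0 := abs_nonneg (b : ℝ)
  gcongr

lemma abs_mul_dk_le (h : ℤ) : |(h : ℝ)| * dk h ≤ 1 := by
  unfold dk
  have h0 := abs_nonneg (h : ℝ)
  rw [mul_one_div, div_le_one (by linarith)]
  linarith

lemma summable_of_le_dk_sq {g : ℤ → ℝ} {c : ℝ} (h : ∀ k, |g k| ≤ c * dk k ^ 2) : Summable g := by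
  have h1 : Summable fun k : ℤ => dk k ^ 2 :=
    summable_of_sum_le (fun k => sq_nonneg _) (c := 4) fun T => by
      have := sum_dk_sq_le T 0
      simpa [dk_neg] using this
  exact Summable.of_norm_bounded (h1.mul_left c) h

lemma abs_tsum_le_of_le_dk_sq {g : ℤ → ℝ} {c : ℝ} (hc : 0 ≤ c) (h : ∀ k, |g k| ≤ c * dk k ^ 2) :
    |∑' k, g k| ≤ 4 * c := by
  have h1 := (summable_of_le_dk_sq h).hasSum
  have h2 : Summable fun k => |g k| := summable_of_le_dk_sq (c := c) (fun k => by
    rw [abs_abs]; exact h k)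
  calc |∑' k, g k| ≤ ∑' k, |g k| := by
        have := norm_tsum_le_tsum_norm (f := g) h2
        exact this
    _ ≤ 4 * c := by
        refine h2.tsum_le_of_sum_le fun T => ?_
        calc ∑ k ∈ T, |g k| ≤ ∑ k ∈ T, c * dk k ^ 2 := sum_le_sum fun k _ => h k
          _ = c * ∑ k ∈ T, dk (0 - k) ^ 2 := by
            rw [mul_sum]; simp [dk_neg]
          _ ≤ c * 4 := by gcongr; exact sum_dk_sq_le T 0
          _ = 4 * c := mul_comm _ _

/-- Triangular window of half-width `ℓ`. -/
def tri (ℓ : ℕ) (x : ℤ) : ℝ := ((max 0 ((ℓ : ℤ) - |x|) : ℤ) : ℝ)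

lemma tri_nonneg (ℓ : ℕ) (x : ℤ) : 0 ≤ tri ℓ x := by
  unfold tri; exact_mod_cast le_max_left _ _

lemma tri_le (ℓ : ℕ) (x : ℤ) : tri ℓ x ≤ ℓ := by
  unfold tri
  have : max 0 ((ℓ : ℤ) - |x|) ≤ ℓ := by
    have := abs_nonneg x; omega
  exact_mod_cast this

lemma tri_eq_zero {ℓ : ℕ} {x : ℤ} (h : (ℓ : ℤ) ≤ |x|) : tri ℓ x = 0 := by
  unfold tri
  rw [max_eq_left (by omega)]; simp

lemma tri_neg (ℓ : ℕ) (x : ℤ) : tri ℓ (-x) = tri ℓ x := by simp [tri]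

lemma sum_Icc_neg_eq (r : ℤ → ℝ) (ℓ : ℕ) : ∑ j ∈ Icc (-(ℓ : ℤ)) ℓ, r j =
      r 0 + ∑ t ∈ range ℓ, (r ((t : ℤ) + 1) + r (-((t : ℤ) + 1))) := by
  induction ℓ with
  | zero => simp
  | succ ℓ ih =>
    rw [sum_range_succ, ← add_assoc, ← ih]
    have h1 : Icc (-((ℓ + 1 : ℕ) : ℤ)) ((ℓ + 1 : ℕ) : ℤ) =
        insert ((ℓ : ℤ) + 1) (insert (-((ℓ : ℤ) + 1)) (Icc (-(ℓ : ℤ)) ℓ)) := by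
      ext x; simp only [mem_insert, mem_Icc]; push_cast; omega
    rw [h1, sum_insert, sum_insert]
    · ring
    · simp
    · simp only [mem_insert, mem_Icc]; omega

lemma sum_sum_sub_eq (r : ℤ → ℝ) (ℓ : ℕ) : ∑ a ∈ range ℓ, ∑ b ∈ range ℓ, r ((b : ℤ) - a) =
      ∑ j ∈ Icc (-(ℓ : ℤ)) ℓ, tri ℓ j * r j := by
  induction ℓ with
  | zero => simp [tri]
  | succ ℓ ih =>
    have h1 : ∑ a ∈ range (ℓ + 1), ∑ b ∈ range (ℓ + 1), r ((b : ℤ) - a) =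
        ∑ a ∈ range ℓ, ∑ b ∈ range ℓ, r ((b : ℤ) - a) +
        (r 0 + ∑ t ∈ range ℓ, (r ((t : ℤ) + 1) + r (-((t : ℤ) + 1)))) := by
      rw [sum_range_succ, sum_range_succ _ ℓ]
      simp only [sum_range_succ _ ℓ, sum_add_distrib, sub_self]
      have e1 : ∑ a ∈ range ℓ, r ((ℓ : ℤ) - a) = ∑ t ∈ range ℓ, r ((t : ℤ) + 1) := by
        rw [← sum_range_reflect]
        refine sum_congr rfl fun t ht => ?_
        have := mem_range.1 ht
        congr 1; omega
      have e2 : ∑ a ∈ range ℓ, r ((a : ℤ) - ℓ) = ∑ t ∈ range ℓ, r (-((t : ℤ) + 1)) := by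
        rw [← sum_range_reflect]
        refine sum_congr rfl fun t ht => ?_
        have := mem_range.1 ht
        congr 1; omega
      rw [e1, e2]; ring
    rw [h1, ih, ← sum_Icc_neg_eq, ← sum_add_distrib]
    refine sum_subset_zero_on_sdiff ?_ ?_ ?_
    · intro x; simp only [mem_Icc]; push_cast; omega
    · intro x hx
      simp only [Finset.mem_sdiff, mem_Icc] at hx
      rw [tri_eq_zero, zero_mul]
      push_cast at hx ⊢
      rcases abs_cases x with h | h <;> omega
    · intro x hx
      simp only [mem_Icc] at hx
      have : tri (ℓ + 1) x = tri ℓ x + 1 := by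
        unfold tri
        have : max 0 (((ℓ + 1 : ℕ) : ℤ) - |x|) = max 0 ((ℓ : ℤ) - |x|) + 1 := by
          push_cast
          rcases abs_cases x with h | h <;> omega
        rw [this]; push_cast; ring
      rw [this]; ring

lemma hasSum_tri (r : ℤ → ℝ) (ℓ : ℕ) : HasSum (fun j => tri ℓ j * r j)
      (∑ a ∈ range ℓ, ∑ b ∈ range ℓ, r ((b : ℤ) - a)) := by
  rw [sum_sum_sub_eq]
  refine hasSum_sum_of_ne_finset_zero fun x hx => ?_
  simp only [mem_Icc] at hx
  rw [tri_eq_zero, zero_mul]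
  rcases abs_cases x with h | h <;> omega

/-- Sum of the values of `r` at all differences of points of two windows of length `ℓ` at
distance `k`. -/
def Rsum (r : ℤ → ℝ) (ℓ : ℕ) (k : ℤ) : ℝ :=
  ∑ a ∈ range ℓ, ∑ b ∈ range ℓ, r (k + ((b : ℤ) - a))

lemma hasSum_Rsum (r : ℤ → ℝ) (ℓ : ℕ) (k : ℤ) :
    HasSum (fun h => tri ℓ (h - k) * r h) (Rsum r ℓ k) := by
  have := hasSum_tri (fun j => r (k + j)) ℓ
  unfold Rsum
  rw [← (Equiv.addLeft k).hasSum_iff]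
  convert this using 2 with j
  simp

lemma abs_mul_decay_le {r : ℤ → ℝ} {C : ℝ} (hr : ∀ h, |r h| ≤ C * dk h ^ 14) (h : ℤ) {x : ℝ}
    (hx : |x| ≤ 2 * |(h : ℝ)|) : |x * r h| ≤ 2 * C * dk h ^ 13 := by
  have h0 := dk_nonneg h
  have hC : 0 ≤ C := by
    have := (abs_nonneg _).trans (hr h)
    have := dk_pos h
    by_contra hc
    have : C * dk h ^ 14 < 0 := mul_neg_of_neg_of_pos (by linarith) (by positivity)
    linarith
  rw [abs_mul]
  calc |x| * |r h| ≤ (2 * |(h : ℝ)|) * (C * dk h ^ 14) := by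
        apply mul_le_mul hx (hr h) (abs_nonneg _) (by positivity)
    _ = 2 * C * dk h ^ 13 * (|(h : ℝ)| * dk h) := by ring
    _ ≤ 2 * C * dk h ^ 13 * 1 := by gcongr; exact abs_mul_dk_le h
    _ = _ := by ring

lemma decay_const_nonneg {r : ℤ → ℝ} {C : ℝ} (hr : ∀ h, |r h| ≤ C * dk h ^ 14) : 0 ≤ C := by
  have := (abs_nonneg _).trans (hr 0)
  simpa [dk] using this

lemma summable_decay {r : ℤ → ℝ} {C : ℝ} (hr : ∀ h, |r h| ≤ C * dk h ^ 14) : Summable r :=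
  summable_of_le_dk_sq (c := C) fun k => (hr k).trans
    (mul_le_mul_of_nonneg_left (dk_pow_le_pow k (by norm_num)) (decay_const_nonneg hr))

lemma summable_abs_mul_decay {r : ℤ → ℝ} {C : ℝ} (hr : ∀ h, |r h| ≤ C * dk h ^ 14) :
    Summable fun h : ℤ => |(h : ℝ)| * r h :=
  summable_of_le_dk_sq (c := 2 * C) fun k => by
    have hC := decay_const_nonneg hr
    refine (abs_mul_decay_le hr k (x := |(k : ℝ)|) ?_).trans ?_
    · rw [abs_abs]; linarith [abs_nonneg (k : ℝ)]
    · exact mul_le_mul_of_nonneg_left (dk_pow_le_pow k (by norm_num)) (by positivity)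

/-- Expansion of the normalized variance of a block sum. -/
lemma abs_Rsum_zero_sub_le {r : ℤ → ℝ} {C : ℝ} (hr : ∀ h, |r h| ≤ C * dk h ^ 14) {ℓ : ℕ}
    (hl : 1 ≤ ℓ) :
    |Rsum r ℓ 0 / ℓ - (∑' h, r h) + (∑' h : ℤ, |(h : ℝ)| * r h) / ℓ| ≤ 8 * C / (ℓ : ℝ) ^ 4 := by
  have hC := decay_const_nonneg hr
  have hl0 : (0 : ℝ) < ℓ := by positivity
  have h1 := ((hasSum_Rsum r ℓ 0).div_const (ℓ : ℝ)).sub (summable_decay hr).hasSum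
  have h2 := h1.add ((summable_abs_mul_decay hr).hasSum.div_const (ℓ : ℝ))
  rw [← h2.tsum_eq]
  have : 8 * C / (ℓ : ℝ) ^ 4 = 4 * (2 * C / (ℓ : ℝ) ^ 4) := by ring
  rw [this]
  refine abs_tsum_le_of_le_dk_sq (by positivity) fun h => ?_
  have e : tri ℓ (h - 0) * r h / ℓ - r h + |(h : ℝ)| * r h / ℓ =
      (tri ℓ h - ℓ + |(h : ℝ)|) * r h / ℓ := by
    rw [sub_zero]; field_simp
  rw [e]
  have hd := dk_nonneg h
  rcases le_or_gt |h| (ℓ : ℤ) with hle | hgt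
  · have : tri ℓ h = ℓ - |(h : ℝ)| := by
      unfold tri
      rw [max_eq_right (by omega)]; push_cast; ring
    rw [this]; simp; positivity
  · have : tri ℓ h = 0 := tri_eq_zero hgt.le
    rw [this]
    have hgt' : (ℓ : ℝ) < |(h : ℝ)| := by exact_mod_cast hgt
    have hx : |(0 : ℝ) - ℓ + (|(h : ℝ)|)| ≤ 2 * |(h : ℝ)| := by
      rw [abs_of_nonneg (by linarith)]; linarith
    have hk : dk h ≤ 1 / ℓ := by
      unfold dk; gcongr; linarith
    rw [abs_div, abs_of_pos hl0]
    calc _ ≤ 2 * C * dk h ^ 13 / ℓ := by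
          gcongr; exact abs_mul_decay_le hr h hx
      _ ≤ 2 * C * dk h ^ 5 / ℓ := by gcongr ?_ * ?_ / _; exact dk_pow_le_pow h (by norm_num)
      _ = 2 * C * (dk h ^ 3 * dk h ^ 2) / ℓ := by ring
      _ ≤ 2 * C * ((1 / ℓ) ^ 3 * dk h ^ 2) / ℓ := by gcongr
      _ = _ := by field_simp

/-- The covariance of two overlapping block sums is nearly a triangular function of the lag. -/
lemma abs_Rsum_sub_tri_le {r : ℤ → ℝ} {C : ℝ} (hr : ∀ h, |r h| ≤ C * dk h ^ 14)
    (heven : ∀ h, r (-h) = r h) (ℓ : ℕ) (k : ℤ) :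
    |Rsum r ℓ k - (∑' h, r h) * tri ℓ k| ≤ 4 * C * (dk k ^ 2 + dk ((ℓ : ℤ) - |k|) ^ 2) := by
  have hC := decay_const_nonneg hr
  have h1 := hasSum_Rsum r ℓ k
  have h2 : HasSum (fun h => tri ℓ (k + h) * r h) (Rsum r ℓ k) := by
    rw [← (Equiv.neg ℤ).hasSum_iff]
    convert h1 using 2 with h
    simp only [Function.comp_apply, Equiv.neg_apply, heven]
    rw [← tri_neg]; congr 2; ring
  have h3 := ((h1.add h2).div_const 2).sub ((summable_decay hr).hasSum.mul_right (tri ℓ k))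
  have e : Rsum r ℓ k - (∑' h, r h) * tri ℓ k =
      (Rsum r ℓ k + Rsum r ℓ k) / 2 - (∑' h, r h) * tri ℓ k := by ring
  rw [e, ← h3.tsum_eq, mul_assoc]
  have hk := dk_nonneg k
  have hk' := dk_nonneg ((ℓ : ℤ) - |k|)
  have e2 : 4 * (C * (dk k ^ 2 + dk ((ℓ : ℤ) - |k|) ^ 2)) =
    4 * (C * (dk k ^ 2 + dk ((ℓ : ℤ) - |k|) ^ 2)) := rfl
  rw [e2]
  refine abs_tsum_le_of_le_dk_sq (by positivity) fun h => ?_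
  have e3 : (tri ℓ (h - k) * r h + tri ℓ (k + h) * r h) / 2 - r h * tri ℓ k =
      (tri ℓ (h - k) + tri ℓ (k + h) - 2 * tri ℓ k) / 2 * r h := by ring
  rw [e3]
  have hd := dk_nonneg h
  have hx : |(tri ℓ (h - k) + tri ℓ (k + h) - 2 * tri ℓ k) / 2| ≤ |(h : ℝ)| := by
    unfold tri
    have hz : |max 0 ((ℓ : ℤ) - |h - k|) + max 0 ((ℓ : ℤ) - |k + h|) - 2 * max 0 ((ℓ : ℤ) - |k|)|
        ≤ 2 * |h| := by
      rw [abs_le]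
      rcases abs_cases h with a1 | a1 <;> rcases abs_cases k with a2 | a2 <;>
      rcases abs_cases (h - k) with a3 | a3 <;> rcases abs_cases (k + h) with a4 | a4 <;>
      omega
    have hz' : (|((max 0 ((ℓ : ℤ) - |h - k|) : ℤ) : ℝ) + ((max 0 ((ℓ : ℤ) - |k + h|) : ℤ) : ℝ) -
      2 * ((max 0 ((ℓ : ℤ) - |k|) : ℤ) : ℝ)|) ≤ 2 * |(h : ℝ)| := by exact_mod_cast hz
    rw [abs_div, abs_two]
    linarith
  by_cases hc : |h| ≤ |k| ∧ |h| ≤ |(ℓ : ℤ) - (|k|)|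
  · have : tri ℓ (h - k) + tri ℓ (k + h) - 2 * tri ℓ k = 0 := by
      unfold tri
      have hz : max 0 ((ℓ : ℤ) - |h - k|) + max 0 ((ℓ : ℤ) - |k + h|) - 2 * max 0 ((ℓ : ℤ) - |k|)
          = 0 := by
        obtain ⟨c1, c2⟩ := hc
        rcases abs_cases h with a1 | a1 <;> rcases abs_cases k with a2 | a2 <;>
        rcases abs_cases (h - k) with a3 | a3 <;> rcases abs_cases (k + h) with a4 | a4 <;>
        rcases abs_cases ((ℓ : ℤ) - |k|) with a5 | a5 <;>
        omega
      exact_mod_cast hz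
    rw [this]; simp; positivity
  · have hb : dk h ^ 2 ≤ dk k ^ 2 + dk ((ℓ : ℤ) - |k|) ^ 2 := by
      rw [not_and_or, not_le, not_le] at hc
      rcases hc with hc | hc
      · have := dk_le_of_abs_le hc.le
        have := pow_le_pow_left₀ hd this 2
        nlinarith
      · have := dk_le_of_abs_le hc.le
        have := pow_le_pow_left₀ hd this 2
        nlinarith
    have key := abs_mul_decay_le hr h
      (x := 2 * ((tri ℓ (h - k) + tri ℓ (k + h) - 2 * tri ℓ k) / 2)) (by
        rw [abs_mul, abs_two]; linarith)
    rw [mul_assoc, abs_mul, abs_two] at key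
    calc _ ≤ C * dk h ^ 13 := by linarith
      _ ≤ C * dk h ^ 4 := by gcongr ?_ * ?_; exact dk_pow_le_pow h (by norm_num)
      _ = C * dk h ^ 2 * dk h ^ 2 := by ring
      _ ≤ _ := by gcongr

lemma sum_tri_sq (ℓ : ℕ) : ∑ k ∈ Icc (-(ℓ : ℤ)) ℓ, tri ℓ k ^ 2 = (2 * (ℓ : ℝ) ^ 3 + ℓ) / 3 := by
  rw [sum_Icc_neg_eq (fun k => tri ℓ k ^ 2)]
  have h1 : ∀ t ∈ range ℓ, tri ℓ ((t : ℤ) + 1) ^ 2 + tri ℓ (-((t : ℤ) + 1)) ^ 2 =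
      2 * ((ℓ - 1 - t : ℕ) : ℝ) ^ 2 := by
    intro t ht
    have := mem_range.1 ht
    rw [tri_neg]
    have : tri ℓ ((t : ℤ) + 1) = ((ℓ - 1 - t : ℕ) : ℝ) := by
      unfold tri
      have : max 0 ((ℓ : ℤ) - |(t : ℤ) + 1|) = ((ℓ - 1 - t : ℕ) : ℤ) := by
        rw [abs_of_nonneg (by omega)]; omega
      rw [this]; simp
    rw [this]; ring
  rw [sum_congr rfl h1, sum_range_reflect (fun t => 2 * (t : ℝ) ^ 2)]
  have h2 : tri ℓ 0 = ℓ := by simp [tri]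
  rw [h2]
  induction ℓ with
  | zero => simp
  | succ ℓ ih =>
    rw [sum_range_succ]
    have : ∑ x ∈ range ℓ, 2 * (x : ℝ) ^ 2 = (2 * (ℓ : ℝ) ^ 3 + ℓ) / 3 - (ℓ : ℝ) ^ 2 := by
      have := ih (fun t ht => by
        have := mem_range.1 ht
        rw [tri_neg]
        have : tri ℓ ((t : ℤ) + 1) = ((ℓ - 1 - t : ℕ) : ℝ) := by
          unfold tri
          have : max 0 ((ℓ : ℤ) - |(t : ℤ) + 1|) = ((ℓ - 1 - t : ℕ) : ℤ) := by
            rw [abs_of_nonneg (by omega)]; omega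
          rw [this]; simp
        rw [this]; ring) (by simp [tri])
      linarith
    rw [this]; push_cast; ring

lemma abs_sum_tri_sq_sub_le {N ℓ : ℕ} (hlN : ℓ ≤ N) :
    |∑ i ∈ range N, ∑ j ∈ range N, tri ℓ ((j : ℤ) - i) ^ 2 -
      N * ((2 * (ℓ : ℝ) ^ 3 + ℓ) / 3)| ≤ ℓ * (2 * ℓ + 1) * (ℓ : ℝ) ^ 2 := by
  rw [sum_sum_sub_eq (fun k => tri ℓ k ^ 2), ← sum_tri_sq, mul_sum]
  have h1 : ∑ j ∈ Icc (-(N : ℤ)) N, tri N j * tri ℓ j ^ 2 =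
      ∑ j ∈ Icc (-(ℓ : ℤ)) ℓ, tri N j * tri ℓ j ^ 2 := by
    symm
    refine sum_subset ?_ ?_
    · intro x; simp only [mem_Icc]; omega
    · intro x _ hx
      simp only [mem_Icc] at hx
      rw [tri_eq_zero (ℓ := ℓ), zero_pow two_ne_zero, mul_zero]
      rcases abs_cases x with h | h <;> omega
  rw [h1, ← sum_sub_distrib]
  refine (abs_sum_le_sum_abs _ _).trans ?_
  calc _ ≤ ∑ j ∈ Icc (-(ℓ : ℤ)) ℓ, (ℓ : ℝ) * (ℓ : ℝ) ^ 2 := by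
        refine sum_le_sum fun j hj => ?_
        simp only [mem_Icc] at hj
        rw [← sub_mul, abs_mul, abs_of_nonneg (sq_nonneg (tri ℓ j))]
        have h2 : |tri N j - N| ≤ ℓ := by
          unfold tri
          have : |max 0 ((N : ℤ) - |j|) - N| ≤ ℓ := by
            rw [abs_le]
            rcases abs_cases j with h | h <;> omega
          exact_mod_cast this
        have h3 := tri_le ℓ j
        have h4 := tri_nonneg ℓ j
        gcongr
    _ = _ := by
        rw [sum_const, nsmul_eq_mul, Int.card_Icc]
        have : ((ℓ : ℤ) + 1 - -(ℓ : ℤ)).toNat = 2 * ℓ + 1 := by omega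
        rw [this]; push_cast; ring

/-- Indicator that the window of length `ℓ` starting at `i` contains `s`. -/
def ind (ℓ i s : ℕ) : ℝ := if i ≤ s ∧ s < i + ℓ then 1 else 0

/-- Number of the first `N` windows of length `ℓ` that contain both `s` and `t`. -/
def wt (ℓ N s t : ℕ) : ℝ := ∑ i ∈ range N, ind ℓ i s * ind ℓ i t

lemma ind_nonneg (ℓ i s : ℕ) : 0 ≤ ind ℓ i s := by unfold ind; split_ifs <;> norm_num

lemma ind_le_one (ℓ i s : ℕ) : ind ℓ i s ≤ 1 := by unfold ind; split_ifs <;> norm_num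

lemma ind_mul_self (ℓ i s : ℕ) : ind ℓ i s * ind ℓ i s = ind ℓ i s := by
  unfold ind; split_ifs <;> norm_num

lemma sum_window_eq {n ℓ i : ℕ} (h : i + ℓ ≤ n) (G : ℕ → ℝ) :
    ∑ a ∈ range ℓ, G (i + a) = ∑ s ∈ range n, ind ℓ i s * G s := by
  have : ∑ s ∈ range n, ind ℓ i s * G s = ∑ s ∈ Ico i (i + ℓ), G s := by
    rw [← sum_subset (s₁ := Ico i (i + ℓ))]
    · refine sum_congr rfl fun s hs => ?_
      rw [mem_Ico] at hs
      simp [ind, hs]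
    · grind
    · intro s _ hs
      rw [mem_Ico] at hs
      simp [ind, hs]
  rw [this, sum_Ico_eq_sum_range]
  simp

lemma sum_windows_eq {n ℓ : ℕ} (h : ℓ ≤ n) (F : ℕ → ℕ → ℝ) :
    ∑ i ∈ range (n - ℓ + 1), ∑ a ∈ range ℓ, ∑ b ∈ range ℓ, F (i + a) (i + b) =
    ∑ s ∈ range n, ∑ t ∈ range n, wt ℓ (n - ℓ + 1) s t * F s t := by
  have h1 : ∀ i ∈ range (n - ℓ + 1), ∑ a ∈ range ℓ, ∑ b ∈ range ℓ,
      F (i + a) (i + b) = ∑ s ∈ range n, ∑ t ∈ range n, ind ℓ i s * ind ℓ i t * F s t := by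
    intro i hi
    have hi' : i + ℓ ≤ n := by grind
    rw [sum_window_eq hi' (fun s => ∑ b ∈ range ℓ, F s (i + b))]
    refine sum_congr rfl fun s _ => ?_
    rw [sum_window_eq hi' (fun t => F s t), mul_sum]
    refine sum_congr rfl fun t _ => ?_
    ring
  rw [sum_congr rfl h1, sum_comm]
  refine sum_congr rfl fun s _ => ?_
  rw [sum_comm]
  refine sum_congr rfl fun t _ => ?_
  rw [wt, sum_mul]

lemma sum_windows_single_eq {n ℓ : ℕ} (h : ℓ ≤ n) (F : ℕ → ℝ) :
    ∑ i ∈ range (n - ℓ + 1), ∑ a ∈ range ℓ, F (i + a) =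
    ∑ s ∈ range n, wt ℓ (n - ℓ + 1) s s * F s := by
  have h1 : ∀ i ∈ range (n - ℓ + 1), ∑ a ∈ range ℓ, F (i + a) = ∑ s ∈ range n, ind ℓ i s * F s := by
    intro i hi
    rw [sum_window_eq (show i + ℓ ≤ n by rw [mem_range] at hi; omega) F]
  rw [sum_congr rfl h1, sum_comm]
  refine sum_congr rfl fun s _ => ?_
  rw [wt, sum_mul]
  simp only [ind_mul_self]

lemma sum_wt_self {n ℓ : ℕ} (h : ℓ ≤ n) :
    ∑ s ∈ range n, wt ℓ (n - ℓ + 1) s s = ((n - ℓ + 1 : ℕ) : ℝ) * ℓ := by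
  have := sum_windows_single_eq h (fun _ => 1)
  simp only [mul_one] at this
  rw [← this]
  simp

lemma wt_nonneg (ℓ N s t : ℕ) : 0 ≤ wt ℓ N s t :=
  sum_nonneg fun i _ => mul_nonneg (ind_nonneg _ _ _) (ind_nonneg _ _ _)

lemma wt_le_self (ℓ N s t : ℕ) : wt ℓ N s t ≤ wt ℓ N t t := by
  refine sum_le_sum fun i _ => ?_
  rw [ind_mul_self]
  exact mul_le_of_le_one_left (ind_nonneg _ _ _) (ind_le_one _ _ _)

lemma wt_comm (ℓ N s t : ℕ) : wt ℓ N s t = wt ℓ N t s := by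
  simp only [wt, mul_comm]

lemma wt_self_le (ℓ N s : ℕ) : wt ℓ N s s ≤ ℓ := by
  simp only [wt, ind_mul_self]
  simp only [ind, sum_boole]
  have : ((range N).filter (fun i => i ≤ s ∧ s < i + ℓ)) ⊆ Ico (s + 1 - ℓ) (s + 1) := by grind
  have := card_le_card this
  rw [Nat.card_Ico] at this
  exact_mod_cast this.trans (by omega)

lemma wt_le (ℓ N s t : ℕ) : wt ℓ N s t ≤ ℓ := (wt_le_self ℓ N s t).trans (wt_self_le ℓ N t)

lemma wt_self_sub_le (ℓ N s t : ℕ) : wt ℓ N s s - wt ℓ N s t ≤ |(t : ℝ) - s| := by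
  have h1 : wt ℓ N s s - wt ℓ N s t =
      ∑ i ∈ range N, (if i ≤ s ∧ s < i + ℓ ∧ ¬ (i ≤ t ∧ t < i + ℓ) then (1 : ℝ) else 0) := by
    simp only [wt, ← sum_sub_distrib]
    refine sum_congr rfl fun i _ => ?_
    unfold ind
    by_cases h1 : i ≤ s ∧ s < i + ℓ <;> by_cases h2 : i ≤ t ∧ t < i + ℓ <;> simp [h1, h2]
  rw [h1, sum_boole]
  rcases le_total s t with h | h
  · have : ((range N).filter (fun i => i ≤ s ∧ s < i + ℓ ∧ ¬ (i ≤ t ∧ t < i + ℓ))) ⊆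
        Ico (s + 1 - ℓ) (t + 1 - ℓ) := by grind
    have := card_le_card this
    rw [Nat.card_Ico] at this
    have h2 : (t : ℝ) - s = ((t - s : ℕ) : ℝ) := by simp_all
    rw [h2, Nat.abs_cast]
    exact_mod_cast this.trans (by omega)
  · have : ((range N).filter (fun i => i ≤ s ∧ s < i + ℓ ∧ ¬ (i ≤ t ∧ t < i + ℓ))) ⊆
        Ico (t + 1) (s + 1) := by grind
    have := card_le_card this
    rw [Nat.card_Ico] at this
    have h2 : (t : ℝ) - s = -((s - t : ℕ) : ℝ) := by simp_all
    rw [h2, abs_neg, Nat.abs_cast]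
    exact_mod_cast this.trans (by omega)

/-- The relative defect of a window count, in terms of that of an anchor point. -/
lemma one_sub_wt_div_le {ℓ : ℕ} (hl : 1 ≤ ℓ) (N s u v : ℕ) :
    1 - wt ℓ N u v / ℓ ≤ (1 - wt ℓ N s s / ℓ) + (|(u : ℝ) - s| + |(v : ℝ) - u|) / ℓ := by
  have h1 := wt_self_sub_le ℓ N u v
  have h2 := wt_self_sub_le ℓ N s u
  have h3 := wt_le_self ℓ N s u
  have hl0 : (0 : ℝ) < ℓ := by positivity
  have : (wt ℓ N s s - wt ℓ N u v) / ℓ ≤ (|(u : ℝ) - s| + |(v : ℝ) - u|) / ℓ := by bound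
  rw [sub_div] at this
  linarith

/-- The sum of `F` over all quadruples of points of a sample of size `n`. -/
abbrev sum4 (n : ℕ) (F : ℕ → ℕ → ℕ → ℕ → ℝ) : ℝ :=
  ∑ s ∈ range n, ∑ t ∈ range n, ∑ u ∈ range n, ∑ v ∈ range n, F s t u v

lemma abs_sum4_le {n : ℕ} {F G : ℕ → ℕ → ℕ → ℕ → ℝ} (h : ∀ s t u v, |F s t u v| ≤ G s t u v) :
    |sum4 n F| ≤ sum4 n G := by
  refine (abs_sum_le_sum_abs _ _).trans (sum_le_sum fun s _ => ?_)
  refine (abs_sum_le_sum_abs _ _).trans (sum_le_sum fun t _ => ?_)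
  refine (abs_sum_le_sum_abs _ _).trans (sum_le_sum fun u _ => ?_)
  exact (abs_sum_le_sum_abs _ _).trans (sum_le_sum fun v _ => h s t u v)

lemma sum4_dk_le (n : ℕ) {C : ℝ} (hC : 0 ≤ C) {w : ℕ → ℝ} (hw : ∀ s, 0 ≤ w s) :
    sum4 n (fun s t u v => w s * (C * dk ((t : ℤ) - s) ^ 2 * dk ((u : ℤ) - s) ^ 2 *
      dk ((v : ℤ) - s) ^ 2)) ≤ 64 * C * ∑ s ∈ range n, w s := by
  simp only [sum4, ← mul_sum, ← sum_mul]
  rw [mul_sum]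
  refine sum_le_sum fun s _ => ?_
  have h4 : ∑ t ∈ range n, dk ((t : ℤ) - s) ^ 2 ≤ 4 := by
    simpa [dk_sub_comm] using sum_range_dk_le n (s : ℤ) 0 (p := 2) le_rfl
  have h0 : 0 ≤ ∑ t ∈ range n, dk ((t : ℤ) - s) ^ 2 := sum_nonneg fun t _ => by positivity
  have := hw s
  calc _ ≤ w s * (C * 4 * 4 * 4) := by gcongr
    _ = _ := by ring

lemma abs_sum_four_le {n : ℕ} {C : ℝ} (hC : 0 ≤ C) {E : ℕ → ℕ → ℕ → ℕ → ℝ}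
    (hE : ∀ s t u v, |E s t u v| ≤ C * dk ((t : ℤ) - s) ^ 3 * dk ((u : ℤ) - s) ^ 3 *
      dk ((v : ℤ) - s) ^ 3) : |sum4 n E| ≤ 64 * C * n := by
  have h (k : ℤ) : dk k ^ 3 ≤ dk k ^ 2 := dk_pow_le_pow k (by norm_num)
  have h0 (k : ℤ) : 0 ≤ dk k := dk_nonneg k
  simpa using (abs_sum4_le fun s t u v => (hE s t u v).trans (by
    rw [one_mul]
    have := h0 (t - s)
    have := h0 (u - s)
    have := h0 (v - s)
    gcongr ?_ * ?_ * ?_ * ?_ <;> apply h)).trans (sum4_dk_le n hC (w := fun _ => 1) (by simp))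

/-- Four-fold sums over points of a sample weighted by window counts agree, up to a small error,
with the corresponding unweighted sums, if the summand decays away from the diagonal. -/
lemma abs_weighted_sum_sub_le (K : ℝ) : ∃ D, 0 ≤ D ∧ ∀ (ε C : ℝ) (n ℓ : ℕ), Reg K ε n ℓ → 0 ≤ C →
    ∀ E : ℕ → ℕ → ℕ → ℕ → ℝ,
    (∀ s t u v, |E s t u v| ≤ C * dk ((t : ℤ) - s) ^ 3 * dk ((u : ℤ) - s) ^ 3 *
      dk ((v : ℤ) - s) ^ 3) →
    |sum4 n (fun s t u v => (wt ℓ (n - ℓ + 1) s t / ℓ) * (wt ℓ (n - ℓ + 1) u v / ℓ) *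
      E s t u v) / ((n - ℓ + 1 : ℕ) : ℝ) ^ 2 - sum4 n E / (n : ℝ) ^ 2| ≤ D * C * ε ^ 8 := by
  refine ⟨2048 * |K|, by positivity, fun ε C n ℓ hr hC E hE => ?_⟩
  set N := n - ℓ + 1 with hN
  set y : ℕ → ℕ → ℕ → ℕ → ℝ := fun s t u v => (wt ℓ N s t / ℓ) * (wt ℓ N u v / ℓ) with hy
  have hl := hr.one_le_len
  have hl0 := hr.len_pos
  have hn0 := hr.size_pos
  have hN0 : (0 : ℝ) < N := Reg.num_pos n ℓ
  have e0 := hr.pos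
  have hx1 : ∀ s t, wt ℓ N s t / ℓ ≤ 1 := fun s t => (div_le_one hl0).2 (wt_le _ _ _ _)
  have hx0 : ∀ s t, 0 ≤ wt ℓ N s t / ℓ := fun s t => div_nonneg (wt_nonneg _ _ _ _) hl0.le
  set df : ℕ → ℝ := fun s => 1 - wt ℓ N s s / ℓ with hdf
  have hdf0 : ∀ s, 0 ≤ df s := fun s => by have := hx1 s s; simp only [hdf]; linarith
  have habs : ∀ a b : ℕ, |(a : ℝ) - b| * dk ((a : ℤ) - b) ≤ 1 := fun a b => by
    unfold dk
    rw [mul_one_div, div_le_one (by positivity)]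
    push_cast; linarith
  have hyE : ∀ s t u v, |(y s t u v - 1) * E s t u v| ≤ (2 * df s + 4 / ℓ) *
      (C * dk ((t : ℤ) - s) ^ 2 * dk ((u : ℤ) - s) ^ 2 * dk ((v : ℤ) - s) ^ 2) := fun s t u v => by
    have h1 := dk_nonneg ((t : ℤ) - s)
    have h2 := dk_nonneg ((u : ℤ) - s)
    have h3 := dk_nonneg ((v : ℤ) - s)
    have h1' := dk_le_one ((t : ℤ) - s)
    have h2' := dk_le_one ((u : ℤ) - s)
    have h3' := dk_le_one ((v : ℤ) - s)
    have k1 := habs t s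
    have k2 := habs u s
    have k3 := habs v s
    have hE' := hE s t u v
    set x := dk ((t : ℤ) - s)
    set p := dk ((u : ℤ) - s)
    set q := dk ((v : ℤ) - s)
    set T := |(t : ℝ) - s| with hT
    set U := |(u : ℝ) - s| with hU
    set V := |(v : ℝ) - s| with hV
    have hyb : |y s t u v - 1| ≤ 2 * df s + (T + 2 * U + V) / ℓ := by
      have a1 := one_sub_wt_div_le hl N s s t
      have a2 := one_sub_wt_div_le hl N s u v
      have a3 : |(v : ℝ) - u| ≤ V + U := by grind
      have a4 : (U + |(v : ℝ) - u|) / ℓ ≤ (2 * U + V) / ℓ :=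
        div_le_div_of_nonneg_right (by linarith) hl0.le
      simp only [sub_self, abs_zero, zero_add] at a1
      have b1 := hx1 s t
      have b2 := hx1 u v
      have b3 := hx0 s t
      have b4 := hx0 u v
      rw [abs_sub_comm, abs_of_nonneg (by simp only [hy]; nlinarith)]
      have : (T + 2 * U + V) / ℓ = T / ℓ + (2 * U + V) / ℓ := by ring
      rw [this]
      simp only [hy, hdf]
      nlinarith
    rw [abs_mul]
    have hd := hdf0 s
    calc |y s t u v - 1| * |E s t u v| ≤ (2 * df s + (T + 2 * U + V) / ℓ) *
        (C * x ^ 3 * p ^ 3 * q ^ 3) := by bound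
      _ = (2 * df s * (x * p * q) +
          (T * x * (p * q) + 2 * (U * p) * (x * q) + (V * q) * (x * p)) / ℓ) *
          (C * x ^ 2 * p ^ 2 * q ^ 2) := by ring
      _ ≤ (2 * df s * (1 * 1 * 1) + (1 * (1 * 1) + 2 * 1 * (1 * 1) + 1 * (1 * 1)) / ℓ) *
          (C * x ^ 2 * p ^ 2 * q ^ 2) := by gcongr
      _ = _ := by ring
  have S1 := (abs_sum4_le (n := n) hyE).trans
    (sum4_dk_le n hC fun s => by have := hdf0 s; positivity)
  have S2 := abs_sum_four_le (n := n) hC hE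
  have hsd : ∑ s ∈ range n, (2 * df s + 4 / (ℓ : ℝ)) ≤ 2 * ℓ + 4 * (n / ℓ) := by
    rw [sum_add_distrib, ← mul_sum]
    simp only [hdf, sum_sub_distrib, ← sum_div]
    rw [sum_wt_self (by have := hr.half; omega)]
    simp only [sum_const, card_range, nsmul_eq_mul, mul_one]
    rw [mul_div_assoc, div_self hl0.ne', hr.cast_num]
    have : (n : ℝ) * 4 / ℓ = 4 * (n / ℓ) := by ring
    rw [this]; linarith
  have hKc := hr.K_nonneg
  have hNi : 1 / (N : ℝ) ^ 2 ≤ 4 * ε ^ 12 := by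
    have := pow_le_pow_left₀ (by positivity) hr.inv_num_le 2
    rw [one_div_pow] at this
    calc _ ≤ (2 * ε ^ 6) ^ 2 := this
      _ = _ := by ring
  have hp10 : ε ^ 10 ≤ ε ^ 8 := hr.pow_le (by norm_num)
  have hup := hr.upper
  have hlow := hr.lower
  have hle12 : (ℓ : ℝ) * ε ^ 12 ≤ K * ε ^ 8 := by
    calc (ℓ : ℝ) * ε ^ 12 = (ℓ * ε ^ 2) * ε ^ 10 := by ring
      _ ≤ K * ε ^ 8 := by gcongr
  have hnl12 : (n : ℝ) / ℓ * ε ^ 12 ≤ K * ε ^ 8 := by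
    calc (n : ℝ) / ℓ * ε ^ 12 = (n * ε ^ 6) * (1 / ℓ) * ε ^ 6 := by ring
      _ = (1 / ℓ) * ε ^ 6 := by rw [hr.size, one_mul]
      _ ≤ (K * ε ^ 2) * ε ^ 6 := by gcongr
      _ = _ := by ring
  have e1 : sum4 n (fun s t u v => y s t u v * E s t u v) =
      sum4 n (fun s t u v => (y s t u v - 1) * E s t u v) + sum4 n E := by
    simp only [sum4, sub_mul, one_mul, sum_sub_distrib, sub_add_cancel]
  rw [e1]
  set T1 := sum4 n fun s t u v => (y s t u v - 1) * E s t u v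
  set T2 := sum4 n E
  have hdiff : |1 / (N : ℝ) ^ 2 - 1 / (n : ℝ) ^ 2| ≤ 2 * ℓ / n * (1 / (N : ℝ) ^ 2) := by
    have hNn := hr.num_le_size
    have hNv := hr.cast_num
    have : 1 / (N : ℝ) ^ 2 - 1 / (n : ℝ) ^ 2 =
        ((n - N) * (n + N) / n ^ 2) * (1 / (N : ℝ) ^ 2) := by field_simp; ring
    rw [this, abs_mul, abs_of_nonneg (show (0 : ℝ) ≤ 1 / (N : ℝ) ^ 2 by positivity)]
    refine mul_le_mul_of_nonneg_right ?_ (by positivity)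
    rw [abs_of_nonneg (by have : (0 : ℝ) ≤ n - N := by linarith
                          positivity)]
    rw [div_le_div_iff₀ (by positivity) hn0]
    have h1 : (n : ℝ) - N ≤ ℓ := by linarith
    have h2 : (n : ℝ) + N ≤ 2 * n := by linarith
    have h3 : ((n : ℝ) - N) * (n + N) ≤ ℓ * (2 * n) := by gcongr
    nlinarith
  have e2 : (T1 + T2) / (N : ℝ) ^ 2 - T2 / (n : ℝ) ^ 2 =
      T1 * (1 / (N : ℝ) ^ 2) + T2 * (1 / (N : ℝ) ^ 2 - 1 / (n : ℝ) ^ 2) := by ring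
  rw [e2]
  refine (abs_add_le _ _).trans ?_
  rw [abs_mul, abs_mul, abs_of_nonneg (show (0 : ℝ) ≤ 1 / (N : ℝ) ^ 2 by positivity)]
  rw [abs_of_nonneg hKc]
  calc |T1| * (1 / (N : ℝ) ^ 2) + |T2| * |1 / (N : ℝ) ^ 2 - 1 / (n : ℝ) ^ 2|
      ≤ (64 * C * (2 * ℓ + 4 * (n / ℓ))) * (4 * ε ^ 12) +
        (64 * C * n) * (2 * ℓ / n * (4 * ε ^ 12)) := by
        gcongr
        · exact S1.trans (by gcongr)
        · exact hdiff.trans (by gcongr)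
    _ = 256 * C * (2 * (ℓ * ε ^ 12) + 4 * (n / ℓ * ε ^ 12)) + 512 * C * (ℓ * ε ^ 12) := by
        field_simp; ring
    _ ≤ 256 * C * (2 * (K * ε ^ 8) + 4 * (K * ε ^ 8)) + 512 * C * (K * ε ^ 8) := by gcongr
    _ = _ := by ring

/-- A relation between four integers that is invariant under adjacent transpositions holds for
all quadruples as soon as it holds for the sorted ones. -/
lemma sorted_quadruple_induction {P : ℤ → ℤ → ℤ → ℤ → Prop}
    (h12 : ∀ s t u v, P t s u v → P s t u v) (h23 : ∀ s t u v, P s u t v → P s t u v)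
    (h34 : ∀ s t u v, P s t v u → P s t u v)
    (h : ∀ s t u v, s ≤ t → t ≤ u → u ≤ v → P s t u v) (s t u v : ℤ) : P s t u v := by
  have h1 : ∀ s t u v, t ≤ u → u ≤ v → P s t u v := fun s t u v htu huv =>
    (le_total s t).elim (h _ _ _ _ · htu huv) fun hst => h12 _ _ _ _ <|
      (le_total s u).elim (h _ _ _ _ hst · huv) fun hsu => h23 _ _ _ _ <|
        (le_total s v).elim (h _ _ _ _ htu hsu) fun hsv => h34 _ _ _ _ (h _ _ _ _ htu huv hsv)
  have h2 : ∀ s t u v, u ≤ v → P s t u v := fun s t u v huv =>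
    (le_total t u).elim (h1 _ _ _ _ · huv) fun htu => h23 _ _ _ _ <|
      (le_total t v).elim (h1 _ _ _ _ htu) fun htv => h34 _ _ _ _ (h1 _ _ _ _ huv htv)
  exact (le_total u v).elim (h2 _ _ _ _) fun huv => h34 _ _ _ _ (h2 _ _ _ _ huv)

lemma Pw.xi_of_mem (φ : LinForm d) (a b t : ℤ)
    (h : a ≤ t ∧ t ≤ b := by omega) : Pw μ X a (b + 1) 1 ‖φ‖ (BlockLength.xi μ X φ t) :=
  Pw.xi φ h.1 (by omega)

lemma one_div_le_dk {G : ℕ} {x : ℤ} (h : |x| ≤ 3 * G) : 1 / ((G : ℝ) + 1) ≤ 3 * dk x := by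
  have h' : |(x : ℝ)| ≤ 3 * G := by exact_mod_cast h
  unfold dk
  rw [mul_one_div, div_le_div_iff₀ (by positivity) (by positivity)]
  linarith

lemma div_pow_le_dk {c : ℝ} (hc : 0 ≤ c) {G : ℕ} {x y z w : ℤ} (hx : |x| ≤ 3 * G)
    (hy : |y| ≤ 3 * G) (hz : |z| ≤ 3 * G) (hw : |w| ≤ 3 * G) :
    c / ((G : ℝ) + 1) ^ 13 ≤ c * 3 ^ 12 * (dk x ^ 3 * dk y ^ 3 * dk z ^ 3 * dk w ^ 3) := by
  have hG1 : 1 / ((G : ℝ) + 1) ≤ 1 := by bound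
  have h0 : 0 ≤ 1 / ((G : ℝ) + 1) := by positivity
  have hd : ∀ {v : ℤ}, |v| ≤ 3 * G → (1 / ((G : ℝ) + 1)) ^ 3 ≤ (3 * dk v) ^ 3 := fun h =>
    pow_le_pow_left₀ h0 (one_div_le_dk h) 3
  have := dk_nonneg x
  have := dk_nonneg y
  have := dk_nonneg z
  have := dk_nonneg w
  calc c / ((G : ℝ) + 1) ^ 13
      = c * ((1 / ((G : ℝ) + 1)) ^ 3 * (1 / ((G : ℝ) + 1)) ^ 3 * (1 / ((G : ℝ) + 1)) ^ 3 *
        (1 / ((G : ℝ) + 1)) ^ 3 * (1 / ((G : ℝ) + 1))) := by field_simp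
    _ ≤ c * ((3 * dk x) ^ 3 * (3 * dk y) ^ 3 * (3 * dk z) ^ 3 * (3 * dk w) ^ 3 * 1) := by
        gcongr c * (?_ * ?_ * ?_ * ?_ * ?_)
        exacts [hd hx, hd hy, hd hz, hd hw]
    _ = _ := by ring

/-- Covariance of functionals of windows separated by at least the length of the windows. -/
lemma Good.abs_cov_le_of_wide_gap (hP : Good μ X a₀ A) {a b c e : ℤ}
    {i j G : ℕ} {C D : ℝ} {f g : Ω → ℝ} (hf : Pw μ X a b i C f) (hg : Pw μ X c e j D g)
    (hG : 1 ≤ G) (hk : b + G ≤ c + 1) (hij : i + j ≤ 13) (hw : b - a ≤ 2 * G + 1)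
    (hw' : e - c ≤ 2 * G + 1) :
    |∫ ω, f ω * g ω ∂μ - (∫ ω, f ω ∂μ) * ∫ ω, g ω ∂μ|
      ≤ 2 ^ 15 * covC a₀ A * (C * D) / ((G : ℝ) + 1) ^ 13 := by
  have hc := hP.covC_nonneg
  have hC := hf.nonneg
  have hD := hg.nonneg
  have hw1 : ∀ {a b : ℤ}, b - a ≤ 2 * G + 1 → ((b - a : ℤ) : ℝ) ≤ 2 * ((G : ℝ) + 1) := by
    intro a b h
    have : ((b - a : ℤ) : ℝ) ≤ ((2 * G + 1 : ℤ) : ℝ) := by exact_mod_cast h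
    push_cast at this ⊢; linarith
  have hG1 : (1 : ℝ) ≤ G := by exact_mod_cast hG
  have h := hP.abs_cov_le hf hg (k := G - 1) (by omega) (by omega) (w := 2 * ((G : ℝ) + 1))
    (by linarith) (hw1 hw) (hw1 hw')
  refine h.trans ?_
  have e1 : ((G - 1 : ℕ) : ℝ) + 1 = G := by push_cast [Nat.cast_sub hG]; ring
  rw [e1]
  have h2 : ((G : ℝ) + 1) ^ 14 ≤ 2 ^ 14 * (G : ℝ) ^ (14 + 4 * a₀) := by
    calc ((G : ℝ) + 1) ^ 14 ≤ (2 * G) ^ 14 := by gcongr; linarith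
      _ = 2 ^ 14 * (G : ℝ) ^ 14 := by ring
      _ ≤ _ := by gcongr <;> first | assumption | omega
  rw [div_le_div_iff₀ (by positivity) (by positivity)]
  change covC a₀ A * _ * _ ≤ _
  calc covC a₀ A * (C * D * (2 * ((G : ℝ) + 1))) * ((G : ℝ) + 1) ^ 13
      = 2 * covC a₀ A * (C * D) * ((G : ℝ) + 1) ^ 14 := by ring
    _ ≤ 2 * covC a₀ A * (C * D) * (2 ^ 14 * (G : ℝ) ^ (14 + 4 * a₀)) := by gcongr
    _ = _ := by ring

lemma Good.abs_integral_triple_le_sorted (hP : Good μ X a₀ A) :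
    ∃ c, 0 ≤ c ∧ ∀ (φ ψ χ : LinForm d) (s t u : ℤ), s ≤ t → t ≤ u →
      ∃ G : ℕ, u - s ≤ 3 * G ∧ |∫ ω, xi μ X φ s ω * xi μ X ψ t ω * xi μ X χ u ω ∂μ| ≤
        c * (‖φ‖ * ‖ψ‖ * ‖χ‖) / ((G : ℝ) + 1) ^ 13 := by
  have hc := hP.covC_nonneg
  have hA := hP.one_le
  refine ⟨2 ^ 15 * covC a₀ A + 2 ^ (29 + 8 * a₀) * A, by positivity, fun φ ψ χ s t u hst htu => ?_⟩
  have hmono1 : ∀ G : ℕ, 2 ^ 15 * covC a₀ A * (‖φ‖ * ‖ψ‖ * ‖χ‖) / ((G : ℝ) + 1) ^ 13 ≤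
      (2 ^ 15 * covC a₀ A + 2 ^ (29 + 8 * a₀) * A) * (‖φ‖ * ‖ψ‖ * ‖χ‖) / ((G : ℝ) + 1) ^ 13 := by
    intro G
    gcongr
    have : 0 ≤ 2 ^ (29 + 8 * a₀) * A := by positivity
    linarith
  obtain ⟨g1, hg1⟩ := Int.eq_ofNat_of_zero_le (show 0 ≤ t - s by omega)
  obtain ⟨g2, hg2⟩ := Int.eq_ofNat_of_zero_le (show 0 ≤ u - t by omega)
  by_cases h0 : g1 = 0 ∧ g2 = 0
  · refine ⟨0, by omega, ?_⟩
    obtain rfl : s = t := by omega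
    obtain rfl : s = u := by omega
    have h1 := ((Pw.xi_single (μ := μ) (X := X) φ s).mul (Pw.xi_single ψ s)).mul (Pw.xi_single χ s)
    have h2 := h1.integral_abs_pow_le hP (p := 1) (by omega) (w := 1) le_rfl (by simp)
    simp only [pow_one, mul_one] at h2
    refine abs_integral_le_integral_abs.trans (h2.trans ?_)
    simp only [CharP.cast_eq_zero, zero_add, one_pow, div_one]
    have : 0 ≤ ‖φ‖ * ‖ψ‖ * ‖χ‖ := by positivity
    have : 0 ≤ 2 ^ 15 * covC a₀ A * (‖φ‖ * ‖ψ‖ * ‖χ‖) := by positivity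
    linarith
  · rcases le_total g2 g1 with hle | hle
    · refine ⟨g1, by omega, le_trans ?_ (hmono1 g1)⟩
      have h := hP.abs_cov_le_of_wide_gap (Pw.xi_single φ s)
        ((Pw.xi_of_mem ψ t u t).mul (Pw.xi_of_mem χ t u u))
        (G := g1) (by omega) (by omega) (by omega) (by omega) (by omega)
      rw [hP.integral_xi, zero_mul, sub_zero] at h
      simp only [← mul_assoc] at h ⊢
      exact h
    · refine ⟨g2, by omega, le_trans ?_ (hmono1 g2)⟩
      have h := hP.abs_cov_le_of_wide_gap
        ((Pw.xi_of_mem φ s t s).mul (Pw.xi_of_mem ψ s t t)) (Pw.xi_single χ u)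
        (G := g2) (by omega) (by omega) (by omega) (by omega) (by omega)
      rw [hP.integral_xi, mul_zero, sub_zero] at h
      exact h

/-- Third mixed moments decay away from the diagonal. -/
lemma Good.triple_decay (hP : Good μ X a₀ A) (φ ψ χ : LinForm d) :
    ∃ C, 0 ≤ C ∧ ∀ s t u : ℤ, |∫ ω, xi μ X φ s ω * xi μ X ψ t ω * xi μ X χ u ω ∂μ| ≤
      C * dk (t - s) ^ 6 * dk (u - s) ^ 6 := by
  obtain ⟨c, hc, h⟩ := hP.abs_integral_triple_le_sorted
  refine ⟨c * (‖φ‖ * ‖ψ‖ * ‖χ‖) * 3 ^ 12, by positivity, fun s t u => ?_⟩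
  have fin : ∀ (φ' ψ' χ' : LinForm d) (s' t' u' : ℤ), s' ≤ t' → t' ≤ u' →
      (∀ ω, xi μ X φ' s' ω * xi μ X ψ' t' ω * xi μ X χ' u' ω =
        xi μ X φ s ω * xi μ X ψ t ω * xi μ X χ u ω) → ‖φ'‖ * ‖ψ'‖ * ‖χ'‖ = ‖φ‖ * ‖ψ‖ * ‖χ‖ →
      s' ≤ min s (min t u) ∧ max s (max t u) ≤ u' →
      |∫ ω, xi μ X φ s ω * xi μ X ψ t ω * xi μ X χ u ω ∂μ| ≤
        c * (‖φ‖ * ‖ψ‖ * ‖χ‖) * 3 ^ 12 * dk (t - s) ^ 6 * dk (u - s) ^ 6 := by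
    intro φ' ψ' χ' s' t' u' h1 h2 h3 h4 _
    obtain ⟨G, hG, hb⟩ := h φ' ψ' χ' s' t' u' h1 h2
    simp only [h3, h4] at hb
    have ht : |t - s| ≤ 3 * G := by rw [abs_le]; constructor <;> omega
    have hu : |u - s| ≤ 3 * G := by rw [abs_le]; constructor <;> omega
    exact hb.trans ((div_pow_le_dk (by positivity) ht ht hu hu).trans_eq (by ring))
  rcases le_total s t with h1 | h1 <;> rcases le_total t u with h2 | h2
  · exact fin φ ψ χ s t u h1 h2 (fun ω => by ring) (by ring) (by omega)
  · rcases le_total s u with h3 | h3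
    · exact fin φ χ ψ s u t h3 h2 (fun ω => by ring) (by ring) (by omega)
    · exact fin χ φ ψ u s t h3 h1 (fun ω => by ring) (by ring) (by omega)
  · rcases le_total s u with h3 | h3
    · exact fin ψ φ χ t s u h1 h3 (fun ω => by ring) (by ring) (by omega)
    · exact fin ψ χ φ t u s h2 h3 (fun ω => by ring) (by ring) (by omega)
  · exact fin χ ψ φ u t s h2 h1 (fun ω => by ring) (by ring) (by omega)

/-- Covariance of two linear functionals at two times. -/
def cov2 (μ : Measure Ω) (X : ℤ → Ω → Fin d → ℝ) (φ : LinForm d) (s t : ℤ) : ℝ :=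
  ∫ ω, xi μ X φ s ω * xi μ X φ t ω ∂μ

/-- Fourth mixed moment of a linear functional. -/
def mom4 (μ : Measure Ω) (X : ℤ → Ω → Fin d → ℝ) (φ : LinForm d) (s t u v : ℤ) : ℝ :=
  ∫ ω, xi μ X φ s ω * xi μ X φ t ω * (xi μ X φ u ω * xi μ X φ v ω) ∂μ

/-- Fourth joint cumulant of a linear functional. -/
def kap (μ : Measure Ω) (X : ℤ → Ω → Fin d → ℝ) (φ : LinForm d) (s t u v : ℤ) : ℝ :=
  mom4 μ X φ s t u v - cov2 μ X φ s t * cov2 μ X φ u v - cov2 μ X φ s u * cov2 μ X φ t v -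
    cov2 μ X φ s v * cov2 μ X φ t u

lemma kap_swap (φ : LinForm d) (s t u v : ℤ) :
    kap μ X φ s t u v = kap μ X φ t s u v ∧ kap μ X φ s t u v = kap μ X φ s u t v ∧
      kap μ X φ s t u v = kap μ X φ s t v u := by
  refine ⟨?_, ?_, ?_⟩ <;> simp only [kap, mom4, cov2]
  · simp only [mul_comm (xi μ X φ s _) (xi μ X φ t _)]; ring
  · simp only [mul_comm (xi μ X φ t _) (xi μ X φ u _),
      mul_left_comm (xi μ X φ t _) (xi μ X φ u _), mul_assoc]; ring
  · simp only [mul_comm (xi μ X φ u _) (xi μ X φ v _)]; ring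

lemma Good.abs_kap_le_sorted (hP : Good μ X a₀ A) (φ : LinForm d) :
    ∃ c, 0 ≤ c ∧ ∀ (s t u v : ℤ), s ≤ t → t ≤ u → u ≤ v →
      ∃ G : ℕ, v - s ≤ 3 * G ∧ |kap μ X φ s t u v| ≤ c / ((G : ℝ) + 1) ^ 13 := by
  have hc := hP.covC_nonneg
  have hA := hP.one_le
  obtain ⟨B, hB, hr⟩ := hP.cov_xi_decay φ φ
  have hr' : ∀ s t, |cov2 μ X φ s t| ≤ B * dk (s - t) ^ 14 := hr
  have hr1 : ∀ s t, |cov2 μ X φ s t| ≤ B := fun s t => (hr' s t).trans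
    (mul_le_of_le_one_right hB (pow_le_one₀ (dk_nonneg _) (dk_le_one _)))
  have hrG : ∀ (G : ℕ) (s t : ℤ), s + G ≤ t → |cov2 μ X φ s t| ≤ B / ((G : ℝ) + 1) ^ 13 := by
    intro G s t h
    refine (hr' s t).trans ?_
    have h1 : dk (s - t) ≤ 1 / ((G : ℝ) + 1) := by
      unfold dk
      have : (G : ℝ) ≤ |((s - t : ℤ) : ℝ)| := by
        have : (G : ℤ) ≤ |s - t| := by rw [abs_sub_comm]; exact le_trans (by omega) (le_abs_self _)
        exact_mod_cast this
      exact one_div_le_one_div_of_le (by positivity) (by linarith)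
    have h0 := dk_nonneg (s - t)
    calc B * dk (s - t) ^ 14 ≤ B * dk (s - t) ^ 13 := by
          gcongr ?_ * ?_; exact dk_pow_le_pow _ (by norm_num)
      _ ≤ B * (1 / ((G : ℝ) + 1)) ^ 13 := by gcongr
      _ = _ := by rw [one_div_pow]; ring
  set m := ‖φ‖ * ‖φ‖ * (‖φ‖ * ‖φ‖) with hm
  have hm0 : 0 ≤ m := by positivity
  set c1 := 2 ^ 15 * covC a₀ A * m with hc1
  set c2 := m * (2 ^ (29 + 8 * a₀) * A) with hc2
  have hc10 : 0 ≤ c1 := by positivity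
  have hc20 : 0 ≤ c2 := by positivity
  refine ⟨c1 + c2 + 3 * (B * B), by positivity, fun s t u v hst htu huv => ?_⟩
  have prod1 : ∀ (G : ℕ) (a b c e : ℤ), a + G ≤ b →
      |cov2 μ X φ a b * cov2 μ X φ c e| ≤ B * B / ((G : ℝ) + 1) ^ 13 := by
    intro G a b c e h
    rw [abs_mul]
    calc _ ≤ B / ((G : ℝ) + 1) ^ 13 * B := by gcongr; exacts [hrG G a b h, hr1 c e]
      _ = _ := by ring
  have tri4 : ∀ (x p q r y a b : ℝ), |x| ≤ a → |p| ≤ b → |q| ≤ b → |r| ≤ b → y = x - p - q - r →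
      0 ≤ b → |y| ≤ a + 3 * b := by
    intro x p q r y a b h1 h2 h3 h4 h5 _
    rw [h5]
    rw [abs_le] at *
    constructor <;> linarith
  obtain ⟨g1, hg1⟩ := Int.eq_ofNat_of_zero_le (show 0 ≤ t - s by omega)
  obtain ⟨g2, hg2⟩ := Int.eq_ofNat_of_zero_le (show 0 ≤ u - t by omega)
  obtain ⟨g3, hg3⟩ := Int.eq_ofNat_of_zero_le (show 0 ≤ v - u by omega)
  have fin : ∀ G : ℕ, c1 / ((G : ℝ) + 1) ^ 13 + 3 * (B * B / ((G : ℝ) + 1) ^ 13) ≤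
      (c1 + c2 + 3 * (B * B)) / ((G : ℝ) + 1) ^ 13 := by
    intro G
    rw [← mul_div_assoc, ← add_div]
    gcongr; linarith
  by_cases h0 : g1 = 0 ∧ g2 = 0 ∧ g3 = 0
  · refine ⟨0, by omega, ?_⟩
    obtain rfl : s = t := by omega
    obtain rfl : s = u := by omega
    obtain rfl : s = v := by omega
    have h1 := ((Pw.xi_single (μ := μ) (X := X) φ s).mul (Pw.xi_single φ s)).mul
      ((Pw.xi_single (μ := μ) (X := X) φ s).mul (Pw.xi_single φ s))
    have h2 := h1.integral_abs_pow_le hP (p := 1) (by omega) (w := 1) le_rfl (by simp)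
    simp only [pow_one, mul_one] at h2
    have h3 : |mom4 μ X φ s s s s| ≤ c2 := abs_integral_le_integral_abs.trans h2
    have hp : ∀ a b c e, |cov2 μ X φ a b * cov2 μ X φ c e| ≤ B * B := fun a b c e => by
      rw [abs_mul]; gcongr <;> apply hr1
    refine (tri4 _ _ _ _ _ _ _ h3 (hp s s s s) (hp s s s s) (hp s s s s) rfl
      (by positivity)).trans ?_
    simp only [CharP.cast_eq_zero, zero_add, one_pow, div_one]
    linarith
  · by_cases hc1' : g2 ≤ g1 ∧ g3 ≤ g1
    · refine ⟨g1, by omega, le_trans ?_ (fin g1)⟩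
      have h := hP.abs_cov_le_of_wide_gap (Pw.xi_single φ s)
        ((Pw.xi_of_mem φ t v t).mul ((Pw.xi_of_mem φ t v u).mul (Pw.xi_of_mem φ t v v)))
        (G := g1) (by omega) (by omega) (by omega) (by omega) (by omega)
      rw [hP.integral_xi, zero_mul, sub_zero] at h
      have h' : |mom4 μ X φ s t u v| ≤ c1 / ((g1 : ℝ) + 1) ^ 13 := by
          simpa only [mom4, hc1, hm, ← mul_assoc] using h
      exact tri4 _ _ _ _ _ _ _ h' (prod1 g1 s t u v (by omega)) (prod1 g1 s u t v (by omega))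
        (prod1 g1 s v t u (by omega)) rfl (by positivity)
    · by_cases hc3' : g1 ≤ g3 ∧ g2 ≤ g3
      · refine ⟨g3, by omega, le_trans ?_ (fin g3)⟩
        have h := hP.abs_cov_le_of_wide_gap (((Pw.xi_of_mem φ s u s).mul (Pw.xi_of_mem φ s u t)).mul
            (Pw.xi_of_mem φ s u u)) (Pw.xi_single φ v)
          (G := g3) (by omega) (by omega) (by omega) (by omega) (by omega)
        rw [hP.integral_xi, mul_zero, sub_zero] at h
        have h' : |mom4 μ X φ s t u v| ≤ c1 / ((g3 : ℝ) + 1) ^ 13 := by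
          simpa only [mom4, hc1, hm, ← mul_assoc] using h
        exact tri4 _ _ _ _ _ _ _ h' (by rw [mul_comm]; exact prod1 g3 _ _ _ _ (by omega))
          (by rw [mul_comm]; exact prod1 g3 _ _ _ _ (by omega)) (prod1 g3 _ _ _ _ (by omega)) rfl
          (by positivity)
      · refine ⟨g2, by omega, le_trans ?_ (fin g2)⟩
        have h := hP.abs_cov_le_of_wide_gap ((Pw.xi_of_mem φ s t s).mul (Pw.xi_of_mem φ s t t))
          ((Pw.xi_of_mem φ u v u).mul (Pw.xi_of_mem φ u v v))
          (G := g2) (by omega) (by omega) (by omega) (by omega) (by omega)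
        have h' : |mom4 μ X φ s t u v - cov2 μ X φ s t * cov2 μ X φ u v| ≤
            c1 / ((g2 : ℝ) + 1) ^ 13 := h
        have hb0 : 0 ≤ B * B / ((g2 : ℝ) + 1) ^ 13 := by positivity
        exact tri4 _ 0 _ _ _ _ _ h' (by simpa using hb0) (prod1 g2 s u t v (by omega))
          (prod1 g2 s v t u (by omega)) (by unfold kap; ring) hb0

/-- Fourth cumulants decay away from the diagonal. -/
lemma Good.kap_decay (hP : Good μ X a₀ A) (φ : LinForm d) :
    ∃ C, 0 ≤ C ∧ ∀ s t u v : ℤ, |kap μ X φ s t u v| ≤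
      C * dk (t - s) ^ 3 * dk (u - s) ^ 3 * dk (v - s) ^ 3 := by
  obtain ⟨c, hc, h⟩ := hP.abs_kap_le_sorted φ
  refine ⟨c * 3 ^ 12, by positivity, fun s t u v => ?_⟩
  have key : ∃ G : ℕ, (|t - s| ≤ 3 * G ∧ |u - s| ≤ 3 * G ∧ |v - s| ≤ 3 * G ∧
      |u - t| ≤ 3 * G ∧ |v - t| ≤ 3 * G ∧ |v - u| ≤ 3 * G) ∧
      |kap μ X φ s t u v| ≤ c / ((G : ℝ) + 1) ^ 13 := by
    refine sorted_quadruple_induction (P := fun s t u v => ∃ G : ℕ, (|t - s| ≤ 3 * G ∧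
      |u - s| ≤ 3 * G ∧ |v - s| ≤ 3 * G ∧ |u - t| ≤ 3 * G ∧ |v - t| ≤ 3 * G ∧ |v - u| ≤ 3 * G) ∧
      |kap μ X φ s t u v| ≤ c / ((G : ℝ) + 1) ^ 13) ?_ ?_ ?_ ?_ s t u v
    · rintro s t u v ⟨G, ⟨h1, h2, h3, h4, h5, h6⟩, h7⟩
      rw [← (kap_swap ..).1] at h7
      exact ⟨G, ⟨by rwa [abs_sub_comm], h4, h5, h2, h3, h6⟩, h7⟩
    · rintro s t u v ⟨G, ⟨h1, h2, h3, h4, h5, h6⟩, h7⟩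
      rw [← (kap_swap ..).2.1] at h7
      exact ⟨G, ⟨h2, h1, h3, by rwa [abs_sub_comm], h6, h5⟩, h7⟩
    · rintro s t u v ⟨G, ⟨h1, h2, h3, h4, h5, h6⟩, h7⟩
      rw [← (kap_swap ..).2.2] at h7
      exact ⟨G, ⟨h1, h3, h2, h5, h4, by rwa [abs_sub_comm]⟩, h7⟩
    · intro s t u v h1 h2 h3
      obtain ⟨G, hG, hb⟩ := h s t u v h1 h2 h3
      refine ⟨G, ?_, hb⟩
      refine ⟨?_, ?_, ?_, ?_, ?_, ?_⟩ <;> rw [abs_le] <;> constructor <;> omega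
  obtain ⟨G, ⟨h1, h2, h3, -⟩, h4⟩ := key
  refine h4.trans ?_
  simpa [dk, mul_assoc] using div_pow_le_dk hc h1 h2 h3 (show |(0 : ℤ)| ≤ 3 * G by simp)

section Gaussian

variable {r : ℤ → ℝ} {C : ℝ}

lemma abs_sum_Rsum_sq_sub_le (hr : ∀ h, |r h| ≤ C * dk h ^ 14) (heven : ∀ h, r (-h) = r h)
    {ℓ : ℕ} (hl : 1 ≤ ℓ) (N : ℕ) :
    |∑ i ∈ range N, ∑ j ∈ range N, Rsum r ℓ ((j : ℤ) - i) ^ 2 -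
      (∑' h, r h) ^ 2 * ∑ i ∈ range N, ∑ j ∈ range N, tri ℓ ((j : ℤ) - i) ^ 2| ≤
      768 * C ^ 2 * ℓ * N := by
  have hC := decay_const_nonneg hr
  have hl' : (1 : ℝ) ≤ ℓ := by exact_mod_cast hl
  set T := ∑' h, r h with hT
  have hT4 : |T| ≤ 4 * C := abs_tsum_le_of_le_dk_sq hC fun k => (hr k).trans
    (mul_le_mul_of_nonneg_left (dk_pow_le_pow k (by norm_num)) hC)
  have hpt : ∀ k : ℤ, |Rsum r ℓ k ^ 2 - T ^ 2 * tri ℓ k ^ 2| ≤ 64 * C ^ 2 * ℓ *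
      (dk k ^ 2 + (dk ((ℓ : ℤ) - k) ^ 2 + dk ((ℓ : ℤ) + k) ^ 2)) := by
    intro k
    have h1 := abs_Rsum_sub_tri_le hr heven ℓ k
    have hd : dk ((ℓ : ℤ) - |k|) ^ 2 ≤ dk ((ℓ : ℤ) - k) ^ 2 + dk ((ℓ : ℤ) + k) ^ 2 := by
      rcases abs_choice k with h | h <;> rw [h]
      · nlinarith [sq_nonneg (dk ((ℓ : ℤ) + k))]
      · rw [sub_neg_eq_add]; nlinarith [sq_nonneg (dk ((ℓ : ℤ) - k))]
    have hd1 : dk k ^ 2 ≤ 1 := pow_le_one₀ (dk_nonneg _) (dk_le_one _)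
    have hd2 : dk ((ℓ : ℤ) - |k|) ^ 2 ≤ 1 := pow_le_one₀ (dk_nonneg _) (dk_le_one _)
    have h2 : |T * tri ℓ k| ≤ 4 * C * ℓ := by
      rw [abs_mul, abs_of_nonneg (tri_nonneg ℓ k)]
      exact mul_le_mul hT4 (tri_le ℓ k) (tri_nonneg ℓ k) (by positivity)
    have h3 : |Rsum r ℓ k + T * tri ℓ k| ≤ 16 * C * ℓ := by
      have : Rsum r ℓ k + T * tri ℓ k = (Rsum r ℓ k - T * tri ℓ k) + 2 * (T * tri ℓ k) := by ring
      rw [this]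
      refine (abs_add_le _ _).trans ?_
      rw [abs_mul, abs_two]
      nlinarith
    calc |Rsum r ℓ k ^ 2 - T ^ 2 * tri ℓ k ^ 2|
        = |Rsum r ℓ k - T * tri ℓ k| * |Rsum r ℓ k + T * tri ℓ k| := by
          rw [← abs_mul]; congr 1; ring
      _ ≤ (4 * C * (dk k ^ 2 + (dk ((ℓ : ℤ) - k) ^ 2 + dk ((ℓ : ℤ) + k) ^ 2))) * (16 * C * ℓ) := by
          refine mul_le_mul (h1.trans ?_) h3 (abs_nonneg _) (by positivity)
          exact mul_le_mul_of_nonneg_left (by linarith) (by positivity)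
      _ = _ := by ring
  have hrow : ∀ i ∈ range N, |∑ j ∈ range N,
      (Rsum r ℓ ((j : ℤ) - i) ^ 2 - T ^ 2 * tri ℓ ((j : ℤ) - i) ^ 2)| ≤ 768 * C ^ 2 * ℓ := by
    intro i _
    refine (abs_sum_le_sum_abs _ _).trans ((sum_le_sum fun j _ => hpt _).trans ?_)
    rw [← mul_sum, sum_add_distrib, sum_add_distrib]
    have e1 := sum_range_dk_le N (i : ℤ) 0 (p := 2) le_rfl
    have e2 := sum_range_dk_le N ((ℓ : ℤ) + i) 0 (p := 2) le_rfl
    have e3 := sum_range_dk_le N ((i : ℤ) - ℓ) 0 (p := 2) le_rfl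
    have f1 : ∀ j : ℕ, dk ((j : ℤ) - i) = dk ((i : ℤ) - (0 + j)) := fun j => by
      rw [← dk_neg]; congr 1; ring
    have f2 : ∀ j : ℕ, dk ((ℓ : ℤ) - (j - i)) = dk ((ℓ : ℤ) + i - (0 + j)) := fun j => by
      congr 1; ring
    have f3 : ∀ j : ℕ, dk ((ℓ : ℤ) + (j - i)) = dk ((i : ℤ) - ℓ - (0 + j)) := fun j => by
      rw [← dk_neg]; congr 1; ring
    simp only [f1, f2, f3]
    calc _ ≤ 64 * C ^ 2 * ℓ * (4 + (4 + 4)) :=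
          mul_le_mul_of_nonneg_left (by linarith) (by positivity)
      _ = _ := by ring
  rw [mul_sum, ← sum_sub_distrib]
  simp_rw [mul_sum, ← sum_sub_distrib]
  refine (abs_sum_le_sum_abs _ _).trans ((sum_le_sum hrow).trans (le_of_eq ?_))
  simp only [sum_const, card_range, nsmul_eq_mul]
  ring

lemma abs_gaussian_part_sub_le (hr : ∀ h, |r h| ≤ C * dk h ^ 14) (heven : ∀ h, r (-h) = r h)
    (K : ℝ) : ∃ D, 0 ≤ D ∧ ∀ ε n ℓ, Reg K ε n ℓ →
      |(∑ i ∈ range (n - ℓ + 1), ∑ j ∈ range (n - ℓ + 1),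
        Rsum r ℓ ((j : ℤ) - i) ^ 2) / ((ℓ : ℝ) ^ 2 * ((n - ℓ + 1 : ℕ) : ℝ) ^ 2) -
        2 / 3 * (∑' h, r h) ^ 2 * (ℓ / n)| ≤ D * ε ^ 8 := by
  have hC := decay_const_nonneg hr
  set T := ∑' h, r h with hT
  refine ⟨|K| * (1536 * C ^ 2 + T ^ 2) + T ^ 2 * (14 * K ^ 2), by positivity, fun ε n ℓ h => ?_⟩
  have hN : (0 : ℝ) < ((n - ℓ + 1 : ℕ) : ℝ) := Reg.num_pos n ℓ
  have hl := h.len_pos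
  have hn := h.size_pos
  have hK : 0 ≤ K := h.K_nonneg
  have hε := h.pos
  have hl1 : (1 : ℝ) ≤ ℓ := by exact_mod_cast h.one_le_len
  have hcast := h.cast_num
  set N : ℝ := ((n - ℓ + 1 : ℕ) : ℝ) with hNdef
  have hlN : ℓ ≤ n - ℓ + 1 := by have := h.half; omega
  have h1 := abs_sum_Rsum_sq_sub_le hr heven h.one_le_len (n - ℓ + 1)
  have h2 := abs_sum_tri_sq_sub_le hlN
  rw [← hNdef] at h1 h2
  set S := ∑ i ∈ range (n - ℓ + 1), ∑ j ∈ range (n - ℓ + 1), Rsum r ℓ ((j : ℤ) - i) ^ 2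
  set U := ∑ i ∈ range (n - ℓ + 1), ∑ j ∈ range (n - ℓ + 1), tri ℓ ((j : ℤ) - i) ^ 2
  have hiN : 1 / N ≤ 2 * ε ^ 6 := h.inv_num_le
  have hin : 1 / (n : ℝ) = ε ^ 6 := h.inv_size
  have hil : 1 / (ℓ : ℝ) ≤ K * ε ^ 2 := h.lower
  have hu : ℓ * ε ^ 2 ≤ K := h.upper
  have key : S / ((ℓ : ℝ) ^ 2 * N ^ 2) - 2 / 3 * T ^ 2 * (ℓ / n) =
      (S - T ^ 2 * U) / ((ℓ : ℝ) ^ 2 * N ^ 2) +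
      T ^ 2 * ((U - N * ((2 * (ℓ : ℝ) ^ 3 + ℓ) / 3)) / ((ℓ : ℝ) ^ 2 * N ^ 2)) +
      T ^ 2 * ((1 / 3) * ((1 / ℓ) * (1 / N))) +
      T ^ 2 * ((2 / 3) * (ℓ * (ℓ - 1) * (1 / n) * (1 / N))) := by
    have : (ℓ : ℝ) / N - ℓ / n = ℓ * (ℓ - 1) * (1 / n) * (1 / N) := by
      rw [hcast] at hN ⊢
      field_simp
      ring
    rw [← this]
    field_simp
    ring
  have b1 : |(S - T ^ 2 * U) / ((ℓ : ℝ) ^ 2 * N ^ 2)| ≤ 1536 * C ^ 2 * K * ε ^ 8 := by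
    rw [abs_div, abs_of_pos (by positivity : 0 < (ℓ : ℝ) ^ 2 * N ^ 2)]
    calc _ ≤ 768 * C ^ 2 * ℓ * N / ((ℓ : ℝ) ^ 2 * N ^ 2) :=
          div_le_div_of_nonneg_right h1 (by positivity)
      _ = 768 * C ^ 2 * ((1 / ℓ) * (1 / N)) := by field_simp
      _ ≤ 768 * C ^ 2 * ((K * ε ^ 2) * (2 * ε ^ 6)) := by gcongr
      _ = _ := by ring
  have hll : (ℓ : ℝ) ^ 2 * ε ^ 4 ≤ K ^ 2 := by
    calc (ℓ : ℝ) ^ 2 * ε ^ 4 = (ℓ * ε ^ 2) ^ 2 := by ring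
      _ ≤ K ^ 2 := by gcongr
  have b2 : |T ^ 2 * ((U - N * ((2 * (ℓ : ℝ) ^ 3 + ℓ) / 3)) / ((ℓ : ℝ) ^ 2 * N ^ 2))| ≤
      T ^ 2 * (12 * K ^ 2 * ε ^ 8) := by
    rw [abs_mul, abs_div, abs_of_pos (by positivity : 0 < (ℓ : ℝ) ^ 2 * N ^ 2),
      abs_of_nonneg (sq_nonneg T)]
    gcongr
    calc _ ≤ ℓ * (2 * ℓ + 1) * (ℓ : ℝ) ^ 2 / ((ℓ : ℝ) ^ 2 * N ^ 2) :=
          div_le_div_of_nonneg_right h2 (by positivity)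
      _ = ℓ * (2 * ℓ + 1) * ((1 / N) * (1 / N)) := by field_simp
      _ ≤ ℓ * (2 * ℓ + ℓ) * ((2 * ε ^ 6) * (2 * ε ^ 6)) := by gcongr
      _ = 12 * (ℓ ^ 2 * ε ^ 4) * ε ^ 8 := by ring
      _ ≤ _ := by gcongr
  have b3 : |T ^ 2 * ((1 / 3) * ((1 / ℓ) * (1 / N)))| ≤ T ^ 2 * (K * ε ^ 8) := by
    rw [abs_of_nonneg (by positivity)]
    refine mul_le_mul_of_nonneg_left ?_ (sq_nonneg T)
    calc 1 / 3 * ((1 / ℓ) * (1 / N)) ≤ 1 / 3 * ((K * ε ^ 2) * (2 * ε ^ 6)) := by gcongr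
      _ ≤ K * ε ^ 8 := by nlinarith [mul_nonneg hK (pow_pos hε 8).le]
  have b4 : |T ^ 2 * ((2 / 3) * (ℓ * (ℓ - 1) * (1 / n) * (1 / N)))| ≤
      T ^ 2 * (2 * K ^ 2 * ε ^ 8) := by
    have : (0 : ℝ) ≤ ℓ - 1 := by linarith
    rw [abs_of_nonneg (by positivity), hin]
    refine mul_le_mul_of_nonneg_left ?_ (sq_nonneg T)
    calc 2 / 3 * (ℓ * (ℓ - 1) * ε ^ 6 * (1 / N)) ≤ 2 / 3 * (ℓ * ℓ * ε ^ 6 * (2 * ε ^ 6)) := by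
          gcongr; linarith
      _ = 4 / 3 * (ℓ ^ 2 * ε ^ 4) * ε ^ 8 := by ring
      _ ≤ 4 / 3 * K ^ 2 * ε ^ 8 := by gcongr
      _ ≤ _ := by nlinarith [mul_nonneg (sq_nonneg K) (pow_pos hε 8).le]
  rw [key, abs_of_nonneg hK]
  refine (abs_add_le _ _).trans ((add_le_add ((abs_add_le _ _).trans (add_le_add
    ((abs_add_le _ _).trans (add_le_add b1 b2)) b3)) b4).trans (le_of_eq ?_))
  ring

end Gaussian

lemma Good.integrable_xi_two (hP : Good μ X a₀ A) (φ ψ : LinForm d) (s t : ℤ) :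
    Integrable (fun ω => xi μ X φ s ω * xi μ X ψ t ω) μ :=
  ((Pw.xi_of_mem φ (min s t) (max s t) s).mul (Pw.xi_of_mem ψ _ _ t)).integrable hP (by omega)

lemma Good.integrable_xi_three (hP : Good μ X a₀ A) (φ ψ χ : LinForm d) (s t u : ℤ) :
    Integrable (fun ω => xi μ X φ s ω * xi μ X ψ t ω * xi μ X χ u ω) μ :=
  (((Pw.xi_of_mem φ (min (min s t) u) (max (max s t) u) s).mul (Pw.xi_of_mem ψ _ _ t)).mul
    (Pw.xi_of_mem χ _ _ u)).integrable hP (by omega)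

lemma Good.integrable_xi_four (hP : Good μ X a₀ A) (φ ψ χ η : LinForm d) (s t u v : ℤ) :
    Integrable (fun ω => xi μ X φ s ω * xi μ X ψ t ω * (xi μ X χ u ω * xi μ X η v ω)) μ :=
  (((Pw.xi_of_mem φ (min (min s t) (min u v)) (max (max s t) (max u v)) s).mul
    (Pw.xi_of_mem ψ _ _ t)).mul ((Pw.xi_of_mem χ _ _ u).mul
      (Pw.xi_of_mem η _ _ v))).integrable hP (by omega)

lemma gam_eq_weighted (φ ψ : LinForm d) (s : ℤ) {n ℓ : ℕ} (h : ℓ ≤ n) (ω : Ω) :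
    gam μ X φ ψ s n ℓ ω = (∑ a ∈ range n, ∑ b ∈ range n,
      wt ℓ (n - ℓ + 1) a b / ℓ * (xi μ X φ (s + a) ω * xi μ X ψ (s + b) ω)) /
        ((n - ℓ + 1 : ℕ) : ℝ) := by
  have e := sum_windows_eq h fun a b => xi μ X φ (s + a) ω * xi μ X ψ (s + b) ω
  unfold gam blk
  simp only [div_mul_eq_mul_div, ← sum_div]
  rw [← e]
  simp only [psum, sum_mul_sum, Nat.cast_add, add_assoc]

lemma mav_eq_weighted (φ : LinForm d) (s : ℤ) {n ℓ : ℕ} (h : ℓ ≤ n) (ω : Ω) :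
    mav μ X φ s n ℓ ω = (∑ a ∈ range n,
      wt ℓ (n - ℓ + 1) a a / ℓ * xi μ X φ (s + a) ω) / ((n - ℓ + 1 : ℕ) : ℝ) := by
  have e := sum_windows_single_eq h fun a => xi μ X φ (s + a) ω
  unfold mav
  simp only [div_mul_eq_mul_div, ← sum_div]
  rw [← e]
  simp only [psum, Nat.cast_add, add_assoc]

lemma integral_sum2 {n : ℕ} {f : ℕ → ℕ → Ω → ℝ} (h : ∀ s t, Integrable (f s t) μ) :
    ∫ ω, ∑ s ∈ range n, ∑ t ∈ range n, f s t ω ∂μ = ∑ s ∈ range n, ∑ t ∈ range n, ∫ ω, f s t ω ∂μ :=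
  (integral_finsetSum _ fun s _ => integrable_finsetSum _ fun t _ => h s t).trans
    (sum_congr rfl fun s _ => integral_finsetSum _ fun t _ => h s t)

lemma integral_sum4 {n : ℕ} {f : ℕ → ℕ → ℕ → ℕ → Ω → ℝ} (h : ∀ s t u v, Integrable (f s t u v) μ) :
    ∫ ω, sum4 n (fun s t u v => f s t u v ω) ∂μ = sum4 n fun s t u v => ∫ ω, f s t u v ω ∂μ :=
  (integral_sum2 fun s t => integrable_finsetSum _ fun u _ => integrable_finsetSum _ fun v _ =>
    h s t u v).trans (sum_congr rfl fun s _ => sum_congr rfl fun t _ =>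
      integral_sum2 (h s t))

/-- Weighted sums of a summable array agree with unweighted ones up to `ε ^ 8`. -/
lemma exists_length_free (K : ℝ) {C : ℝ} (hC : 0 ≤ C) (E : ℤ → ℕ → ℕ → ℕ → ℕ → ℝ)
    (hE : ∀ z s t u v, |E z s t u v| ≤ C * dk ((t : ℤ) - s) ^ 3 * dk ((u : ℤ) - s) ^ 3 *
      dk ((v : ℤ) - s) ^ 3) :
    ∃ (D : ℝ) (F : ℤ → ℕ → ℝ), 0 ≤ D ∧ ∀ ε (z : ℤ) n ℓ, Reg K ε n ℓ →
      |sum4 n (fun s t u v => (wt ℓ (n - ℓ + 1) s t / ℓ) * (wt ℓ (n - ℓ + 1) u v / ℓ) *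
        E z s t u v) / ((n - ℓ + 1 : ℕ) : ℝ) ^ 2 - F z n| ≤ D * ε ^ 8 ∧ |F z n| ≤ D * ε ^ 6 := by
  obtain ⟨D, hD, h⟩ := abs_weighted_sum_sub_le K
  refine ⟨D * C + 64 * C, fun z n => sum4 n (E z) / (n : ℝ) ^ 2, by positivity,
    fun ε z n ℓ hr => ⟨?_, ?_⟩⟩
  · have hε := hr.pos
    refine (h ε C n ℓ hr hC (E z) (hE z)).trans ?_
    gcongr
    nlinarith
  · have hε := hr.pos
    have hn := hr.size_pos
    rw [abs_div, abs_of_pos (by positivity : 0 < (n : ℝ) ^ 2)]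
    calc _ ≤ 64 * C * n / (n : ℝ) ^ 2 :=
          div_le_div_of_nonneg_right (abs_sum_four_le hC (hE z)) (by positivity)
      _ = 64 * C * (1 / n) := by field_simp
      _ = 64 * C * ε ^ 6 := by rw [hr.inv_size]
      _ ≤ _ := by gcongr; nlinarith [mul_nonneg hD hC]

lemma Good.integral_gam_mul_mav (hP : Good μ X a₀ A) (φ ψ χ : LinForm d) (K : ℝ) :
    ∃ (D : ℝ) (F : ℤ → ℕ → ℝ), 0 ≤ D ∧ ∀ ε (z : ℤ) n ℓ, Reg K ε n ℓ →
      |∫ ω, gam μ X φ ψ z n ℓ ω * mav μ X χ z n ℓ ω ∂μ - F z n| ≤ D * ε ^ 8 ∧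
        |F z n| ≤ D * ε ^ 6 := by
  obtain ⟨C, hC, hc⟩ := hP.triple_decay φ ψ χ
  obtain ⟨D, F, hD, h⟩ := exists_length_free K hC (fun z s t u v => if v = u then
    ∫ ω, xi μ X φ (z + s) ω * xi μ X ψ (z + t) ω * xi μ X χ (z + u) ω ∂μ else 0) (by
    intro z s t u v
    have h0 : ∀ k : ℤ, 0 ≤ dk k ^ 3 := fun k => pow_nonneg (dk_nonneg _) _
    split_ifs with hv
    · subst hv
      refine (hc _ _ _).trans ?_
      rw [add_sub_add_left_eq_sub, add_sub_add_left_eq_sub, mul_assoc _ (dk ((v : ℤ) - s) ^ 3),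
        ← pow_add]
      exact mul_le_mul (mul_le_mul_of_nonneg_left (dk_pow_le_pow _ (by norm_num)) hC) le_rfl
        (pow_nonneg (dk_nonneg _) _) (mul_nonneg hC (h0 _))
    · rw [abs_zero]
      exact mul_nonneg (mul_nonneg (mul_nonneg hC (h0 _)) (h0 _)) (h0 _))
  refine ⟨D, F, hD, fun ε z n ℓ hr => ⟨le_trans (le_of_eq ?_) (h ε z n ℓ hr).1, (h ε z n ℓ hr).2⟩⟩
  have hl : ℓ ≤ n := by have := hr.half; omega
  congr 2
  simp_rw [gam_eq_weighted φ ψ z hl, mav_eq_weighted χ z hl, div_mul_div_comm _ ((_ : ℕ) : ℝ) _ _,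
    ← sq, sum_mul, mul_sum]
  have hi : ∀ s t u : ℕ, Integrable (fun ω => wt ℓ (n - ℓ + 1) s t / ℓ *
      (xi μ X φ (z + s) ω * xi μ X ψ (z + t) ω) *
        (wt ℓ (n - ℓ + 1) u u / ℓ * xi μ X χ (z + u) ω)) μ := fun s t u =>
    ((hP.integrable_xi_three φ ψ χ (z + s) (z + t) (z + u)).const_mul
      (wt ℓ (n - ℓ + 1) s t / ℓ * (wt ℓ (n - ℓ + 1) u u / ℓ))).congr
      (Eventually.of_forall fun ω => by ring)
  rw [integral_div, integral_sum2 fun s t => integrable_finsetSum _ fun u _ => hi s t u]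
  congr 1
  refine sum_congr rfl fun s _ => sum_congr rfl fun t _ => ?_
  rw [integral_finsetSum _ fun u _ => hi s t u]
  refine sum_congr rfl fun u hu => ?_
  simp only [mul_ite, mul_zero]
  rw [sum_ite_eq', if_pos hu, ← integral_const_mul]
  congr 1; funext ω; ring

lemma Good.integral_mav_mul_mav (hP : Good μ X a₀ A) (φ ψ : LinForm d) (K : ℝ) :
    ∃ (D : ℝ) (F : ℤ → ℕ → ℝ), 0 ≤ D ∧ ∀ ε (z : ℤ) n ℓ, Reg K ε n ℓ →
      |∫ ω, mav μ X φ z n ℓ ω * mav μ X ψ z n ℓ ω ∂μ - F z n| ≤ D * ε ^ 8 ∧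
        |F z n| ≤ D * ε ^ 6 := by
  obtain ⟨C, hC, hc⟩ := hP.cov_xi_decay φ ψ
  obtain ⟨D, F, hD, h⟩ := exists_length_free K hC (fun z s t u v => if t = s then if v = u then
    ∫ ω, xi μ X φ (z + s) ω * xi μ X ψ (z + u) ω ∂μ else 0 else 0) (by
    intro z s t u v
    have h0 : ∀ k : ℤ, 0 ≤ dk k ^ 3 := fun k => pow_nonneg (dk_nonneg _) _
    have h1 : 0 ≤ C * dk ((t : ℤ) - s) ^ 3 * dk ((u : ℤ) - s) ^ 3 * dk ((v : ℤ) - s) ^ 3 :=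
      mul_nonneg (mul_nonneg (mul_nonneg hC (h0 _)) (h0 _)) (h0 _)
    split_ifs with ht hv
    · subst hv; subst ht
      refine (hc _ _).trans ?_
      rw [add_sub_add_left_eq_sub, dk_sub_comm, sub_self, mul_assoc _ (dk ((v : ℤ) - t) ^ 3),
        ← pow_add, show dk 0 = 1 by simp [dk], one_pow, mul_one]
      exact mul_le_mul_of_nonneg_left (dk_pow_le_pow _ (by norm_num)) hC
    · rwa [abs_zero]
    · rwa [abs_zero])
  refine ⟨D, F, hD, fun ε z n ℓ hr => ⟨le_trans (le_of_eq ?_) (h ε z n ℓ hr).1, (h ε z n ℓ hr).2⟩⟩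
  have hl : ℓ ≤ n := by have := hr.half; omega
  congr 2
  simp_rw [mav_eq_weighted _ z hl, div_mul_div_comm, ← sq, sum_mul_sum]
  have hi : ∀ s u : ℕ, Integrable (fun ω => wt ℓ (n - ℓ + 1) s s / ℓ * xi μ X φ (z + s) ω *
      (wt ℓ (n - ℓ + 1) u u / ℓ * xi μ X ψ (z + u) ω)) μ := fun s u =>
    ((hP.integrable_xi_two φ ψ (z + s) (z + u)).const_mul
      (wt ℓ (n - ℓ + 1) s s / ℓ * (wt ℓ (n - ℓ + 1) u u / ℓ))).congr
      (Eventually.of_forall fun ω => by ring)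
  rw [integral_div, integral_sum2 hi]
  congr 1
  refine sum_congr rfl fun s hs => ?_
  rw [sum_comm]
  refine sum_congr rfl fun u hu => ?_
  simp only [mul_ite, mul_zero]
  rw [sum_comm]
  have : ∀ v ∈ range n, (∑ t ∈ range n, if t = s then if v = u then
      wt ℓ (n - ℓ + 1) s t * wt ℓ (n - ℓ + 1) u v / (ℓ : ℝ) ^ 2 *
        ∫ ω, xi μ X φ (z + s) ω * xi μ X ψ (z + u) ω ∂μ else 0 else 0) = if v = u then
      wt ℓ (n - ℓ + 1) s s * wt ℓ (n - ℓ + 1) u v / (ℓ : ℝ) ^ 2 *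
        ∫ ω, xi μ X φ (z + s) ω * xi μ X ψ (z + u) ω ∂μ else 0 := fun v _ => by
    rw [sum_ite_eq', if_pos hs]
  rw [sum_congr rfl this, sum_ite_eq', if_pos hu, ← integral_const_mul]
  congr 1; funext ω; ring

/-- The cross-covariance at lag `h`. -/
def lagCov (μ : Measure Ω) (X : ℤ → Ω → Fin d → ℝ) (φ ψ : LinForm d) (h : ℤ) : ℝ :=
  ∫ ω, xi μ X φ 0 ω * xi μ X ψ h ω ∂μ

lemma Good.integral_xi_mul_xi (hP : Good μ X a₀ A) (φ ψ : LinForm d) (s t : ℤ) :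
    ∫ ω, xi μ X φ s ω * xi μ X ψ t ω ∂μ = lagCov μ X φ ψ (t - s) := by
  have := hP.integral_xi_mul_shift φ ψ 0 (t - s) s
  rwa [zero_add, sub_add_cancel] at this

lemma Good.lagCov_neg (hP : Good μ X a₀ A) (φ : LinForm d) (h : ℤ) :
    lagCov μ X φ φ (-h) = lagCov μ X φ φ h := by
  rw [← zero_sub, ← hP.integral_xi_mul_xi, lagCov]
  simp_rw [mul_comm]

lemma Good.egam_eq (hP : Good μ X a₀ A) (φ ψ : LinForm d)
    (ℓ : ℕ) : egam μ X φ ψ ℓ = Rsum (lagCov μ X φ ψ) ℓ 0 / ℓ := by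
  unfold egam blk Rsum
  rw [integral_div, hP.integral_psum_mul]
  simp_rw [hP.integral_xi_mul_xi, add_sub_add_left_eq_sub, zero_add]

lemma Good.egam_expansion (hP : Good μ X a₀ A) (φ ψ : LinForm d) :
    ∃ C, 0 ≤ C ∧ ∀ ℓ : ℕ, 1 ≤ ℓ → |egam μ X φ ψ ℓ - (∑' h, lagCov μ X φ ψ h) +
      (∑' h : ℤ, |(h : ℝ)| * lagCov μ X φ ψ h) / ℓ| ≤ C / (ℓ : ℝ) ^ 4 := by
  obtain ⟨C, hC, h⟩ := hP.cov_xi_decay φ ψ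
  refine ⟨8 * C, by positivity, fun ℓ hl => ?_⟩
  rw [hP.egam_eq]
  refine abs_Rsum_zero_sub_le (fun k => ?_) hl
  have := h 0 k
  rwa [zero_sub, dk_neg] at this

lemma sum4_congr {n : ℕ} {F G : ℕ → ℕ → ℕ → ℕ → ℝ} (h : ∀ s t u v, F s t u v = G s t u v) :
    sum4 n F = sum4 n G :=
  congrArg (sum4 n) (by funext s t u v; exact h s t u v)

lemma sum_wt_mul_cov_eq (r : ℤ → ℝ) {n ℓ : ℕ} (h : ℓ ≤ n) : sum4 n (fun s t u v =>
      wt ℓ (n - ℓ + 1) s t * wt ℓ (n - ℓ + 1) u v * (r ((u : ℤ) - s) * r ((v : ℤ) - t))) =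
    ∑ i ∈ range (n - ℓ + 1), ∑ j ∈ range (n - ℓ + 1), Rsum r ℓ ((j : ℤ) - i) ^ 2 := by
  set f : ℕ → ℕ → ℝ := fun s t => ∑ j ∈ range (n - ℓ + 1),
    (∑ c ∈ range ℓ, r (((j + c : ℕ) : ℤ) - s)) * ∑ e ∈ range ℓ, r (((j + e : ℕ) : ℤ) - t) with hf
  have h1 (s t : ℕ) : ∑ u ∈ range n, ∑ v ∈ range n,
      wt ℓ (n - ℓ + 1) s t * wt ℓ (n - ℓ + 1) u v * (r ((u : ℤ) - s) * r ((v : ℤ) - t)) =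
      wt ℓ (n - ℓ + 1) s t * f s t := by
    have e := sum_windows_eq h fun u v => r ((u : ℤ) - s) * r ((v : ℤ) - t)
    simp_rw [← mul_sum, ← sum_mul] at e
    simp_rw [hf, mul_assoc, ← mul_sum]
    rw [← e]
  simp_rw [sum4, h1, ← sum_windows_eq h f]
  refine sum_congr rfl fun i _ => ?_
  rw [sum_congr rfl fun a _ => sum_comm, sum_comm]
  refine sum_congr rfl fun j _ => ?_
  rw [← sum_mul_sum, ← sq, Rsum]
  congr 2; funext a; congr 1; funext b; congr 1; push_cast; ring

lemma Good.integral_cgam_sq_eq (hP : Good μ X a₀ A) (φ : LinForm d) (z : ℤ) {n ℓ : ℕ} (h : ℓ ≤ n) :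
    ∫ ω, cgam μ X φ φ z n ℓ ω ^ 2 ∂μ =
      sum4 n (fun s t u v => (wt ℓ (n - ℓ + 1) s t / ℓ) * (wt ℓ (n - ℓ + 1) u v / ℓ) *
        kap μ X φ (z + s) (z + t) (z + u) (z + v)) / ((n - ℓ + 1 : ℕ) : ℝ) ^ 2 +
      2 * ((∑ i ∈ range (n - ℓ + 1), ∑ j ∈ range (n - ℓ + 1),
        Rsum (lagCov μ X φ φ) ℓ ((j : ℤ) - i) ^ 2) /
          ((ℓ : ℝ) ^ 2 * ((n - ℓ + 1 : ℕ) : ℝ) ^ 2)) := by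
  have hN := (Reg.num_pos n ℓ).ne'
  have hs1 := sum_wt_mul_cov_eq (lagCov μ X φ φ) h
  set N : ℝ := ((n - ℓ + 1 : ℕ) : ℝ) with hNdef
  set w := wt ℓ (n - ℓ + 1)
  let c (s t : ℕ) : ℝ := cov2 μ X φ (z + s) (z + t)
  let y (s t : ℕ) (ω : Ω) : ℝ := xi μ X φ (z + s) ω * xi μ X φ (z + t) ω
  have hy (s t) : Integrable (y s t) μ := hP.integrable_xi_two φ φ _ _
  have hy2 (s t) : MemLp (y s t) 2 μ := (memLp_two_iff_integrable_sq (hy s t).1).2 <| by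
    simpa only [sq] using hP.integrable_xi_four φ φ φ φ _ _ _ _
  have hyc (s t) : MemLp (fun ω => y s t ω - c s t) 2 μ := (hy2 s t).sub (memLp_const _)
  have hyy (s t u v) : Integrable (fun ω => (y s t ω - c s t) * (y u v ω - c u v)) μ :=
    (hyc s t).integrable_mul (hyc u v)
  have hcov (s t u v) : ∫ ω, (y s t ω - c s t) * (y u v ω - c u v) ∂μ =
      mom4 μ X φ (z + s) (z + t) (z + u) (z + v) - c s t * c u v :=
    covariance_eq_sub (hy2 s t) (hy2 u v)
  have hg1 : ∫ ω, gam μ X φ φ z n ℓ ω ∂μ = egam μ X φ φ ℓ := by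
    unfold gam
    rw [integral_div, integral_finsetSum _ fun i _ => ?_]
    · simp_rw [hP.integral_blk, sum_const, card_range, nsmul_eq_mul]
      field_simp
    · obtain ⟨C, hC, h⟩ := hP.blk_bd φ φ
      exact (h _ ℓ).integrable (by norm_num)
  have hg (ω) : cgam μ X φ φ z n ℓ ω =
      (∑ s ∈ range n, ∑ t ∈ range n, w s t / ℓ * (y s t ω - c s t)) / N := by
    simp_rw [cgam, ← hg1, gam_eq_weighted φ φ z h]
    rw [integral_div, integral_sum2 fun s t => (hy s t).const_mul _, ← sub_div]
    simp_rw [integral_const_mul, mul_sub, sum_sub_distrib]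
    rfl
  have hg2 (ω) : cgam μ X φ φ z n ℓ ω ^ 2 = sum4 n (fun s t u v =>
      w s t / ℓ * (w u v / ℓ) * ((y s t ω - c s t) * (y u v ω - c u v))) / N ^ 2 := by
    rw [hg, div_pow, sq]
    simp_rw [sum_mul, mul_sum]
    exact congrArg (· / _) (sum4_congr fun s t u v => by ring)
  have hs2 : sum4 n (fun s t u v =>
      w s t * w u v * (lagCov μ X φ φ ((v : ℤ) - s) * lagCov μ X φ φ ((u : ℤ) - t))) =
      ∑ i ∈ range (n - ℓ + 1), ∑ j ∈ range (n - ℓ + 1),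
        Rsum (lagCov μ X φ φ) ℓ ((j : ℤ) - i) ^ 2 := by
    rw [← hs1]
    refine sum_congr rfl fun s _ => sum_congr rfl fun t _ => ?_
    rw [sum_comm]
    exact sum_congr rfl fun u _ => sum_congr rfl fun v _ =>
      congrArg (w s t * · * _) (wt_comm ℓ _ v u)
  simp_rw [hg2]
  rw [integral_div, integral_sum4 fun s t u v => (hyy s t u v).const_mul _, ← div_div, two_mul]
  nth_rewrite 1 [← hs1]
  rw [← hs2, ← add_div, ← add_div]
  congr 1
  simp_rw [integral_const_mul, hcov, sum4, sum_div, ← sum_add_distrib]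
  refine sum4_congr fun s t u v => ?_
  have hc (s t) : cov2 μ X φ s t = lagCov μ X φ φ (t - s) := hP.integral_xi_mul_xi φ φ s t
  simp only [c, kap, hc, add_sub_add_left_eq_sub]
  ring

/-- The variance of the centered block average, up to a length-free term and `O(ε ^ 8)`. -/
lemma Good.integral_cgam_sq (hP : Good μ X a₀ A) (φ : LinForm d) (K : ℝ) :
    ∃ (D : ℝ) (F : ℤ → ℕ → ℝ), 0 ≤ D ∧ ∀ ε (z : ℤ) n ℓ, Reg K ε n ℓ →
      |∫ ω, cgam μ X φ φ z n ℓ ω ^ 2 ∂μ -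
        (4 / 3 * (∑' h, lagCov μ X φ φ h) ^ 2 * (ℓ / n) + F z n)| ≤ D * ε ^ 8 := by
  obtain ⟨C, hC, hk⟩ := hP.kap_decay φ
  obtain ⟨C', hC', hr⟩ := hP.cov_xi_decay φ φ
  obtain ⟨D, F, hD, h⟩ := exists_length_free K hC
    (fun z s t u v => kap μ X φ (z + s) (z + t) (z + u) (z + v)) (fun z s t u v => by
      have := hk (z + s) (z + t) (z + u) (z + v)
      simpa only [add_sub_add_left_eq_sub] using this)
  obtain ⟨D', hD', h'⟩ := abs_gaussian_part_sub_le (r := lagCov μ X φ φ) (C := C') (fun k => by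
    have := hr 0 k
    rwa [zero_sub, dk_neg] at this) (hP.lagCov_neg φ) K
  refine ⟨D + 2 * D', F, by positivity, fun ε z n ℓ hreg => ?_⟩
  rw [hP.integral_cgam_sq_eq φ z (by have := hreg.half; omega)]
  have h1 := abs_le.1 (h ε z n ℓ hreg).1
  have h2 := abs_le.1 (h' ε n ℓ hreg)
  rw [abs_le]
  constructor <;> linarith [h1.1, h1.2, h2.1, h2.2]

/-- The integral of the integrable function `f` is within `e` of `a`. -/
structure Est (μ : Measure Ω) (f : Ω → ℝ) (a e : ℝ) : Prop where
  int : Integrable f μ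
  le : |∫ ω, f ω ∂μ - a| ≤ e

namespace Est

variable {f g : Ω → ℝ} {a b e e' c : ℝ}

lemma add (hf : Est μ f a e) (hg : Est μ g b e') : Est μ (fun ω => f ω + g ω) (a + b) (e + e') :=
  ⟨hf.int.add hg.int, by
    rw [integral_add hf.int hg.int, add_sub_add_comm]
    exact (abs_add_le _ _).trans (add_le_add hf.le hg.le)⟩

lemma const_mul (hf : Est μ f a e) (c : ℝ) : Est μ (fun ω => c * f ω) (c * a) (|c| * e) :=
  ⟨hf.int.const_mul c, by
    rw [integral_const_mul, ← mul_sub, abs_mul]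
    exact mul_le_mul_of_nonneg_left hf.le (abs_nonneg c)⟩

lemma of_bd {p : ℕ} (h : Bd μ p c f) (hp : 1 ≤ p) : Est μ f 0 c :=
  ⟨h.integrable hp, by simpa using h.abs_integral_le hp⟩

lemma mono (h : Est μ f a e) (he : |a - b| + e ≤ e') : Est μ f b e' :=
  ⟨h.int, by
    have := abs_sub_le (∫ ω, f ω ∂μ) a b
    linarith [h.le]⟩

lemma congr (h : Est μ f a e) (hfg : ∀ ω, g ω = f ω) : Est μ g a e := by
  rwa [show g = f from funext hfg]

lemma sum {ι : Type*} (s : Finset ι) {F : ι → Ω → ℝ} {a e : ι → ℝ}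
    (h : ∀ x ∈ s, Est μ (F x) (a x) (e x)) :
    Est μ (fun ω => ∑ x ∈ s, F x ω) (∑ x ∈ s, a x) (∑ x ∈ s, e x) :=
  ⟨integrable_finsetSum s fun x hx => (h x hx).int, by
    rw [integral_finsetSum s fun x hx => (h x hx).int, ← sum_sub_distrib]
    exact (abs_sum_le_sum_abs _ _).trans (sum_le_sum fun x hx => (h x hx).le)⟩

end Est

/-- Average over all overlapping blocks of the vector-valued block means. -/
def vbar (μ : Measure Ω) (X : ℤ → Ω → Fin d → ℝ) (s : ℤ) (n ℓ : ℕ) (ω : Ω) : Fin d → ℝ :=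
  ((n - ℓ + 1 : ℕ) : ℝ)⁻¹ • ∑ i ∈ range (n - ℓ + 1),
    (ℓ : ℝ)⁻¹ • ∑ t ∈ range ℓ, cen μ X (s + i + t) ω

lemma mav_eq_apply (φ : LinForm d) (s : ℤ) (n ℓ : ℕ) (ω : Ω) :
    mav μ X φ s n ℓ ω = φ (vbar μ X s n ℓ ω) := by
  simp only [mav, psum, vbar, map_smul, map_sum, smul_eq_mul, xi, div_eq_inv_mul]

/-- The limit of `egam`. -/
def elim (μ : Measure Ω) (X : ℤ → Ω → Fin d → ℝ) (φ ψ : LinForm d) : ℝ :=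
  ∑' h, lagCov μ X φ ψ h

/-- The constant in the leading bias term of `egam`. -/
def ebias (μ : Measure Ω) (X : ℤ → Ω → Fin d → ℝ) (φ ψ : LinForm d) : ℝ :=
  ∑' h : ℤ, |(h : ℝ)| * lagCov μ X φ ψ h

/-- Centered main part of the bootstrap variance, for the linear part `L` of the statistic and
its quadratic part with rows `q k`. -/
def mainP (μ : Measure Ω) (X : ℤ → Ω → Fin d → ℝ) (L : LinForm d)
    (q : Fin d → LinForm d) (s : ℤ) (n ℓ : ℕ) (ω : Ω) : ℝ :=
  gam μ X L L s n ℓ ω - elim μ X L L - ℓ * mav μ X L s n ℓ ω ^ 2 +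
    4 * ∑ k, gam μ X L (q k) s n ℓ ω * mav μ X (coord k) s n ℓ ω

/-- The functional obtained by replacing the covariances in the quadratic part by their limits. -/
def limFun (μ : Measure Ω) (X : ℤ → Ω → Fin d → ℝ) (L : LinForm d)
    (q : Fin d → LinForm d) : LinForm d :=
  ∑ k, elim μ X L (q k) • coord k

/-- The part of `mainP` carrying the fluctuation of the covariances in the quadratic part. -/
def secP (μ : Measure Ω) (X : ℤ → Ω → Fin d → ℝ) (L : LinForm d)
    (q : Fin d → LinForm d) (s : ℤ) (n ℓ : ℕ) (ω : Ω) : ℝ :=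
  ∑ k, (gam μ X L (q k) s n ℓ ω - elim μ X L (q k)) * mav μ X (coord k) s n ℓ ω

lemma mav_limFun (L : LinForm d) (q : Fin d → LinForm d) (s : ℤ) (n ℓ : ℕ) (ω : Ω) :
    mav μ X (limFun μ X L q) s n ℓ ω = ∑ k, elim μ X L (q k) * mav μ X (coord k) s n ℓ ω := by
  simp [mav_eq_apply, limFun]

lemma mainP_eq (L : LinForm d) (q : Fin d → LinForm d) (s : ℤ) (n ℓ : ℕ) (ω : Ω) :
    mainP μ X L q s n ℓ ω = cgam μ X L L s n ℓ ω + (egam μ X L L ℓ - elim μ X L L) -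
      ℓ * (mav μ X L s n ℓ ω * mav μ X L s n ℓ ω) + 4 * mav μ X (limFun μ X L q) s n ℓ ω +
      4 * secP μ X L q s n ℓ ω := by
  rw [mav_limFun]
  simp only [mainP, secP, cgam, sub_mul, sum_sub_distrib]
  ring

lemma Good.abs_egam_sub_elim_le (hP : Good μ X a₀ A) (φ ψ : LinForm d) (K : ℝ) :
    ∃ C, 0 ≤ C ∧ ∀ ε n ℓ, Reg K ε n ℓ →
      |egam μ X φ ψ ℓ - elim μ X φ ψ| ≤ C * ε ^ 2 ∧
      |egam μ X φ ψ ℓ - elim μ X φ ψ + ebias μ X φ ψ / ℓ| ≤ C * ε ^ 8 ∧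
      |(egam μ X φ ψ ℓ - elim μ X φ ψ) * ℓ + ebias μ X φ ψ| ≤ C * ε ^ 6 := by
  obtain ⟨C, h0, h⟩ := hP.egam_expansion φ ψ
  refine ⟨C * |K| ^ 4 + |ebias μ X φ ψ| * |K| + C * |K| ^ 3, by positivity, fun ε n ℓ hr => ?_⟩
  · rw [abs_of_nonneg hr.K_nonneg]
    have hl := hr.len_pos
    have e := hr.pos
    have hK := hr.K_nonneg
    have h1 := h ℓ hr.one_le_len
    change |egam μ X φ ψ ℓ - elim μ X φ ψ + ebias μ X φ ψ / ℓ| ≤ _ at h1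
    have hp : ∀ p : ℕ, 1 / (ℓ : ℝ) ^ p ≤ K ^ p * ε ^ (2 * p) := fun p => by
      rw [show K ^ p * ε ^ (2 * p) = (K * ε ^ 2) ^ p by rw [mul_pow, ← pow_mul], ← one_div_pow]
      exact pow_le_pow_left₀ (by positivity) hr.lower p
    have h2 : C / (ℓ : ℝ) ^ 4 ≤ C * K ^ 4 * ε ^ 8 := by
      calc C / (ℓ : ℝ) ^ 4 = C * (1 / (ℓ : ℝ) ^ 4) := by ring
        _ ≤ C * (K ^ 4 * ε ^ 8) := mul_le_mul_of_nonneg_left (hp 4) h0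
        _ = _ := by ring
    have h3 : |ebias μ X φ ψ / ℓ| ≤ |ebias μ X φ ψ| * K * ε ^ 2 := by
      rw [abs_div, abs_of_pos hl]
      calc |ebias μ X φ ψ| / ℓ = |ebias μ X φ ψ| * (1 / ℓ) := by ring
        _ ≤ |ebias μ X φ ψ| * (K * ε ^ 2) := mul_le_mul_of_nonneg_left hr.lower (abs_nonneg _)
        _ = _ := by ring
    have h4 : ε ^ 8 ≤ ε ^ 2 := hr.pow_le (by norm_num)
    refine ⟨?_, ?_, ?_⟩
    · have h5 := abs_sub_abs_le_abs_sub (egam μ X φ ψ ℓ - elim μ X φ ψ)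
        (-(ebias μ X φ ψ / ℓ))
      rw [sub_neg_eq_add, abs_neg] at h5
      have h6 : C * K ^ 4 * ε ^ 8 ≤ C * K ^ 4 * ε ^ 2 := by gcongr
      have h7 : 0 ≤ C * K ^ 3 * ε ^ 2 := by positivity
      linarith
    · have h7 : 0 ≤ C * K ^ 3 * ε ^ 8 := by positivity
      have h8 : 0 ≤ |ebias μ X φ ψ| * K * ε ^ 8 := by positivity
      linarith
    · have h7 : 0 ≤ C * K ^ 4 * ε ^ 6 := by positivity
      have h8 : 0 ≤ |ebias μ X φ ψ| * K * ε ^ 6 := by positivity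
      have h9 : (egam μ X φ ψ ℓ - elim μ X φ ψ) * ℓ + ebias μ X φ ψ =
          (egam μ X φ ψ ℓ - elim μ X φ ψ + ebias μ X φ ψ / ℓ) * ℓ := by field_simp
      rw [h9, abs_mul, abs_of_pos hl]
      calc _ ≤ C / (ℓ : ℝ) ^ 4 * ℓ := by gcongr
        _ = C * (1 / (ℓ : ℝ) ^ 3) := by field_simp
        _ ≤ C * (K ^ 3 * ε ^ 6) := mul_le_mul_of_nonneg_left (hp 3) h0
        _ ≤ _ := by linarith

lemma Good.integral_mav (hP : Good μ X a₀ A)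
    (φ : LinForm d) (s : ℤ) (n ℓ : ℕ) : ∫ ω, mav μ X φ s n ℓ ω ∂μ = 0 := by
  have hi : ∀ s : ℤ, Integrable (psum μ X φ s ℓ) μ := fun s =>
    (psum_Pw φ s ℓ).integrable hP (by omega)
  simp only [mav, integral_div]
  rw [integral_finsetSum _ fun i _ => (hi _).div_const _]
  simp [integral_div, hP.integral_psum]

lemma Good.integral_cgam (hP : Good μ X a₀ A)
    (φ ψ : LinForm d) (s : ℤ) (n ℓ : ℕ) : ∫ ω, cgam μ X φ ψ s n ℓ ω ∂μ = 0 := by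
  have hi : ∀ i : ℕ, Integrable (cblk μ X φ ψ (s + i) ℓ) μ := fun i => by
    obtain ⟨C, -, h⟩ := hP.cblk_bd φ ψ
    exact (h _ ℓ).integrable (by norm_num)
  simp only [cgam_eq, integral_div]
  rw [integral_finsetSum _ fun i _ => hi i]
  simp [hP.integral_cblk]

lemma Good.mav_mul_bd (hP : Good μ X a₀ A) (φ ψ : LinForm d) :
    ∃ C, 0 ≤ C ∧ ∀ K ε (s : ℤ) n ℓ, Reg K ε n ℓ →
      Bd μ 4 (C * ε ^ 6) (fun ω => mav μ X φ s n ℓ ω * mav μ X ψ s n ℓ ω) := by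
  obtain ⟨C, h0, h⟩ := hP.mav_bd φ
  obtain ⟨D, h0', h'⟩ := hP.mav_bd ψ
  refine ⟨C * D, by positivity, fun K ε s n ℓ hr => ?_⟩
  exact (Bd.mul_self_exp (p := 4) ((h K ε s n ℓ hr).mono_exp (by omega))
    ((h' K ε s n ℓ hr).mono_exp (by omega))).mono_const (le_of_eq (by ring))

lemma Good.gam_sub_elim_bd (hP : Good μ X a₀ A) (φ ψ : LinForm d) (K : ℝ) :
    ∃ C, 0 ≤ C ∧ ∀ ε (s : ℤ) n ℓ, Reg K ε n ℓ →
      Bd μ 4 (C * ε ^ 2) (fun ω => gam μ X φ ψ s n ℓ ω - elim μ X φ ψ) ∧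
      Bd μ 6 C (fun ω => gam μ X φ ψ s n ℓ ω - elim μ X φ ψ) := by
  obtain ⟨C, h0, h⟩ := hP.cgam_bd φ ψ K
  obtain ⟨D, h0', h'⟩ := hP.abs_egam_sub_elim_le φ ψ K
  obtain ⟨G, hG0, hG⟩ := hP.gam_bd φ ψ
  refine ⟨C + D + (G + |elim μ X φ ψ|), by positivity, fun ε s n ℓ hr => ⟨?_, ?_⟩⟩
  · have h1 := (h ε s n ℓ hr).add (Bd.const (μ := μ) (egam μ X φ ψ ℓ - elim μ X φ ψ)
      (by norm_num : 1 ≤ 4)) (by norm_num)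
    have h2 := (h' ε n ℓ hr).1
    have e := hr.pos
    have h3 : 0 ≤ (G + |elim μ X φ ψ|) * ε ^ 2 := by positivity
    have h4 := h1.mono_const (D := (C + D + (G + |elim μ X φ ψ|)) * ε ^ 2) (by linarith)
    simpa only [cgam, sub_add_sub_cancel] using h4
  · exact ((hG s n ℓ).sub (Bd.const _ (by norm_num)) (by norm_num)).mono_const (by linarith)

lemma Good.secP_bd (hP : Good μ X a₀ A) (L : LinForm d) (q : Fin d → LinForm d) (K : ℝ) :
    ∃ C, 0 ≤ C ∧ ∀ ε (s : ℤ) n ℓ, Reg K ε n ℓ →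
      Bd μ 2 (C * ε ^ 5) (secP μ X L q s n ℓ) ∧ Bd μ 4 (C * ε ^ 3) (secP μ X L q s n ℓ) := by
  choose C h0 h using fun k => hP.gam_sub_elim_bd L (q k) K
  choose D h0' h' using fun k : Fin d => hP.mav_bd (coord k)
  have hc : ∀ k, 0 ≤ C k * D k := fun k => mul_nonneg (h0 k) (h0' k)
  refine ⟨∑ k, C k * D k, sum_nonneg fun k _ => hc k, fun ε s n ℓ hr => ⟨?_, ?_⟩⟩
  · refine (Bd.sum univ (fun k _ => Bd.mul_self_exp (p := 2) (h k ε s n ℓ hr).1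
      ((h' k K ε s n ℓ hr).mono_exp (by omega))) (by norm_num)).mono_const ?_
    rw [sum_mul]
    exact le_of_eq (sum_congr rfl fun k _ => by ring)
  · refine (Bd.sum univ (fun k _ => (h k ε s n ℓ hr).2.mul
      ((h' k K ε s n ℓ hr).mono_exp (by omega)) holderTriple_six_twelve) (by norm_num)).mono_const ?_
    rw [sum_mul]
    exact le_of_eq (sum_congr rfl fun k _ => by ring)

lemma Good.mainP_bd (hP : Good μ X a₀ A) (L : LinForm d) (q : Fin d → LinForm d) (K : ℝ) :
    ∃ C, 0 ≤ C ∧ ∀ ε (s : ℤ) n ℓ, Reg K ε n ℓ → Bd μ 4 (C * ε ^ 2) (mainP μ X L q s n ℓ) := by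
  obtain ⟨C₁, h₁, H₁⟩ := hP.gam_sub_elim_bd L L K
  obtain ⟨C₂, h₂, H₂⟩ := hP.mav_mul_bd L L
  obtain ⟨C₃, h₃, H₃⟩ := hP.mav_bd (limFun μ X L q)
  obtain ⟨C₄, h₄, H₄⟩ := hP.secP_bd L q K
  refine ⟨C₁ + |K| * C₂ + 4 * C₃ + 4 * C₄, by positivity, fun ε s n ℓ hr => ?_⟩
  have e := hr.pos
  have h := (((H₁ ε s n ℓ hr).1.sub ((H₂ K ε s n ℓ hr).const_mul (ℓ : ℝ)) (by norm_num)).add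
    (((H₃ K ε s n ℓ hr).mono_exp (by omega)).const_mul 4) (by norm_num)).add
    ((H₄ ε s n ℓ hr).2.const_mul 4) (by norm_num)
  have hl := hr.upper
  have e3 : ε ^ 3 ≤ ε ^ 2 := hr.pow_le (by norm_num)
  have e4 : ε ^ 4 ≤ ε ^ 2 := hr.pow_le (by norm_num)
  refine (show mainP μ X L q s n ℓ = _ from funext fun ω => ?_) ▸
    h.mono_const (D := (C₁ + |K| * C₂ + 4 * C₃ + 4 * C₄) * ε ^ 2) ?_
  · rw [mainP_eq, cgam]; ring
  · rw [abs_of_nonneg hr.K_nonneg]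
    have hK := hr.K_nonneg
    have h5 : |(ℓ : ℝ)| * (C₂ * ε ^ 6) ≤ K * C₂ * ε ^ 2 := by
      rw [abs_of_pos hr.len_pos]
      calc _ = (ℓ * ε ^ 2) * (C₂ * ε ^ 4) := by ring
        _ ≤ K * (C₂ * ε ^ 2) := by gcongr
        _ = _ := by ring
    have h6 : C₃ * ε ^ 3 ≤ C₃ * ε ^ 2 := by gcongr
    have h7 : C₄ * ε ^ 3 ≤ C₄ * ε ^ 2 := by gcongr
    rw [show |(4 : ℝ)| = 4 by norm_num]
    linarith

lemma Good.est_secP (hP : Good μ X a₀ A) (L : LinForm d) (q : Fin d → LinForm d) (K : ℝ) :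
    ∃ C, 0 ≤ C ∧ ∀ ε (s : ℤ) n ℓ, Reg K ε n ℓ → Est μ (secP μ X L q s n ℓ) 0 (C * ε ^ 6) ∧
      Est μ (fun ω => cgam μ X L L s n ℓ ω * secP μ X L q s n ℓ ω) 0 (C * ε ^ 8) := by
  choose C h0 h using fun k => hP.abs_integral_cgam_cgam_mav_le L L L (q k) (coord k) K
  choose D F D0 H using fun k => hP.integral_gam_mul_mav L (q k) (coord k) K
  choose D' F' D0' H' using fun k : Fin d =>
    hP.integral_gam_mul_mav L L (coord k) K
  choose E E0 HE using fun k => hP.abs_egam_sub_elim_le L (q k) K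
  choose G G0 HG using fun k => hP.gam_sub_elim_bd L (q k) K
  choose M M0 HM using fun k : Fin d => hP.mav_bd (coord k)
  obtain ⟨B, B0, HB⟩ := hP.cgam_bd L L K
  have hc : ∀ k, 0 ≤ 2 * D k + C k + E k * (2 * D' k) := fun k => by
    have := h0 k; have := D0 k; have := D0' k; have := E0 k; positivity
  refine ⟨∑ k, (2 * D k + C k + E k * (2 * D' k)), sum_nonneg fun k _ => hc k, fun ε s n ℓ hr => ?_⟩
  have e := hr.pos
  have e86 : ε ^ 8 ≤ ε ^ 6 := hr.pow_le (by norm_num)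
  have im : ∀ k : Fin d, Integrable (mav μ X (coord k) s n ℓ) μ := fun k =>
    (HM k K ε s n ℓ hr).integrable (by omega)
  have iw : ∀ k, Integrable (fun ω => (gam μ X L (q k) s n ℓ ω - elim μ X L (q k)) *
      mav μ X (coord k) s n ℓ ω) μ := fun k =>
    (Bd.mul_self_exp (p := 2) (HG k ε s n ℓ hr).1
      ((HM k K ε s n ℓ hr).mono_exp (by omega))).integrable (by norm_num)
  have ig : ∀ k : Fin d, Integrable (fun ω => cgam μ X L L s n ℓ ω *
      mav μ X (coord k) s n ℓ ω) μ := fun k =>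
    (Bd.mul_self_exp (p := 2) (HB ε s n ℓ hr)
      ((HM k K ε s n ℓ hr).mono_exp (by omega))).integrable (by norm_num)
  have igw : ∀ k, Integrable (fun ω => cgam μ X L L s n ℓ ω *
      ((gam μ X L (q k) s n ℓ ω - elim μ X L (q k)) *
      mav μ X (coord k) s n ℓ ω)) μ := fun k =>
    (Bd.mul_self_exp (p := 1) ((HB ε s n ℓ hr).mono_exp (by norm_num))
      (Bd.mul_self_exp (p := 2) (HG k ε s n ℓ hr).1
      ((HM k K ε s n ℓ hr).mono_exp (by omega)))).integrable (by norm_num)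
  have hgm : ∀ k : Fin d, |∫ ω, cgam μ X L L s n ℓ ω *
      mav μ X (coord k) s n ℓ ω ∂μ| ≤ 2 * D' k * ε ^ 6 := fun k => by
    have h1 : (fun ω => gam μ X L L s n ℓ ω * mav μ X (coord k) s n ℓ ω) =
        fun ω => cgam μ X L L s n ℓ ω * mav μ X (coord k) s n ℓ ω +
          egam μ X L L ℓ * mav μ X (coord k) s n ℓ ω := by
      funext ω; rw [cgam]; ring
    have h2 := H' k ε s n ℓ hr
    rw [h1, integral_add (ig k) ((im k).const_mul _), integral_const_mul, hP.integral_mav,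
      mul_zero, add_zero] at h2
    have h3 : D' k * ε ^ 8 ≤ D' k * ε ^ 6 := mul_le_mul_of_nonneg_left e86 (D0' k)
    have := abs_sub_abs_le_abs_sub (∫ ω, cgam μ X L L s n ℓ ω *
      mav μ X (coord k) s n ℓ ω ∂μ) (F' k s n)
    linarith [h2.1, h2.2]
  constructor
  · have h1 : ∀ k ∈ univ, Est μ (fun ω => (gam μ X L (q k) s n ℓ ω - elim μ X L (q k)) *
        mav μ X (coord k) s n ℓ ω) 0
        ((2 * D k + C k + E k * (2 * D' k)) * ε ^ 6) := fun k _ => ⟨iw k, by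
      have h2 : (fun ω => gam μ X L (q k) s n ℓ ω * mav μ X (coord k) s n ℓ ω) =
          fun ω => (gam μ X L (q k) s n ℓ ω - elim μ X L (q k)) * mav μ X (coord k) s n ℓ ω +
            elim μ X L (q k) * mav μ X (coord k) s n ℓ ω := by
        funext ω; ring
      have h3 := H k ε s n ℓ hr
      rw [h2, integral_add (iw k) ((im k).const_mul _), integral_const_mul, hP.integral_mav,
        mul_zero, add_zero] at h3
      have h4 : D k * ε ^ 8 ≤ D k * ε ^ 6 := mul_le_mul_of_nonneg_left e86 (D0 k)
      have h5 : 0 ≤ (C k + E k * (2 * D' k)) * ε ^ 6 := by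
        have := h0 k; have := D0' k; have := E0 k; positivity
      have := abs_sub_abs_le_abs_sub (∫ ω, (gam μ X L (q k) s n ℓ ω - elim μ X L (q k)) *
        mav μ X (coord k) s n ℓ ω ∂μ) (F k s n)
      rw [sub_zero]
      linarith [h3.1, h3.2]⟩
    refine (Est.sum univ h1).mono ?_
    simp [sum_mul]
  · have h1 : ∀ k ∈ univ, Est μ (fun ω => cgam μ X L L s n ℓ ω *
        ((gam μ X L (q k) s n ℓ ω - elim μ X L (q k)) *
        mav μ X (coord k) s n ℓ ω)) 0
        ((2 * D k + C k + E k * (2 * D' k)) * ε ^ 8) := fun k _ => ⟨igw k, by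
      have h2 : (fun ω => cgam μ X L L s n ℓ ω * cgam μ X L (q k) s n ℓ ω *
          mav μ X (coord k) s n ℓ ω) =
          fun ω => cgam μ X L L s n ℓ ω * ((gam μ X L (q k) s n ℓ ω - elim μ X L (q k)) *
            mav μ X (coord k) s n ℓ ω) -
            (egam μ X L (q k) ℓ - elim μ X L (q k)) *
            (cgam μ X L L s n ℓ ω * mav μ X (coord k) s n ℓ ω) := by
        funext ω; simp only [cgam]; ring
      have h3 := h k ε s n ℓ hr
      rw [h2, integral_sub (igw k) ((ig k).const_mul _), integral_const_mul] at h3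
      have h4 : |(egam μ X L (q k) ℓ - elim μ X L (q k)) * ∫ ω, cgam μ X L L s n ℓ ω *
          mav μ X (coord k) s n ℓ ω ∂μ| ≤ E k * (2 * D' k) * ε ^ 8 := by
        rw [abs_mul]
        calc _ ≤ (E k * ε ^ 2) * (2 * D' k * ε ^ 6) :=
              mul_le_mul (HE k ε n ℓ hr).1 (hgm k) (abs_nonneg _)
                (mul_nonneg (E0 k) (by positivity))
          _ = _ := by ring
      have h5 : 0 ≤ 2 * D k * ε ^ 8 := by have := D0 k; positivity
      have := abs_sub_abs_le_abs_sub (∫ ω, cgam μ X L L s n ℓ ω *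
        ((gam μ X L (q k) s n ℓ ω - elim μ X L (q k)) *
        mav μ X (coord k) s n ℓ ω) ∂μ)
        ((egam μ X L (q k) ℓ - elim μ X L (q k)) * ∫ ω, cgam μ X L L s n ℓ ω *
          mav μ X (coord k) s n ℓ ω ∂μ)
      rw [sub_zero]
      linarith⟩
    refine ((Est.sum univ h1).congr fun ω => ?_).mono ?_
    · rw [secP, mul_sum]
    · simp [sum_mul]

theorem Good.integral_mainP_sq (hP : Good μ X a₀ A)
    (L : LinForm d) (q : Fin d → LinForm d) (K CR : ℝ) :
    ∃ (D : ℝ) (F : ℤ → ℕ → ℝ), 0 ≤ D ∧ ∀ (ε : ℝ) (z : ℤ) (n ℓ : ℕ) (R : Ω → ℝ), Reg K ε n ℓ →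
      Bd μ 2 (CR * ε ^ 6) R →
      |∫ ω, (mainP μ X L q z n ℓ ω + R ω) ^ 2 ∂μ - (ebias μ X L L ^ 2 / (ℓ : ℝ) ^ 2 +
        4 / 3 * elim μ X L L ^ 2 * (ℓ / n) + F z n)| ≤ D * ε ^ 8 := by
  obtain ⟨D₁, F₁, d₁, H₁⟩ := hP.integral_cgam_sq L K
  obtain ⟨D₂, F₂, d₂, H₂⟩ := hP.integral_mav_mul_mav (limFun μ X L q) (limFun μ X L q) K
  obtain ⟨D₃, F₃, d₃, H₃⟩ := hP.integral_mav_mul_mav L L K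
  obtain ⟨D₄, F₄, d₄, H₄⟩ := hP.integral_gam_mul_mav L L (limFun μ X L q) K
  obtain ⟨D₅, d₅, H₅⟩ := hP.abs_integral_cgam_mav_mav_le L L L L K
  obtain ⟨D₆, d₆, H₆⟩ := hP.abs_integral_mav_three_le L L (limFun μ X L q) K
  obtain ⟨C₁, c₁, B₁⟩ := hP.cgam_bd L L K
  obtain ⟨C₂, c₂, B₂⟩ := hP.mav_mul_bd L L
  obtain ⟨C₃, c₃, B₃⟩ := hP.mav_bd (limFun μ X L q)
  obtain ⟨C₄, c₄, B₄⟩ := hP.secP_bd L q K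
  obtain ⟨C₅, c₅, B₅⟩ := hP.mainP_bd L q K
  obtain ⟨E, hE0, hE⟩ := hP.abs_egam_sub_elim_le L L K
  obtain ⟨S, hS0, hS⟩ := hP.est_secP L q K
  set B := ebias μ X L L with hB
  refine ⟨D₁ + E * (E + 2 * |B| * |K|) + |K| ^ 2 * C₂ ^ 2 + 16 * D₂ +
    (4 * E * D₃ + 2 * |B| * D₃) + 8 * D₄ + 2 * |K| * D₅ + 8 * |K| * D₆ + 8 * S + 8 * E * S +
    8 * |K| * (C₂ * C₄) + 32 * (C₃ * C₄) + 16 * C₄ ^ 2 + 2 * (C₅ * |CR|) + CR ^ 2,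
    fun z n => F₁ z n + 16 * F₂ z n + 8 * F₄ z n + 2 * B * F₃ z n, by positivity,
    fun ε z n ℓ R hr hR => ?_⟩
  have e := hr.pos
  have hl := hr.len_pos
  have hlK := hr.len_le
  have hK := hr.K_nonneg
  set β := egam μ X L L ℓ - elim μ X L L with hβ
  set g := cgam μ X L L z n ℓ with hg
  set M := mav μ X L z n ℓ with hM
  set N := mav μ X (limFun μ X L q) z n ℓ with hN
  set W := secP μ X L q z n ℓ with hW
  set P := mainP μ X L q z n ℓ with hPdef
  have pw : ∀ i, 8 ≤ i → ε ^ i ≤ ε ^ 8 := fun i hi => hr.pow_le hi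
  obtain ⟨b1, b2, b3⟩ := hE ε n ℓ hr
  rw [← hβ] at b2 b3
  rw [← hβ] at b1
  have hlε : (ℓ : ℝ) * ε ^ 2 ≤ |K| := hr.upper.trans (le_abs_self K)
  have bM := B₂ K ε z n ℓ hr
  have bg := B₁ ε z n ℓ hr
  have bN : Bd μ 4 (C₃ * ε ^ 3) N := (B₃ K ε z n ℓ hr).mono_exp (by omega)
  obtain ⟨bW, -⟩ := B₄ ε z n ℓ hr
  have bP := B₅ ε z n ℓ hr
  have two : ∀ {f h : Ω → ℝ} {c c' : ℝ}, Bd μ 2 c f → Bd μ 2 c' h →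
      Bd μ 1 (c * c') (fun ω => f ω * h ω) := fun hf hh => Bd.mul_self_exp (p := 1) hf hh
  have four : ∀ {f h : Ω → ℝ} {c c' : ℝ}, Bd μ 4 c f → Bd μ 4 c' h →
      Bd μ 2 (c * c') (fun ω => f ω * h ω) := fun hf hh => Bd.mul_self_exp (p := 2) hf hh
  have m2 : ∀ {f : Ω → ℝ} {c : ℝ}, Bd μ 4 c f → Bd μ 2 c f := fun hf => hf.mono_exp (by norm_num)
  -- the individual terms of the expanded square
  have t1 : Est μ (fun ω => g ω ^ 2) (4 / 3 * elim μ X L L ^ 2 * (ℓ / n) + F₁ z n) (D₁ * ε ^ 8) :=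
    ⟨((four bg bg).integrable (by norm_num)).congr (ae_of_all _ fun ω => by simp only; ring),
      H₁ ε z n ℓ hr⟩
  have t2 : Est μ (fun ω => 16 * (N ω * N ω)) (16 * F₂ z n) (16 * D₂ * ε ^ 8) :=
    (Est.const_mul ⟨(four bN bN).integrable (by norm_num), (H₂ ε z n ℓ hr).1⟩ 16).mono (by
      norm_num; linarith)
  have t3 : Est μ (fun ω => -(2 * (β * ℓ)) * (M ω * M ω)) (2 * B * F₃ z n)
      ((4 * E * D₃ + 2 * |B| * D₃) * ε ^ 8) := by
    refine (Est.const_mul ⟨bM.integrable (by norm_num), (H₃ ε z n ℓ hr).1⟩ _).mono ?_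
    have h1 := (H₃ ε z n ℓ hr).2
    have h2 : |-(2 * (β * ℓ)) * F₃ z n - 2 * B * F₃ z n| ≤ 2 * (E * D₃) * ε ^ 8 := by
      rw [show -(2 * (β * ℓ)) * F₃ z n - 2 * B * F₃ z n = -(2 * ((β * ℓ + B) * F₃ z n)) by ring,
        abs_neg, abs_mul, abs_mul, abs_two]
      calc _ ≤ 2 * (E * ε ^ 6 * (D₃ * ε ^ 6)) := by gcongr
        _ = 2 * (E * D₃) * ε ^ 12 := by ring
        _ ≤ _ := mul_le_mul_of_nonneg_left (pw 12 (by norm_num)) (by positivity)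
    have h3 : |-(2 * (β * ℓ))| ≤ 2 * (E + |B|) := by
      rw [abs_neg, abs_mul, abs_two]
      have h4 := abs_sub_abs_le_abs_sub (β * ℓ) (-B)
      rw [sub_neg_eq_add, abs_neg] at h4
      have h5 : E * ε ^ 6 ≤ E * 1 := mul_le_mul_of_nonneg_left (pow_le_one₀ e.le hr.le_one) hE0
      linarith
    have h4 : |-(2 * (β * ℓ))| * (D₃ * ε ^ 8) ≤ 2 * (E + |B|) * (D₃ * ε ^ 8) :=
      mul_le_mul_of_nonneg_right h3 (by positivity)
    linarith
  have iN : Integrable N μ := bN.integrable (by norm_num)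
  have t4 : Est μ (fun ω => 8 * (gam μ X L L z n ℓ ω * N ω)) (8 * F₄ z n) (8 * D₄ * ε ^ 8) := by
    refine (Est.const_mul ⟨?_, (H₄ ε z n ℓ hr).1⟩ 8).mono (by norm_num; linarith)
    have h1 := ((four bg bN).integrable (by norm_num)).add (iN.const_mul (egam μ X L L ℓ))
    refine h1.congr (ae_of_all _ fun ω => ?_)
    simp only [Pi.add_apply, cgam]; ring
  have t5 : Est μ (fun ω => (8 * β - 8 * egam μ X L L ℓ) * N ω) 0 0 :=
    (Est.const_mul ⟨iN, le_of_eq (by rw [hN, hP.integral_mav, sub_zero, abs_zero])⟩ _).mono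
      (by simp)
  have t6 : Est μ (fun ω => 2 * β * g ω) 0 0 :=
    (Est.const_mul (a := 0) (e := 0) ⟨bg.integrable (by norm_num),
      le_of_eq (by rw [hP.integral_cgam, sub_zero, abs_zero])⟩ _).mono (by simp)
  have t7 : Est μ (fun ω => -(2 * ℓ) * (g ω * M ω * M ω)) 0 (2 * |K| * D₅ * ε ^ 8) := by
    refine (Est.const_mul (a := 0) (e := D₅ * ε ^ 10) ⟨?_, ?_⟩ _).mono ?_
    · simpa only [mul_assoc] using (four bg bM).integrable (by norm_num)
    · simpa using H₅ ε z n ℓ hr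
    · rw [mul_zero, sub_zero, abs_zero, zero_add, abs_neg, abs_of_pos (by positivity)]
      calc 2 * (ℓ : ℝ) * (D₅ * ε ^ 10) = 2 * (ℓ * ε ^ 2) * (D₅ * ε ^ 8) := by ring
        _ ≤ 2 * |K| * (D₅ * ε ^ 8) := by gcongr
        _ = _ := by ring
  have t8 : Est μ (fun ω => -(8 * ℓ) * (M ω * M ω * N ω)) 0 (8 * |K| * D₆ * ε ^ 8) := by
    refine (Est.const_mul (a := 0) (e := D₆ * ε ^ 10) ⟨?_, ?_⟩ _).mono ?_
    · exact (four bM bN).integrable (by norm_num)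
    · simpa using H₆ ε z n ℓ hr
    · rw [mul_zero, sub_zero, abs_zero, zero_add, abs_neg, abs_of_pos (by positivity)]
      calc 8 * (ℓ : ℝ) * (D₆ * ε ^ 10) = 8 * (ℓ * ε ^ 2) * (D₆ * ε ^ 8) := by ring
        _ ≤ 8 * |K| * (D₆ * ε ^ 8) := by gcongr
        _ = _ := by ring
  have t9 : Est μ (fun ω => (ℓ : ℝ) ^ 2 * ((M ω * M ω) * (M ω * M ω))) 0
      (|K| ^ 2 * C₂ ^ 2 * ε ^ 8) := by
    refine ((Est.of_bd (four bM bM) (by norm_num)).const_mul _).mono ?_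
    rw [mul_zero, sub_zero, abs_zero, zero_add, abs_of_pos (by positivity)]
    calc (ℓ : ℝ) ^ 2 * (C₂ * ε ^ 6 * (C₂ * ε ^ 6)) = (ℓ * ε ^ 2) ^ 2 * (C₂ ^ 2 * ε ^ 8) := by ring
      _ ≤ |K| ^ 2 * (C₂ ^ 2 * ε ^ 8) := by gcongr
      _ = _ := by ring
  have t10 : Est μ (fun ω => 8 * (g ω * W ω)) 0 (8 * S * ε ^ 8) :=
    ((hS ε z n ℓ hr).2.const_mul 8).mono (by norm_num; linarith)
  have t11 : Est μ (fun ω => 8 * β * W ω) 0 (8 * E * S * ε ^ 8) := by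
    refine ((hS ε z n ℓ hr).1.const_mul _).mono ?_
    rw [mul_zero, sub_zero, abs_zero, zero_add, abs_mul, show |(8 : ℝ)| = 8 by norm_num]
    calc 8 * |β| * (S * ε ^ 6) ≤ 8 * (E * ε ^ 2) * (S * ε ^ 6) := by gcongr
      _ = _ := by ring
  have t12 : Est μ (fun ω => -(8 * ℓ) * (M ω * M ω * W ω)) 0 (8 * |K| * (C₂ * C₄) * ε ^ 8) := by
    refine ((Est.of_bd (two (m2 bM) bW) (by norm_num)).const_mul _).mono ?_
    rw [mul_zero, sub_zero, abs_zero, zero_add, abs_neg, abs_of_pos (by positivity)]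
    calc 8 * (ℓ : ℝ) * (C₂ * ε ^ 6 * (C₄ * ε ^ 5)) = 8 * (ℓ * ε ^ 2) * (C₂ * C₄ * ε ^ 9) := by ring
      _ ≤ 8 * |K| * (C₂ * C₄ * ε ^ 8) := by gcongr ?_ * (_ * ?_); exacts [by gcongr, pw 9 (by norm_num)]
      _ = _ := by ring
  have t13 : Est μ (fun ω => 32 * (N ω * W ω)) 0 (32 * (C₃ * C₄) * ε ^ 8) :=
    ((Est.of_bd (two (m2 bN) bW) (by norm_num)).const_mul 32).mono
      (le_of_eq (by norm_num; ring))
  have t14 : Est μ (fun ω => 16 * (W ω * W ω)) 0 (16 * C₄ ^ 2 * ε ^ 8) := by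
    refine ((Est.of_bd (two bW bW) (by norm_num)).const_mul 16).mono ?_
    have h1 := mul_le_mul_of_nonneg_left (pw 10 (by norm_num)) (sq_nonneg C₄)
    norm_num
    linarith
  have hR' : Bd μ 2 (|CR| * ε ^ 6) R := hR.mono_const (by gcongr; exact le_abs_self _)
  have t15 : Est μ (fun ω => 2 * (P ω * R ω)) 0 (2 * (C₅ * |CR|) * ε ^ 8) :=
    ((Est.of_bd (two (m2 bP) hR') (by norm_num)).const_mul 2).mono
      (le_of_eq (by norm_num; ring))
  have t16 : Est μ (fun ω => R ω * R ω) 0 (CR ^ 2 * ε ^ 8) := by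
    refine (Est.of_bd (two hR' hR') (by norm_num)).mono ?_
    have h1 := mul_le_mul_of_nonneg_left (pw 12 (by norm_num)) (sq_nonneg CR)
    rw [sub_zero, abs_zero, zero_add, ← sq_abs CR]
    rw [← sq_abs CR] at h1
    linarith
  have t17 : Est μ (fun _ => β ^ 2) (B ^ 2 / (ℓ : ℝ) ^ 2) (E * (E + 2 * |B| * |K|) * ε ^ 8) := by
    refine ⟨integrable_const _, ?_⟩
    rw [integral_const, probReal_univ, one_smul, ← div_pow, sq_sub_sq, abs_mul, mul_comm]
    have h1 : |β - B / ℓ| ≤ E + 2 * |B| * |K| := by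
      have h2 := abs_sub (β + B / ℓ) (2 * (B / ℓ))
      rw [show β + B / ℓ - 2 * (B / ℓ) = β - B / ℓ by ring, abs_mul, abs_two, abs_div,
        abs_of_pos hl] at h2
      have h3 : |B| / ℓ ≤ |B| * |K| := by
        rw [div_eq_mul_one_div]
        refine mul_le_mul_of_nonneg_left (hr.lower.trans ?_) (abs_nonneg B)
        calc K * ε ^ 2 ≤ K * 1 := by gcongr; exact pow_le_one₀ e.le hr.le_one
          _ ≤ |K| := by rw [mul_one]; exact le_abs_self K
      have h4 : E * ε ^ 8 ≤ E * 1 := mul_le_mul_of_nonneg_left (pow_le_one₀ e.le hr.le_one) hE0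
      linarith
    calc |β - B / ℓ| * |β + B / ℓ| ≤ (E + 2 * |B| * |K|) * (E * ε ^ 8) := by gcongr
      _ = _ := by ring
  have total := ((((((((((((((((t1.add t17).add t9).add t2).add t3).add t4).add t7).add t8).add
    t10).add t11).add t12).add t13).add t14).add t15).add t16).add t5).add t6)
  refine ((total.congr (g := fun ω => (P ω + R ω) ^ 2) fun ω => ?_).mono
    (b := B ^ 2 / (ℓ : ℝ) ^ 2 + 4 / 3 * elim μ X L L ^ 2 * (ℓ / n) +
      (F₁ z n + 16 * F₂ z n + 8 * F₄ z n + 2 * B * F₃ z n)) ?_).le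
  · have h1 := mainP_eq (μ := μ) (X := X) L q z n ℓ ω
    rw [← hPdef, ← hg, ← hβ, ← hM, ← hN, ← hW] at h1
    have h2 : gam μ X L L z n ℓ ω = g ω + egam μ X L L ℓ := by rw [hg, cgam]; ring
    rw [h2]
    linear_combination (P ω + (g ω + β - ℓ * (M ω * M ω) + 4 * N ω + 4 * W ω)) * h1
  · rw [show ∀ x y : ℝ, |x - y| = |x - y - 0| from fun x y => by rw [sub_zero]]
    refine le_of_eq ?_
    rw [show (4 / 3 * elim μ X L L ^ 2 * (ℓ / n) + F₁ z n + B ^ 2 / (ℓ : ℝ) ^ 2 + 0 + 16 * F₂ z n +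
      2 * B * F₃ z n + 8 * F₄ z n + 0 + 0 + 0 + 0 + 0 + 0 + 0 + 0 + 0 + 0 + 0 -
      (B ^ 2 / (ℓ : ℝ) ^ 2 + 4 / 3 * elim μ X L L ^ 2 * (ℓ / n) +
      (F₁ z n + 16 * F₂ z n + 8 * F₄ z n + 2 * B * F₃ z n)) - 0) = 0 by ring, abs_zero]
    ring

/-- Average of a function over a finite type. -/
def favg {ι : Type*} [Fintype ι] (u : ι → ℝ) : ℝ := (∑ i, u i) / (Fintype.card ι : ℝ)

section Favg

variable {ι : Type*} [Fintype ι]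

lemma favg_add (u v : ι → ℝ) : favg (fun i => u i + v i) = favg u + favg v := by
  simp only [favg, sum_add_distrib, add_div]

lemma favg_sub (u v : ι → ℝ) : favg (fun i => u i - v i) = favg u - favg v := by
  simp only [favg, sum_sub_distrib, sub_div]

lemma favg_mul (c : ℝ) (u : ι → ℝ) : favg (fun i => c * u i) = c * favg u := by
  simp only [favg, ← mul_sum, mul_div_assoc]

lemma favg_mul_const (u : ι → ℝ) (c : ℝ) : favg (fun i => u i * c) = favg u * c := by
  simp only [mul_comm _ c, favg_mul]

lemma favg_sum {κ : Type*} (s : Finset κ) (u : κ → ι → ℝ) :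
    favg (fun i => ∑ k ∈ s, u k i) = ∑ k ∈ s, favg (u k) := by
  simp only [favg]
  rw [sum_comm, sum_div]

lemma favg_const [Nonempty ι] (c : ℝ) : favg (fun _ : ι => c) = c := by
  have : (Fintype.card ι : ℝ) ≠ 0 := by exact_mod_cast Fintype.card_ne_zero
  simp only [favg, sum_const, card_univ, nsmul_eq_mul]
  field_simp

lemma favg_mono {u v : ι → ℝ} (h : ∀ i, u i ≤ v i) : favg u ≤ favg v := by
  simp only [favg]
  gcongr with i
  exact h i

lemma favg_nonneg {u : ι → ℝ} (h : ∀ i, 0 ≤ u i) : 0 ≤ favg u :=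
  div_nonneg (sum_nonneg fun i _ => h i) (by positivity)

/-- Variance under the uniform distribution on a finite type. -/
def fvar (u : ι → ℝ) : ℝ := favg (fun i => u i ^ 2) - favg u ^ 2

lemma fvar_eq_favg [Nonempty ι] (u : ι → ℝ) : fvar u = favg fun i => (u i - favg u) ^ 2 := by
  have : (fun i => (u i - favg u) ^ 2) = fun i => u i ^ 2 - 2 * favg u * u i + favg u ^ 2 := by
    funext i; ring
  rw [this, favg_add, favg_sub, favg_mul, favg_const, fvar]
  ring

lemma fvar_nonneg [Nonempty ι] (u : ι → ℝ) : 0 ≤ fvar u := by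
  rw [fvar_eq_favg]
  exact favg_nonneg fun i => sq_nonneg _

lemma fvar_le (u : ι → ℝ) : fvar u ≤ favg fun i => u i ^ 2 := by
  rw [fvar]; linarith [sq_nonneg (favg u)]

/-- Covariance under the uniform distribution on a finite type. -/
def fcov (u v : ι → ℝ) : ℝ := favg (fun i => u i * v i) - favg u * favg v

lemma fvar_add (u v : ι → ℝ) : fvar (fun i => u i + v i) = fvar u + 2 * fcov u v + fvar v := by
  have : (fun i => (u i + v i) ^ 2) = fun i => u i ^ 2 + 2 * (u i * v i) + v i ^ 2 := by
    funext i; ring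
  rw [fvar, this, favg_add, favg_add, favg_mul, favg_add, fvar, fcov, fvar]
  ring

lemma fvar_const_mul (c : ℝ) (u : ι → ℝ) : fvar (fun i => c * u i) = c ^ 2 * fvar u := by
  have : (fun i => (c * u i) ^ 2) = fun i => c ^ 2 * u i ^ 2 := by funext i; ring
  rw [fvar, this, favg_mul, favg_mul, fvar]; ring

lemma fvar_const_add [Nonempty ι] (c : ℝ) (u : ι → ℝ) : fvar (fun i => c + u i) = fvar u := by
  simp only [fvar_eq_favg, favg_add, favg_const, add_sub_add_left_eq_sub]

lemma fcov_const_mul (c : ℝ) (u v : ι → ℝ) : fcov u (fun i => c * v i) = c * fcov u v := by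
  have : (fun i => u i * (c * v i)) = fun i => c * (u i * v i) := by funext i; ring
  rw [fcov, this, favg_mul, favg_mul, fcov]; ring

lemma fcov_add (u v w : ι → ℝ) : fcov u (fun i => v i + w i) = fcov u v + fcov u w := by
  simp only [fcov, mul_add, favg_add]; ring

lemma fcov_sum {κ : Type*} (s : Finset κ) (u : ι → ℝ) (v : κ → ι → ℝ) :
    fcov u (fun i => ∑ k ∈ s, v k i) = ∑ k ∈ s, fcov u (v k) := by
  simp only [fcov, mul_sum, favg_sum, sum_sub_distrib]

lemma abs_two_fcov_le [Nonempty ι] (u v : ι → ℝ) {δ : ℝ} (hδ : 0 < δ) :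
    |2 * fcov u v| ≤ δ * favg (fun i => u i ^ 2) + δ⁻¹ * favg fun i => v i ^ 2 := by
  have h1 := fvar_nonneg fun i => δ * u i + v i
  have h2 := fvar_nonneg fun i => δ * u i + (-1) * v i
  rw [fvar_add, fvar_const_mul] at h1 h2
  rw [fcov_const_mul, fvar_const_mul] at h2
  have e : fcov (fun i => δ * u i) v = δ * fcov u v := by
    have : (fun i => δ * u i * v i) = fun i => δ * (u i * v i) := by funext i; ring
    rw [fcov, this, favg_mul, favg_mul, fcov]; ring
  rw [e] at h1 h2
  have h3 : δ * |2 * fcov u v| ≤ δ * (δ * fvar u + δ⁻¹ * fvar v) := by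
    rw [mul_add, ← mul_assoc, ← mul_assoc, mul_inv_cancel₀ hδ.ne', one_mul, ← abs_of_pos hδ,
      ← abs_mul, abs_of_pos hδ, abs_le]
    constructor <;> nlinarith
  have h4 := le_of_mul_le_mul_left h3 hδ
  have h5 := mul_le_mul_of_nonneg_left (fvar_le u) hδ.le
  have h6 := mul_le_mul_of_nonneg_left (fvar_le v) (inv_pos.2 hδ).le
  linarith

lemma favg_pow_mul_favg_sq_le [Nonempty ι] (c : ι → ℝ) (q : ℕ) :
    favg (fun i => c i ^ (2 * q)) * favg (fun i => c i ^ 2) ≤ favg fun i => c i ^ (2 * q + 2) := by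
  have hm : Monovary (fun i => c i ^ (2 * q)) (fun i => c i ^ 2) := fun i j hij => by
    simp only [pow_mul]
    exact pow_le_pow_left₀ (sq_nonneg _) hij.le q
  have h := hm.sum_mul_sum_le_card_mul_sum
  have hc : (0 : ℝ) < Fintype.card ι := by exact_mod_cast Fintype.card_pos
  simp only [favg, pow_add]
  rw [div_mul_div_comm, div_le_div_iff₀ (by positivity) hc]
  nlinarith

lemma favg_succ {k : ℕ} (F : (Fin (k + 1) → ι) → ℝ) :
    favg F = favg fun i => favg fun f : Fin k → ι => F (Fin.cons i f) := by
  have h : ∑ f, F f = ∑ i, ∑ f : Fin k → ι, F (Fin.cons i f) := by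
    rw [← Fintype.sum_prod_type', ← (Fin.consEquiv fun _ : Fin (k + 1) => ι).sum_comp]
    rfl
  simp only [favg, h, ← sum_div, div_div, Fintype.card_fun, Fintype.card_fin]
  push_cast
  rw [pow_succ]

/-- Sum of the values of `u` at the coordinates of `f`. -/
def fsum (u : ι → ℝ) {k : ℕ} (f : Fin k → ι) : ℝ := ∑ a, u (f a)

lemma fsum_cons (u : ι → ℝ) {k : ℕ} (i : ι) (f : Fin k → ι) :
    fsum u (Fin.cons i f : Fin (k + 1) → ι) = u i + fsum u f := by
  simp [fsum, Fin.sum_univ_succ]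

variable [Nonempty ι]

lemma favg_fsum (u : ι → ℝ) (k : ℕ) : favg (fsum u (k := k)) = k * favg u := by
  induction k with
  | zero => simp [favg, fsum]
  | succ k ih =>
    rw [favg_succ]
    simp only [fsum_cons, favg_add, favg_const]
    rw [ih]
    push_cast; ring

lemma favg_fsum_mul {u v : ι → ℝ} (hu : favg u = 0) (hv : favg v = 0) (k : ℕ) :
    favg (fun f : Fin k → ι => fsum u f * fsum v f) = k * favg fun i => u i * v i := by
  induction k with
  | zero => simp [favg, fsum]
  | succ k ih =>
    have e : ∀ (i : ι) (f : Fin k → ι), (u i + fsum u f) * (v i + fsum v f) =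
        u i * v i + u i * fsum v f + v i * fsum u f + fsum u f * fsum v f := fun i f => by ring
    rw [favg_succ]
    simp only [fsum_cons, e, favg_add, favg_const, favg_mul]
    rw [favg_fsum, favg_fsum, ih]
    simp only [hu, hv, mul_zero, favg_const]
    push_cast; ring

lemma favg_fsum_triple {u v w : ι → ℝ} (hu : favg u = 0) (hv : favg v = 0) (hw : favg w = 0)
    (k : ℕ) : favg (fun f : Fin k → ι => fsum u f * (fsum v f * fsum w f)) =
      k * favg fun i => u i * (v i * w i) := by
  induction k with
  | zero => simp [favg, fsum]
  | succ k ih =>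
    have e : ∀ (i : ι) (f : Fin k → ι), (u i + fsum u f) * ((v i + fsum v f) * (w i + fsum w f)) =
        u i * (v i * w i) + (u i * v i) * fsum w f + (u i * w i) * fsum v f +
        (v i * w i) * fsum u f + u i * (fsum v f * fsum w f) + v i * (fsum u f * fsum w f) +
        w i * (fsum u f * fsum v f) + fsum u f * (fsum v f * fsum w f) := fun i f => by ring
    rw [favg_succ]
    simp only [fsum_cons, e, favg_add, favg_const, favg_mul]
    rw [favg_fsum, favg_fsum, favg_fsum, ih, favg_fsum_mul hv hw, favg_fsum_mul hu hw, favg_fsum_mul hu hv]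
    simp only [hu, hv, hw, mul_zero, favg_const, mul_comm _ (_ * favg _), favg_mul]
    push_cast; ring

lemma add_pow_le_expand (q : ℕ) : ∃ C : ℝ, 0 ≤ C ∧ ∀ x c : ℝ, (x + c) ^ (2 * q + 2) ≤
      x ^ (2 * q + 2) + ((2 * q + 2 : ℕ) * x ^ (2 * q + 1)) * c +
        C * (x ^ (2 * q) * c ^ 2 + c ^ (2 * q + 2)) := by
  refine ⟨∑ j ∈ range (2 * q + 1), ((2 * q + 2).choose (j + 2) : ℝ), by positivity,
    fun x c => ?_⟩
  have hev : ∀ y : ℝ, ∀ j, y ^ (2 * j) = |y| ^ (2 * j) := fun y j => by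
    rw [pow_mul, pow_mul, sq_abs]
  have hj : ∀ j ∈ range (2 * q + 1), c ^ (j + 2) * x ^ (2 * q + 2 - (j + 2)) ≤
      x ^ (2 * q) * c ^ 2 + c ^ (2 * q + 2) := fun j hj => by
    have hj : j ≤ 2 * q := by simpa [Nat.lt_succ_iff] using hj
    have h0 : c ^ (j + 2) * x ^ (2 * q + 2 - (j + 2)) ≤
        |c| ^ j * |x| ^ (2 * q - j) * |c| ^ 2 := by
      refine (le_abs_self _).trans (le_of_eq ?_)
      rw [abs_mul, abs_pow, abs_pow, show 2 * q + 2 - (j + 2) = 2 * q - j by omega]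
      ring
    refine h0.trans ?_
    have e1 : c ^ (2 * q + 2) = |c| ^ (2 * q) * |c| ^ 2 := by
      rw [pow_add, hev, sq_abs]
    rw [e1, hev, ← sq_abs c, ← add_mul]
    refine mul_le_mul_of_nonneg_right ?_ (by positivity)
    rcases le_total |c| |x| with h | h
    · calc |c| ^ j * |x| ^ (2 * q - j) ≤ |x| ^ j * |x| ^ (2 * q - j) := by gcongr
        _ = |x| ^ (2 * q) := by rw [← pow_add]; congr 1; omega
        _ ≤ _ := le_add_of_nonneg_right (by positivity)
    · calc |c| ^ j * |x| ^ (2 * q - j) ≤ |c| ^ j * |c| ^ (2 * q - j) := by gcongr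
        _ = |c| ^ (2 * q) := by rw [← pow_add]; congr 1; omega
        _ ≤ _ := le_add_of_nonneg_left (by positivity)
  rw [add_comm x c, add_pow, sum_range_succ', sum_range_succ', sum_mul]
  have := sum_le_sum fun j h => mul_le_mul_of_nonneg_left (hj j h)
    (Nat.cast_nonneg (α := ℝ) ((2 * q + 2).choose (j + 2)))
  have e : ∑ j ∈ range (2 * q + 1),
      c ^ (j + 1 + 1) * x ^ (2 * q + 2 - (j + 1 + 1)) * ((2 * q + 2).choose (j + 1 + 1) : ℝ) =
      ∑ j ∈ range (2 * q + 1), ((2 * q + 2).choose (j + 2) : ℝ) *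
        (c ^ (j + 2) * x ^ (2 * q + 2 - (j + 2))) :=
    sum_congr rfl fun j _ => by ring
  rw [e]
  simp only [zero_add, Nat.choose_one_right, Nat.choose_zero_right, pow_zero, pow_one,
    Nat.sub_zero, Nat.cast_one, one_mul, mul_one]
  rw [show 2 * q + 2 - 1 = 2 * q + 1 by omega]
  linarith

/-- Moments of sums of independent centered variables, uniformly distributed on a finite type. -/
lemma exists_favg_fsum_pow_le (q : ℕ) : ∃ B : ℝ, 0 ≤ B ∧
    ∀ {ι : Type} [Fintype ι] [Nonempty ι] (c : ι → ℝ) (_ : favg c = 0) (k : ℕ),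
      favg (fun f : Fin k → ι => fsum c f ^ (2 * q)) ≤ B * k ^ q * favg fun i => c i ^ (2 * q) := by
  induction q with
  | zero =>
    refine ⟨1, by norm_num, fun c _ k => ?_⟩
    simp only [mul_zero, pow_zero, favg_const, mul_one, le_refl]
  | succ q ih =>
    obtain ⟨B, hB, ih⟩ := ih
    obtain ⟨C, hC, hx⟩ := add_pow_le_expand q
    refine ⟨C * (B + 1), by positivity, fun {ι} _ _ c hc k => ?_⟩
    rw [show 2 * (q + 1) = 2 * q + 2 by ring]
    set M := favg fun i => c i ^ (2 * q + 2) with hM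
    have hM0 : 0 ≤ M := favg_nonneg fun i => by
      rw [show 2 * q + 2 = 2 * (q + 1) by ring, pow_mul]; positivity
    induction k with
    | zero => simp [favg, fsum]
    | succ k ihk =>
      have h1 : favg (fun f : Fin (k + 1) → ι => fsum c f ^ (2 * q + 2)) ≤
          favg (fun f : Fin k → ι => fsum c f ^ (2 * q + 2)) +
          C * (favg (fun f : Fin k → ι => fsum c f ^ (2 * q)) * favg (fun i => c i ^ 2) + M) := by
        rw [favg_succ]
        refine (favg_mono fun i => favg_mono fun f => ?_).trans (le_of_eq (a := favg fun i : ι =>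
          favg fun f : Fin k → ι => fsum c f ^ (2 * q + 2) +
          c i * ((2 * q + 2 : ℕ) * fsum c f ^ (2 * q + 1)) +
          C * (c i ^ 2 * fsum c f ^ (2 * q) + c i ^ (2 * q + 2))) ?_)
        · have := hx (fsum c f) (c i)
          rw [fsum_cons, add_comm (c i)]
          linarith
        · simp only [favg_add, favg_mul, favg_mul_const, favg_const, hc]
          rw [hM]; ring
      have h2 : favg (fun f : Fin k → ι => fsum c f ^ (2 * q)) * favg (fun i => c i ^ 2) ≤
          B * k ^ q * M := by
        refine (mul_le_mul_of_nonneg_right (ih c hc k) (favg_nonneg fun i => sq_nonneg _)).trans ?_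
        rw [mul_assoc]
        exact mul_le_mul_of_nonneg_left (favg_pow_mul_favg_sq_le c q) (by positivity)
      have h3 : (k : ℝ) ^ q ≤ ((k : ℝ) + 1) ^ q := by gcongr; linarith
      have h4 : (1 : ℝ) ≤ ((k : ℝ) + 1) ^ q := one_le_pow₀ (by linarith [Nat.cast_nonneg (α := ℝ) k])
      have h5 : (k : ℝ) ^ (q + 1) ≤ k * ((k : ℝ) + 1) ^ q := by
        rw [pow_succ']; gcongr
      calc favg (fun f : Fin (k + 1) → ι => fsum c f ^ (2 * q + 2))
          ≤ C * (B + 1) * k ^ (q + 1) * M + C * (B * k ^ q * M + M) :=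
            h1.trans (add_le_add ihk (mul_le_mul_of_nonneg_left (by linarith) hC))
        _ ≤ C * (B + 1) * (k * ((k : ℝ) + 1) ^ q) * M +
            C * (B * ((k : ℝ) + 1) ^ q * M + ((k : ℝ) + 1) ^ q * M) := by
            have : M ≤ ((k : ℝ) + 1) ^ q * M := le_mul_of_one_le_left hM0 h4
            gcongr
        _ = _ := by push_cast; ring

end Favg

lemma norm_le_of_norm_fderiv_le {E F : Type*} [NormedAddCommGroup E] [NormedSpace ℝ E]
    [NormedAddCommGroup F] [NormedSpace ℝ F] {f : E → F} {f' : E → E →L[ℝ] F} {r M : ℝ}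
    (hf : ∀ x, HasFDerivAt f (f' x) x) (h : ∀ x, ‖x‖ ≤ r → ‖f' x‖ ≤ M) (h0 : f 0 = 0)
    {x : E} (hx : ‖x‖ ≤ r) : ‖f x‖ ≤ M * ‖x‖ := by
  have := (convex_closedBall (0 : E) r).norm_image_sub_le_of_norm_hasFDerivWithin_le
    (fun y _ => (hf y).hasFDerivWithinAt) (fun y hy => h y (by simpa using hy))
    (show (0 : E) ∈ Metric.closedBall 0 r by simpa using (norm_nonneg x).trans hx)
    (show x ∈ Metric.closedBall 0 r by simpa using hx)
  simpa [h0] using this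

/-- Rows of the symmetrized second derivative, scaled by one half. -/
def qrow (H : (Fin d → ℝ) → ℝ) (c : Fin d → ℝ) (k : Fin d) : LinForm d :=
  (1 / 2 : ℝ) • (fderiv ℝ (fderiv ℝ H) c) (Pi.single k 1)

lemma isSymmSndFDerivAt_of_contDiff {H : (Fin d → ℝ) → ℝ} (hH : ContDiff ℝ 3 H) (c : Fin d → ℝ) :
    IsSymmSndFDerivAt ℝ H c :=
  hH.contDiffAt.isSymmSndFDerivAt (by rw [minSmoothness_of_isRCLikeNormedField]; norm_num)

lemma sum_qrow {H : (Fin d → ℝ) → ℝ} (hH : ContDiff ℝ 3 H) (c x y : Fin d → ℝ) :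
    ∑ k, qrow H c k x * y k = 1 / 2 * fderiv ℝ (fderiv ℝ H) c x y := by
  rw [(isSymmSndFDerivAt_of_contDiff hH c).eq x y]
  conv_rhs => rw [← univ_sum_single y]
  rw [map_sum, ContinuousLinearMap.sum_apply, mul_sum]
  refine sum_congr rfl fun k _ => ?_
  have : Pi.single k (y k) = y k • (Pi.single k 1 : Fin d → ℝ) := by
    rw [← Pi.single_smul, smul_eq_mul, mul_one]
  rw [this, map_smul]
  simp only [qrow, ContinuousLinearMap.smul_apply, smul_eq_mul]
  ring

lemma sum_qrow_symm {H : (Fin d → ℝ) → ℝ} (hH : ContDiff ℝ 3 H) (c x y : Fin d → ℝ) :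
    ∑ k, qrow H c k x * y k = ∑ k, qrow H c k y * x k := by
  rw [sum_qrow hH, sum_qrow hH, (isSymmSndFDerivAt_of_contDiff hH c).eq x y]

set_option maxSynthPendingDepth 3 in
set_option synthInstance.maxHeartbeats 200000 in
/-- Second order Taylor expansion with a polynomially growing remainder. -/
lemma taylor_remainder_le {H : (Fin d → ℝ) → ℝ} {a₀ : ℕ} (hD : CondD H a₀) (c : Fin d → ℝ) :
    ∃ C, 0 ≤ C ∧ ∀ x, |H (c + x) - (H c + fderiv ℝ H c x + ∑ k, qrow H c k x * x k)| ≤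
      C * (‖x‖ ^ 3 + ‖x‖ ^ (3 + a₀)) := by
  obtain ⟨hH, C, hC, hb⟩ := hD
  have hH1 : ContDiff ℝ 2 (fderiv ℝ H) := hH.fderiv_right (by norm_num)
  have hH2 : ContDiff ℝ 1 (fderiv ℝ (fderiv ℝ H)) := hH1.fderiv_right (by norm_num)
  have hb3 : ∀ x, ‖fderiv ℝ (fderiv ℝ (fderiv ℝ H)) x‖ ≤ C * (1 + ‖x‖ ^ a₀) := fun x => by
    have := hb x
    rwa [← norm_iteratedFDeriv_fderiv, ← norm_iteratedFDeriv_fderiv, norm_iteratedFDeriv_one] at this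
  refine ⟨C * (2 + (2 * (‖c‖ + 1)) ^ a₀), by positivity, fun x => ?_⟩
  set r := ‖x‖ with hr
  set M := C * (1 + (‖c‖ + r) ^ a₀) with hM
  have hr0 : 0 ≤ r := norm_nonneg x
  set B := fderiv ℝ (fderiv ℝ H) c with hB
  have d0 : ∀ y, HasFDerivAt H (fderiv ℝ H y) y := fun y =>
    (hH.differentiable (by norm_num) y).hasFDerivAt
  have d1 : ∀ y, HasFDerivAt (fderiv ℝ H) (fderiv ℝ (fderiv ℝ H) y) y := fun y =>
    (hH1.differentiable (by norm_num) y).hasFDerivAt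
  have d2 : ∀ y, HasFDerivAt (fderiv ℝ (fderiv ℝ H)) (fderiv ℝ (fderiv ℝ (fderiv ℝ H)) y) y :=
    fun y => (hH2.differentiable (by norm_num) y).hasFDerivAt
  have s2 : ∀ y, ‖y‖ ≤ r → ‖fderiv ℝ (fderiv ℝ H) (c + y) - B‖ ≤ M * r := fun y hy => by
    refine (norm_le_of_norm_fderiv_le (r := r) (M := M)
      (f := fun y => fderiv ℝ (fderiv ℝ H) (c + y) - B)
      (fun y => ((hasFDerivAt_comp_add_left c).2 (d2 (c + y))).sub_const B) (fun z hz => ?_) (by simp [hB])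
      hy).trans (mul_le_mul_of_nonneg_left hy (by positivity))
    refine (hb3 _).trans ?_
    rw [hM]
    gcongr
    exact (norm_add_le _ _).trans (by linarith)
  have s1 : ∀ y, ‖y‖ ≤ r → ‖fderiv ℝ H (c + y) - fderiv ℝ H c - B y‖ ≤ M * r * r := fun y hy =>
    (norm_le_of_norm_fderiv_le (r := r) (M := M * r)
      (f := fun y => fderiv ℝ H (c + y) - fderiv ℝ H c - B y)
      (fun y => (((hasFDerivAt_comp_add_left c).2 (d1 (c + y))).sub_const _).sub B.hasFDerivAt) s2 (by simp)
      hy).trans (mul_le_mul_of_nonneg_left hy (by positivity))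
  have hQ : ∀ y, HasFDerivAt (fun y => ∑ k, qrow H c k y * y k) (B y) y := fun y => by
    simp only [sum_qrow hH, ← hB]
    have h1 : HasFDerivAt (fun y => B y y) (B y + B.flip y) y := by
      have := B.hasFDerivAt.clm_apply (hasFDerivAt_id y) (x := y)
      refine this.congr_fderiv ?_
      ext z; simp
    refine (h1.const_mul (1 / 2 : ℝ)).congr_fderiv ?_
    ext z
    have := (isSymmSndFDerivAt_of_contDiff hH c).eq z y
    rw [← hB] at this
    simp [this]
    ring
  have s0 := norm_le_of_norm_fderiv_le (r := r) (M := M * r * r)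
      (f := fun y => H (c + y) - (H c + fderiv ℝ H c y + ∑ k, qrow H c k y * y k))
      (f' := fun y => fderiv ℝ H (c + y) - fderiv ℝ H c - B y)
      (fun y => (((hasFDerivAt_comp_add_left c).2 (d0 (c + y))).sub
        ((((fderiv ℝ H c).hasFDerivAt).const_add _).add (hQ y))).congr_fderiv (by abel)) s1
      (by simp) (x := x) le_rfl
  rw [Real.norm_eq_abs] at s0
  refine s0.trans ?_
  have h5 : (‖c‖ + r) ^ a₀ ≤ (2 * (‖c‖ + 1)) ^ a₀ * (1 + r ^ a₀) := by
    have hc := norm_nonneg c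
    have : (‖c‖ + r) ≤ (2 * (‖c‖ + 1)) * max 1 r := by
      have h1 := le_max_left 1 r
      have h2 := le_max_right 1 r
      nlinarith
    calc (‖c‖ + r) ^ a₀ ≤ ((2 * (‖c‖ + 1)) * max 1 r) ^ a₀ := by gcongr
      _ = (2 * (‖c‖ + 1)) ^ a₀ * (max 1 r) ^ a₀ := mul_pow _ _ _
      _ ≤ _ := by
        gcongr
        rcases max_cases 1 r with h | h <;> rw [h.1]
        · rw [one_pow]; have := pow_nonneg hr0 a₀; linarith
        · linarith
  have h6 : 0 ≤ r ^ a₀ := by positivity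
  calc M * r * r * ‖x‖ = C * (1 + (‖c‖ + r) ^ a₀) * r ^ 3 := by rw [← hr, hM]; ring
    _ ≤ C * (1 + (2 * (‖c‖ + 1)) ^ a₀ * (1 + r ^ a₀)) * r ^ 3 := by gcongr
    _ ≤ C * ((2 + (2 * (‖c‖ + 1)) ^ a₀) * (1 + r ^ a₀)) * r ^ 3 := by gcongr; nlinarith
    _ = _ := by ring

section Resample

variable {ι : Type} [Fintype ι] [Nonempty ι] {k : ℕ}

/-- Mean of the vectors `v` selected by `f`. -/
def zvec (v : ι → Fin d → ℝ) (f : Fin k → ι) : Fin d → ℝ := (k : ℝ)⁻¹ • ∑ a, v (f a)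

variable {v : ι → Fin d → ℝ} {m : Fin d → ℝ}

lemma apply_zvec (hk : 1 ≤ k) (φ : LinForm d) (f : Fin k → ι) :
    φ (zvec v f) = φ m + (k : ℝ)⁻¹ * fsum (fun i => φ (v i) - φ m) f := by
  have : (k : ℝ) ≠ 0 := by exact_mod_cast (by omega : k ≠ 0)
  simp only [zvec, map_smul, map_sum, fsum, sum_sub_distrib, sum_const,
    card_univ, Fintype.card_fin, nsmul_eq_mul, smul_eq_mul]
  field_simp
  ring

lemma favg_center (hm : ∀ φ : LinForm d, favg (fun i => φ (v i)) = φ m)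
    (φ : LinForm d) : favg (fun i => φ (v i) - φ m) = 0 := by
  rw [favg_sub, favg_const, hm, sub_self]

lemma favg_center_mul (hm : ∀ φ : LinForm d, favg (fun i => φ (v i)) = φ m)
    (φ ψ : LinForm d) : favg (fun i => (φ (v i) - φ m) * (ψ (v i) - ψ m)) =
      favg (fun i => φ (v i) * ψ (v i)) - φ m * ψ m := by
  have : ∀ i, (φ (v i) - φ m) * (ψ (v i) - ψ m) =
      φ (v i) * ψ (v i) - φ m * ψ (v i) - ψ m * φ (v i) + φ m * ψ m := fun i => by ring
  simp only [this, favg_add, favg_sub, favg_mul, favg_const, hm]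
  ring

/-- Third central moment of the vectors `v` in the directions `φ`, `ψ`, `χ`. -/
def cen3 (v : ι → Fin d → ℝ) (m : Fin d → ℝ) (φ ψ χ : LinForm d) : ℝ :=
  favg (fun i => φ (v i) * (ψ (v i) * χ (v i))) - φ m * favg (fun i => ψ (v i) * χ (v i)) -
    ψ m * favg (fun i => φ (v i) * χ (v i)) - χ m * favg (fun i => φ (v i) * ψ (v i)) +
    2 * (φ m * (ψ m * χ m))

lemma favg_center_triple (hm : ∀ φ : LinForm d, favg (fun i => φ (v i)) = φ m) (φ ψ χ : LinForm d) :
    favg (fun i => (φ (v i) - φ m) * ((ψ (v i) - ψ m) * (χ (v i) - χ m))) = cen3 v m φ ψ χ := by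
  have : ∀ i, (φ (v i) - φ m) * ((ψ (v i) - ψ m) * (χ (v i) - χ m)) =
      φ (v i) * (ψ (v i) * χ (v i)) - φ m * (ψ (v i) * χ (v i)) - ψ m * (φ (v i) * χ (v i)) -
      χ m * (φ (v i) * ψ (v i)) + (ψ m * χ m) * φ (v i) + (φ m * χ m) * ψ (v i) +
      (φ m * ψ m) * χ (v i) - φ m * (ψ m * χ m) := fun i => by ring
  simp only [this, favg_add, favg_sub, favg_mul, favg_const, hm, cen3]
  ring

lemma fvar_zvec (hm : ∀ φ : LinForm d, favg (fun i => φ (v i)) = φ m) (hk : 1 ≤ k)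
    (φ : LinForm d) : k * fvar (fun f : Fin k → ι => φ (zvec v f)) =
      favg (fun i => φ (v i) * φ (v i)) - φ m * φ m := by
  have hk' : (k : ℝ) ≠ 0 := by exact_mod_cast (by omega : k ≠ 0)
  have h0 := favg_center hm φ
  simp only [apply_zvec (m := m) hk, fvar_const_add, fvar_const_mul]
  simp only [fvar, sq (fsum _ _)]
  rw [favg_fsum_mul h0 h0, show favg (fun f : Fin k → ι => fsum (fun i => φ (v i) - φ m) f) = _ from
    favg_fsum (fun i => φ (v i) - φ m) k, h0, favg_center_mul hm]
  field_simp
  ring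

lemma fcov_zvec (hm : ∀ φ : LinForm d, favg (fun i => φ (v i)) = φ m) (hk : 1 ≤ k)
    (φ ψ χ : LinForm d) :
    k * fcov (fun f : Fin k → ι => φ (zvec v f)) (fun f => ψ (zvec v f) * χ (zvec v f)) =
      ψ m * (favg (fun i => φ (v i) * χ (v i)) - φ m * χ m) +
      χ m * (favg (fun i => φ (v i) * ψ (v i)) - φ m * ψ m) + (k : ℝ)⁻¹ * cen3 v m φ ψ χ := by
  have hk' : (k : ℝ) ≠ 0 := by exact_mod_cast (by omega : k ≠ 0)
  have h1 := favg_center hm φ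
  have h2 := favg_center hm ψ
  have h3 := favg_center hm χ
  simp only [apply_zvec (m := m) hk]
  rw [← favg_center_mul hm, ← favg_center_mul hm, ← favg_center_triple hm]
  set a := fun i => φ (v i) - φ m
  set b := fun i => ψ (v i) - ψ m
  set c := fun i => χ (v i) - χ m
  have e1 : ∀ f : Fin k → ι, (φ m + (k : ℝ)⁻¹ * fsum a f) *
      ((ψ m + (k : ℝ)⁻¹ * fsum b f) * (χ m + (k : ℝ)⁻¹ * fsum c f)) =
      φ m * ((ψ m + (k : ℝ)⁻¹ * fsum b f) * (χ m + (k : ℝ)⁻¹ * fsum c f)) +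
      (k : ℝ)⁻¹ * ψ m * χ m * fsum a f +
      (k : ℝ)⁻¹ ^ 2 * ψ m * (fsum a f * fsum c f) + (k : ℝ)⁻¹ ^ 2 * χ m * (fsum a f * fsum b f) +
      (k : ℝ)⁻¹ ^ 3 * (fsum a f * (fsum b f * fsum c f)) := fun f => by ring
  have e2 : ∀ w : ι → ℝ, favg w = 0 → favg (fun f : Fin k → ι => fsum w f) = 0 := fun w hw => by
    rw [show (fun f : Fin k → ι => fsum w f) = fsum w from rfl, favg_fsum, hw, mul_zero]
  simp only [fcov, e1, favg_add _ _, favg_mul _ _, favg_const, favg_fsum_mul h1 h3,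
    favg_fsum_mul h1 h2, favg_fsum_triple h1 h2 h3, e2 a h1]
  field_simp
  ring

lemma exists_favg_norm_zvec_pow_le (d j : ℕ) (hj : j ≠ 0) : ∃ C : ℝ, 0 ≤ C ∧
    ∀ {ι : Type} [Fintype ι] [Nonempty ι] {k : ℕ} {v : ι → Fin d → ℝ} {m : Fin d → ℝ},
      (∀ φ : LinForm d, favg (fun i => φ (v i)) = φ m) → 1 ≤ k →
      favg (fun f : Fin k → ι => ‖zvec v f‖ ^ (2 * j)) ≤
        C * ∑ r, (m r ^ (2 * j) + (k : ℝ)⁻¹ ^ j * favg fun i => v i r ^ (2 * j)) := by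
  obtain ⟨B, hB, h⟩ := exists_favg_fsum_pow_le j
  have ev : Even (2 * j) := even_two_mul j
  have add_pow_le : ∀ x y : ℝ, (x + y) ^ (2 * j) ≤ 2 ^ (2 * j) * (x ^ (2 * j) + y ^ (2 * j)) :=
    fun x y => (ev.add_pow_le).trans (mul_le_mul_of_nonneg_right
      (pow_le_pow_right₀ (by norm_num) (by omega)) (add_nonneg (ev.pow_nonneg _) (ev.pow_nonneg _)))
  refine ⟨2 ^ (2 * j) * (1 + B * 2 ^ (2 * j) * 2), by positivity,
    fun {ι} _ _ {k v m} hm hk => ?_⟩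
  have hk' : (0 : ℝ) < k := by exact_mod_cast hk
  have hk1 : (k : ℝ)⁻¹ ≤ 1 := inv_le_one_of_one_le₀ (by exact_mod_cast hk)
  have h1 : ∀ f : Fin k → ι, ‖zvec v f‖ ^ (2 * j) ≤ ∑ r, (zvec v f r) ^ (2 * j) := fun f => by
    rcases isEmpty_or_nonempty (Fin d) with hd | hd
    · rw [Subsingleton.elim (zvec v f) 0, norm_zero, zero_pow (by omega)]; simp
    · obtain ⟨r, hr⟩ := Finite.exists_max fun r => ‖zvec v f r‖
      refine (pow_le_pow_left₀ (norm_nonneg _) ((pi_norm_le_iff_of_nonempty _).2 hr) _).trans ?_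
      rw [Real.norm_eq_abs, ev.pow_abs]
      exact single_le_sum (f := fun r => zvec v f r ^ (2 * j))
        (fun r _ => ev.pow_nonneg _) (mem_univ r)
  refine (favg_mono h1).trans ?_
  rw [favg_sum, mul_sum]
  refine sum_le_sum fun r _ => ?_
  have h0 := favg_center hm (coord r)
  set c := fun i => (coord r) (v i) - (coord r) m with hc
  have hz : ∀ f : Fin k → ι, zvec v f r = m r + (k : ℝ)⁻¹ * fsum c f := fun f =>
    apply_zvec hk (coord r) f
  have h2 : favg (fun i => c i ^ (2 * j)) ≤
      2 ^ (2 * j) * (favg (fun i => v i r ^ (2 * j)) + m r ^ (2 * j)) := by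
    refine (favg_mono fun i => (?_ : c i ^ (2 * j) ≤
      2 ^ (2 * j) * (v i r ^ (2 * j) + m r ^ (2 * j)))).trans (le_of_eq ?_)
    · have := add_pow_le (v i r) (-m r)
      rwa [ev.neg_pow, ← sub_eq_add_neg] at this
    · rw [favg_mul, favg_add, favg_const]
  have hm0 : 0 ≤ m r ^ (2 * j) := ev.pow_nonneg _
  have hv0 : 0 ≤ favg fun i => v i r ^ (2 * j) := favg_nonneg fun i => ev.pow_nonneg _
  calc favg (fun f : Fin k → ι => zvec v f r ^ (2 * j))
      ≤ favg (fun f : Fin k → ι => 2 ^ (2 * j) *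
          (m r ^ (2 * j) + (k : ℝ)⁻¹ ^ (2 * j) * fsum c f ^ (2 * j))) := favg_mono fun f => by
        rw [hz, ← mul_pow]; exact add_pow_le _ _
    _ = 2 ^ (2 * j) * (m r ^ (2 * j) +
        (k : ℝ)⁻¹ ^ (2 * j) * favg fun f : Fin k → ι => fsum c f ^ (2 * j)) := by
        rw [favg_mul, favg_add, favg_const, favg_mul]
    _ ≤ 2 ^ (2 * j) * (m r ^ (2 * j) + (k : ℝ)⁻¹ ^ (2 * j) * (B * k ^ j *
        (2 ^ (2 * j) * (favg (fun i => v i r ^ (2 * j)) + m r ^ (2 * j))))) := by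
        gcongr
        exact (h c h0 k).trans (mul_le_mul_of_nonneg_left h2 (by positivity))
    _ = 2 ^ (2 * j) * (m r ^ (2 * j) + B * 2 ^ (2 * j) *
        ((k : ℝ)⁻¹ ^ j * favg (fun i => v i r ^ (2 * j)) + (k : ℝ)⁻¹ ^ j * m r ^ (2 * j))) := by
        have : (k : ℝ)⁻¹ ^ (2 * j) * k ^ j = (k : ℝ)⁻¹ ^ j := by
          rw [two_mul, pow_add, mul_assoc, ← mul_pow, inv_mul_cancel₀ hk'.ne', one_pow, mul_one]
        rw [← this]; ring
    _ ≤ 2 ^ (2 * j) * ((1 + B * 2 ^ (2 * j) * 2) *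
        (m r ^ (2 * j) + (k : ℝ)⁻¹ ^ j * favg fun i => v i r ^ (2 * j))) := by
        have h3 : (k : ℝ)⁻¹ ^ j * m r ^ (2 * j) ≤ m r ^ (2 * j) :=
          mul_le_of_le_one_left hm0 (pow_le_one₀ (inv_nonneg.2 hk'.le) hk1)
        have h4 : 0 ≤ (k : ℝ)⁻¹ ^ j * favg (fun i => v i r ^ (2 * j)) :=
          mul_nonneg (pow_nonneg (inv_nonneg.2 hk'.le) _) hv0
        refine mul_le_mul_of_nonneg_left ?_ (pow_nonneg zero_le_two _)
        have hB' : 0 ≤ B * 2 ^ (2 * j) := by positivity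
        nlinarith [mul_le_mul_of_nonneg_left h3 hB', mul_nonneg hB' hm0, mul_nonneg hB' h4]
    _ = _ := by ring

end Resample

lemma Good.abs_integral_psum_three_le (hP : Good μ X a₀ A)
    (φ ψ χ : LinForm d) : ∃ C, 0 ≤ C ∧ ∀ (s : ℤ) (ℓ : ℕ),
      |∫ ω, psum μ X φ s ℓ ω * psum μ X ψ s ℓ ω * psum μ X χ s ℓ ω ∂μ| ≤ C * ℓ := by
  obtain ⟨C, hC, h⟩ := hP.triple_decay φ ψ χ
  refine ⟨16 * C, by positivity, fun s ℓ => ?_⟩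
  have e : ∀ ω, psum μ X φ s ℓ ω * psum μ X ψ s ℓ ω * psum μ X χ s ℓ ω =
      ∑ t ∈ range ℓ, ∑ u ∈ range ℓ, ∑ v ∈ range ℓ,
        xi μ X φ (s + t) ω * xi μ X ψ (s + u) ω * xi μ X χ (s + v) ω := fun ω => by
    rw [psum, psum, psum, sum_mul_sum, sum_mul]
    exact sum_congr rfl fun t _ => by rw [sum_mul_sum]
  simp only [e]
  have hi := hP.integrable_xi_three φ ψ χ
  rw [integral_finsetSum _ fun t _ => integrable_finsetSum _ fun u _ =>
    integrable_finsetSum _ fun v _ => hi _ _ _]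
  have hs : ∀ t ∈ range ℓ, |∫ ω, ∑ u ∈ range ℓ, ∑ v ∈ range ℓ,
      xi μ X φ (s + t) ω * xi μ X ψ (s + u) ω * xi μ X χ (s + v) ω ∂μ| ≤ 16 * C := fun t _ => by
    rw [integral_finsetSum _ fun u _ => integrable_finsetSum _ fun v _ => hi _ _ _]
    have hd := sum_range_dk_le ℓ (s + t) s (p := 6) (by norm_num)
    calc _ ≤ ∑ u ∈ range ℓ, ∑ v ∈ range ℓ,
          C * dk ((s + t) - (s + u)) ^ 6 * dk ((s + t) - (s + v)) ^ 6 := by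
          refine (abs_sum_le_sum_abs _ _).trans (sum_le_sum fun u _ => ?_)
          rw [integral_finsetSum _ fun v _ => hi _ _ _]
          refine (abs_sum_le_sum_abs _ _).trans (sum_le_sum fun v _ => ?_)
          rw [dk_sub_comm (s + t), dk_sub_comm (s + t)]
          exact h _ _ _
      _ = C * ((∑ u ∈ range ℓ, dk ((s + t) - (s + u)) ^ 6) *
          ∑ v ∈ range ℓ, dk ((s + t) - (s + v)) ^ 6) := by
          rw [sum_mul_sum, mul_sum]
          refine sum_congr rfl fun u _ => ?_
          rw [mul_sum]
          exact sum_congr rfl fun v _ => by ring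
      _ ≤ C * (4 * 4) := by
          have := sum_nonneg fun u (_ : u ∈ range ℓ) =>
            pow_nonneg (dk_nonneg ((s + t) - (s + u))) 6
          gcongr
      _ = _ := by ring
  calc _ ≤ ∑ t ∈ range ℓ, 16 * C :=
        (abs_sum_le_sum_abs _ _).trans (sum_le_sum hs)
    _ = _ := by simp; ring

/-- The mean of the centered observations in a block. -/
def vblk (μ : Measure Ω) (X : ℤ → Ω → Fin d → ℝ) (s : ℤ) (ℓ : ℕ) (ω : Ω) : Fin d → ℝ :=
  (ℓ : ℝ)⁻¹ • ∑ t ∈ range ℓ, cen μ X (s + t) ω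

lemma apply_vblk (φ : LinForm d) (s : ℤ) (ℓ : ℕ) (ω : Ω) :
    φ (vblk μ X s ℓ ω) = psum μ X φ s ℓ ω / ℓ := by
  simp only [psum, vblk, map_smul, map_sum, smul_eq_mul, xi, div_eq_inv_mul]

lemma Good.vblk_bd (hP : Good μ X a₀ A) (φ : LinForm d) :
    ∃ C, 0 ≤ C ∧ ∀ K ε (s : ℤ) n ℓ, Reg K ε n ℓ →
      Bd μ (12 + 4 * a₀) (C * K * ε) (fun ω => φ (vblk μ X s ℓ ω)) := by
  obtain ⟨C, hC, h⟩ := hP.psum_bd φ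
  refine ⟨C, hC, fun K ε s n ℓ hr => ?_⟩
  have hl := hr.len_pos
  have e := hr.pos
  have hK := hr.K_nonneg
  simp only [apply_vblk]
  refine ((h s ℓ).div_const (ℓ : ℝ)).mono_const ?_
  rw [abs_of_pos hl, mul_div_assoc, mul_assoc]
  refine mul_le_mul_of_nonneg_left ?_ hC
  rw [Real.sqrt_div_self', ← Real.sqrt_one, ← Real.sqrt_div zero_le_one]
  refine Real.sqrt_le_iff.2 ⟨by positivity, hr.lower.trans ?_⟩
  rw [mul_pow]
  exact mul_le_mul_of_nonneg_right (by nlinarith [hr.one_le]) (by positivity)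

/-- Average over all overlapping blocks of the triple products of the block means. -/
def avg3 (μ : Measure Ω) (X : ℤ → Ω → Fin d → ℝ) (φ ψ χ : LinForm d) (s : ℤ)
    (n ℓ : ℕ) (ω : Ω) : ℝ :=
  (∑ i ∈ range (n - ℓ + 1), φ (vblk μ X (s + i) ℓ ω) *
    (ψ (vblk μ X (s + i) ℓ ω) * χ (vblk μ X (s + i) ℓ ω))) / ((n - ℓ + 1 : ℕ) : ℝ)

lemma Good.avg3_bd (hP : Good μ X a₀ A) (φ ψ χ : LinForm d) (K : ℝ) : ∃ C, 0 ≤ C ∧ ∀ ε (s : ℤ) n ℓ,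
      Reg K ε n ℓ → Bd μ 2 (C * ε ^ 4) (avg3 μ X φ ψ χ s n ℓ) := by
  by_cases hK : 1 ≤ K
  swap
  · exact ⟨0, le_rfl, fun ε s n ℓ hr => absurd hr.one_le hK⟩
  obtain ⟨C₁, hC₁, h₁⟩ := hP.vblk_bd φ
  obtain ⟨C₂, hC₂, h₂⟩ := hP.vblk_bd ψ
  obtain ⟨C₃, hC₃, h₃⟩ := hP.vblk_bd χ
  obtain ⟨C, hC, h⟩ := hP.abs_integral_psum_three_le φ ψ χ
  have hcov := hP.covC_nonneg
  set D := ‖φ‖ * (‖ψ‖ * ‖χ‖) with hD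
  set G := 2 * (C₁ * K * (C₂ * K * (C₃ * K))) with hG
  set T := 18 * K * G ^ 2 + covC a₀ A * (D + C * K ^ 2) ^ 2 * K ^ 4 with hT
  have hT0 : 0 ≤ T := by positivity
  refine ⟨√T + C * K ^ 2, by positivity, fun ε s n ℓ hr => ?_⟩
  have hl := hr.len_pos
  have hl1 : (1 : ℝ) ≤ ℓ := by exact_mod_cast hr.one_le_len
  have e := hr.pos
  set N := n - ℓ + 1
  let F : ℕ → Ω → ℝ := fun i ω => φ (vblk μ X (s + i) ℓ ω) *
    (ψ (vblk μ X (s + i) ℓ ω) * χ (vblk μ X (s + i) ℓ ω))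
  have hb4 : ∀ i, Bd μ 4 (C₁ * K * ε * (C₂ * K * ε * (C₃ * K * ε))) (F i) := fun i => by
    have b1 := (h₁ K ε (s + i) n ℓ hr).mono_exp (q := 12) (by omega)
    have b2 := (h₂ K ε (s + i) n ℓ hr).mono_exp (q := 12) (by omega)
    have b3 := (h₃ K ε (s + i) n ℓ hr).mono_exp (q := 12) (by omega)
    have := (b2.mul_self_exp (p := 6) b3).mul b1 holderTriple_six_twelve
    refine (mul_comm (C₁ * K * ε) _) ▸ ?_
    simpa only [F, mul_comm (φ _)] using this
  have hpF : ∀ i : ℕ, Pw μ X (s + i) (s + i + ℓ) 3 D (F i) := fun i => by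
    have hp : ∀ θ : LinForm d, Pw μ X (s + i) (s + i + ℓ) 1 ‖θ‖
        (fun ω => θ (vblk μ X (s + i) ℓ ω)) := fun θ => by
      simp only [apply_vblk]
      refine ((psum_Pw θ (s + i) ℓ).div_const (ℓ : ℝ)).mono le_rfl ?_
      rw [abs_of_pos hl, mul_div_cancel_left₀ _ hl.ne']
    exact ((hp φ).mul ((hp ψ).mul (hp χ))).mono le_rfl le_rfl
  have hle2 : 1 / (ℓ : ℝ) ^ 2 ≤ K ^ 2 * ε ^ 4 := by
    rw [← one_div_pow]
    calc (1 / (ℓ : ℝ)) ^ 2 ≤ (K * ε ^ 2) ^ 2 := by have := hr.lower; gcongr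
      _ = _ := by ring
  have hm : ∀ i, |∫ ω, F i ω ∂μ| ≤ C * K ^ 2 * ε ^ 4 := fun i => by
    have e1 : ∀ ω, F i ω = psum μ X φ (s + i) ℓ ω * psum μ X ψ (s + i) ℓ ω *
        psum μ X χ (s + i) ℓ ω / (ℓ : ℝ) ^ 3 := fun ω => by
      simp only [F, apply_vblk]; field_simp
    simp only [e1]
    rw [integral_div, abs_div, abs_of_pos (show (0 : ℝ) < (ℓ : ℝ) ^ 3 by positivity)]
    calc _ ≤ C * ℓ / (ℓ : ℝ) ^ 3 := by gcongr; exact h _ _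
      _ = C * (1 / (ℓ : ℝ) ^ 2) := by field_simp
      _ ≤ C * (K ^ 2 * ε ^ 4) := by gcongr
      _ = _ := by ring
  have hm' : ∀ i, |∫ ω, F i ω ∂μ| ≤ C * K ^ 2 := fun i => (hm i).trans
    (mul_le_of_le_one_right (by positivity) (pow_le_one₀ e.le hr.le_one))
  have hpf : ∀ i : ℕ, Pw μ X (s + i) (s + i + ℓ) 3 (D + C * K ^ 2)
      (fun ω => F i ω - ∫ ω', F i ω' ∂μ) := fun i =>
    (hpF i).sub ((Pw.const _).mono (by norm_num) (hm' i))
  have hbf : ∀ i, Bd μ 2 (G * ε ^ 3) (fun ω => F i ω - ∫ ω', F i ω' ∂μ) := fun i =>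
    ((hb4 i).mono_exp (q := 2) (by norm_num)).sub_integral (by norm_num) |>.mono_const
      (le_of_eq (by rw [hG]; ring))
  have key := hP.integral_avg_sq_le (s := s) (N := N) (w := ℓ) (a := 3) (L := ℓ)
    (f := fun i ω => F i ω - ∫ ω', F i ω' ∂μ) (by omega) le_rfl hr.one_le_len
    (fun i _ => hpf i) (by omega) (fun i _ => by
      rw [integral_sub ((hb4 i).integrable (by norm_num)) (integrable_const _)]; simp)
    (fun i _ => hbf i)
  have hN : (0 : ℝ) < (N : ℝ) := Reg.num_pos n ℓ
  have hbd0 : Bd μ 2 (G * ε ^ 3) (fun ω => (∑ i ∈ range N, (F i ω - ∫ ω', F i ω' ∂μ)) / N) :=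
    Bd.avg (fun i _ => hbf i) (by positivity) (by norm_num)
  have hA : Bd μ 2 (√T * ε ^ 4) (fun ω => (∑ i ∈ range N, (F i ω - ∫ ω', F i ω' ∂μ)) / N) := by
    refine Bd.of_integral hbd0.memLp two_ne_zero (by positivity) ?_
    simp only [sq_abs]
    refine key.trans ?_
    have t1 := hr.ratio_four_le
    have t2 : (ℓ : ℝ) / ((ℓ : ℝ) + 1) ^ 14 ≤ K ^ 4 * ε ^ 8 := by
      calc (ℓ : ℝ) / ((ℓ : ℝ) + 1) ^ 14 ≤ ℓ / (ℓ : ℝ) ^ 5 := by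
            gcongr
            calc (ℓ : ℝ) ^ 5 ≤ ((ℓ : ℝ) + 1) ^ 5 := by gcongr; linarith
              _ ≤ _ := pow_le_pow_right₀ (by linarith) (by norm_num)
        _ = (1 / (ℓ : ℝ) ^ 2) ^ 2 := by field_simp
        _ ≤ (K ^ 2 * ε ^ 4) ^ 2 := by gcongr
        _ = _ := by ring
    have t3 : ε ^ 10 ≤ ε ^ 8 := hr.pow_le (by norm_num)
    rw [mul_pow (√T), Real.sq_sqrt hT0]
    calc _ = (4 * ℓ + 1) / (N : ℝ) * (G ^ 2 * ε ^ 6) +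
          covC a₀ A * (D + C * K ^ 2) ^ 2 * (ℓ / ((ℓ : ℝ) + 1) ^ 14) := by ring
      _ ≤ 18 * K * ε ^ 4 * (G ^ 2 * ε ^ 6) +
          covC a₀ A * (D + C * K ^ 2) ^ 2 * (K ^ 4 * ε ^ 8) := by gcongr
      _ = 18 * K * G ^ 2 * ε ^ 10 + covC a₀ A * (D + C * K ^ 2) ^ 2 * K ^ 4 * ε ^ 8 := by ring
      _ ≤ 18 * K * G ^ 2 * ε ^ 8 + covC a₀ A * (D + C * K ^ 2) ^ 2 * K ^ 4 * ε ^ 8 := by gcongr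
      _ = _ := by rw [hT]; ring
  have hB : Bd μ 2 (C * K ^ 2 * ε ^ 4) (fun _ : Ω => (∑ i ∈ range N, ∫ ω', F i ω' ∂μ) / N) :=
    Bd.avg (fun i _ => (Bd.const _ (by norm_num)).mono_const (hm i)) (by positivity) (by norm_num)
  have := (hA.add hB (by norm_num)).mono_const
    (le_of_eq (show _ = (√T + C * K ^ 2) * ε ^ 4 by ring))
  refine this.dominated ?_ fun ω => le_of_eq ?_
  · have := this.memLp.1
    simp only [← add_div, ← sum_add_distrib, sub_add_cancel] at this
    exact this
  · rw [← add_div, ← sum_add_distrib]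
    simp only [sub_add_cancel]
    rfl

lemma Reg.inv_div_le {K ε : ℝ} {n ℓ : ℕ} (hr : Reg K ε n ℓ) :
    1 ≤ n / ℓ ∧ ((n / ℓ : ℕ) : ℝ)⁻¹ ≤ 2 * K * ε ^ 4 ∧ (ℓ : ℝ) * (n / ℓ : ℕ) * ε ^ 6 ≤ 1 := by
  have hl := hr.len_pos
  have e := hr.pos
  have h1 : 1 ≤ n / ℓ := (Nat.one_le_div_iff (by have := hr.one_le_len; omega)).2
    (by have := hr.half; omega)
  have hk : (0 : ℝ) < (n / ℓ : ℕ) := by exact_mod_cast h1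
  have h2 : n ≤ 2 * (ℓ * (n / ℓ)) := by
    have h3 := Nat.div_add_mod n ℓ
    have h4 := Nat.mod_lt n (show ℓ > 0 from hr.one_le_len)
    have h5 : ℓ * 1 ≤ ℓ * (n / ℓ) := Nat.mul_le_mul_left _ h1
    omega
  have h2' : (n : ℝ) ≤ 2 * (ℓ * (n / ℓ : ℕ)) := by exact_mod_cast h2
  refine ⟨h1, ?_, ?_⟩
  · rw [inv_le_iff_one_le_mul₀ hk]
    calc (1 : ℝ) = n * ε ^ 6 := hr.size.symm
      _ ≤ 2 * (ℓ * (n / ℓ : ℕ)) * ε ^ 6 := by gcongr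
      _ = 2 * (ℓ * ε ^ 2) * ε ^ 4 * (n / ℓ : ℕ) := by ring
      _ ≤ 2 * K * ε ^ 4 * (n / ℓ : ℕ) := by have := hr.upper; gcongr
  · rw [← hr.size]
    refine mul_le_mul_of_nonneg_right ?_ (by positivity)
    exact_mod_cast Nat.mul_div_le n ℓ

lemma favg_range {N : ℕ} (g : ℕ → ℝ) :
    favg (fun i : ↥(range N) => g i) = (∑ i ∈ range N, g i) / N := by
  rw [favg, sum_coe_sort (range N) g, Fintype.card_coe, card_range]

lemma favg_apply_vblk (s : ℤ) (n ℓ : ℕ) (ω : Ω) (φ : LinForm d) :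
    favg (fun i : ↥(range (n - ℓ + 1)) => φ (vblk μ X (s + (i : ℕ)) ℓ ω)) =
      φ (vbar μ X s n ℓ ω) := by
  rw [favg_range fun i => φ (vblk μ X (s + (i : ℕ)) ℓ ω), ← mav_eq_apply, mav]
  simp only [apply_vblk]

lemma favg_mul_vblk {ℓ : ℕ} (hl : 1 ≤ ℓ) (s : ℤ) (n : ℕ) (ω : Ω) (φ ψ : LinForm d) :
    favg (fun i : ↥(range (n - ℓ + 1)) => φ (vblk μ X (s + (i : ℕ)) ℓ ω) *
      ψ (vblk μ X (s + (i : ℕ)) ℓ ω)) = gam μ X φ ψ s n ℓ ω / ℓ := by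
  have hl' : (ℓ : ℝ) ≠ 0 := by exact_mod_cast (by omega : ℓ ≠ 0)
  rw [favg_range fun i => φ (vblk μ X (s + (i : ℕ)) ℓ ω) * ψ (vblk μ X (s + (i : ℕ)) ℓ ω), gam,
    div_right_comm, sum_div _ _ (ℓ : ℝ)]
  congr 1
  refine sum_congr rfl fun i _ => ?_
  rw [apply_vblk, apply_vblk, blk]
  field_simp

instance (n ℓ : ℕ) : Nonempty ↥(range (n - ℓ + 1)) := ⟨⟨0, by simp⟩⟩

/-- The means of the centered observations in the overlapping blocks of a sample. -/
def vsel (μ : Measure Ω) (X : ℤ → Ω → Fin d → ℝ) (s : ℤ) (n ℓ : ℕ) (ω : Ω)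
    (i : ↥(range (n - ℓ + 1))) : Fin d → ℝ :=
  vblk μ X (s + (i : ℕ)) ℓ ω

/-- The bootstrap average of the `p`-th power of the norm of the centered bootstrap mean. -/
def bnorm (μ : Measure Ω) (X : ℤ → Ω → Fin d → ℝ) (s : ℤ) (n ℓ p : ℕ) (ω : Ω) : ℝ :=
  favg fun f : Fin (n / ℓ) → ↥(range (n - ℓ + 1)) =>
    ‖zvec (vsel μ X s n ℓ ω) f‖ ^ p

lemma mbbVar_eq {ℓ n : ℕ} (hl : 1 ≤ ℓ) (hk : 1 ≤ n / ℓ) (s : ℤ) (ω : Ω) :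
    mbbVar X H s n ℓ ω = (ℓ : ℝ) * (n / ℓ : ℕ) * fvar (fun f : Fin (n / ℓ) → ↥(range (n - ℓ + 1)) =>
        H (meanVec μ X + zvec (vsel μ X s n ℓ ω) f)) := by
  have hl' : (ℓ : ℝ) ≠ 0 := by exact_mod_cast (by omega : ℓ ≠ 0)
  have hk' : ((n / ℓ : ℕ) : ℝ) ≠ 0 := by exact_mod_cast (by omega : n / ℓ ≠ 0)
  have h : ∀ f : Fin (n / ℓ) → ↥(range (n - ℓ + 1)),
      (fun j => (∑ a, (∑ t ∈ range ℓ, X (s + ((f a : ℕ) : ℤ) + (t : ℤ)) ω j) / (ℓ : ℝ)) /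
        ((n / ℓ : ℕ) : ℝ)) =
      meanVec μ X + zvec (vsel μ X s n ℓ ω) f := fun f => by
    funext j
    simp only [zvec, vsel, vblk, cen, Pi.add_apply, Pi.smul_apply, Finset.sum_apply, smul_eq_mul,
      sum_sub_distrib, sum_const, card_range, nsmul_eq_mul, mul_sub,
      inv_mul_cancel_left₀ hl', card_univ, Fintype.card_fin, inv_mul_cancel_left₀ hk',
      ← mul_sum, ← sum_div]
    field_simp
    ring
  simp only [mbbVar, mbbVarOn, h, fvar, favg, Fintype.card_fun, Fintype.card_coe,
    Fintype.card_fin, Nat.cast_pow]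

set_option maxHeartbeats 1000000 in
lemma mbbVar_expansion (hD : CondD H a₀) : ∃ C, 0 ≤ C ∧ ∀ (K ε : ℝ) (s : ℤ) (n ℓ : ℕ) (ω : Ω),
    Reg K ε n ℓ →
    |mbbVar X H s n ℓ ω - elim μ X (fderiv ℝ H (meanVec μ X)) (fderiv ℝ H (meanVec μ X)) -
        mainP μ X (fderiv ℝ H (meanVec μ X)) (qrow H (meanVec μ X)) s n ℓ ω -
        ∑ j, (2 * ℓ * ((n / ℓ : ℕ) : ℝ)⁻¹ * cen3 (vsel μ X s n ℓ ω) (vbar μ X s n ℓ ω) (fderiv ℝ H (meanVec μ X))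
            (qrow H (meanVec μ X) j) (coord j) -
          4 * ℓ * (mav μ X (fderiv ℝ H (meanVec μ X)) s n ℓ ω *
          (mav μ X (qrow H (meanVec μ X) j) s n ℓ ω * mav μ X (coord j) s n ℓ ω)))| ≤
      C * (bnorm μ X s n ℓ 2 ω + (ε ^ 6)⁻¹ * bnorm μ X s n ℓ 4 ω +
        (ε ^ 12)⁻¹ * (bnorm μ X s n ℓ 6 ω + bnorm μ X s n ℓ (2 * (3 + a₀)) ω)) := by
  set M := meanVec μ X
  set L := fderiv ℝ H M
  set q := qrow H M
  obtain ⟨C, hC, hT⟩ := taylor_remainder_le hD M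
  set Q : ℝ := ∑ j, ‖q j‖ with hQ
  have hQ0 : 0 ≤ Q := sum_nonneg fun j _ => norm_nonneg _
  refine ⟨‖L‖ ^ 2 + 2 * Q ^ 2 + 6 * C ^ 2, by positivity, fun K ε s n ℓ ω hr => ?_⟩
  obtain ⟨hk, -, hlk⟩ := hr.inv_div_le
  have hl := hr.len_pos
  have e := hr.pos
  set k := n / ℓ
  set v := vsel μ X s n ℓ ω with hv
  set m := vbar μ X s n ℓ ω
  have hm : ∀ φ : LinForm d, favg (fun i => φ (v i)) = φ m :=
    favg_apply_vblk s n ℓ ω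
  have hg : ∀ φ ψ : LinForm d, favg (fun i => φ (v i) * ψ (v i)) =
    gam μ X φ ψ s n ℓ ω / ℓ := favg_mul_vblk hr.one_le_len s n ω
  let R3 : (Fin d → ℝ) → ℝ := fun x => H (M + x) - (H M + L x + ∑ j, q j x * x j)
  let Qz : (Fin k → ↥(range (n - ℓ + 1))) → ℝ := fun f =>
    ∑ j, q j (zvec v f) * (coord j) (zvec v f)
  let Lz : (Fin k → ↥(range (n - ℓ + 1))) → ℝ := fun f => L (zvec v f)
  let Rz : (Fin k → ↥(range (n - ℓ + 1))) → ℝ := fun f => R3 (zvec v f)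
  have hk0 : (0 : ℝ) < k := by exact_mod_cast hk
  have e1 : mbbVar X H s n ℓ ω = ℓ * (k * fvar Lz) + ℓ * (2 * (k * fcov Lz Qz)) +
      ℓ * k * (2 * fcov Lz Rz + fvar (fun f => Qz f + Rz f)) := by
    have : ∀ f : Fin k → ↥(range (n - ℓ + 1)),
        H (M + zvec v f) = H M + (Lz f + (Qz f + Rz f)) := fun f => by
      simp only [Lz, Qz, Rz, R3, ContinuousLinearMap.proj_apply]; ring
    rw [mbbVar_eq (μ := μ) hr.one_le_len hk]
    simp only [k, hv, M] at this ⊢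
    rw [funext this, fvar_const_add, fvar_add, fcov_add]
    ring
  have e2 : k * fvar Lz = gam μ X L L s n ℓ ω / ℓ - L m * L m := by
    rw [← hg]; exact fvar_zvec hm hk L
  have e3 : k * fcov Lz Qz = ∑ j, (q j m * (gam μ X L (coord j) s n ℓ ω / ℓ -
      L m * m j) + m j * (gam μ X L (q j) s n ℓ ω / ℓ - L m * q j m) +
      (k : ℝ)⁻¹ * cen3 v m L (q j) (coord j)) := by
    rw [show fcov Lz Qz = _ from fcov_sum .., mul_sum]
    refine sum_congr rfl fun j _ => ?_
    rw [fcov_zvec hm hk, hg, hg]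
    rfl
  have e4 : ∑ j, q j m * (gam μ X L (coord j) s n ℓ ω / ℓ) =
      ∑ j, m j * (gam μ X L (q j) s n ℓ ω / ℓ) := by
    simp only [← hg, ← favg_mul, ← favg_sum]
    congr 1; funext i
    calc _ = L (v i) * ∑ j, q j m * v i j := by
          rw [mul_sum]; exact sum_congr rfl fun j _ => by
            rw [ContinuousLinearMap.proj_apply]; ring
      _ = L (v i) * ∑ j, q j (v i) * m j := by rw [sum_qrow_symm hD.1]
      _ = _ := by rw [mul_sum]; exact sum_congr rfl fun j _ => by ring
  have e5 : mbbVar X H s n ℓ ω - elim μ X L L - mainP μ X L q s n ℓ ω -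
      ∑ j, (2 * ℓ * (k : ℝ)⁻¹ * cen3 v m L (q j) (coord j) -
        4 * ℓ * (mav μ X L s n ℓ ω * (mav μ X (q j) s n ℓ ω * mav μ X (coord j) s n ℓ ω))) =
      ℓ * k * (2 * fcov Lz Rz + fvar (fun f => Qz f + Rz f)) := by
    rw [e1, e2, e3, mainP]
    simp only [mul_sub, sum_add_distrib, sum_sub_distrib, e4, mav_eq_apply,
      ContinuousLinearMap.proj_apply]
    have s1 : ∑ j, m j * (gam μ X L (q j) s n ℓ ω / ℓ) =
        (∑ j, gam μ X L (q j) s n ℓ ω * m j) / ℓ := by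
      rw [sum_div]; exact sum_congr rfl fun j _ => by ring
    have s2 : ∑ j, q j m * (L m * m j) = ∑ j, m j * (L m * q j m) :=
      sum_congr rfl fun j _ => by ring
    have s3 : ∑ j, 4 * (ℓ : ℝ) * (L m * (q j m * m j)) = 4 * ℓ * ∑ j, m j * (L m * q j m) := by
      rw [mul_sum]; exact sum_congr rfl fun j _ => by ring
    have s4 : ∑ j, 2 * (ℓ : ℝ) * (k : ℝ)⁻¹ * cen3 v m L (q j) (coord j) =
        2 * ℓ * ∑ j, (k : ℝ)⁻¹ * cen3 v m L (q j) (coord j) := by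
      rw [mul_sum]; exact sum_congr rfl fun j _ => by ring
    rw [s1, s2, s3, s4]
    field_simp
    ring
  rw [e5]
  have hE0 : ∀ p, 0 ≤ bnorm μ X s n ℓ p ω := fun p => favg_nonneg fun f => by positivity
  set E2 := bnorm μ X s n ℓ 2 ω
  set E4 := bnorm μ X s n ℓ 4 ω
  set E6 := bnorm μ X s n ℓ 6 ω
  set Ea := bnorm μ X s n ℓ (2 * (3 + a₀)) ω
  have b1 : favg (fun f => Lz f ^ 2) ≤ ‖L‖ ^ 2 * E2 := by
    refine (favg_mono fun f => ?_).trans_eq (favg_mul _ _)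
    rw [← mul_pow, ← sq_abs (Lz f)]
    exact pow_le_pow_left₀ (abs_nonneg _) (L.le_opNorm _) 2
  have b2 : favg (fun f => Qz f ^ 2) ≤ Q ^ 2 * E4 := by
    refine (favg_mono fun f => ?_).trans_eq (favg_mul _ _)
    rw [show ‖zvec v f‖ ^ 4 = (‖zvec v f‖ ^ 2) ^ 2 by ring, ← mul_pow, ← sq_abs (Qz f)]
    refine pow_le_pow_left₀ (abs_nonneg _) ((abs_sum_le_sum_abs _ _).trans ?_) 2
    rw [hQ, sum_mul]
    refine sum_le_sum fun j _ => ?_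
    rw [abs_mul, sq, ← mul_assoc]
    exact mul_le_mul ((q j).le_opNorm _) (norm_le_pi_norm (zvec v f) j) (abs_nonneg _)
      (by positivity)
  have b3 : favg (fun f => Rz f ^ 2) ≤ 2 * C ^ 2 * (E6 + Ea) := by
    have : favg (fun f => Rz f ^ 2) ≤ favg (fun f : Fin k → ↥(range (n - ℓ + 1)) =>
        2 * C ^ 2 * (‖zvec v f‖ ^ 6 + ‖zvec v f‖ ^ (2 * (3 + a₀)))) := favg_mono fun f => by
      have h1 := pow_le_pow_left₀ (abs_nonneg _) (hT (zvec v f)) 2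
      rw [sq_abs] at h1
      refine h1.trans ?_
      rw [show ‖zvec v f‖ ^ 6 = (‖zvec v f‖ ^ 3) ^ 2 by ring,
        show ‖zvec v f‖ ^ (2 * (3 + a₀)) = (‖zvec v f‖ ^ (3 + a₀)) ^ 2 by ring]
      nlinarith [mul_nonneg (sq_nonneg C) (sq_nonneg (‖zvec v f‖ ^ 3 - ‖zvec v f‖ ^ (3 + a₀)))]
    refine this.trans_eq ?_
    rw [favg_mul, favg_add]
    rfl
  have b4 : fvar (fun f => Qz f + Rz f) ≤ 2 * (Q ^ 2 * E4) + 2 * (2 * C ^ 2 * (E6 + Ea)) := by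
    refine (fvar_le _).trans ?_
    have : favg (fun f => (Qz f + Rz f) ^ 2) ≤ favg (fun f => 2 * Qz f ^ 2 + 2 * Rz f ^ 2) :=
      favg_mono fun f => by nlinarith [sq_nonneg (Qz f - Rz f)]
    rw [favg_add, favg_mul, favg_mul] at this
    linarith
  have b5 := abs_two_fcov_le Lz Rz (show (0 : ℝ) < ε ^ 6 by positivity)
  have hlk' : (ℓ : ℝ) * k ≤ (ε ^ 6)⁻¹ := by rwa [← one_div, le_div_iff₀ (by positivity)]
  have he1 : 1 ≤ (ε ^ 6)⁻¹ := one_le_inv_iff₀.2 ⟨by positivity, pow_le_one₀ e.le hr.le_one⟩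
  have h6 := hE0 6
  have ha := hE0 (2 * (3 + a₀))
  have h4 := hE0 4
  have h2 := hE0 2
  set i6 := (ε ^ 6)⁻¹ with hi6
  have hi12 : (ε ^ 12)⁻¹ = i6 * i6 := by rw [hi6, ← mul_inv, ← pow_add]
  have hie : i6 * ε ^ 6 = 1 := inv_mul_cancel₀ (by positivity)
  rw [abs_mul, abs_of_nonneg (show (0 : ℝ) ≤ ℓ * k by positivity)]
  calc (ℓ : ℝ) * k * |2 * fcov Lz Rz + fvar (fun f => Qz f + Rz f)|
      ≤ i6 * (ε ^ 6 * (‖L‖ ^ 2 * E2) + i6 * (2 * C ^ 2 * (E6 + Ea)) +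
        (2 * (Q ^ 2 * E4) + 2 * (i6 * (2 * C ^ 2 * (E6 + Ea))))) := by
        refine mul_le_mul hlk' ((abs_add_le _ _).trans (add_le_add ?_ ?_)) (abs_nonneg _)
          (by positivity)
        · refine b5.trans ?_
          gcongr
        · rw [abs_of_nonneg (fvar_nonneg _)]
          refine b4.trans ?_
          have : 2 * C ^ 2 * (E6 + Ea) ≤ i6 * (2 * C ^ 2 * (E6 + Ea)) :=
            le_mul_of_one_le_left (by positivity) he1
          linarith
    _ = ‖L‖ ^ 2 * E2 + 2 * Q ^ 2 * (i6 * E4) + 6 * C ^ 2 * (i6 * i6 * (E6 + Ea)) := by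
        linear_combination (‖L‖ ^ 2 * E2) * hie
    _ ≤ _ := by
        rw [hi12]
        have p1 : 0 ≤ i6 * E4 := by positivity
        have p2 : 0 ≤ i6 * i6 * (E6 + Ea) := by positivity
        have x1 : 0 ≤ ‖L‖ ^ 2 := by positivity
        have x2 : 0 ≤ Q ^ 2 := by positivity
        have x3 : 0 ≤ C ^ 2 := by positivity
        nlinarith [mul_nonneg x1 p1, mul_nonneg x1 p2, mul_nonneg x2 h2, mul_nonneg x2 p2,
          mul_nonneg x3 h2, mul_nonneg x3 p1]

lemma measurable_mbbVar (hX : ∀ i, Measurable (X i)) (hH : Measurable H) (s : ℤ) (n ℓ : ℕ) :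
    Measurable (mbbVar X H s n ℓ) := by
  have h : ∀ (k : ℕ) (f : Fin k → ↥(range (n - ℓ + 1))), Measurable fun ω =>
      H (fun j => (∑ a, (∑ t ∈ range ℓ, X (s + ((f a : ℕ) : ℤ) + (t : ℤ)) ω j) / (ℓ : ℝ)) /
        (k : ℝ)) := fun k f =>
    hH.comp (measurable_pi_lambda _ fun j => (measurable_sum _ fun a _ =>
      (measurable_sum _ fun t _ => (measurable_pi_apply j).comp (hX _)).div_const _).div_const
        _)
  unfold mbbVar mbbVarOn
  exact (((measurable_sum _ fun f _ => (h _ f).pow_const 2).div_const _).sub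
    (((measurable_sum _ fun f _ => h _ f).div_const _).pow_const 2)).const_mul _

lemma Good.bnorm_bd (hP : Good μ X a₀ A) {j : ℕ} (hj : j ≠ 0)
    (hj' : j ≤ 3 + a₀) (K : ℝ) : ∃ C, 0 ≤ C ∧ ∀ ε (s : ℤ) n ℓ, Reg K ε n ℓ →
      ∃ W, Bd μ 2 (C * ε ^ (6 * j)) W ∧ ∀ ω, |bnorm μ X s n ℓ (2 * j) ω| ≤ |W ω| := by
  obtain ⟨C, hC, h⟩ := exists_favg_norm_zvec_pow_le d j hj
  choose C₁ hC₁ h₁ using fun r : Fin d => hP.mav_bd (coord r)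
  choose C₂ hC₂ h₂ using fun r : Fin d => hP.vblk_bd (coord r)
  by_cases hK : 1 ≤ K
  swap
  · exact ⟨0, le_rfl, fun ε s n ℓ hr => absurd hr.one_le hK⟩
  refine ⟨C * ∑ r, (C₁ r ^ (2 * j) + (2 * K) ^ j * (C₂ r * K) ^ (2 * j)),
    mul_nonneg hC (sum_nonneg fun r _ => add_nonneg (pow_nonneg (hC₁ r) _)
      (mul_nonneg (by positivity) (pow_nonneg (mul_nonneg (hC₂ r) (by linarith)) _))),
    fun ε s n ℓ hr => ?_⟩
  obtain ⟨hk, hk', -⟩ := hr.inv_div_le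
  have e := hr.pos
  have ev : Even (2 * j) := even_two_mul j
  refine ⟨fun ω => C * ∑ r, (mav μ X (coord r) s n ℓ ω ^ (2 * j) +
    ((n / ℓ : ℕ) : ℝ)⁻¹ ^ j * ((∑ i ∈ range (n - ℓ + 1),
      vblk μ X (s + i) ℓ ω r ^ (2 * j)) / (n - ℓ + 1 : ℕ))), ?_, fun ω => ?_⟩
  · have hb := (Bd.sum univ (fun r _ => (((h₁ r K ε s n ℓ hr).mono_exp
      (q := 2 * (2 * j)) (by omega)).pow two_ne_zero (by omega)).add ((Bd.avg (n := n - ℓ + 1)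
        (fun i _ => ((h₂ r K ε (s + (i : ℤ)) n ℓ hr).mono_exp (q := 2 * (2 * j)) (by omega)).pow
        two_ne_zero (by omega)) (pow_nonneg (mul_nonneg (mul_nonneg (hC₂ r) (by linarith)) e.le) _)
        one_le_two).const_mul (((n / ℓ : ℕ) : ℝ)⁻¹ ^ j)) one_le_two) one_le_two).const_mul C
    refine hb.mono_const ?_
    rw [abs_of_nonneg hC, mul_assoc, sum_mul]
    refine mul_le_mul_of_nonneg_left (sum_le_sum fun r _ => ?_) hC
    rw [abs_of_nonneg (by positivity)]
    have := hC₂ r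
    calc _ ≤ (C₁ r * ε ^ 3) ^ (2 * j) + (2 * K * ε ^ 4) ^ j * (C₂ r * K * ε) ^ (2 * j) := by
          gcongr
      _ = _ := by
          rw [mul_pow, mul_pow (2 * K), mul_pow (C₂ r * K), ← pow_mul, ← pow_mul, add_mul,
            show 3 * (2 * j) = 6 * j by ring, show 6 * j = 4 * j + 2 * j by ring, pow_add]
          ring
  · have hb := h (v := vsel μ X s n ℓ ω) (m := vbar μ X s n ℓ ω) (favg_apply_vblk s n ℓ ω) hk
    rw [bnorm, abs_of_nonneg (favg_nonneg fun f => by positivity)]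
    refine hb.trans (le_trans (le_of_eq ?_) (le_abs_self _))
    congr 1
    refine sum_congr rfl fun r _ => ?_
    rw [mav_eq_apply]
    congr 2
    exact favg_range fun i => vblk μ X (s + i) ℓ ω r ^ (2 * j)

lemma Good.mav_three_bd (hP : Good μ X a₀ A)
    (φ ψ χ : LinForm d) : ∃ C, 0 ≤ C ∧ ∀ K ε (s : ℤ) n ℓ, Reg K ε n ℓ →
      Bd μ 2 (C * ε ^ 9) (fun ω => mav μ X φ s n ℓ ω * (mav μ X ψ s n ℓ ω * mav μ X χ s n ℓ ω)) := by
  obtain ⟨C₁, hC₁, h₁⟩ := hP.mav_bd φ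
  obtain ⟨C₂, hC₂, h₂⟩ := hP.mav_bd ψ
  obtain ⟨C₃, hC₃, h₃⟩ := hP.mav_bd χ
  refine ⟨C₂ * C₃ * C₁, by positivity, fun K ε s n ℓ hr => ?_⟩
  have := ((((h₂ K ε s n ℓ hr).mono_exp (by omega)).mul_self_exp (p := 6)
    ((h₃ K ε s n ℓ hr).mono_exp (by omega))).mul ((h₁ K ε s n ℓ hr).mono_exp (by omega))
    holderTriple_six_twelve).mono_exp (q := 2) (by norm_num)
  simp only [mul_comm (mav μ X φ s n ℓ _)]
  exact this.mono_const (le_of_eq (by ring))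

lemma Good.mav_mul_gam_div_bd (hP : Good μ X a₀ A)
    (φ ψ χ : LinForm d) (K : ℝ) : ∃ C, 0 ≤ C ∧ ∀ ε (s : ℤ) n ℓ, Reg K ε n ℓ →
      Bd μ 2 (C * ε ^ 4) (fun ω => φ (vbar μ X s n ℓ ω) * (gam μ X ψ χ s n ℓ ω / ℓ)) := by
  obtain ⟨C₁, hC₁, h₁⟩ := hP.mav_bd φ
  obtain ⟨C₂, hC₂, h₂⟩ := hP.gam_bd ψ χ
  by_cases hK : 1 ≤ K
  swap
  · exact ⟨0, le_rfl, fun ε s n ℓ hr => absurd hr.one_le hK⟩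
  refine ⟨C₂ * C₁ * K, by positivity, fun ε s n ℓ hr => ?_⟩
  have e := hr.pos
  have := ((((h₂ s n ℓ).mul ((h₁ K ε s n ℓ hr).mono_exp (by omega)) holderTriple_six_twelve).mono_exp (q := 2)
    (by norm_num)).div_const (ℓ : ℝ)).mono_const (D := C₂ * C₁ * K * ε ^ 4) (by
      rw [abs_of_pos hr.len_pos]
      calc _ = C₂ * C₁ * ε ^ 3 * (1 / ℓ) := by ring
        _ ≤ C₂ * C₁ * ε ^ 3 * (K * ε ^ 2) := by have := hr.lower; gcongr
        _ = C₂ * C₁ * K * ε ^ 5 := by ring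
        _ ≤ _ := by have : ε ^ 5 ≤ ε ^ 4 := hr.pow_le (by norm_num); gcongr)
  refine this.dominated ?_ fun ω => le_of_eq ?_
  · simp only [← mav_eq_apply]
    convert this.memLp.1 using 2
    ring
  · rw [← mav_eq_apply]; congr 1; ring

lemma Good.cen3_bd (hP : Good μ X a₀ A) (φ ψ χ : LinForm d) (K : ℝ) : ∃ C, 0 ≤ C ∧ ∀ ε (s : ℤ) n ℓ,
      Reg K ε n ℓ →
      Bd μ 2 (C * ε ^ 4) (fun ω => cen3 (vsel μ X s n ℓ ω) (vbar μ X s n ℓ ω) φ ψ χ) := by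
  obtain ⟨C₁, hC₁, h₁⟩ := hP.avg3_bd φ ψ χ K
  obtain ⟨C₂, hC₂, h₂⟩ := hP.mav_mul_gam_div_bd φ ψ χ K
  obtain ⟨C₃, hC₃, h₃⟩ := hP.mav_mul_gam_div_bd ψ φ χ K
  obtain ⟨C₄, hC₄, h₄⟩ := hP.mav_mul_gam_div_bd χ φ ψ K
  obtain ⟨C₅, hC₅, h₅⟩ := hP.mav_three_bd φ ψ χ
  refine ⟨C₁ + C₂ + C₃ + C₄ + 2 * C₅, by positivity, fun ε s n ℓ hr => ?_⟩
  have e := hr.pos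
  have hb := ((((h₁ ε s n ℓ hr).sub (h₂ ε s n ℓ hr) one_le_two).sub (h₃ ε s n ℓ hr)
    one_le_two).sub (h₄ ε s n ℓ hr) one_le_two).add ((h₅ K ε s n ℓ hr).const_mul 2) one_le_two
  simp only [mav_eq_apply] at hb
  have e1 : ∀ ω, cen3 (vsel μ X s n ℓ ω) (vbar μ X s n ℓ ω) φ ψ χ = avg3 μ X φ ψ χ s n ℓ ω -
      φ (vbar μ X s n ℓ ω) * (gam μ X ψ χ s n ℓ ω / ℓ) -
      ψ (vbar μ X s n ℓ ω) * (gam μ X φ χ s n ℓ ω / ℓ) -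
      χ (vbar μ X s n ℓ ω) * (gam μ X φ ψ s n ℓ ω / ℓ) + 2 * (φ (vbar μ X s n ℓ ω) *
        (ψ (vbar μ X s n ℓ ω) * χ (vbar μ X s n ℓ ω))) := fun ω => by
    simp only [cen3, vsel, favg_mul_vblk hr.one_le_len, avg3]
    rw [favg_range fun i => φ (vblk μ X (s + (i : ℕ)) ℓ ω) * (ψ (vblk μ X (s + (i : ℕ)) ℓ ω) *
      χ (vblk μ X (s + (i : ℕ)) ℓ ω))]
  simp only [e1]
  refine hb.mono_const ?_
  have : ε ^ 9 ≤ ε ^ 4 := hr.pow_le (by norm_num)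
  rw [abs_two]
  nlinarith

theorem Good.mbbVar_sub_mainP_bd (hP : Good μ X a₀ A) (hD : CondD H a₀)
    (K : ℝ) : ∃ C, 0 ≤ C ∧ ∀ ε (s : ℤ) n ℓ, Reg K ε n ℓ →
      Bd μ 2 (C * ε ^ 6) (fun ω => mbbVar X H s n ℓ ω -
        elim μ X (fderiv ℝ H (meanVec μ X)) (fderiv ℝ H (meanVec μ X)) -
        mainP μ X (fderiv ℝ H (meanVec μ X)) (qrow H (meanVec μ X)) s n ℓ ω) := by
  by_cases hK : 1 ≤ K
  swap
  · exact ⟨0, le_rfl, fun ε s n ℓ hr => absurd hr.one_le hK⟩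
  obtain ⟨C, hC, h⟩ := mbbVar_expansion (μ := μ) (X := X) hD
  set L := fderiv ℝ H (meanVec μ X)
  set q := qrow H (meanVec μ X)
  obtain ⟨B₁, hB₁, hw₁⟩ := hP.bnorm_bd (j := 1) one_ne_zero (by omega) K
  obtain ⟨B₂, hB₂, hw₂⟩ := hP.bnorm_bd (j := 2) two_ne_zero (by omega) K
  obtain ⟨B₃, hB₃, hw₃⟩ := hP.bnorm_bd (j := 3) three_ne_zero (by omega) K
  obtain ⟨B₄, hB₄, hw₄⟩ := hP.bnorm_bd (j := 3 + a₀) (by omega) le_rfl K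
  choose D hD0 hd using fun j => hP.cen3_bd L (q j) (coord j) K
  choose E hE0 he using fun j => hP.mav_three_bd L (q j) (coord j)
  obtain ⟨C', hC', hm⟩ := hP.mainP_bd L q K
  refine ⟨C * (B₁ + B₂ + (B₃ + B₄)) + ∑ j, (4 * K ^ 2 * D j + 4 * K * E j), add_nonneg
    (by positivity) (sum_nonneg fun j _ => add_nonneg (mul_nonneg (by positivity) (hD0 j))
      (mul_nonneg (by positivity) (hE0 j))), fun ε s n ℓ hr => ?_⟩
  have e := hr.pos
  have hl := hr.len_pos
  obtain ⟨hk, hk', -⟩ := hr.inv_div_le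
  obtain ⟨W₁, bW₁, hW₁⟩ := hw₁ ε s n ℓ hr
  obtain ⟨W₂, bW₂, hW₂⟩ := hw₂ ε s n ℓ hr
  obtain ⟨W₃, bW₃, hW₃⟩ := hw₃ ε s n ℓ hr
  obtain ⟨W₄, bW₄, hW₄⟩ := hw₄ ε s n ℓ hr
  have h6 : ε ^ (6 * (3 + a₀)) ≤ ε ^ 18 := hr.pow_le (by omega)
  have hS := Bd.sum univ (fun j _ => ((hd j ε s n ℓ hr).const_mul
    (2 * ℓ * ((n / ℓ : ℕ) : ℝ)⁻¹)).sub ((he j K ε s n ℓ hr).const_mul (4 * (ℓ : ℝ))) one_le_two)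
    one_le_two
  have hW := ((bW₁.abs.add (bW₂.abs.const_mul (ε ^ 6)⁻¹) one_le_two).add
    ((bW₃.abs.add bW₄.abs one_le_two).const_mul (ε ^ 12)⁻¹) one_le_two).const_mul C
  have hmeas := ((measurable_mbbVar hP.meas hD.1.continuous.measurable s n ℓ).aestronglyMeasurable
    (μ := μ).sub (aestronglyMeasurable_const (b := elim μ X L L))).sub (hm ε s n ℓ hr).memLp.1
  have hT := hW.dominated (hmeas.sub hS.memLp.1) fun ω => (h K ε s n ℓ ω hr).trans
    (le_trans ?_ (le_abs_self _))
  · have hfin := hT.add hS one_le_two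
    simp only [Pi.sub_apply, sub_add_cancel] at hfin
    refine hfin.mono_const ?_
    rw [add_mul, sum_mul]
    refine add_le_add ?_ (sum_le_sum fun j _ => ?_)
    · rw [abs_of_nonneg hC, mul_assoc, abs_of_pos (by positivity), abs_of_pos (by positivity)]
      refine mul_le_mul_of_nonneg_left ?_ hC
      calc _ ≤ B₁ * ε ^ 6 + (ε ^ 6)⁻¹ * (B₂ * ε ^ 12) + (ε ^ 12)⁻¹ * (B₃ * ε ^ 18 + B₄ * ε ^ 18) := by
            gcongr
        _ = _ := by field_simp
    · rw [abs_of_nonneg (by positivity), abs_of_nonneg (by positivity)]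
      have := hD0 j
      have := hE0 j
      have hll := hr.len_le
      calc _ ≤ 2 * (K / ε ^ 2) * (2 * K * ε ^ 4) * (D j * ε ^ 4) + 4 * (K / ε ^ 2) * (E j * ε ^ 9) := by
            gcongr
        _ = 4 * K ^ 2 * D j * ε ^ 6 + 4 * K * E j * ε ^ 7 := by field_simp; ring
        _ ≤ 4 * K ^ 2 * D j * ε ^ 6 + 4 * K * E j * ε ^ 6 := by
            have : ε ^ 7 ≤ ε ^ 6 := hr.pow_le (by norm_num)
            gcongr
        _ = _ := by ring
  · have a1 := (le_abs_self _).trans (hW₁ ω)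
    have a2 := (le_abs_self _).trans (hW₂ ω)
    have a3 := (le_abs_self _).trans (hW₃ ω)
    have a4 := (le_abs_self _).trans (hW₄ ω)
    refine mul_le_mul_of_nonneg_left ?_ hC
    gcongr

lemma Good.blk_sub_bd (hP : Good μ X a₀ A) (φ : LinForm d)
    (K : ℝ) : ∃ C, 0 ≤ C ∧ ∀ ε (s : ℤ) n ℓ k, Reg K ε n ℓ → Reg K ε n (ℓ + k) →
      Bd μ 4 (C * (1 + k) * ε) (fun ω => cblk μ X φ φ s (ℓ + k) ω - cblk μ X φ φ s ℓ ω) := by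
  obtain ⟨C, hC, h⟩ := hP.psum_bd φ
  replace h s n := (h s n).mono_exp (q := 12) (by omega)
  refine ⟨8 * C ^ 2 * |K|, by positivity, fun ε s n ℓ k hr hr' => ?_⟩
  have e := hr.pos
  have hK := hr.one_le
  have hl := hr.len_pos
  have hl' := hr'.len_pos
  have b := ((((h s ℓ).mul_self_exp (p := 6) (h (s + ℓ) k)).const_mul 2).add
    ((h (s + ℓ) k).mul_self_exp (p := 6) (h (s + ℓ) k)) (by norm_num)).div_const ((ℓ + k : ℕ) : ℝ)
  have b' := ((h s ℓ).mul_self_exp (p := 6) (h s ℓ)).const_mul ((k : ℝ) / (ℓ * (ℓ + k : ℕ)))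
  have hb := (((b.sub b' (by norm_num)).mono_exp (q := 4) (by norm_num)).mono_const
    (D := 4 * C ^ 2 * |K| * (1 + k) * ε) ?_).sub_integral (by norm_num)
  · refine (show (fun ω => _) = _ from funext fun ω => ?_) ▸ hb.mono_const
      (D := 8 * C ^ 2 * |K| * (1 + k) * ε) (by linarith)
    have e1 : ∀ ω, (2 * (psum μ X φ s ℓ ω * psum μ X φ (s + ℓ) k ω) +
        psum μ X φ (s + ℓ) k ω * psum μ X φ (s + ℓ) k ω) / ((ℓ + k : ℕ) : ℝ) -
        k / (ℓ * ((ℓ + k : ℕ) : ℝ)) * (psum μ X φ s ℓ ω * psum μ X φ s ℓ ω) =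
        blk μ X φ φ s (ℓ + k) ω - blk μ X φ φ s ℓ ω := fun ω => by
      rw [blk, blk, psum_add]
      push_cast at hl' ⊢
      field_simp
      ring
    simp only [e1]
    rw [integral_sub ((blk_Pw φ φ s _).integrable hP (by omega))
      ((blk_Pw φ φ s _).integrable hP (by omega)), hP.integral_blk, hP.integral_blk, cblk, cblk]
    ring
  · have h1 : 1 / ((ℓ + k : ℕ) : ℝ) ≤ |K| * ε := by
      rw [abs_of_pos (by linarith)]
      exact hr'.lower.trans (by have := hr.pow_le (i := 2) (j := 1) (by norm_num); gcongr; simpa using this)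
    have hs : √(ℓ : ℝ) / ((ℓ + k : ℕ) : ℝ) ≤ |K| * ε := by
      rw [abs_of_pos (by linarith), div_le_iff₀ hl']
      refine (Real.sqrt_le_sqrt (show (ℓ : ℝ) ≤ (ℓ + k : ℕ) by push_cast; linarith [k.cast_nonneg (α := ℝ)])).trans ?_
      refine Real.sqrt_le_iff.2 ⟨by positivity, ?_⟩
      have := hr'.lower
      rw [div_le_iff₀ hl'] at this
      calc ((ℓ + k : ℕ) : ℝ) = ((ℓ + k : ℕ) : ℝ) * 1 := by ring
        _ ≤ ((ℓ + k : ℕ) : ℝ) * (K * ε ^ 2 * ((ℓ + k : ℕ) : ℝ)) := by gcongr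
        _ ≤ ((ℓ + k : ℕ) : ℝ) * (K * K * ε ^ 2 * ((ℓ + k : ℕ) : ℝ)) := by
          gcongr; nlinarith
        _ = _ := by ring
    have hk : √(k : ℝ) ≤ 1 + k := Real.sqrt_le_iff.2 ⟨by positivity, by nlinarith [k.cast_nonneg (α := ℝ)]⟩
    have hk2 := Real.mul_self_sqrt (k.cast_nonneg (α := ℝ))
    have hl2 := Real.mul_self_sqrt hl.le
    rw [abs_of_pos hl', abs_of_pos two_pos, abs_of_nonneg (by positivity)]
    calc _ = C ^ 2 * (2 * (√ℓ / ((ℓ + k : ℕ) : ℝ)) * √k + (√k * √k) * (1 / ((ℓ + k : ℕ) : ℝ)) +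
          k * (√ℓ * √ℓ / ℓ) * (1 / ((ℓ + k : ℕ) : ℝ))) := by field_simp
      _ ≤ C ^ 2 * (2 * (|K| * ε) * (1 + k) + k * (|K| * ε) + k * 1 * (|K| * ε)) := by
        rw [hk2, hl2, div_self hl.ne']
        gcongr
      _ ≤ _ := by nlinarith [mul_nonneg (sq_nonneg C) (mul_nonneg (abs_nonneg K) e.le)]

lemma Good.cgam_sub_bd (hP : Good μ X a₀ A) (φ : LinForm d)
    (K : ℝ) : ∃ C, 0 ≤ C ∧ ∀ ε (s : ℤ) n ℓ k, Reg K ε n ℓ → Reg K ε n (ℓ + k) →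
      Bd μ 4 (C * (1 + k) * ε ^ 3)
        (fun ω => cgam μ X φ φ s n (ℓ + k) ω - cgam μ X φ φ s n ℓ ω) := by
  obtain ⟨C, hC, h⟩ := hP.cblk_Pw φ φ
  obtain ⟨b, hb0, hb⟩ := hP.cblk_bd φ φ
  obtain ⟨D, hD, hd⟩ := hP.avg_bd K (C := 2 * C) (by positivity)
  obtain ⟨B, hB, hs⟩ := hP.blk_sub_bd φ K
  refine ⟨D * (B + 1) + 4 * b, by positivity, fun ε s n ℓ k hr hr' => ?_⟩
  have e := hr.pos
  have h1 := hr.half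
  have h2 := hr'.half
  have h3 := hr.one_le_len
  have hN := Reg.num_pos n (ℓ + k)
  have hM := Reg.num_pos n ℓ
  have hNM : n - ℓ + 1 = n - (ℓ + k) + 1 + k := by omega
  have a₁ := hd ε s n (ℓ + k) (n - (ℓ + k) + 1) _ _ hr' (by omega) (by omega)
    (mul_nonneg (mul_nonneg hB (by positivity)) e.le)
    (fun i _ => ((h (s + i) (ℓ + k) hr'.one_le_len).sub
      ((h (s + i) ℓ h3).mono_window le_rfl (by push_cast; omega))).mono le_rfl
        (by push_cast; nlinarith [mul_nonneg hC (k.cast_nonneg (α := ℝ))]))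
    (fun i _ => ((integral_sub ((hb _ _).integrable (by norm_num))
      ((hb _ _).integrable (by norm_num))).trans (by rw [hP.integral_cblk, hP.integral_cblk, sub_zero])))
    (fun i _ => hs ε (s + i) n ℓ k hr hr')
  have a₂ := (Bd.sum (range k) (c := fun _ => b)
    (fun i _ => hb (s + (n - (ℓ + k) + 1 + i : ℕ)) ℓ) (by norm_num)).const_mul (1 / ((n - ℓ + 1 : ℕ) : ℝ))
  have a₃ := (Bd.avg (n := n - (ℓ + k) + 1) (fun i _ => hb (s + i) ℓ) hb0 (by norm_num)).const_mul
    ((k : ℝ) / ((n - ℓ + 1 : ℕ) : ℝ))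
  have a := a₁.add (a₃.sub a₂ (by norm_num)) (by norm_num)
  refine (show (fun ω => _) = _ from funext fun ω => ?_) ▸ a.mono_const
      (D := (D * (B + 1) + 4 * b) * (1 + k) * ε ^ 3) ?_
  · rw [cgam_eq, cgam_eq, hNM]
    generalize n - (ℓ + k) + 1 = N at *
    rw [sum_range_add _ N k, sum_sub_distrib]
    push_cast at hN ⊢
    have : (0 : ℝ) < (N : ℝ) + k := by positivity
    field_simp
    ring
  · have h6 : ε ^ 6 ≤ ε ^ 3 := hr.pow_le (by norm_num)
    have h7 := hr.inv_num_le
    simp only [sum_const, card_range, nsmul_eq_mul]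
    rw [abs_of_nonneg (by positivity), abs_of_nonneg (by positivity)]
    calc _ = D * (B * (1 + k) * ε + ε) * ε ^ 2 + 2 * (k * b) * (1 / ((n - ℓ + 1 : ℕ) : ℝ)) := by ring
      _ ≤ D * (B * (1 + k) * ε + (1 + k) * ε) * ε ^ 2 + 2 * ((1 + k) * b) * (2 * ε ^ 3) := by
        gcongr
        · nlinarith [mul_nonneg e.le (k.cast_nonneg (α := ℝ))]
        · linarith
        · linarith
      _ = _ := by ring

lemma Pw.avg {a b : ℤ} {j N : ℕ} {C : ℝ} {F : ℕ → Ω → ℝ} (hN : 0 < N)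
    (h : ∀ i < N, Pw μ X a b j C (F i)) :
    Pw μ X a b j C (fun ω => (∑ i ∈ range N, F i ω) / N) := by
  refine ((Pw.sum (range N) fun i hi => h i (mem_range.1 hi)).div_const _).mono le_rfl ?_
  have : (0 : ℝ) < N := by exact_mod_cast hN
  rw [card_range, abs_of_pos this]
  field_simp
  rfl

lemma gam_Pw (φ ψ : LinForm d) (s : ℤ) {n ℓ : ℕ} (h : ℓ ≤ n) :
    Pw μ X s (s + n) 2 (ℓ * (‖φ‖ * ‖ψ‖)) (gam μ X φ ψ s n ℓ) :=
  Pw.avg (Nat.succ_pos _) fun i hi => (blk_Pw φ ψ (s + i) ℓ).mono_window (by omega) (by omega)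

lemma mav_Pw (φ : LinForm d) (s : ℤ) {n ℓ : ℕ} (h : ℓ ≤ n) (h1 : 1 ≤ ℓ) :
    Pw μ X s (s + n) 1 ‖φ‖ (mav μ X φ s n ℓ) := by
  refine Pw.avg (Nat.succ_pos _) fun i hi => (((psum_Pw φ (s + i) ℓ).mono_window
    (by omega) (by omega)).div_const (ℓ : ℝ)).mono le_rfl ?_
  have : (0 : ℝ) < ℓ := by exact_mod_cast h1
  rw [abs_of_pos this]
  field_simp
  rfl

lemma mainP_Pw (L : LinForm d) (q : Fin d → LinForm d) :
    ∃ C, 0 ≤ C ∧ ∀ (s : ℤ) (n ℓ : ℕ), ℓ ≤ n → 1 ≤ ℓ →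
      Pw μ X s (s + n) 3 (C * ℓ) (mainP μ X L q s n ℓ) := by
  set Q := ∑ j, ‖q j‖
  set P := ∑ j : Fin d, ‖coord j‖
  have hQ : 0 ≤ Q := sum_nonneg fun _ _ => norm_nonneg _
  have hP : 0 ≤ P := sum_nonneg fun _ _ => norm_nonneg _
  refine ⟨‖L‖ * ‖L‖ + |elim μ X L L| + ‖L‖ ^ 2 + 4 * (d * (‖L‖ * Q * P)), by positivity,
    fun s n ℓ h h1 => ?_⟩
  have hl : (1 : ℝ) ≤ ℓ := by exact_mod_cast h1
  have a := ((gam_Pw (μ := μ) (X := X) L L s h).sub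
    ((Pw.const (elim μ X L L)).mono (Nat.zero_le 2) le_rfl)).sub
    ((((mav_Pw (μ := μ) (X := X) L s h h1).pow 2).const_mul (ℓ : ℝ)).mono (by norm_num) le_rfl)
  have b := (Pw.sum (C := ℓ * (‖L‖ * Q * P)) univ fun k _ =>
    ((gam_Pw (μ := μ) (X := X) L (q k) s h).mul
      (mav_Pw (μ := μ) (X := X) (coord k) s h h1)).mono le_rfl (by
        rw [mul_assoc, mul_assoc, mul_assoc]
        have h2 : ‖q k‖ ≤ Q := single_le_sum (f := fun j => ‖q j‖)
          (fun _ _ => norm_nonneg _) (mem_univ k)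
        have h3 : ‖coord k‖ ≤ P :=
          single_le_sum (f := fun j => ‖coord j‖) (fun _ _ => norm_nonneg _) (mem_univ k)
        gcongr)).const_mul 4
  refine ((a.mono (by norm_num) le_rfl).add b).mono le_rfl ?_
  rw [abs_of_pos (by linarith : (0 : ℝ) < ℓ), abs_of_pos (by norm_num : (0 : ℝ) < 4)]
  simp only [card_univ, Fintype.card_fin]
  nlinarith [abs_nonneg (elim μ X L L)]

lemma Good.mainP_rest (hP : Good μ X a₀ A) (L : LinForm d) (q : Fin d → LinForm d) (K : ℝ) :
    ∃ C, 0 ≤ C ∧ ∀ ε (s : ℤ) n ℓ, Reg K ε n ℓ → ∃ r : Ω → ℝ,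
      Bd μ 4 (C * ε ^ 3) r ∧ Est μ r 0 (C * ε ^ 4) ∧ ∀ ω, mainP μ X L q s n ℓ ω =
        cgam μ X L L s n ℓ ω + (egam μ X L L ℓ - elim μ X L L) + r ω := by
  obtain ⟨C₂, h₂, H₂⟩ := hP.mav_mul_bd L L
  obtain ⟨C₃, h₃, H₃⟩ := hP.mav_bd (limFun μ X L q)
  obtain ⟨C₄, h₄, H₄⟩ := hP.secP_bd L q K
  refine ⟨|K| * C₂ + 4 * C₃ + 4 * C₄, by positivity, fun ε s n ℓ hr => ?_⟩
  have e := hr.pos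
  have b₁ : Bd μ 4 (|K| * C₂ * ε ^ 4) _ := (((H₂ K ε s n ℓ hr).const_mul (ℓ : ℝ)).neg).mono_const (by
    rw [abs_of_nonneg hr.K_nonneg, abs_of_pos hr.len_pos]
    calc _ = (ℓ * ε ^ 2) * (C₂ * ε ^ 4) := by ring
      _ ≤ K * (C₂ * ε ^ 4) := by have := hr.upper; gcongr
      _ = _ := by ring)
  have b₂ := ((H₃ K ε s n ℓ hr).mono_exp (q := 4) (by omega)).const_mul 4
  have b₃ := H₄ ε s n ℓ hr
  have i₂ : Est μ _ 0 0 := ⟨b₂.integrable (by norm_num), by simp [integral_const_mul, hP.integral_mav]⟩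
  have e3 : ε ^ 4 ≤ ε ^ 3 := hr.pow_le (by norm_num)
  have e4 : ε ^ 5 ≤ ε ^ 4 := hr.pow_le (by norm_num)
  have h4 : |(4 : ℝ)| = 4 := by norm_num
  refine ⟨_, ((b₁.add b₂ (by norm_num)).add (b₃.2.const_mul 4) (by norm_num)).mono_const ?_,
    (((Est.of_bd b₁ (by norm_num)).add i₂).add (Est.of_bd (b₃.1.const_mul 4) (by norm_num))).mono ?_,
    fun ω => ?_⟩
  · rw [h4]
    nlinarith [mul_nonneg (abs_nonneg K) h₂]
  · rw [h4]
    simp only [add_zero, sub_self, abs_zero, zero_add]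
    nlinarith [mul_nonneg h₃ (pow_pos e 4).le]
  · rw [mainP_eq]; ring

lemma Good.mainP_sub_bd (hP : Good μ X a₀ A) (L : LinForm d) (q : Fin d → LinForm d) (K : ℝ) :
    ∃ C, 0 ≤ C ∧ ∀ ε (s : ℤ) n ℓ k, Reg K ε n ℓ → Reg K ε n (ℓ + k) →
      Bd μ 4 (C * (1 + k) * ε ^ 3) (fun ω => mainP μ X L q s n (ℓ + k) ω - mainP μ X L q s n ℓ ω) ∧
      |∫ ω, (mainP μ X L q s n (ℓ + k) ω - mainP μ X L q s n ℓ ω) ∂μ| ≤ C * (1 + k) * ε ^ 4 := by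
  obtain ⟨C₁, h₁, H₁⟩ := hP.mainP_rest L q K
  obtain ⟨C₂, h₂, H₂⟩ := hP.cgam_sub_bd L K
  obtain ⟨C₃, h₃, H₃⟩ := hP.abs_egam_sub_elim_le L L K
  set B := ebias μ X L L
  refine ⟨C₂ + (2 * C₃ + |B| * K ^ 2) + 2 * C₁, by positivity, fun ε s n ℓ k hr hr' => ?_⟩
  have e := hr.pos
  have hk : (0 : ℝ) ≤ k := k.cast_nonneg
  obtain ⟨r, b₁, i₁, hr₁⟩ := H₁ ε s n ℓ hr
  obtain ⟨r', b₁', i₁', hr₁'⟩ := H₁ ε s n _ hr'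
  have b₂ := H₂ ε s n ℓ k hr hr'
  set δ := (egam μ X L L (ℓ + k) - elim μ X L L) - (egam μ X L L ℓ - elim μ X L L) with hδ
  have g : |δ| ≤ (2 * C₃ + |B| * K ^ 2) * (1 + k) * ε ^ 4 := by
    have g1 := (H₃ ε n _ hr').2.1
    have g2 := (H₃ ε n ℓ hr).2.1
    have hl := hr.len_pos
    have hl' := hr'.len_pos
    have g3 : |B / ℓ - B / ((ℓ + k : ℕ) : ℝ)| ≤ |B| * K ^ 2 * (k * ε ^ 4) := by
      rw [show B / ℓ - B / ((ℓ + k : ℕ) : ℝ) = B * (k * ((1 / ℓ) * (1 / ((ℓ + k : ℕ) : ℝ)))) by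
        push_cast at hl' ⊢; field_simp; ring, abs_mul, abs_of_nonneg (a := _ * _) (by positivity)]
      calc _ ≤ |B| * (k * ((K * ε ^ 2) * (K * ε ^ 2))) := by
            have := hr.lower; have := hr'.lower; have := hr.K_nonneg
            gcongr
        _ = _ := by ring
    have e8 : ε ^ 8 ≤ ε ^ 4 := hr.pow_le (by norm_num)
    have h5 := mul_nonneg h₃ (pow_pos e 4).le
    have h6 : 0 ≤ |B| * K ^ 2 * ε ^ 4 := by positivity
    have h7 := mul_nonneg h5 hk
    have h8 := mul_le_mul_of_nonneg_left e8 h₃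
    rw [abs_le] at g1 g2 g3 ⊢
    constructor <;> nlinarith
  have e3 : ε ^ 4 ≤ ε ^ 3 := hr.pow_le (by norm_num)
  have hc : 0 ≤ (2 * C₃ + |B| * K ^ 2) * (1 + k) := by positivity
  have h9 := mul_nonneg h₁ (mul_nonneg hk (pow_pos e 3).le)
  have h10 := mul_nonneg h₁ (mul_nonneg hk (pow_pos e 4).le)
  have h11 := mul_le_mul_of_nonneg_left e3 hc
  have i₂ : Est μ _ 0 0 := ⟨b₂.integrable (by norm_num), by
    obtain ⟨c, -, hcg⟩ := hP.cgam_bd L L K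
    rw [integral_sub ((hcg ε s n _ hr').integrable (by norm_num))
      ((hcg ε s n ℓ hr).integrable (by norm_num)), hP.integral_cgam, hP.integral_cgam]
    simp⟩
  have ic : Est μ (fun _ => δ) δ 0 := ⟨integrable_const _, by simp⟩
  have j₂ := ((i₂.add ic).add (i₁'.add (i₁.const_mul (-1)))).mono (b := 0)
      (e' := (C₂ + (2 * C₃ + |B| * K ^ 2) + 2 * C₁) * (1 + k) * ε ^ 4) (by
        simp only [mul_zero, zero_add, add_zero, sub_zero, abs_neg, abs_one, one_mul]
        linarith [mul_nonneg h₂ (mul_nonneg (by positivity : (0 : ℝ) ≤ 1 + k) (pow_pos e 4).le)])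
  refine ⟨(show (fun ω => _) = _ from funext fun ω => ?_) ▸ (((b₂.add (Bd.const δ (by norm_num))
    (by norm_num)).add (b₁'.sub b₁ (by norm_num)) (by norm_num)).mono_const
      (D := (C₂ + (2 * C₃ + |B| * K ^ 2) + 2 * C₁) * (1 + k) * ε ^ 3)
      (by linarith)), ?_⟩
  · rw [hr₁, hr₁', hδ]; ring
  · have := (j₂.congr (g := fun ω => mainP μ X L q s n (ℓ + k) ω - mainP μ X L q s n ℓ ω)
      fun ω => by rw [hr₁, hr₁', hδ]; ring).le
    rwa [sub_zero] at this

/-- The errors `D s n ℓ` have main parts `P s n ℓ` over the window `[s, s + n)`, with the sizes,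
moments and increments in `ℓ` of a block bootstrap variance estimator of squared bias `β² / ℓ²` and
variance `V ℓ / n`. -/
structure MainPart (μ : Measure Ω) (X : ℤ → Ω → Fin d → ℝ) (P D : ℤ → ℕ → ℕ → Ω → ℝ)
    (β V K C : ℝ) (F : ℤ → ℕ → ℝ) : Prop where
  nonneg : 0 ≤ C
  window : ∀ {s : ℤ} {n ℓ : ℕ}, ℓ ≤ n → 1 ≤ ℓ → Pw μ X s (s + n) 3 (C * ℓ) (P s n ℓ)
  rest : ∀ {ε : ℝ} {n ℓ : ℕ} (s : ℤ), Reg K ε n ℓ →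
    Bd μ 2 (C * ε ^ 6) (fun ω => D s n ℓ ω - P s n ℓ ω)
  size : ∀ {ε : ℝ} {n ℓ : ℕ} (s : ℤ), Reg K ε n ℓ → Bd μ 4 (C * ε ^ 2) (P s n ℓ)
  incr : ∀ {ε : ℝ} {n ℓ ℓ' : ℕ} (s : ℤ), Reg K ε n ℓ → Reg K ε n ℓ' →
    Bd μ 4 (C * (1 + |(ℓ : ℝ) - ℓ'|) * ε ^ 3) (fun ω => P s n ℓ ω - P s n ℓ' ω) ∧
    |∫ ω, (P s n ℓ ω - P s n ℓ' ω) ∂μ| ≤ C * (1 + |(ℓ : ℝ) - ℓ'|) * ε ^ 4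
  sq : ∀ {ε : ℝ} {n ℓ : ℕ} (s : ℤ), Reg K ε n ℓ →
    |∫ ω, D s n ℓ ω ^ 2 ∂μ - (β ^ 2 / (ℓ : ℝ) ^ 2 + V * (ℓ / n) + F s n)| ≤ C * ε ^ 8

lemma Good.rcov_eq (hP : Good μ X a₀ A) (k : ℤ) : rcov μ X H k =
      lagCov μ X (fderiv ℝ H (meanVec μ X)) (fderiv ℝ H (meanVec μ X)) k := by
  have h := hP.integral_xi (fderiv ℝ H (meanVec μ X)) 0
  change ∫ ω, Ylin μ X H 0 ω ∂μ = 0 at h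
  rw [rcov, h, zero_mul, sub_zero]
  rfl

lemma Good.exists_mainPart (hP : Good μ X a₀ A) (hD : CondD H a₀)
    (K : ℝ) : ∃ P C F, MainPart μ X P (fun s n ℓ ω => mbbVar X H s n ℓ ω - sigInfSq μ X H)
      (B0 μ X H) (V0 μ X H) K C F := by
  set L := fderiv ℝ H (meanVec μ X)
  set q := qrow H (meanVec μ X)
  have hσ : sigInfSq μ X H = elim μ X L L := tsum_congr hP.rcov_eq
  have hB : B0 μ X H = ebias μ X L L := tsum_congr fun k => by rw [hP.rcov_eq]
  obtain ⟨C₁, h₁, H₁⟩ := mainP_Pw (μ := μ) (X := X) L q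
  obtain ⟨C₂, h₂, H₂⟩ := hP.mbbVar_sub_mainP_bd hD K
  obtain ⟨C₃, h₃, H₃⟩ := hP.mainP_bd L q K
  obtain ⟨C₄, h₄, H₄⟩ := hP.mainP_sub_bd L q K
  obtain ⟨C₅, F, h₅, H₅⟩ := hP.integral_mainP_sq L q K C₂
  have hpow (ε : ℝ) (j : ℕ) {c : ℝ} (hε : 0 < ε) (hc : c ≤ C₁ + C₂ + C₃ + C₄ + C₅) :
      c * ε ^ j ≤ (C₁ + C₂ + C₃ + C₄ + C₅) * ε ^ j := by gcongr
  have hincr {ε : ℝ} {n ℓ ℓ' : ℕ} (s : ℤ) (h : ℓ' ≤ ℓ) (hr : Reg K ε n ℓ) (hr' : Reg K ε n ℓ') :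
      Bd μ 4 ((C₁ + C₂ + C₃ + C₄ + C₅) * (1 + |(ℓ : ℝ) - ℓ'|) * ε ^ 3)
        (fun ω => mainP μ X L q s n ℓ ω - mainP μ X L q s n ℓ' ω) ∧
      |∫ ω, (mainP μ X L q s n ℓ ω - mainP μ X L q s n ℓ' ω) ∂μ| ≤
        (C₁ + C₂ + C₃ + C₄ + C₅) * (1 + |(ℓ : ℝ) - ℓ'|) * ε ^ 4 := by
    obtain ⟨k, rfl⟩ := Nat.exists_eq_add_of_le h
    obtain ⟨b, i⟩ := H₄ ε s n ℓ' k hr' hr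
    have e := hr.pos
    rw [show ((ℓ' + k : ℕ) : ℝ) - ℓ' = k by push_cast; ring, Nat.abs_cast]
    exact ⟨b.mono_const (by gcongr; linarith), i.trans (by gcongr; linarith)⟩
  refine ⟨mainP μ X L q, C₁ + C₂ + C₃ + C₄ + C₅, F, by positivity, fun hl h1 =>
    (H₁ _ _ _ hl h1).mono le_rfl (by gcongr; linarith), fun {ε} _ _ s hr => ?_, fun {ε} _ _ s hr =>
    (H₃ ε s _ _ hr).mono_const (hpow _ _ hr.pos (by linarith)), fun {ε n ℓ ℓ'} s hr hr' => ?_,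
    fun {ε n ℓ} s hr => ?_⟩
  · rw [hσ]
    exact (H₂ ε s _ _ hr).mono_const (hpow _ _ hr.pos (by linarith))
  · rcases le_total ℓ' ℓ with h | h
    · exact hincr s h hr hr'
    · obtain ⟨b, i⟩ := hincr s h hr' hr
      rw [abs_sub_comm] at b i
      refine ⟨by simpa only [neg_sub] using b.neg, ?_⟩
      rw [← abs_neg, ← integral_neg]
      simpa only [neg_sub] using i
  · refine le_trans ?_ ((H₅ ε s n ℓ _ hr (H₂ ε s n ℓ hr)).trans (hpow _ _ hr.pos (by linarith)))
    rw [hB, V0, hσ]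
    exact le_of_eq (by congr! 4 with ω; ring)

lemma Reg.le_risk_sub {K ε y β V : ℝ} {n ℓ ℓ₀ : ℕ} (hr : Reg K ε n ℓ) (hr₀ : Reg K ε n ℓ₀)
    (hy : 0 < y) (hV : V * y ^ 3 = 2 * β ^ 2) (h₀ : |ℓ₀ * ε ^ 2 - y| ≤ ε ^ 2) :
    (β ^ 2 / (K * y) ^ 2 * |(ℓ : ℝ) - ℓ₀| ^ 2 - β ^ 2 * (2 / (K * y) ^ 2 + (2 * K + y) * K ^ 2 / y ^ 3)
      * (1 + |(ℓ : ℝ) - ℓ₀|)) * ε ^ 8 ≤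
      β ^ 2 / (ℓ : ℝ) ^ 2 + V * (ℓ / n) - (β ^ 2 / (ℓ₀ : ℝ) ^ 2 + V * (ℓ₀ / n)) := by
  have e := hr.pos
  have hK := hr.one_le
  have key {ℓ : ℕ} (hr : Reg K ε n ℓ) : β ^ 2 / (ℓ : ℝ) ^ 2 + V * (ℓ / n) =
      β ^ 2 * ε ^ 4 * (3 / y ^ 2 +
        (ℓ * ε ^ 2 - y) ^ 2 * ((2 * (ℓ * ε ^ 2) + y) * (1 / (ℓ * ε ^ 2)) ^ 2 / y ^ 3)) := by
    have hl := hr.len_pos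
    rw [div_eq_mul_one_div (ℓ : ℝ), hr.inv_size, eq_div_of_mul_eq (by positivity) hV]
    field_simp
    ring
  have ha {ℓ : ℕ} (hr : Reg K ε n ℓ) : 1 / (ℓ * ε ^ 2) ≤ K := by
    rw [← div_div, div_le_iff₀ (by positivity)]
    exact hr.lower
  have hl := hr.len_pos
  have hl₀ := hr₀.len_pos
  have u₀ := hr₀.upper
  have u := hr.upper
  have h1 : (ℓ₀ * ε ^ 2 - y) ^ 2 * ((2 * (ℓ₀ * ε ^ 2) + y) * (1 / (ℓ₀ * ε ^ 2)) ^ 2 / y ^ 3) ≤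
      (ε ^ 2) ^ 2 * ((2 * K + y) * K ^ 2 / y ^ 3) := by
    rw [← sq_abs]
    have := ha hr₀
    gcongr
  have h2 : 1 / (K * y) ^ 2 ≤ (2 * (ℓ * ε ^ 2) + y) * (1 / (ℓ * ε ^ 2)) ^ 2 / y ^ 3 := by
    calc 1 / (K * y) ^ 2 ≤ 1 / ((ℓ * ε ^ 2) * y) ^ 2 := by gcongr
      _ = y * (1 / (ℓ * ε ^ 2)) ^ 2 / y ^ 3 := by field_simp
      _ ≤ _ := by gcongr; linarith [mul_pos hl (pow_pos e 2)]
  set κ := |(ℓ : ℝ) - ℓ₀| with hκ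
  have hκ0 : 0 ≤ κ := abs_nonneg _
  have h3 : (κ ^ 2 - 2 * κ) * ε ^ 4 ≤ (ℓ * ε ^ 2 - y) ^ 2 := by
    have h4 : κ * ε ^ 2 = |(ℓ * ε ^ 2 - y) - (ℓ₀ * ε ^ 2 - y)| := by
      rw [← abs_of_pos (pow_pos e 2), hκ, ← abs_mul]
      congr 1
      rw [abs_of_pos (pow_pos e 2)]
      ring
    have h5 := abs_sub (ℓ * ε ^ 2 - y) (ℓ₀ * ε ^ 2 - y)
    rw [← h4] at h5
    by_cases hc : κ ≤ 2
    · nlinarith [sq_nonneg (ℓ * ε ^ 2 - y), mul_nonneg (mul_nonneg hκ0 (sub_nonneg.2 hc)) (pow_pos e 4).le]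
    · have h6 : (κ - 1) * ε ^ 2 ≤ |ℓ * ε ^ 2 - y| := by linarith
      have := pow_le_pow_left₀ (mul_nonneg (by linarith) (pow_pos e 2).le) h6 2
      rw [sq_abs] at this
      nlinarith [pow_pos e 4]
  have h7 := mul_le_mul_of_nonneg_left h2 (sq_nonneg (ℓ * ε ^ 2 - y))
  have h8 := mul_le_mul_of_nonneg_right h3 (by positivity : 0 ≤ 1 / (K * y) ^ 2)
  have h9 : 0 ≤ (2 / (K * y) ^ 2 + (2 * K + y) * K ^ 2 / y ^ 3 * κ) * ε ^ 4 := by positivity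
  rw [key hr, key hr₀, ← mul_sub]
  calc _ = β ^ 2 * ε ^ 4 * ((κ ^ 2 - 2 * κ) * ε ^ 4 * (1 / (K * y) ^ 2) -
        (ε ^ 2) ^ 2 * ((2 * K + y) * K ^ 2 / y ^ 3) -
        (2 / (K * y) ^ 2 + (2 * K + y) * K ^ 2 / y ^ 3 * κ) * ε ^ 4) := by ring
    _ ≤ _ := mul_le_mul_of_nonneg_left (by linarith) (by positivity)

namespace MainPart
lemma bd (h : MainPart μ X P D β V K C F) (s : ℤ) (hr : Reg K ε n ℓ) :
    Bd μ 2 (2 * C * ε ^ 2) (D s n ℓ) := by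
  have := ((h.rest s hr).add ((h.size s hr).mono_exp (by norm_num)) (by norm_num)).mono_const
    (D := 2 * C * ε ^ 2) ?_
  · simpa using this
  nlinarith [mul_le_mul_of_nonneg_left (hr.pow_le (show 2 ≤ 6 by norm_num)) h.nonneg]

lemma integrable_sub_sq (h : MainPart μ X P D β V K C F) (s : ℤ) (hr : Reg K ε n ℓ) (z : ℝ) :
    Integrable (fun ω => (D s n ℓ ω - z) ^ 2) μ := by
  simpa only [sq_abs] using
    ((h.bd s hr).sub (Bd.const z (by norm_num)) (by norm_num)).integrable_abs_pow two_ne_zero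

lemma le_integral_sub (h : MainPart μ X P D β V K C F) (hy : 0 < y)
    (hV : V * y ^ 3 = 2 * β ^ 2) : ∃ G, 0 ≤ G ∧ ∀ {ε : ℝ} {n ℓ ℓ₀ : ℕ} (s : ℤ) (z : ℝ),
      Reg K ε n ℓ → Reg K ε n ℓ₀ → |ℓ₀ * ε ^ 2 - y| ≤ ε ^ 2 →
      β ^ 2 / (K * y) ^ 2 * |(ℓ : ℝ) - ℓ₀| ^ 2 * ε ^ 8 -
          G * (1 + |(ℓ : ℝ) - ℓ₀|) * (ε ^ 8 + |z| * ε ^ 4) ≤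
        ∫ ω, ((D s n ℓ ω - z) ^ 2 - (D s n ℓ₀ ω - z) ^ 2) ∂μ := by
  have hC := h.nonneg
  refine ⟨β ^ 2 * (2 / (K * y) ^ 2 + (2 * |K| + y) * K ^ 2 / y ^ 3) + 6 * C, by positivity,
    fun {ε n ℓ ℓ₀} s z hr hr₀ h₀ => ?_⟩
  have e := hr.pos
  have hd := (h.bd s hr).integrable (by norm_num)
  have hd₀ := (h.bd s hr₀).integrable (by norm_num)
  have hs {ℓ : ℕ} (hr : Reg K ε n ℓ) : Integrable (fun ω => D s n ℓ ω ^ 2) μ := by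
    simpa using h.integrable_sub_sq s hr 0
  have i₁ : |∫ ω, (D s n ℓ ω - D s n ℓ₀ ω) ∂μ| ≤ 3 * C * (1 + |(ℓ : ℝ) - ℓ₀|) * ε ^ 4 := by
    have i := (((Est.of_bd (h.rest s hr) (by norm_num)).add
      ((Est.of_bd (h.rest s hr₀) (by norm_num)).const_mul (-1))).add
        (⟨((h.incr s hr hr₀).1.integrable (by norm_num)), by simpa using (h.incr s hr hr₀).2⟩ :
          Est μ _ 0 _)).congr (g := fun ω => D s n ℓ ω - D s n ℓ₀ ω) fun ω => by ring
    have := i.le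
    simp only [mul_zero, add_zero, sub_zero, abs_neg, abs_one, one_mul] at this
    have h6 := mul_le_mul_of_nonneg_left (hr.pow_le (show 4 ≤ 6 by norm_num)) hC
    have h7 := mul_nonneg (mul_nonneg hC (abs_nonneg ((ℓ : ℝ) - ℓ₀))) (pow_pos e 4).le
    linarith
  have i₂ : ∫ ω, ((D s n ℓ ω - z) ^ 2 - (D s n ℓ₀ ω - z) ^ 2) ∂μ =
      ∫ ω, D s n ℓ ω ^ 2 ∂μ - ∫ ω, D s n ℓ₀ ω ^ 2 ∂μ -
        2 * z * ∫ ω, (D s n ℓ ω - D s n ℓ₀ ω) ∂μ := by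
    have := integral_sub ((hs hr).sub (hs hr₀)) ((hd.sub hd₀).const_mul (2 * z))
    simp only [Pi.sub_apply] at this
    rw [← integral_sub (hs hr) (hs hr₀), ← integral_const_mul, ← this]
    exact integral_congr_ae (.of_forall fun ω => by ring)
  have i₃ : |2 * z * ∫ ω, (D s n ℓ ω - D s n ℓ₀ ω) ∂μ| ≤
      2 * |z| * (3 * C * (1 + |(ℓ : ℝ) - ℓ₀|) * ε ^ 4) := by
    rw [abs_mul, abs_mul, abs_two]
    gcongr
  have j := hr.le_risk_sub hr₀ hy hV h₀
  have j₁ := (abs_le.1 (h.sq s hr)).1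
  have j₂ := (abs_le.1 (h.sq s hr₀)).2
  have j₃ := (abs_le.1 i₃).2
  rw [abs_of_nonneg hr.K_nonneg, i₂]
  have j₄ : 0 ≤ β ^ 2 * (2 / (K * y) ^ 2 + (2 * K + y) * K ^ 2 / y ^ 3) * (1 + |(ℓ : ℝ) - ℓ₀|) *
    (|z| * ε ^ 4) := by have := hr.K_nonneg; positivity
  have j₅ : 0 ≤ C * (1 + |(ℓ : ℝ) - ℓ₀|) * ε ^ 8 := by positivity
  have j₆ : 0 ≤ C * |(ℓ : ℝ) - ℓ₀| * ε ^ 8 := by positivity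
  linarith

lemma sub_sq_bd (h : MainPart μ X P D β V K C F) (s : ℤ) (hr : Reg K ε m b) (hM : 0 ≤ M)
    (hz : |z| ≤ M * ε ^ 4) :
    Bd μ 1 (C * (3 * C + 2 * M) * ε ^ 8) (fun ω => (D s m b ω - z) ^ 2 - (P s m b ω - z) ^ 2) := by
  have e := hr.pos
  have b₁ := (((h.bd s hr).add ((h.size s hr).mono_exp (q := 2) (by norm_num)) (by norm_num)).sub
    (Bd.const (2 * z) (by norm_num)) (by norm_num)).mono_const (D := (3 * C + 2 * M) * ε ^ 2) (by
      rw [abs_mul, abs_two]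
      linarith [mul_le_mul_of_nonneg_left (hr.pow_le (show 2 ≤ 4 by norm_num)) hM])
  have := (Bd.mul_self_exp (p := 1) (h.rest s hr) b₁).mono_const
    (D := C * (3 * C + 2 * M) * ε ^ 8) (le_of_eq (by ring))
  convert this using 2 with ω
  ring

lemma main_sub_sq_bd (h : MainPart μ X P D β V K C F) (s : ℤ) (hr : Reg K ε m b)
    (hr₀ : Reg K ε m b₀) (hM : 0 ≤ M) (hz : |z| ≤ M * ε ^ 4) :
    Bd μ 2 (2 * C * (C + M) * (1 + |(b : ℝ) - b₀|) * ε ^ 5)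
      (fun ω => (P s m b ω - z) ^ 2 - (P s m b₀ ω - z) ^ 2) := by
  have b₁ := (((h.size s hr).add (h.size s hr₀) (by norm_num)).sub
    (Bd.const (2 * z) (by norm_num)) (by norm_num)).mono_const (D := 2 * (C + M) * ε ^ 2) (by
      rw [abs_mul, abs_two]
      linarith [mul_le_mul_of_nonneg_left (hr.pow_le (show 2 ≤ 4 by norm_num)) hM])
  have := (Bd.mul_self_exp (p := 2) (h.incr s hr hr₀).1 b₁).mono_const
    (D := 2 * C * (C + M) * (1 + |(b : ℝ) - b₀|) * ε ^ 5) (le_of_eq (by ring))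
  convert this using 2 with ω
  ring

lemma main_sub_sq_Pw (h : MainPart μ X P D β V K C F) (s : ℤ) (hr : Reg K ε m b)
    (hr₀ : Reg K ε m b₀) (hM : 0 ≤ M) (hz : |z| ≤ M * ε ^ 4) :
    Pw μ X s (s + m) 6 (4 * C * (C + M) * m ^ 2)
      (fun ω => (P s m b ω - z) ^ 2 - (P s m b₀ ω - z) ^ 2) := by
  have hC := h.nonneg
  have w {b : ℕ} (hr : Reg K ε m b) : Pw μ X s (s + m) 3 (C * m) (P s m b) := by
    have := hr.half
    refine (h.window (by omega) hr.one_le_len).mono le_rfl ?_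
    gcongr
    omega
  have hz' : |2 * z| ≤ 2 * M * m := by
    have h1 : (1 : ℝ) ≤ m := by exact_mod_cast hr.one_le_len.trans (by have := hr.half; omega)
    have h2 := mul_le_mul_of_nonneg_left (hr.pow_le (show 0 ≤ 4 by norm_num)) hM
    rw [abs_mul, abs_two]
    nlinarith
  have := (((w hr).sub (w hr₀)).mul (((w hr).add (w hr₀)).sub
    ((Pw.const (2 * z)).mono (Nat.zero_le 3) hz'))).mono le_rfl
      (show _ ≤ 4 * C * (C + M) * (m : ℝ) ^ 2 from le_of_eq (by ring))
  convert this using 2 with ω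
  ring

lemma avg_main_bd (hP : Good μ X a₀ A) (h : MainPart μ X P D β V K C F) (hM : 0 ≤ M) :
    ∃ W, 0 ≤ W ∧ ∀ {ε z : ℝ} {m b b₀ N : ℕ}, Reg K ε m b → Reg K ε m b₀ → |z| ≤ M * ε ^ 4 →
      0 < N → 1 / (N : ℝ) ≤ M * ε ^ 12 → Bd μ 2 (W * (1 + |(b : ℝ) - b₀|) * ε ^ 8)
        (fun ω => (∑ i ∈ range N, ((P (i + 1) m b ω - z) ^ 2 - (P (i + 1) m b₀ ω - z) ^ 2 -
          ∫ ω', ((P (i + 1) m b ω' - z) ^ 2 - (P (i + 1) m b₀ ω' - z) ^ 2) ∂μ)) / N) := by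
  have hC := h.nonneg
  have hc := hP.covC_nonneg
  set g := 2 * C * (C + M) with hg
  have hg0 : 0 ≤ g := by positivity
  set W := 20 * M * g ^ 2 + 16 * covC a₀ A * g ^ 2 with hW
  have hW0 : 0 ≤ W := by positivity
  refine ⟨1 + W, by positivity, fun {ε z m b b₀ N} hr hr₀ hz hN hNM => ?_⟩
  have e := hr.pos
  have hk : 0 ≤ |(b : ℝ) - b₀| := abs_nonneg _
  have b₁ (s : ℤ) := h.main_sub_sq_bd s hr hr₀ hM hz
  have b₂ (i : ℕ) := (b₁ (i + 1)).sub_integral (by norm_num)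
  have hm : (1 : ℝ) ≤ m := by exact_mod_cast hr.one_le_len.trans (by have := hr.half; omega)
  have hκ : 1 + |(b : ℝ) - b₀| ≤ 2 * m ^ 2 := by
    have h1 := hr.half
    have h2 := hr₀.half
    have h3 : |(b : ℝ) - b₀| ≤ m := by
      have h4 : (b : ℝ) ≤ m := by exact_mod_cast (by omega)
      have h5 : (b₀ : ℝ) ≤ m := by exact_mod_cast (by omega)
      rw [abs_le]
      constructor <;> linarith [b.cast_nonneg (α := ℝ), b₀.cast_nonneg (α := ℝ)]
    nlinarith
  have b₃ (i : ℕ) : Pw μ X (1 + i) (1 + i + m) 6 (4 * g * m ^ 2) _ :=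
    (((h.main_sub_sq_Pw (i + 1) hr hr₀ hM hz).sub ((Pw.const _).mono (Nat.zero_le 6)
      ((b₁ (i + 1)).abs_integral_le (by norm_num)))).mono_window (a' := 1 + i) (b' := 1 + i + m)
        (by omega) (by omega)).mono le_rfl (by
      have h5 : ε ^ 5 ≤ 1 := hr.pow_le (show 0 ≤ 5 by norm_num)
      have := mul_le_mul hκ h5 (by positivity) (by positivity)
      nlinarith)
  have key := hP.integral_avg_sq_le hN (le_refl m) (by exact_mod_cast hm) (fun i _ => b₃ i)
    (by omega) (fun i _ => by
      rw [integral_sub ((b₁ _).integrable (by norm_num)) (integrable_const _)]; simp)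
    (fun i _ => b₂ i)
  refine Bd.of_integral (Bd.avg (fun i _ => b₂ i) (b₂ 0).nonneg (by norm_num)).memLp two_ne_zero
    (by positivity) ?_
  simp only [sq_abs]
  refine key.trans ?_
  have h1 : (4 * (m : ℝ) + 1) / N ≤ 5 * M * ε ^ 6 := by
    rw [div_eq_mul_one_div]
    calc _ ≤ (5 * m) * (M * ε ^ 12) := by gcongr; linarith
      _ = 5 * M * ((m * ε ^ 6) * ε ^ 6) := by ring
      _ = _ := by rw [hr.size, one_mul]
  have h2 : (m : ℝ) ^ 5 / ((m : ℝ) + 1) ^ 14 ≤ ε ^ 16 := by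
    calc _ ≤ (m : ℝ) ^ 5 / ((m : ℝ) ^ 8) := by
          gcongr
          exact (pow_le_pow_right₀ hm (by norm_num : 8 ≤ 14)).trans (by gcongr; linarith)
      _ = (1 / m) ^ 3 := by field_simp
      _ = ε ^ 18 := by rw [hr.inv_size]; ring
      _ ≤ ε ^ 16 := hr.pow_le (by norm_num)
  set κ := |(b : ℝ) - b₀|
  calc _ = (4 * (m : ℝ) + 1) / N * (4 * g ^ 2 * (1 + κ) ^ 2 * ε ^ 10) +
        16 * covC a₀ A * g ^ 2 * ((m : ℝ) ^ 5 / ((m : ℝ) + 1) ^ 14) * 1 ^ 2 := by ring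
    _ ≤ 5 * M * ε ^ 6 * (4 * g ^ 2 * (1 + κ) ^ 2 * ε ^ 10) +
        16 * covC a₀ A * g ^ 2 * ε ^ 16 * (1 + κ) ^ 2 := by gcongr; linarith
    _ = W * ((1 + κ) ^ 2 * ε ^ 16) := by rw [hW]; ring
    _ ≤ (1 + W) ^ 2 * ((1 + κ) ^ 2 * ε ^ 16) := by gcongr; nlinarith
    _ = _ := by ring

lemma measure_avg_le (hP : Good μ X a₀ A) (h : MainPart μ X P D β V K C F) (hK : 0 < K)
    (hβ : β ≠ 0) (hy : 0 < y) (hV : V * y ^ 3 = 2 * β ^ 2) (hM : 0 ≤ M) :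
    ∃ B k, 0 ≤ B ∧ 1 ≤ k ∧ ∀ {ε z : ℝ} {m b b₀ N : ℕ}, Reg K ε m b → Reg K ε m b₀ →
      |b₀ * ε ^ 2 - y| ≤ ε ^ 2 → |z| ≤ M * ε ^ 4 → 0 < N → 1 / (N : ℝ) ≤ M * ε ^ 12 →
      k ≤ |(b : ℝ) - b₀| →
      μ.real {ω | ∑ i ∈ range N, ((D (i + 1) m b ω - z) ^ 2 -
        (D (i + 1) m b₀ ω - z) ^ 2) ≤ 0} ≤ B / ((b : ℝ) - b₀) ^ 2 := by
  have hC := h.nonneg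
  obtain ⟨W, hW, H⟩ := avg_main_bd hP h hM
  obtain ⟨G, hG, hS⟩ := h.le_integral_sub hy hV
  set w := 2 * (C * (3 * C + 2 * M)) with hw
  set c := β ^ 2 / (K * y) ^ 2 with hc
  have hc0 : 0 < c := by positivity
  have hw0 : 0 ≤ w := by positivity
  refine ⟨64 * W ^ 2 / c ^ 2 + 4 * w / c, 1 + 2 * (2 * G * (1 + M) + w) / c, by positivity,
    le_add_of_nonneg_right (by positivity), fun {ε z m b b₀ N} hr hr₀ h₀ hz hN hNM hk => ?_⟩
  have e := hr.pos
  rw [← sq_abs ((b : ℝ) - b₀)]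
  set κ := |(b : ℝ) - b₀| with hκ
  have hκ1 : 1 ≤ κ := le_trans (le_add_of_nonneg_right (by positivity)) hk
  set f : ℕ → Ω → ℝ := fun i ω => (P (i + 1) m b ω - z) ^ 2 - (P (i + 1) m b₀ ω - z) ^ 2 with hf
  set u : ℕ → Ω → ℝ := fun i ω =>
    ((D (i + 1) m b ω - z) ^ 2 - (P (i + 1) m b ω - z) ^ 2) -
      ((D (i + 1) m b₀ ω - z) ^ 2 - (P (i + 1) m b₀ ω - z) ^ 2) with hu
  have bu (i : ℕ) : Bd μ 1 (w * ε ^ 8) (u i) :=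
    ((h.sub_sq_bd (i + 1) hr hM hz).sub (h.sub_sq_bd (i + 1) hr₀ hM hz) le_rfl).mono_const
      (by rw [hw]; linarith)
  have hmean (i : ℕ) : c / 2 * κ ^ 2 * ε ^ 8 ≤ ∫ ω, f i ω ∂μ := by
    have h1 := hS (i + 1) z hr hr₀ h₀
    have h2 := integral_add ((h.main_sub_sq_bd (i + 1) hr hr₀ hM hz).integrable (by norm_num))
      ((bu i).integrable le_rfl)
    have h3 : ∫ ω, ((D (i + 1) m b ω - z) ^ 2 - (D (i + 1) m b₀ ω - z) ^ 2) ∂μ =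
        ∫ ω, f i ω ∂μ + ∫ ω, u i ω ∂μ := by
      rw [← h2]
      exact integral_congr_ae (.of_forall fun ω => by simp only [hu]; ring)
    have h4 := (abs_le.1 ((bu i).abs_integral_le le_rfl)).2
    have h5 : G * (1 + κ) * (ε ^ 8 + |z| * ε ^ 4) ≤ G * (2 * κ) * ((1 + M) * ε ^ 8) := by
      gcongr
      · linarith
      · nlinarith [mul_le_mul_of_nonneg_right hz (pow_pos e 4).le]
    have h6 : (2 * G * (1 + M) + w) * κ ≤ c / 2 * κ ^ 2 := by
      have : 2 * (2 * G * (1 + M) + w) ≤ κ * c := by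
        rw [← div_le_iff₀ hc0]
        linarith
      nlinarith
    have h7 := mul_le_mul_of_nonneg_right h6 (pow_pos e 8).le
    have h8 : w * ε ^ 8 ≤ w * κ * ε ^ 8 := by gcongr; exact le_mul_of_one_le_right hw0 hκ1
    linarith
  have hN' : (0 : ℝ) < N := by exact_mod_cast hN
  set S₁ : Ω → ℝ := fun ω => (∑ i ∈ range N, (f i ω - ∫ ω', f i ω' ∂μ)) / N
  set S₂ : Ω → ℝ := fun ω => (∑ i ∈ range N, u i ω) / N
  have hT : 0 < c / 4 * κ ^ 2 * ε ^ 8 := by positivity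
  have hsub : {ω | ∑ i ∈ range N, ((D (i + 1) m b ω - z) ^ 2 -
      (D (i + 1) m b₀ ω - z) ^ 2) ≤ 0} ⊆ {ω | c / 4 * κ ^ 2 * ε ^ 8 ≤ |S₁ ω|} ∪
        {ω | c / 4 * κ ^ 2 * ε ^ 8 ≤ |S₂ ω|} := by
    intro ω hω
    by_contra hcon
    simp only [Set.mem_union, Set.mem_ofPred_eq, not_or, not_le] at hcon
    have g1 := (abs_lt.1 hcon.1).1
    have g2 := (abs_lt.1 hcon.2).1
    have g3 : c / 2 * κ ^ 2 * ε ^ 8 * N ≤ ∑ i ∈ range N, ∫ ω, f i ω ∂μ := by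
      simpa [mul_comm] using card_nsmul_le_sum (range N) _ _ fun i _ => hmean i
    simp only [S₁, S₂, lt_div_iff₀ hN'] at g1 g2
    rw [Set.mem_ofPred_eq, sum_congr rfl fun i _ => show _ =
      (f i ω - ∫ ω', f i ω' ∂μ) + u i ω + ∫ ω', f i ω' ∂μ by simp only [hf, hu]; ring,
      sum_add_distrib, sum_add_distrib] at hω
    linarith
  calc _ ≤ _ := (measureReal_mono hsub).trans (measureReal_union_le _ _)
    _ ≤ (W * (1 + κ) * ε ^ 8) ^ 2 / (c / 4 * κ ^ 2 * ε ^ 8) ^ 2 +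
        (w * ε ^ 8) ^ 1 / (c / 4 * κ ^ 2 * ε ^ 8) ^ 1 :=
      add_le_add ((H hr hr₀ hz hN hNM).measure_le two_ne_zero hT)
        ((Bd.avg (fun i _ => bu i) (bu 0).nonneg le_rfl).measure_le one_ne_zero hT)
    _ ≤ (W * (2 * κ) * ε ^ 8) ^ 2 / (c / 4 * κ ^ 2 * ε ^ 8) ^ 2 +
        (w * ε ^ 8) ^ 1 / (c / 4 * κ ^ 2 * ε ^ 8) ^ 1 := by gcongr; linarith
    _ = _ := by field_simp; ring

lemma abs_argmin_sub_le (h : MainPart μ X P D β V K C F) (hK : 0 < K)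
    (hβ : β ≠ 0) (hy : 0 < y) (hV : V * y ^ 3 = 2 * β ^ 2) :
    ∃ k, ∀ {ε : ℝ} {n ℓ ℓ₀ : ℕ} (s : ℤ), Reg K ε n ℓ → Reg K ε n ℓ₀ → |ℓ₀ * ε ^ 2 - y| ≤ ε ^ 2 →
      ∫ ω, D s n ℓ ω ^ 2 ∂μ ≤ ∫ ω, D s n ℓ₀ ω ^ 2 ∂μ → |(ℓ : ℝ) - ℓ₀| ≤ k := by
  obtain ⟨G, hG, hS⟩ := h.le_integral_sub hy hV
  set c := β ^ 2 / (K * y) ^ 2 with hc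
  have hc0 : 0 < c := by positivity
  refine ⟨1 + 2 * G / c, fun {ε n ℓ ℓ₀} s hr hr₀ h₀ hle => ?_⟩
  have h1 := hS s 0 hr hr₀ h₀
  rw [integral_sub (h.integrable_sub_sq s hr 0) (h.integrable_sub_sq s hr₀ 0)] at h1
  simp only [sub_zero, abs_zero, zero_mul, add_zero] at h1
  have h2 := le_of_mul_le_mul_right (show (c * |(ℓ : ℝ) - ℓ₀| ^ 2) * ε ^ 8 ≤
    (G * (1 + |(ℓ : ℝ) - ℓ₀|)) * ε ^ 8 by linarith) (pow_pos hr.pos 8)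
  by_contra! hcon
  have h3 : 2 * G < (|(ℓ : ℝ) - ℓ₀| - 1) * c := by
    rw [← div_lt_iff₀ hc0]
    linarith
  have h4 : 0 ≤ 2 * G / c := by positivity
  nlinarith

end MainPart

lemma MainPart.measure_argmin_le (hP : Good μ X a₀ A) (h : MainPart μ X P D β V K C F) (hK : 0 < K)
    (hβ : β ≠ 0) (hy : 0 < y) (hV : V * y ^ 3 = 2 * β ^ 2) (hM : 0 ≤ M) {η : ℝ} (hη : 0 < η) :
    ∃ k, ∀ {ε : ℝ} {m b₀ N : ℕ} {J : Finset ℕ} {Z : Ω → ℝ} {b : Ω → ℕ}, (∀ c ∈ J, Reg K ε m c) →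
      b₀ ∈ J → |b₀ * ε ^ 2 - y| ≤ ε ^ 2 → 0 < N → 1 / (N : ℝ) ≤ M * ε ^ 12 → (∀ ω, b ω ∈ J) →
      (∀ ω, ∑ i ∈ range N, (D (i + 1) m (b ω) ω - Z ω) ^ 2 ≤
        ∑ i ∈ range N, (D (i + 1) m b₀ ω - Z ω) ^ 2) →
      μ.real {ω | k < |(b ω : ℝ) - b₀|} ≤ μ.real {ω | M * ε ^ 4 < |Z ω|} + η := by
  obtain ⟨B, k₀, hB, -, H⟩ := measure_avg_le hP h hK hβ hy hV hM
  obtain ⟨S, hS⟩ := summable_iff_vanishing_norm.1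
    (Real.summable_one_div_int_pow.2 one_lt_two) (η / (2 * B + 1)) (by positivity)
  refine ⟨max k₀ (∑ j ∈ S, |(j : ℝ)|), fun {ε m b₀ N J Z b} hJ hb₀ h₀ hN hNM hb hle => ?_⟩
  have e := (hJ _ hb₀).pos
  set J' := J.filter fun c : ℕ => max k₀ (∑ j ∈ S, |(j : ℝ)|) < |(c : ℝ) - b₀| with hJ'
  set E : ℕ → ℝ → Set Ω := fun c z => {ω | ∑ i ∈ range N, ((D (i + 1) m c ω - z) ^ 2 -
        (D (i + 1) m b₀ ω - z) ^ 2) ≤ 0}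
  have hsub : {ω | max k₀ (∑ j ∈ S, |(j : ℝ)|) < |(b ω : ℝ) - b₀|} ⊆
      {ω | M * ε ^ 4 < |Z ω|} ∪ ⋃ c ∈ J', (E c (M * ε ^ 4) ∪ E c (-(M * ε ^ 4))) := by
    intro ω hω
    by_cases hZ : M * ε ^ 4 < |Z ω|
    · exact Or.inl hZ
    refine Or.inr (Set.mem_biUnion (mem_coe.2 (mem_filter.2 ⟨hb ω, hω⟩)) ?_)
    have hlin (z : ℝ) : ∑ i ∈ range N, ((D (i + 1) m (b ω) ω - z) ^ 2 -
        (D (i + 1) m b₀ ω - z) ^ 2) = ∑ i ∈ range N, ((D (i + 1) m (b ω) ω - Z ω) ^ 2 -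
        (D (i + 1) m b₀ ω - Z ω) ^ 2) +
        2 * (Z ω - z) * ∑ i ∈ range N, (D (i + 1) m (b ω) ω - D (i + 1) m b₀ ω) := by
      rw [mul_sum, ← sum_add_distrib]
      exact sum_congr rfl fun i _ => by ring
    have h1 := hle ω
    rw [← sub_nonpos, ← sum_sub_distrib] at h1
    obtain ⟨h2, h3⟩ := abs_le.1 (not_lt.1 hZ)
    rcases le_total 0 (∑ i ∈ range N, (D (i + 1) m (b ω) ω - D (i + 1) m b₀ ω)) with h4 | h4
    · exact Or.inl ((hlin _).trans_le (b := _) (c := 0) (by nlinarith))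
    · exact Or.inr ((hlin _).trans_le (b := _) (c := 0) (by nlinarith))
  have hE : ∀ c ∈ J', μ.real (E c (M * ε ^ 4) ∪ E c (-(M * ε ^ 4))) ≤
      2 * B * (1 / (((c : ℤ) - b₀ : ℤ) : ℝ) ^ 2) := fun c hc => by
    obtain ⟨hc, hk⟩ := mem_filter.1 hc
    have hk := (le_max_left _ _).trans hk.le
    have hz : |M * ε ^ 4| ≤ M * ε ^ 4 := (abs_of_nonneg (by positivity)).le
    have g := H (hJ c hc) (hJ _ hb₀) h₀ hz hN hNM hk
    have g' := H (hJ c hc) (hJ _ hb₀) h₀ ((abs_neg _).le.trans hz) hN hNM hk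
    refine (measureReal_union_le _ _).trans ((add_le_add g g').trans_eq ?_)
    push_cast
    ring
  have hT := hS (J'.image fun c : ℕ => (c : ℤ) - b₀) (disjoint_left.2 fun j hj hjS => by
    obtain ⟨c, hc, rfl⟩ := mem_image.1 hj
    have h1 := (le_max_right _ _).trans_lt (mem_filter.1 hc).2
    have h2 := single_le_sum (f := fun j : ℤ => |(j : ℝ)|) (fun _ _ => abs_nonneg _) hjS
    push_cast at h2
    linarith)
  rw [sum_image fun a _ c _ hac => by simpa using hac] at hT
  have hT := (le_abs_self _).trans hT.le
  calc _ ≤ _ := (measureReal_mono hsub).trans (measureReal_union_le _ _)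
    _ ≤ _ := by
      gcongr
      calc _ ≤ _ := (measureReal_biUnion_finset_le _ _).trans (sum_le_sum hE)
        _ ≤ 2 * B * (η / (2 * B + 1)) := by
          rw [← mul_sum]
          gcongr
        _ ≤ η := by
          rw [mul_div_assoc', div_le_iff₀ (by positivity)]
          linarith

lemma rpow_scale {n : ℕ} (hn : 1 ≤ n) : ∃ ε : ℝ, ε = (n : ℝ) ^ (-(1 : ℝ) / 6) ∧ 0 < ε ∧ ε ≤ 1 ∧
    n * ε ^ 6 = 1 ∧ (n : ℝ) ^ ((1 : ℝ) / 3) = 1 / ε ^ 2 ∧ (n : ℝ) ^ ((1 : ℝ) / 2) = 1 / ε ^ 3 ∧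
    (n : ℝ) ^ (-(1 : ℝ) / 3) = ε ^ 2 := by
  have h : (0 : ℝ) < n := by exact_mod_cast hn
  refine ⟨_, rfl, by positivity, Real.rpow_le_one_of_one_le_of_nonpos (by exact_mod_cast hn)
    (by norm_num), ?_, ?_, ?_, ?_⟩
  · rw [← Real.rpow_mul_natCast h.le]
    norm_num [Real.rpow_neg_one, h.ne']
  all_goals
    rw [← Real.rpow_mul_natCast h.le]
    try rw [one_div ((n : ℝ) ^ _), ← Real.rpow_neg h.le]
    norm_num

lemma reg_of_le {K ε : ℝ} {n ℓ : ℕ} (hK : 1 ≤ K) (e : 0 < ε) (e1 : ε ≤ 1) (hn : n * ε ^ 6 = 1)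
    (hs : 2 * K * ε ^ 4 ≤ 1) (h₁ : K⁻¹ * (1 / ε ^ 2) ≤ ℓ) (h₂ : ℓ ≤ K * (1 / ε ^ 2)) :
    Reg K ε n ℓ := by
  have hl : (0 : ℝ) < ℓ := lt_of_lt_of_le (by positivity) h₁
  refine ⟨hK, e, e1, hn, ?_, ?_, ?_, by exact_mod_cast hl⟩
  · rw [div_le_iff₀ hl]
    calc 1 = K * ε ^ 2 * (K⁻¹ * (1 / ε ^ 2)) := by field_simp
      _ ≤ _ := by gcongr
  · rwa [← div_eq_mul_one_div, le_div_iff₀ (by positivity)] at h₂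
  · have : (2 * ℓ : ℝ) ≤ n := by
      rw [eq_div_of_mul_eq (by positivity) hn, le_div_iff₀ (by positivity)]
      calc _ ≤ 2 * (K * (1 / ε ^ 2)) * ε ^ 6 := by gcongr
        _ = 2 * K * ε ^ 4 := by field_simp
        _ ≤ 1 := hs
    exact_mod_cast this

lemma reg_of_mem_Jset {K ε : ℝ} {n ℓ : ℕ} (hK : 1 ≤ K) (e : 0 < ε) (e1 : ε ≤ 1)
    (hn : n * ε ^ 6 = 1) (h3 : (n : ℝ) ^ ((1 : ℝ) / 3) = 1 / ε ^ 2) (hs : 2 * K * ε ^ 4 ≤ 1)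
    (h : ℓ ∈ Jset K n) : Reg K ε n ℓ := by
  obtain ⟨-, h₁, h₂⟩ := mem_filter.1 h
  rw [h3] at h₁ h₂
  exact reg_of_le hK e e1 hn hs h₁ h₂

lemma exists_mem_Jset {K ε y : ℝ} {n : ℕ} (hK : 1 ≤ K) (e : 0 < ε) (e1 : ε ≤ 1)
    (hn : n * ε ^ 6 = 1) (h3 : (n : ℝ) ^ ((1 : ℝ) / 3) = 1 / ε ^ 2) (hs : 2 * K * ε ^ 4 ≤ 1)
    (hy : K⁻¹ + ε ^ 2 ≤ y) (hyK : y ≤ K) : ∃ ℓ ∈ Jset K n, |ℓ * ε ^ 2 - y| ≤ ε ^ 2 := by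
  have hy0 : 0 < y := lt_of_lt_of_le (by positivity) hy
  have h₁ := Nat.floor_le (show 0 ≤ y * (1 / ε ^ 2) by positivity)
  have h₂ := Nat.lt_floor_add_one (y * (1 / ε ^ 2))
  set ℓ := ⌊y * (1 / ε ^ 2)⌋₊
  have h₄ : K⁻¹ * (1 / ε ^ 2) ≤ ℓ := by
    have : (K⁻¹ + ε ^ 2) * (1 / ε ^ 2) ≤ y * (1 / ε ^ 2) := by gcongr
    rw [add_mul, mul_one_div_cancel (by positivity)] at this
    linarith
  have h₅ : ℓ ≤ K * (1 / ε ^ 2) := h₁.trans (by gcongr)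
  have hr := reg_of_le hK e e1 hn hs h₄ h₅
  have := hr.half
  refine ⟨ℓ, mem_filter.2 ⟨mem_Icc.2 ⟨hr.one_le_len, by omega⟩, ?_⟩, ?_⟩
  · rw [h3]
    exact ⟨h₄, h₅⟩
  · rw [← div_eq_mul_one_div, le_div_iff₀ (by positivity)] at h₁
    rw [← div_eq_mul_one_div, div_lt_iff₀ (by positivity)] at h₂
    rw [abs_le]
    constructor <;> nlinarith [pow_pos e 2]

lemma abs_div_sub_le {ε θ y K γ k k' : ℝ} {n m b b₀ ℓ ℓ₀ : ℕ} (e : 0 < ε) (t : 0 < θ) (e1 : ε ≤ 1)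
    (hn : n * ε ^ 6 = 1) (hm : m * θ ^ 6 = 1) (hθ : θ ^ 2 ≤ γ * ε) (hb : |(b : ℝ) - b₀| ≤ k)
    (hb₀ : |b₀ * θ ^ 2 - y| ≤ θ ^ 2) (hr : Reg K ε n ℓ) (hℓ : |(ℓ : ℝ) - ℓ₀| ≤ k')
    (hℓ₀ : |ℓ₀ * ε ^ 2 - y| ≤ ε ^ 2) :
    |(((n : ℝ) / m) ^ ((1 : ℝ) / 3) * b - ℓ) / ℓ| ≤ K * (γ * (k + 1) + (k' + 1)) * ε := by
  have hl := hr.len_pos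
  have hK := hr.K_nonneg
  have h₁ : ((n : ℝ) / m) ^ ((1 : ℝ) / 3) = θ ^ 2 / ε ^ 2 := by
    rw [show (n : ℝ) / m = (θ ^ 2 / ε ^ 2) ^ 3 by
      rw [eq_div_of_mul_eq (by positivity) hn, eq_div_of_mul_eq (by positivity) hm]
      field_simp, ← Real.rpow_natCast, ← Real.rpow_mul (by positivity)]
    norm_num
  have h₂ {b b₀ : ℕ} {θ k : ℝ} (hb : |(b : ℝ) - b₀| ≤ k) (hb₀ : |b₀ * θ ^ 2 - y| ≤ θ ^ 2) :
      |b * θ ^ 2 - y| ≤ (k + 1) * θ ^ 2 := by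
    have := mul_le_mul_of_nonneg_right hb (sq_nonneg θ)
    rw [← abs_of_nonneg (sq_nonneg θ), ← abs_mul, abs_of_nonneg (sq_nonneg θ)] at this
    calc _ = |(b - b₀) * θ ^ 2 + (b₀ * θ ^ 2 - y)| := by congr 1; ring
      _ ≤ _ := (abs_add_le _ _).trans (by linarith)
  have hk := (abs_nonneg _).trans hb
  have hk' := (abs_nonneg _).trans hℓ
  rw [h₁, show (θ ^ 2 / ε ^ 2 * b - ℓ) / (ℓ : ℝ) =
    1 / ℓ * (((b * θ ^ 2 - y) - (ℓ * ε ^ 2 - y)) / ε ^ 2) by field_simp; ring, abs_mul,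
    abs_of_nonneg (a := 1 / (ℓ : ℝ)) (by positivity), abs_div, abs_of_pos (pow_pos e 2)]
  calc _ ≤ K * ε ^ 2 * (((k + 1) * θ ^ 2 + (k' + 1) * ε ^ 2) / ε ^ 2) := by
        gcongr
        · exact hr.lower
        · exact (abs_sub _ _).trans (add_le_add (h₂ hb hb₀) (h₂ hℓ hℓ₀))
    _ = K * ((k + 1) * θ ^ 2 + (k' + 1) * ε ^ 2) := by field_simp
    _ ≤ K * ((k + 1) * (γ * ε) + (k' + 1) * ε) := by
        gcongr
        nlinarith
    _ = _ := by ring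

lemma le_mul_of_pow_three_le {x y c : ℝ} (hx : 0 ≤ x) (hy : 0 ≤ y) (h : x ^ 3 ≤ c * y ^ 3) :
    x ≤ (1 + |c|) * y := by
  refine le_of_pow_le_pow_left₀ three_ne_zero (by positivity) (h.trans ?_)
  rw [mul_pow]
  gcongr
  nlinarith [le_abs_self c, abs_nonneg c, pow_nonneg (abs_nonneg c) 3]

lemma tendsto_rpow_sixth : Tendsto (fun n : ℕ => (n : ℝ) ^ (-(1 : ℝ) / 6)) atTop (nhds 0) := by
  rw [neg_div]
  exact (tendsto_rpow_neg_atTop (by norm_num)).comp tendsto_natCast_atTop_atTop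

lemma C0_pow (hS : CondS μ X H) : V0 μ X H * C0 μ X H ^ 3 = 2 * B0 μ X H ^ 2 := by
  have := hS.2
  rw [C0, ← Real.rpow_natCast, ← Real.rpow_mul (by positivity)]
  norm_num
  field_simp

set_option maxHeartbeats 1000000 in
theorem isBigOp_argmin {H : (Fin d → ℝ) → ℝ} {a₀ : ℕ} {A K : ℝ} (hP : Good μ X a₀ A) (hD : CondD H a₀)
    (hS : CondS μ X H) (hK : 0 < K ∧ K⁻¹ < C0 μ X H ∧ C0 μ X H < K) {ℓopt m : ℕ → ℕ}
    (hopt : ∀ n, (Jset K n).Nonempty → IsArgminOn (MSEfun μ X H n) (Jset K n) (ℓopt n))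
    (hm : ∃ c₁ : ℝ, 0 < c₁ ∧ ∃ c₂ : ℝ, 0 < c₂ ∧ ∀ n : ℕ, 1 ≤ n →
      c₁ * (n : ℝ) ^ ((1 : ℝ) / 2) ≤ m n ∧ m n ≤ c₂ * (n : ℝ) ^ ((1 : ℝ) / 2))
    {Z : ℕ → Ω → ℝ} (hZ : IsBigOp μ Z (fun n => (n : ℝ) ^ (-(1 : ℝ) / 3))) {b : ℕ → Ω → ℕ}
    (hb : ∀ n ω, (Jset K (m n)).Nonempty → IsArgminOn (fun b =>
      (∑ i ∈ range (n - m n + 1), (mbbVar X H ((i : ℤ) + 1) (m n) b ω -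
        (sigInfSq μ X H + Z n ω)) ^ 2) / ((n - m n + 1 : ℕ) : ℝ)) (Jset K (m n)) (b n ω)) :
    IsBigOp μ (fun n ω => (((n : ℝ) / (m n : ℝ)) ^ ((1 : ℝ) / 3) * (b n ω : ℝ) - ℓopt n) / ℓopt n)
      (fun n => (n : ℝ) ^ (-(1 : ℝ) / 6)) := by
  intro η hη
  obtain ⟨hK0, hyK, hyK'⟩ := hK
  have hK1 : 1 ≤ K := by
    by_contra! hc
    linarith [(one_lt_inv₀ hK0).2 hc]
  set y := C0 μ X H
  have hy : 0 < y := lt_trans (by positivity) hyK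
  have hV := C0_pow hS
  obtain ⟨P, C, F, h⟩ := hP.exists_mainPart hD K
  obtain ⟨c₁, h₁, c₂, h₂, hm⟩ := hm
  obtain ⟨CZ, hCZ, hZ⟩ := hZ (η / 2) (by positivity)
  set γ := 1 + |c₂|
  set γ' := 1 + |c₁⁻¹|
  have hγ : 0 < γ := by positivity
  have hγ' : 0 < γ' := by positivity
  obtain ⟨k, hk⟩ := h.measure_argmin_le hP hK0 hS.1 hy hV
    (show 0 ≤ CZ * γ ^ 2 + 2 * γ ^ 6 by positivity) (half_pos hη)
  obtain ⟨k', hk'⟩ := h.abs_argmin_sub_le hK0 hS.1 hy hV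
  refine ⟨1 + |K * (γ' * (k + 1) + (k' + 1))|, by positivity, ?_⟩
  set τ := 1 / (1 + 2 * K * γ' ^ 2 + 2 * K + 2 * c₂ + γ' / (y - K⁻¹) + 1 / (y - K⁻¹)) with hτ
  have hyK0 := sub_pos.2 hyK
  have hτ0 : 0 < τ := by positivity
  filter_upwards [hZ, tendsto_rpow_sixth.eventually_lt_const hτ0, eventually_ge_atTop 1] with n hZn hsm hn1
  obtain ⟨ε, hε, e, e1, hn, hn3, hn2, hnZ⟩ := rpow_scale hn1
  obtain ⟨hml, hmu⟩ := hm n hn1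
  rw [hn2] at hml hmu
  have hm1 : 1 ≤ m n := by
    have : (0 : ℝ) < m n := lt_of_lt_of_le (by positivity) hml
    exact_mod_cast this
  obtain ⟨θ, -, t, t1, hm6, hm3, -, -⟩ := rpow_scale hm1
  rw [← hε] at hsm ⊢
  rw [lt_div_iff₀ (by positivity)] at hsm
  simp only [mul_add, mul_one] at hsm
  have hθε : θ ^ 2 ≤ γ' * ε := by
    refine le_mul_of_pow_three_le (by positivity) e.le ?_
    rw [← div_eq_mul_one_div, div_le_iff₀ (by positivity)] at hml
    rw [inv_mul_eq_div, le_div_iff₀ h₁]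
    nlinarith [mul_le_mul_of_nonneg_right hml (pow_pos t 6).le, pow_pos e 3]
  have hεθ : ε ≤ γ * θ ^ 2 := by
    refine le_mul_of_pow_three_le e.le (by positivity) ?_
    rw [← div_eq_mul_one_div, le_div_iff₀ (by positivity)] at hmu
    nlinarith [mul_le_mul_of_nonneg_right hmu (pow_pos t 6).le, pow_pos e 3]
  have s₁ : 0 ≤ ε * (2 * K * γ' ^ 2) := by positivity
  have s₂ : 0 ≤ ε * (2 * K) := by positivity
  have s₃ : 0 ≤ ε * (2 * c₂) := by positivity
  have s₄ : 0 ≤ ε * (γ' / (y - K⁻¹)) := by positivity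
  have s₅ : 0 ≤ ε * (1 / (y - K⁻¹)) := by positivity
  have ej {j : ℕ} (hj : 1 ≤ j) : ε ^ j ≤ ε := pow_le_of_le_one e.le e1 (by omega)
  have hsε : 2 * K * ε ^ 4 ≤ 1 := by
    have := mul_le_mul_of_nonneg_left (ej (show 1 ≤ 4 by norm_num)) (by positivity : 0 ≤ 2 * K)
    linarith
  have hsθ : 2 * K * θ ^ 4 ≤ 1 := by
    have := pow_le_pow_left₀ (by positivity) hθε 2
    calc 2 * K * θ ^ 4 = 2 * K * (θ ^ 2) ^ 2 := by ring
      _ ≤ 2 * K * (γ' * ε) ^ 2 := by gcongr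
      _ = 2 * K * γ' ^ 2 * ε ^ 2 := by ring
      _ ≤ 2 * K * γ' ^ 2 * ε := by gcongr; exact ej (by norm_num)
      _ ≤ 1 := by linarith
  have hyε : K⁻¹ + ε ^ 2 ≤ y := by
    have : ε * (1 / (y - K⁻¹)) ≤ 1 := by linarith
    rw [← div_eq_mul_one_div, div_le_one hyK0] at this
    linarith [ej (show 1 ≤ 2 by norm_num)]
  have hyθ : K⁻¹ + θ ^ 2 ≤ y := by
    have : ε * (γ' / (y - K⁻¹)) ≤ 1 := by linarith
    rw [mul_div_assoc', div_le_one hyK0] at this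
    linarith
  obtain ⟨ℓ₀, hℓ₀, hℓ₀y⟩ := exists_mem_Jset hK1 e e1 hn hn3 hsε hyε hyK'.le
  obtain ⟨b₀, hb₀, hb₀y⟩ := exists_mem_Jset hK1 t t1 hm6 hm3 hsθ hyθ hyK'.le
  obtain ⟨ho, ho'⟩ := hopt n ⟨ℓ₀, hℓ₀⟩
  have hro := reg_of_mem_Jset hK1 e e1 hn hn3 hsε ho
  have hℓ := hk' 1 hro (reg_of_mem_Jset hK1 e e1 hn hn3 hsε hℓ₀) hℓ₀y (ho' ℓ₀ hℓ₀)
  have hN : 1 / ((n - m n + 1 : ℕ) : ℝ) ≤ (CZ * γ ^ 2 + 2 * γ ^ 6) * θ ^ 12 := by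
    have hle : 2 * m n ≤ n := by
      have : 2 * (m n : ℝ) ≤ n := by
        rw [eq_div_of_mul_eq (by positivity) hn, le_div_iff₀ (by positivity)]
        calc _ ≤ 2 * (c₂ * (1 / ε ^ 3)) * ε ^ 6 := by gcongr
          _ = 2 * c₂ * ε ^ 3 := by field_simp
          _ ≤ 2 * c₂ * ε := by gcongr; exact ej (by norm_num)
          _ ≤ 1 := by linarith
      exact_mod_cast this
    have h1 : (n : ℝ) ≤ 2 * ((n - m n + 1 : ℕ) : ℝ) := by exact_mod_cast (by omega)
    have h2 : 1 / ((n - m n + 1 : ℕ) : ℝ) ≤ 2 * ε ^ 6 := by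
      rw [div_le_iff₀ (by positivity)]
      nlinarith [mul_le_mul_of_nonneg_right h1 (pow_pos e 6).le]
    calc _ ≤ 2 * (γ * θ ^ 2) ^ 6 := h2.trans (by gcongr)
      _ ≤ _ := by
        rw [mul_pow, add_mul]
        exact (le_of_eq (by ring)).trans (le_add_of_nonneg_left (by positivity))
  have key := hk (fun c hc => reg_of_mem_Jset hK1 t t1 hm6 hm3 hsθ hc) hb₀ hb₀y
    (Nat.succ_pos (n - m n)) hN (Z := Z n) (fun ω => (hb n ω ⟨b₀, hb₀⟩).1) fun ω => by
      have := (div_le_div_iff_of_pos_right (by positivity)).1 ((hb n ω ⟨b₀, hb₀⟩).2 b₀ hb₀)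
      simpa only [sub_sub] using this
  refine (measureReal_mono (μ := μ) (s₂ := {ω | k < |(b n ω : ℝ) - b₀|}) fun ω hω => ?_).trans
    (key.trans ?_)
  · rw [Set.mem_ofPred_eq] at hω ⊢
    by_contra! hc
    have := abs_div_sub_le e t e1 hn hm6 hθε hc hb₀y hro hℓ hℓ₀y
    rw [abs_of_pos e] at hω
    nlinarith [le_abs_self (K * (γ' * (k + 1) + (k' + 1)))]
  · have : μ.real {ω | (CZ * γ ^ 2 + 2 * γ ^ 6) * θ ^ 4 < |Z n ω|} ≤ η / 2 := by
      refine (measureReal_mono fun ω hω => ?_).trans hZn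
      rw [Set.mem_ofPred_eq, hnZ, abs_of_pos (by positivity)]
      refine lt_of_le_of_lt ?_ hω
      calc _ ≤ CZ * (γ * θ ^ 2) ^ 2 := by gcongr
        _ ≤ _ := by
          rw [mul_pow, add_mul]
          exact (le_of_eq (by ring)).trans (le_add_of_nonneg_right (by positivity))
    linarith

lemma isBigOp_sigmaHat {H : (Fin d → ℝ) → ℝ} {a₀ : ℕ} {A : ℝ} (hP : Good μ X a₀ A) (hD : CondD H a₀) {ℓt : ℕ → ℕ}
    (hpt : ∃ c₁ : ℝ, 0 < c₁ ∧ ∃ c₂ : ℝ, 0 < c₂ ∧ ∀ n : ℕ, 1 ≤ n →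
      c₁ * (n : ℝ) ^ ((1 : ℝ) / 3) ≤ ℓt n ∧ ℓt n ≤ c₂ * (n : ℝ) ^ ((1 : ℝ) / 3)) :
    IsBigOp μ (fun n ω => sigmaHat X H n (ℓt n) ω - sigInfSq μ X H)
      (fun n => (n : ℝ) ^ (-(1 : ℝ) / 3)) := by
  intro η hη
  obtain ⟨c₁, h₁, c₂, h₂, hl⟩ := hpt
  set K := 1 + c₁⁻¹ + c₂ with hKdef
  have hi : 0 < c₁⁻¹ := by positivity
  have hK1 : 1 ≤ K := by linarith
  obtain ⟨P, C, F, h⟩ := hP.exists_mainPart hD K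
  have hC := h.nonneg
  refine ⟨1 + 4 * C ^ 2 / η, by positivity, ?_⟩
  filter_upwards [tendsto_rpow_sixth.eventually_lt_const (show 0 < 1 / (2 * K) by positivity),
    eventually_ge_atTop 1] with n hsm hn1
  obtain ⟨ε, hε, e, e1, hn, hn3, -, hnZ⟩ := rpow_scale hn1
  rw [← hε, lt_div_iff₀ (by positivity)] at hsm
  obtain ⟨hl₁, hl₂⟩ := hl n hn1
  rw [hn3] at hl₁ hl₂
  have hr : Reg K ε n (ℓt n) := by
    refine reg_of_le hK1 e e1 hn ?_ (le_trans ?_ hl₁) (hl₂.trans ?_)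
    · nlinarith [pow_le_of_le_one e.le e1 (show 4 ≠ 0 by norm_num)]
    · gcongr
      exact inv_le_of_inv_le₀ h₁ (by linarith)
    · gcongr
      linarith
  have hpos : 0 < (1 + 4 * C ^ 2 / η) * ε ^ 2 := by positivity
  have key := (h.bd 1 hr).measure_le two_ne_zero hpos
  refine (measureReal_mono fun ω hω => ?_).trans (key.trans ?_)
  · rw [Set.mem_ofPred_eq, hnZ, abs_of_pos (by positivity)] at hω
    exact hω.le
  · rw [div_le_iff₀ (by positivity)]
    calc _ = η * (4 * C ^ 2 / η) * ε ^ 4 := by field_simp; ring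
      _ ≤ η * (1 + 4 * C ^ 2 / η) ^ 2 * ε ^ 4 := by
        gcongr
        nlinarith [show 0 ≤ 4 * C ^ 2 / η by positivity]
      _ = _ := by ring

end Proof

theorem statement_6 {Ω : Type*} [MeasurableSpace Ω] {d a₀ : ℕ}
    (μ : Measure Ω) [IsProbabilityMeasure μ]
    (X : ℤ → Ω → Fin d → ℝ) (H : (Fin d → ℝ) → ℝ)
    (hmeas : ∀ i, Measurable (X i))
    (hstat : IsStationary μ X)
    (hD : CondD H a₀)
    (hM : CondM μ X (14 + 4 * a₀))
    (hS : CondS μ X H)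
    (hσ : SigLimit μ X H)
    (K : ℝ) (hK : 0 < K ∧ K⁻¹ < C0 μ X H ∧ C0 μ X H < K)
    (ℓopt : ℕ → ℕ)
    (hopt : ∀ n, (Jset K n).Nonempty → IsArgminOn (MSEfun μ X H n) (Jset K n) (ℓopt n))
    (m : ℕ → ℕ) (ℓt : ℕ → ℕ)
    (hm : ∃ c₁ : ℝ, 0 < c₁ ∧ ∃ c₂ : ℝ, 0 < c₂ ∧ ∀ n : ℕ, 1 ≤ n →
      c₁ * (n : ℝ) ^ ((1 : ℝ) / 2) ≤ (m n : ℝ) ∧ (m n : ℝ) ≤ c₂ * (n : ℝ) ^ ((1 : ℝ) / 2))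
    (hpt : ∃ c₁ : ℝ, 0 < c₁ ∧ ∃ c₂ : ℝ, 0 < c₂ ∧ ∀ n : ℕ, 1 ≤ n →
      c₁ * (n : ℝ) ^ ((1 : ℝ) / 3) ≤ (ℓt n : ℝ) ∧ (ℓt n : ℝ) ≤ c₂ * (n : ℝ) ^ ((1 : ℝ) / 3))
    (bhatInf : ℕ → Ω → ℕ)
    (hbhatInf : ∀ n ω, (Jset K (m n)).Nonempty →
      IsArgminOn (fun b => MSEhatInf μ X H n (m n) b ω) (Jset K (m n)) (bhatInf n ω))
    (bhatH : ℕ → Ω → ℕ)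
    (hbhatH : ∀ n ω, (Jset K (m n)).Nonempty →
      IsArgminOn (fun b => MSEhatPilot X H n (m n) b (ℓt n) ω) (Jset K (m n)) (bhatH n ω))
 :
    IsBigOp μ (fun n ω => (((n : ℝ) / (m n : ℝ)) ^ ((1 : ℝ) / 3) * (bhatInf n ω : ℝ) - (ℓopt n : ℝ)) / (ℓopt n : ℝ))
        (fun n => (n : ℝ) ^ (-(1 : ℝ) / 6)) ∧
    IsBigOp μ (fun n ω => (((n : ℝ) / (m n : ℝ)) ^ ((1 : ℝ) / 3) * (bhatH n ω : ℝ) - (ℓopt n : ℝ)) / (ℓopt n : ℝ))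
        (fun n => (n : ℝ) ^ (-(1 : ℝ) / 6)) := by
  obtain ⟨A, hP⟩ := exists_good hmeas hstat hM
  constructor
  · refine isBigOp_argmin hP hD hS hK hopt hm (Z := fun _ _ => 0)
      (fun η hη => ⟨1, one_pos, .of_forall fun n => ?_⟩) (by simpa [MSEhatInf] using hbhatInf)
    simp [hη.le, (abs_nonneg _).not_gt]
  · refine isBigOp_argmin hP hD hS hK hopt hm (isBigOp_sigmaHat hP hD hpt) ?_
    simpa [MSEhatPilot] using hbhatH

end BlockLength
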